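/- Let N ≥ 2, 0 < c₁⁰ < … < c_N⁰, and let δ > 0 be fixed. There exist constants α₀, L₀ > 0 (depending on δ and on the c_j⁰) such that the following holds. Let L > L₀, α ∈ (0, α₀), and x₁⁰ < … < x_N⁰ with x_j⁰ > x_{j-1}⁰ + L for j = 2, …, N. Let u be a classical solution of the KdV equation with ‖u(0,·) − Σ_{j=1}^N Q_{c_j⁰}(· − x_j⁰)‖_{L²(ℝ)} ≤ α. Then there exist T̃ ≥ 0 and functions x₁, …, x_N : (−∞, −T̃] → ℝ such that sup_{t ≤ −T̃} ‖u(t,·) − Σ_{j=1}^N Q_{c_j⁰}(· − x_j(t))‖_{L²(ℝ)} ≤ δ. -/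

import Mathlib

open MeasureTheory Filter Real

/-- The KdV soliton profile `Q_c(s) = 3c / (1 + cosh(√c s))`. -/
noncomputable def Q (c s : ℝ) : ℝ := 3 * c / (1 + Real.cosh (Real.sqrt c * s))

/-- Squared `L²(ℝ)` norm. -/
noncomputable def L2sq (f : ℝ → ℝ) : ℝ := ∫ x : ℝ, (f x) ^ 2

/-- `f` satisfies the Schwartz class decay estimates. -/
def IsSchwartzFn (f : ℝ → ℝ) : Prop :=
  ∀ k n : ℕ, ∃ C : ℝ, ∀ x : ℝ, |x| ^ k * |iteratedDeriv n f x| ≤ C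

/-- `u` is a classical solution of the KdV equation `u_t + (u_xx + u²)_x = 0`,
smooth and Schwartz in space for each time. -/
def IsKdVSolution (u : ℝ → ℝ → ℝ) : Prop :=
  ContDiff ℝ (⊤ : ℕ∞) (Function.uncurry u) ∧ (∀ t : ℝ, IsSchwartzFn (u t)) ∧
  ∀ t x : ℝ,
    deriv (fun τ => u τ x) t +
      deriv (fun y => deriv (deriv (u t)) y + (u t y) ^ 2) x = 0

/-! ### Jointly smooth functions of two real variables -/

/-- Joint smoothness of a function of time and space. -/
def Sm (f : ℝ → ℝ → ℝ) : Prop := ContDiff ℝ (⊤ : ℕ∞) (Function.uncurry f)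

/-- The space derivative. -/
noncomputable def dx (f : ℝ → ℝ → ℝ) (t x : ℝ) : ℝ := deriv (f t) x

/-- The time derivative. -/
noncomputable def dt (f : ℝ → ℝ → ℝ) (t x : ℝ) : ℝ := deriv (fun s => f s x) t

namespace Sm

variable {f g : ℝ → ℝ → ℝ}

theorem differentiable (hf : Sm f) : Differentiable ℝ (Function.uncurry f) :=
  ContDiff.differentiable hf (by simp)

theorem hasFDerivAt (hf : Sm f) (t x : ℝ) :
    HasFDerivAt (Function.uncurry f) (fderiv ℝ (Function.uncurry f) (t, x)) (t, x) :=
  (hf.differentiable _).hasFDerivAt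

theorem hasDerivAt_x' (hf : Sm f) (t x : ℝ) :
    HasDerivAt (f t) (fderiv ℝ (Function.uncurry f) (t, x) (0, 1)) x := by
  have h1 : HasDerivAt (fun y : ℝ => (t, y)) ((0 : ℝ), (1 : ℝ)) x :=
    (hasDerivAt_const x t).prodMk (hasDerivAt_id x)
  exact (hf.hasFDerivAt t x).comp_hasDerivAt x h1

theorem hasDerivAt_t' (hf : Sm f) (t x : ℝ) :
    HasDerivAt (fun s => f s x) (fderiv ℝ (Function.uncurry f) (t, x) (1, 0)) t := by
  have h1 : HasDerivAt (fun y : ℝ => (y, x)) ((1 : ℝ), (0 : ℝ)) t :=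
    (hasDerivAt_id t).prodMk (hasDerivAt_const t x)
  exact (hf.hasFDerivAt t x).comp_hasDerivAt t h1

theorem dx_eq (hf : Sm f) (t x : ℝ) : dx f t x = fderiv ℝ (Function.uncurry f) (t, x) (0, 1) :=
  (hf.hasDerivAt_x' t x).deriv

theorem dt_eq (hf : Sm f) (t x : ℝ) : dt f t x = fderiv ℝ (Function.uncurry f) (t, x) (1, 0) :=
  (hf.hasDerivAt_t' t x).deriv

theorem hasDerivAt_x (hf : Sm f) (t x : ℝ) : HasDerivAt (f t) (dx f t x) x := by
  rw [hf.dx_eq]; exact hf.hasDerivAt_x' t x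

theorem hasDerivAt_t (hf : Sm f) (t x : ℝ) : HasDerivAt (fun s => f s x) (dt f t x) t := by
  rw [hf.dt_eq]; exact hf.hasDerivAt_t' t x

theorem contDiff_fderiv (hf : Sm f) :
    ContDiff ℝ (⊤ : ℕ∞) (fderiv ℝ (Function.uncurry f)) :=
  ContDiff.fderiv_right (m := (⊤ : ℕ∞)) hf (by exact_mod_cast le_top)

theorem dx (hf : Sm f) : Sm (dx f) := by
  have : Function.uncurry (_root_.dx f) = fun p => fderiv ℝ (Function.uncurry f) p (0, 1) := by
    ext ⟨t, x⟩; exact hf.dx_eq t x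
  unfold Sm; rw [this]
  exact hf.contDiff_fderiv.clm_apply contDiff_const

theorem dt (hf : Sm f) : Sm (dt f) := by
  have : Function.uncurry (_root_.dt f) = fun p => fderiv ℝ (Function.uncurry f) p (1, 0) := by
    ext ⟨t, x⟩; exact hf.dt_eq t x
  unfold Sm; rw [this]
  exact hf.contDiff_fderiv.clm_apply contDiff_const

theorem dt_dx (hf : Sm f) (t x : ℝ) : _root_.dt (_root_.dx f) t x = _root_.dx (_root_.dt f) t x := by
  rw [hf.dx.dt_eq, hf.dt.dx_eq]
  have e1 : Function.uncurry (_root_.dx f) = fun p => fderiv ℝ (Function.uncurry f) p (0, 1) := by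
    ext ⟨t, x⟩; exact hf.dx_eq t x
  have e2 : Function.uncurry (_root_.dt f) = fun p => fderiv ℝ (Function.uncurry f) p (1, 0) := by
    ext ⟨t, x⟩; exact hf.dt_eq t x
  have hd : DifferentiableAt ℝ (fderiv ℝ (Function.uncurry f)) (t, x) :=
    (hf.contDiff_fderiv.differentiable (by simp)) _
  rw [e1, e2, fderiv_clm_apply hd (by fun_prop), fderiv_clm_apply hd (by fun_prop)]
  have hs : IsSymmSndFDerivAt ℝ (Function.uncurry f) (t, x) :=
    (ContDiff.contDiffAt hf).isSymmSndFDerivAt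
      (by
        rw [minSmoothness_of_isRCLikeNormedField]
        exact WithTop.coe_le_coe.2 (le_top : (2 : ℕ∞) ≤ ⊤))
  simpa using hs.eq (1, 0) (0, 1)

theorem continuous (hf : Sm f) : Continuous (Function.uncurry f) := ContDiff.continuous hf

theorem cx (hf : Sm f) (t : ℝ) : Continuous (f t) :=
  hf.continuous.comp (by fun_prop : Continuous fun x : ℝ => (t, x))

theorem ct (hf : Sm f) (x : ℝ) : Continuous (fun t => f t x) :=
  hf.continuous.comp (by fun_prop : Continuous fun t : ℝ => (t, x))

theorem const (c : ℝ) : Sm (fun _ _ => c) := contDiff_const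

theorem add (hf : Sm f) (hg : Sm g) : Sm (fun t x => f t x + g t x) := ContDiff.add hf hg

theorem sub (hf : Sm f) (hg : Sm g) : Sm (fun t x => f t x - g t x) := ContDiff.sub hf hg

theorem mul (hf : Sm f) (hg : Sm g) : Sm (fun t x => f t x * g t x) := ContDiff.mul hf hg

theorem neg (hf : Sm f) : Sm (fun t x => -f t x) := ContDiff.neg hf

theorem pow (hf : Sm f) (n : ℕ) : Sm (fun t x => f t x ^ n) := ContDiff.pow hf n

theorem div (hf : Sm f) (hg : Sm g) (h : ∀ t x, g t x ≠ 0) : Sm (fun t x => f t x / g t x) :=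
  ContDiff.div hf hg (fun p => h p.1 p.2)

end Sm

/-! ### Parameterized linear differential equations -/

/-- Differentiation under an integral over a compact interval. -/
theorem hasDerivAt_intervalIntegral_param_on {E : Type*} [NormedAddCommGroup E] [NormedSpace ℝ E]
    [CompleteSpace E] {F F' : ℝ → ℝ → E} {U : Set ℝ} (hU : IsOpen U)
    (hF' : ContinuousOn (Function.uncurry F') (Set.univ ×ˢ U))
    (hd : ∀ s, ∀ x ∈ U, HasDerivAt (F s) (F' s x) x)
    (hc : ∀ x ∈ U, Continuous fun s => F s x) (a b : ℝ) {x : ℝ} (hx : x ∈ U) :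
    HasDerivAt (fun y => ∫ s in a..b, F s y) (∫ s in a..b, F' s x) x := by
  obtain ⟨r, hr, hrU⟩ := Metric.nhds_basis_closedBall.mem_iff.1 (hU.mem_nhds hx)
  have hK : IsCompact (Set.uIcc a b ×ˢ Metric.closedBall x r) :=
    isCompact_uIcc.prod (isCompact_closedBall x r)
  obtain ⟨C, hC⟩ := hK.exists_bound_of_continuousOn
    (hF'.mono (Set.prod_mono (Set.subset_univ _) hrU))
  refine (intervalIntegral.hasDerivAt_integral_of_dominated_loc_of_deriv_le
    (F := fun y s => F s y) (F' := fun y s => F' s y) (bound := fun _ => C)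
    (Metric.closedBall_mem_nhds x hr)
    (eventually_of_mem (hU.mem_nhds hx) fun y hy => (hc y hy).aestronglyMeasurable)
    ((hc x hx).intervalIntegrable _ _) ?_ ?_ (by simp) ?_).2
  · have : Continuous fun s => Function.uncurry F' (s, x) :=
      hF'.comp_continuous (by fun_prop) fun s => ⟨Set.mem_univ _, hx⟩
    exact this.aestronglyMeasurable
  · exact Eventually.of_forall fun s hs y hy =>
      hC (s, y) ⟨Set.uIoc_subset_uIcc hs, hy⟩
  · exact Eventually.of_forall fun s _ y hy => hd s y (hrU hy)

theorem hasDerivAt_intervalIntegral_param {E : Type*} [NormedAddCommGroup E] [NormedSpace ℝ E]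
    [CompleteSpace E] {F F' : ℝ → ℝ → E}
    (hF' : Continuous (Function.uncurry F')) (hd : ∀ s x, HasDerivAt (F s) (F' s x) x)
    (hc : ∀ x, Continuous fun s => F s x) (a b x : ℝ) :
    HasDerivAt (fun y => ∫ s in a..b, F s y) (∫ s in a..b, F' s x) x :=
  hasDerivAt_intervalIntegral_param_on isOpen_univ hF'.continuousOn (fun s x _ => hd s x)
    (fun x _ => hc x) a b (Set.mem_univ x)

theorem integral_mul_exp_primitive {k : ℝ → ℝ} (hk : Continuous k) (x : ℝ) :
    ∫ s in (0 : ℝ)..x, k s * exp (2 * ∫ r in (0 : ℝ)..s, k r)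
      = (exp (2 * ∫ r in (0 : ℝ)..x, k r) - 1) / 2 := by
  have hd : ∀ y, HasDerivAt (fun y => exp (2 * ∫ r in (0 : ℝ)..y, k r) / 2)
      (k y * exp (2 * ∫ r in (0 : ℝ)..y, k r)) y := by
    intro y
    have h1 := (hk.integral_hasStrictDerivAt 0 y).hasDerivAt
    have := ((h1.const_mul 2).exp.div_const 2)
    exact this.congr_deriv (by ring)
  have hcont : Continuous fun s => k s * exp (2 * ∫ r in (0 : ℝ)..s, k r) := by
    have : Continuous fun s => ∫ r in (0 : ℝ)..s, k r :=
      intervalIntegral.continuous_primitive (fun a b => hk.intervalIntegrable a b) 0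
    fun_prop
  rw [intervalIntegral.integral_eq_sub_of_hasDerivAt (fun y _ => hd y)
    (hcont.intervalIntegrable _ _)]
  simp; ring

theorem norm_integral_le_exp_weight {E : Type*} [NormedAddCommGroup E] [NormedSpace ℝ E]
    {k : ℝ → ℝ} (hk : Continuous k) (hk0 : ∀ s, 0 ≤ k s) {f : ℝ → E} {M x : ℝ} (hM : 0 ≤ M)
    (hf : ∀ s, ‖f s‖ ≤ M * (k s * exp (2 * |∫ r in (0 : ℝ)..s, k r|))) :
    ‖∫ s in (0 : ℝ)..x, f s‖ ≤ M / 2 * exp (2 * |∫ r in (0 : ℝ)..x, k r|) := by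
  have hcont : Continuous fun s => ∫ r in (0 : ℝ)..s, k r :=
      intervalIntegral.continuous_primitive (fun a b => hk.intervalIntegrable a b) 0
  have hI : ∀ a b, IntervalIntegrable
      (fun s => M * (k s * exp (2 * |∫ r in (0 : ℝ)..s, k r|))) volume a b :=
    fun a b => (by fun_prop : Continuous _).intervalIntegrable a b
  rcases le_total 0 x with hx | hx
  · refine (intervalIntegral.norm_integral_le_of_norm_le hx
      (Eventually.of_forall fun s _ => hf s) (hI _ _)).trans ?_
    rw [intervalIntegral.integral_const_mul]
    have e : ∫ s in (0 : ℝ)..x, k s * exp (2 * |∫ r in (0 : ℝ)..s, k r|)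
        = ∫ s in (0 : ℝ)..x, k s * exp (2 * ∫ r in (0 : ℝ)..s, k r) := by
      refine intervalIntegral.integral_congr fun s hs => ?_
      rw [Set.uIcc_of_le hx] at hs
      simp only [abs_of_nonneg (intervalIntegral.integral_nonneg hs.1 (fun u _ => hk0 u))]
    rw [e, integral_mul_exp_primitive hk,
      abs_of_nonneg (intervalIntegral.integral_nonneg hx (fun u _ => hk0 u))]
    nlinarith [exp_pos (2 * ∫ r in (0 : ℝ)..x, k r)]
  · rw [intervalIntegral.integral_symm, norm_neg]
    refine (intervalIntegral.norm_integral_le_of_norm_le hx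
      (Eventually.of_forall fun s _ => hf s) (hI _ _)).trans ?_
    rw [intervalIntegral.integral_const_mul]
    have hneg : ∀ s ≤ 0, |∫ r in (0 : ℝ)..s, k r| = ∫ r in (0 : ℝ)..s, -k r := by
      intro s hs
      rw [intervalIntegral.integral_neg, abs_of_nonpos]
      rw [intervalIntegral.integral_symm]
      linarith [intervalIntegral.integral_nonneg (μ := volume) hs (fun u _ => hk0 u)]
    have e : ∫ s in x..(0 : ℝ), k s * exp (2 * |∫ r in (0 : ℝ)..s, k r|)
        = ∫ s in (0 : ℝ)..x, (-k s) * exp (2 * ∫ r in (0 : ℝ)..s, -k r) := by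
      rw [intervalIntegral.integral_symm, ← intervalIntegral.integral_neg]
      refine intervalIntegral.integral_congr fun s hs => ?_
      rw [Set.uIcc_of_ge hx] at hs
      simp only [hneg s hs.2]; ring
    rw [e, integral_mul_exp_primitive (k := fun s => -k s) hk.neg, hneg x hx]
    nlinarith [exp_pos (2 * ∫ r in (0 : ℝ)..x, -k r)]

open BoundedContinuousFunction in
/-- Global solutions of linear equations, continuous with respect to parameters. -/
theorem exists_linear_ode {E P : Type*} [NormedAddCommGroup E] [NormedSpace ℝ E]
    [CompleteSpace E] [TopologicalSpace P] [FirstCountableTopology P]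
    {A : P → ℝ → E →L[ℝ] E} (hA : Continuous (Function.uncurry A)) {y₀ : P → E}
    (hy : Continuous y₀) :
    ∃ Y : P → ℝ → E, Continuous (Function.uncurry Y) ∧ (∀ p, Y p 0 = y₀ p) ∧
      ∀ p x, HasDerivAt (Y p) (A p x (Y p x)) x := by
  classical
  set k : P → ℝ → ℝ := fun p s => ‖A p s‖ with hkdef
  have hk : Continuous (Function.uncurry k) := hA.norm
  have hkp : ∀ p, Continuous (k p) := fun p =>
    hk.comp (by fun_prop : Continuous fun s : ℝ => (p, s))
  set W : P × ℝ → ℝ := fun z => (1 + ‖y₀ z.1‖) * exp (2 * |∫ r in (0 : ℝ)..z.2, k z.1 r|) with hW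
  have hkI : Continuous fun z : P × ℝ => ∫ r in (0 : ℝ)..z.2, k z.1 r :=
    intervalIntegral.continuous_parametric_primitive_of_continuous hk
  have hWc : Continuous W := by
    have : Continuous fun z : P × ℝ => ‖y₀ z.1‖ := (hy.comp continuous_fst).norm
    fun_prop
  have hWpos : ∀ z, 0 < W z := fun z => by positivity
  have hW1 : ∀ z, 1 + ‖y₀ z.1‖ ≤ W z := fun z => by
    have : 1 ≤ exp (2 * |∫ r in (0 : ℝ)..z.2, k z.1 r|) := one_le_exp (by positivity)
    have h2 : 0 ≤ ‖y₀ z.1‖ := norm_nonneg _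
    simp only [hW]; nlinarith
  let I : (P × ℝ →ᵇ E) → P × ℝ → E := fun Z z =>
    ∫ s in (0 : ℝ)..z.2, A z.1 s (W (z.1, s) • Z (z.1, s))
  have hgc : ∀ Z : P × ℝ →ᵇ E, Continuous (Function.uncurry fun (p : P) (s : ℝ) =>
      A p s (W (p, s) • Z (p, s))) := fun Z => by
    have h1 : Continuous fun z : P × ℝ => W z • Z z := hWc.smul Z.continuous
    exact hA.clm_apply h1
  have hIc : ∀ Z, Continuous (I Z) := fun Z =>
    intervalIntegral.continuous_parametric_primitive_of_continuous (hgc Z)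
  have hgi : ∀ (Z : P × ℝ →ᵇ E) p a b, IntervalIntegrable
      (fun s => A p s (W (p, s) • Z (p, s))) volume a b := fun Z p a b =>
    ((hgc Z).comp (by fun_prop : Continuous fun s : ℝ => (p, s))).intervalIntegrable a b
  have hest : ∀ (Z : P × ℝ → E) (M : ℝ), 0 ≤ M → (∀ z, ‖Z z‖ ≤ M) → ∀ z : P × ℝ,
      ‖∫ s in (0 : ℝ)..z.2, A z.1 s (W (z.1, s) • Z (z.1, s))‖ ≤ M / 2 * W z := by
    intro Z M hM hZ z
    have := norm_integral_le_exp_weight (x := z.2) (M := M * (1 + ‖y₀ z.1‖)) (hkp z.1)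
      (fun s => norm_nonneg _) (f := fun s => A z.1 s (W (z.1, s) • Z (z.1, s)))
      (by positivity) (fun s => by
        refine ((A z.1 s).le_opNorm _).trans ?_
        rw [norm_smul, Real.norm_of_nonneg (hWpos _).le]
        have h1 := mul_le_mul_of_nonneg_left (hZ (z.1, s))
          (mul_nonneg (norm_nonneg (A z.1 s)) (hWpos (z.1, s)).le)
        simp only [hW, hkdef] at h1 ⊢
        linarith)
    refine this.trans (le_of_eq ?_)
    simp only [hW]; ring
  let T : (P × ℝ →ᵇ E) → (P × ℝ →ᵇ E) := fun Z =>
    BoundedContinuousFunction.ofNormedAddCommGroup (fun z => (W z)⁻¹ • (y₀ z.1 + I Z z))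
      ((hWc.inv₀ fun z => (hWpos z).ne').smul ((hy.comp continuous_fst).add (hIc Z)))
      (1 + ‖Z‖ / 2) (fun z => by
        rw [norm_smul, norm_inv, Real.norm_of_nonneg (hWpos z).le,
          inv_mul_le_iff₀ (hWpos z)]
        have h1 := hest Z ‖Z‖ (norm_nonneg _) (fun z => Z.norm_coe_le_norm z) z
        have h2 := norm_add_le (y₀ z.1) (I Z z)
        have h3 := hW1 z
        simp only [I] at h2 ⊢
        linarith)
  have hT : ContractingWith (1 / 2) T := by
    refine ⟨by rw [← NNReal.coe_lt_coe]; norm_num, LipschitzWith.of_dist_le_mul fun Z₁ Z₂ => ?_⟩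
    rw [BoundedContinuousFunction.dist_le (by positivity)]
    intro z
    have h1 := hest (fun z => Z₁ z - Z₂ z) (dist Z₁ Z₂) dist_nonneg
      (fun z => by rw [← dist_eq_norm]; exact BoundedContinuousFunction.dist_coe_le_dist z) z
    have h2 : I Z₁ z - I Z₂ z
        = ∫ s in (0 : ℝ)..z.2, A z.1 s (W (z.1, s) • (Z₁ (z.1, s) - Z₂ (z.1, s))) := by
      simp only [I]
      rw [← intervalIntegral.integral_sub (hgi Z₁ _ _ _) (hgi Z₂ _ _ _)]
      refine intervalIntegral.integral_congr fun s _ => ?_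
      simp only [smul_sub, map_sub]
    have h3 : T Z₁ z - T Z₂ z = (W z)⁻¹ • (I Z₁ z - I Z₂ z) := by
      simp only [T, BoundedContinuousFunction.coe_ofNormedAddCommGroup, ← smul_sub,
        add_sub_add_left_eq_sub]
    rw [dist_eq_norm, h3, norm_smul, norm_inv, Real.norm_of_nonneg (hWpos z).le,
          inv_mul_le_iff₀ (hWpos z), h2]
    refine h1.trans (le_of_eq ?_)
    push_cast; ring
  obtain ⟨Z, hZ⟩ : ∃ Z, T Z = Z := ⟨hT.fixedPoint, hT.fixedPoint_isFixedPt⟩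
  have hY : ∀ z, W z • Z z = y₀ z.1 + I Z z := by
    intro z
    have : T Z z = Z z := by rw [hZ]
    rw [← this]
    simp only [T, BoundedContinuousFunction.coe_ofNormedAddCommGroup]
    rw [smul_inv_smul₀ (hWpos z).ne']
  refine ⟨fun p x => W (p, x) • Z (p, x), hWc.smul Z.continuous, fun p => ?_, fun p x => ?_⟩
  · simp only [hY]; simp [I]
  · have e : (fun x => W (p, x) • Z (p, x)) =
        fun x => y₀ p + ∫ s in (0 : ℝ)..x, A p s (W (p, s) • Z (p, s)) :=
      funext fun x => hY (p, x)
    change HasDerivAt (fun x => W (p, x) • Z (p, x)) _ x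
    rw [e]
    have hc : Continuous fun s => A p s (W (p, s) • Z (p, s)) :=
      (hgc Z).comp (by fun_prop : Continuous fun s : ℝ => (p, s))
    exact ((hc.integral_hasStrictDerivAt 0 x).hasDerivAt).const_add (y₀ p)

/-- A weighted supremum argument for Volterra inequalities. -/
theorem eq_zero_of_volterra {E : Type*} [NormedAddCommGroup E] {e : ℝ → ℝ → E}
    (he : Continuous (Function.uncurry e)) {a b : ℝ}
    (h : ∀ R > 0, ∃ C > 0, ∀ t ∈ Set.Icc a b, ∀ x ∈ Set.Icc (-R) R, ∀ M l : ℝ, 0 < l →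
      (∀ s ∈ Set.Icc a b, ∀ y ∈ Set.Icc (-R) R, ‖e s y‖ ≤ M * exp (l * |y|)) →
      ‖e t x‖ ≤ C * |∫ y in (0 : ℝ)..x, M * exp (l * |y|)|) :
    ∀ t ∈ Set.Icc a b, ∀ x, e t x = 0 := by
  intro t ht x
  set R := |x| + 1
  have hR : 0 < R := by positivity
  obtain ⟨C, hC, hv⟩ := h R hR
  set l := 2 * C
  have hl : 0 < l := by positivity
  have hKc : IsCompact (Set.Icc a b ×ˢ Set.Icc (-R) R) := isCompact_Icc.prod isCompact_Icc
  have hx : x ∈ Set.Icc (-R) R := by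
    constructor
    · linarith [neg_abs_le x]
    · linarith [le_abs_self x]
  obtain ⟨⟨s, y⟩, ⟨hs, hy⟩, hmax⟩ := hKc.exists_isMaxOn ⟨(t, x), ht, hx⟩
    (f := fun z : ℝ × ℝ => ‖e z.1 z.2‖ * exp (-(l * |z.2|)))
    (by
      have : Continuous fun z : ℝ × ℝ => ‖e z.1 z.2‖ := he.norm
      exact (by fun_prop : Continuous _).continuousOn)
  set M := ‖e s y‖ * exp (-(l * |y|)) with hM
  have hM0 : 0 ≤ M := by positivity
  have hb : ∀ s ∈ Set.Icc a b, ∀ y ∈ Set.Icc (-R) R, ‖e s y‖ ≤ M * exp (l * |y|) := by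
    intro s' hs' y' hy'
    have h1 : ‖e s' y'‖ * exp (-(l * |y'|)) ≤ M := hmax (show (s', y') ∈ _ from ⟨hs', hy'⟩)
    calc ‖e s' y'‖ = ‖e s' y'‖ * exp (-(l * |y'|)) * exp (l * |y'|) := by
          rw [mul_assoc, ← exp_add]; simp
      _ ≤ _ := by gcongr
  have h_integral : ∀ y : ℝ, |∫ y in (0 : ℝ)..y, M * exp (l * |y|)| ≤ M / l * exp (l * |y|) := by
    intro y
    have hp : ∀ z : ℝ, 0 ≤ z → ∫ y in (0 : ℝ)..z, M * exp (l * |y|)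
        = M / l * (exp (l * z) - 1) := by
      intro z hz
      have : ∫ y in (0 : ℝ)..z, M * exp (l * |y|) = ∫ y in (0 : ℝ)..z, M * exp (l * y) := by
        refine intervalIntegral.integral_congr fun y hy => ?_
        rw [Set.uIcc_of_le hz] at hy
        simp only [abs_of_nonneg hy.1]
      rw [this, intervalIntegral.integral_const_mul,
        intervalIntegral.integral_comp_mul_left (fun y => exp y) hl.ne', integral_exp]
      simp; field_simp
    have key : |∫ y in (0 : ℝ)..y, M * exp (l * |y|)| = M / l * (exp (l * |y|) - 1) := by
      have hnn : ∀ z : ℝ, 0 ≤ z → 0 ≤ M / l * (exp (l * z) - 1) := fun z hz =>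
        mul_nonneg (by positivity) (by linarith [one_le_exp (mul_nonneg hl.le hz)])
      rcases le_total 0 y with h | h
      · rw [hp y h, abs_of_nonneg h, abs_of_nonneg (hnn y h)]
      · have := intervalIntegral.integral_comp_neg (a := 0) (b := -y)
          (fun y => M * exp (l * |y|))
        simp only [abs_neg, neg_neg, neg_zero] at this
        rw [intervalIntegral.integral_symm, ← this, hp (-y) (by linarith), abs_of_nonpos h,
          abs_neg, abs_of_nonneg (hnn _ (by linarith))]
    rw [key]
    have : 0 ≤ M / l := by positivity
    nlinarith
  have h2 := (hv s hs y hy M l hl hb).trans (mul_le_mul_of_nonneg_left (h_integral y) hC.le)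
  have h3 : M ≤ M / 2 := by
    calc M = ‖e s y‖ * exp (-(l * |y|)) := hM
      _ ≤ C * (M / l * exp (l * |y|)) * exp (-(l * |y|)) := by gcongr
      _ = M / 2 := by
        rw [mul_assoc, mul_assoc, ← exp_add]; simp [l]; field_simp
  have hM00 : M = 0 := by linarith
  have := hb t ht x hx
  rw [hM00, zero_mul] at this
  exact norm_le_zero_iff.1 this

theorem linear_ode_unique {E : Type*} [NormedAddCommGroup E] [NormedSpace ℝ E] [CompleteSpace E]
    {A : ℝ → E →L[ℝ] E} (hA : Continuous A) {y : ℝ → E}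
    (hy : ∀ x, HasDerivAt y (A x (y x)) x) (h0 : y 0 = 0) (x : ℝ) : y x = 0 := by
  have hyc : Continuous y := continuous_iff_continuousAt.2 fun x => (hy x).continuousAt
  refine eq_zero_of_volterra (e := fun _ x => y x) (a := 0) (b := 0)
    (hyc.comp continuous_snd) (fun R hR => ?_) 0 (by simp) x
  obtain ⟨C, hC⟩ := (isCompact_Icc (a := -R) (b := R)).exists_bound_of_continuousOn hA.continuousOn
  have hC0 : 0 ≤ C := (norm_nonneg _).trans (hC 0 ⟨by linarith, hR.le⟩)
  refine ⟨C + 1, by positivity, fun t ht x hx M l hl hM => ?_⟩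
  have hc : Continuous fun x => A x (y x) := hA.clm_apply hyc
  have : y x = ∫ s in (0 : ℝ)..x, A s (y s) := by
    rw [intervalIntegral.integral_eq_sub_of_hasDerivAt (fun s _ => hy s)
      (hc.intervalIntegrable _ _), h0, sub_zero]
  rw [this, ← abs_of_nonneg (by positivity : 0 ≤ C + 1), ← abs_mul,
    ← intervalIntegral.integral_const_mul]
  refine intervalIntegral.norm_integral_le_abs_of_norm_le
    (ae_restrict_of_forall_mem measurableSet_uIoc fun s hs => ?_)
    ((by fun_prop : Continuous fun s => (C + 1) * (M * exp (l * |s|))).intervalIntegrable _ _)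
  have hs' : s ∈ Set.Icc (-R) R :=
    (Set.uIcc_subset_Icc ⟨by linarith, hR.le⟩ hx) (Set.uIoc_subset_uIcc hs)
  refine ((A s).le_opNorm _).trans ?_
  exact mul_le_mul ((hC s hs').trans (by linarith)) (hM t ht s hs') (norm_nonneg _) (by positivity)

/-- Compatible linear systems are solvable. -/
theorem zero_curvature {E : Type*} [NormedAddCommGroup E] [NormedSpace ℝ E] [CompleteSpace E]
    {A A' B B' : ℝ → ℝ → E →L[ℝ] E} (hA : Continuous (Function.uncurry A))
    (hA' : Continuous (Function.uncurry A')) (hB : Continuous (Function.uncurry B))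
    (hB' : Continuous (Function.uncurry B'))
    (hAd : ∀ t x, HasDerivAt (fun s => A s x) (A' t x) t)
    (hBd : ∀ t x, HasDerivAt (B t) (B' t x) x)
    (hcomm : ∀ t x y, A' t x y + A t x (B t x y) = B' t x y + B t x (A t x y))
    (t₀ : ℝ) (y₀ : E) :
    ∃ Y : ℝ → ℝ → E, Continuous (Function.uncurry Y) ∧ Y t₀ 0 = y₀ ∧
      (∀ t x, HasDerivAt (Y t) (A t x (Y t x)) x) ∧
      ∀ t x, HasDerivAt (fun s => Y s x) (B t x (Y t x)) t := by
  obtain ⟨y, hyc, hy0, hyd⟩ := exists_linear_ode (P := Unit) (E := E)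
    (A := fun _ t => B (t + t₀) 0)
    (hB.comp (by fun_prop : Continuous fun z : Unit × ℝ => (z.2 + t₀, (0 : ℝ))))
    (y₀ := fun _ => y₀) continuous_const
  have hyd' : ∀ t, HasDerivAt (fun t => y () (t - t₀)) (B t 0 (y () (t - t₀))) t := fun t => by
    have := (hyd () (t - t₀)).comp_sub_const t t₀
    rwa [sub_add_cancel] at this
  have hyc' : Continuous fun t => y () (t - t₀) :=
    continuous_iff_continuousAt.2 fun x => (hyd' x).continuousAt
  obtain ⟨Y, hYc, hY0, hYd⟩ := exists_linear_ode hA hyc'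
  have hYcx : ∀ t, Continuous (Y t) := fun t =>
    hYc.comp (by fun_prop : Continuous fun x : ℝ => (t, x))
  have hYct : ∀ x, Continuous fun t => Y t x := fun x =>
    hYc.comp (by fun_prop : Continuous fun t : ℝ => (t, x))
  have hBY : Continuous (Function.uncurry fun t x => B t x (Y t x)) := hB.clm_apply hYc
  have hBYt : ∀ x, Continuous fun t => B t x (Y t x) := fun x =>
    hBY.comp (by fun_prop : Continuous fun t : ℝ => (t, x))
  set Z : ℝ → ℝ → E := fun t x => Y t₀ x + ∫ s in t₀..t, B s x (Y s x) with hZ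
  have hZt : ∀ t x, HasDerivAt (fun s => Z s x) (B t x (Y t x)) t := fun t x =>
    ((hBYt x).integral_hasStrictDerivAt t₀ t).hasDerivAt.const_add _
  have hZc : Continuous (Function.uncurry Z) := by
    have h1 : Continuous fun z : ℝ × ℝ => ∫ s in t₀..z.1, B s z.2 (Y s z.2) :=
      intervalIntegral.continuous_parametric_intervalIntegral_of_continuous
        (f := fun (z : ℝ × ℝ) s => B s z.2 (Y s z.2))
        (hBY.comp (by fun_prop : Continuous fun w : (ℝ × ℝ) × ℝ => (w.2, w.1.2))) continuous_fst
    exact ((hYcx t₀).comp continuous_snd).add h1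
  have hdBY : Continuous (Function.uncurry fun t x => B' t x (Y t x) + B t x (A t x (Y t x))) :=
    (hB'.clm_apply hYc).add (hB.clm_apply (hA.clm_apply hYc))
  have hZx : ∀ t x, HasDerivAt (Z t)
      (A t x (Z t x) + ∫ s in t₀..t, A' s x (Y s x - Z s x)) x := by
    intro t x
    have h1 := hasDerivAt_intervalIntegral_param (F := fun s x => B s x (Y s x)) hdBY
      (fun s x => (hBd s x).clm_apply (hYd s x)) hBYt t₀ t x
    refine ((hYd t₀ x).add h1).congr_deriv ?_
    have cA' : Continuous fun s => A' s x :=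
      hA'.comp (by fun_prop : Continuous fun t : ℝ => (t, x))
    have cA : Continuous fun s => A s x :=
      hA.comp (by fun_prop : Continuous fun t : ℝ => (t, x))
    have cZ : Continuous fun s => Z s x :=
      hZc.comp (by fun_prop : Continuous fun t : ℝ => (t, x))
    have h2 : ∫ s in t₀..t, (A' s x (Z s x) + A s x (B s x (Y s x)))
        = A t x (Z t x) - A t₀ x (Z t₀ x) :=
      intervalIntegral.integral_eq_sub_of_hasDerivAt
        (fun s _ => (hAd s x).clm_apply (hZt s x))
        (((cA'.clm_apply cZ).add (cA.clm_apply (hBYt x))).intervalIntegrable _ _)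
    have h3 : Z t₀ x = Y t₀ x := by simp [hZ]
    rw [h3] at h2
    have h4 : ∫ s in t₀..t, (B' s x (Y s x) + B s x (A s x (Y s x)))
        = (∫ s in t₀..t, A' s x (Y s x - Z s x))
          + ∫ s in t₀..t, (A' s x (Z s x) + A s x (B s x (Y s x))) := by
      rw [← intervalIntegral.integral_add]
      · refine intervalIntegral.integral_congr fun s _ => ?_
        simp only [← hcomm, map_sub]; abel
      · exact (cA'.clm_apply ((hYct x).sub cZ)).intervalIntegrable _ _
      · exact ((cA'.clm_apply cZ).add (cA.clm_apply (hBYt x))).intervalIntegrable _ _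
    rw [h4, h2]; abel
  have hZ0 : ∀ t, Z t 0 = Y t 0 := by
    intro t
    simp only [hZ, hY0]
    have := intervalIntegral.integral_eq_sub_of_hasDerivAt (fun s _ => hyd' s)
      ((by simpa only [hY0] using hBYt 0 :
        Continuous fun s => B s 0 (y () (s - t₀))).intervalIntegrable t₀ t)
    rw [this]; abel
  have hec : Continuous (Function.uncurry fun t x => Y t x - Z t x) := hYc.sub hZc
  have hfin : ∀ t x, Y t x - Z t x = 0 := by
    intro T x
    refine eq_zero_of_volterra (e := fun t x => Y t x - Z t x) (a := min t₀ T) (b := max t₀ T)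
      hec (fun R hR => ?_) T ⟨min_le_right _ _, le_max_right _ _⟩ x
    have hK : IsCompact (Set.Icc (min t₀ T) (max t₀ T) ×ˢ Set.Icc (-R) R) :=
      isCompact_Icc.prod isCompact_Icc
    obtain ⟨C₁, hC₁⟩ := hK.exists_bound_of_continuousOn hA.continuousOn
    obtain ⟨C₂, hC₂⟩ := hK.exists_bound_of_continuousOn hA'.continuousOn
    have hmem : ((t₀, 0) : ℝ × ℝ) ∈ Set.Icc (min t₀ T) (max t₀ T) ×ˢ Set.Icc (-R) R :=
      ⟨⟨min_le_left _ _, le_max_left _ _⟩, by linarith, hR.le⟩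
    have hC₁0 : 0 ≤ C₁ := (norm_nonneg _).trans (hC₁ _ hmem)
    have hC₂0 : 0 ≤ C₂ := (norm_nonneg _).trans (hC₂ _ hmem)
    have hl : 0 ≤ max t₀ T - min t₀ T := sub_nonneg.2 min_le_max
    refine ⟨C₁ + C₂ * (max t₀ T - min t₀ T) + 1, by positivity, fun t ht x hx M l hl0 hM => ?_⟩
    have hcA' : Continuous fun x => ∫ s in t₀..t, A' s x (Y s x - Z s x) :=
      intervalIntegral.continuous_parametric_intervalIntegral_of_continuous'
        (f := fun x s => A' s x (Y s x - Z s x))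
        ((hA'.clm_apply hec).comp (by fun_prop : Continuous fun w : ℝ × ℝ => (w.2, w.1))) _ _
    have hcA : Continuous fun x => A t x (Y t x - Z t x) :=
      (hA.clm_apply hec).comp (by fun_prop : Continuous fun x : ℝ => (t, x))
    have hd : ∀ x, HasDerivAt (fun x => Y t x - Z t x)
        (A t x (Y t x - Z t x) - ∫ s in t₀..t, A' s x (Y s x - Z s x)) x := fun x => by
      refine ((hYd t x).sub (hZx t x)).congr_deriv ?_
      rw [map_sub]; abel
    have : Y t x - Z t x = ∫ s in (0 : ℝ)..x,
        (A t s (Y t s - Z t s) - ∫ r in t₀..t, A' r s (Y r s - Z r s)) := by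
      rw [intervalIntegral.integral_eq_sub_of_hasDerivAt (fun s _ => hd s)
        ((hcA.sub hcA').intervalIntegrable _ _), hZ0]
      simp
    rw [this]
    set K := C₁ + C₂ * (max t₀ T - min t₀ T) + 1
    rw [← abs_of_nonneg (by positivity : 0 ≤ K), ← abs_mul, ← intervalIntegral.integral_const_mul]
    refine intervalIntegral.norm_integral_le_abs_of_norm_le
      (ae_restrict_of_forall_mem measurableSet_uIoc fun s hs => ?_)
      ((by fun_prop : Continuous fun s => K * (M * exp (l * |s|))).intervalIntegrable _ _)
    have hs' : s ∈ Set.Icc (-R) R :=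
      (Set.uIcc_subset_Icc ⟨by linarith, hR.le⟩ hx) (Set.uIoc_subset_uIcc hs)
    have hM0 : 0 ≤ M * exp (l * |s|) := (norm_nonneg _).trans (hM t ht s hs')
    have e1 : ‖A t s (Y t s - Z t s)‖ ≤ C₁ * (M * exp (l * |s|)) :=
      ((A t s).le_opNorm _).trans
        (mul_le_mul (hC₁ (t, s) ⟨ht, hs'⟩) (hM t ht s hs') (norm_nonneg _) hC₁0)
    have e2 : ‖∫ r in t₀..t, A' r s (Y r s - Z r s)‖ ≤ C₂ * (M * exp (l * |s|)) * |t - t₀| := by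
      refine intervalIntegral.norm_integral_le_of_norm_le_const fun r hr => ?_
      have hr' : r ∈ Set.Icc (min t₀ T) (max t₀ T) :=
        (Set.uIcc_subset_Icc ⟨min_le_left _ _, le_max_left _ _⟩ ht) (Set.uIoc_subset_uIcc hr)
      exact ((A' r s).le_opNorm _).trans
        (mul_le_mul (hC₂ (r, s) ⟨hr', hs'⟩) (hM r hr' s hs') (norm_nonneg _) hC₂0)
    have e3 : |t - t₀| ≤ max t₀ T - min t₀ T := by
      rw [abs_le]
      constructor <;> linarith [ht.1, ht.2, min_le_left t₀ T, le_max_left t₀ T]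
    refine (norm_sub_le _ _).trans ?_
    have e4 := mul_le_mul_of_nonneg_left e3 (mul_nonneg hC₂0 hM0)
    simp only [K]; nlinarith
  have hYZ : Y = Z := by
    funext t x; exact sub_eq_zero.1 (hfin t x)
  refine ⟨Y, hYc, ?_, hYd, fun t x => ?_⟩
  · rw [hY0, sub_self, hy0]
  · have := hZt t x
    rwa [← hYZ] at this

/-- A function of two variables with `C^n` partial derivatives is `C^(n+1)`. -/
theorem contDiff_succ_of_partial {u u₁ u₂ : ℝ → ℝ → ℝ} (h1 : ∀ t x, HasDerivAt (fun s => u s x) (u₁ t x) t)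
    (h2 : ∀ t x, HasDerivAt (u t) (u₂ t x) x) (n : ℕ)
    (s1 : ContDiff ℝ n (Function.uncurry u₁)) (s2 : ContDiff ℝ n (Function.uncurry u₂)) :
    ContDiff ℝ (n + 1) (Function.uncurry u) := by
  have c1 := s1.continuous
  have c2 := s2.continuous
  rw [contDiff_succ_iff_hasFDerivAt]
  refine ⟨fun z => (ContinuousLinearMap.toSpanSingleton ℝ (u₁ z.1 z.2)).coprod
    (ContinuousLinearMap.toSpanSingleton ℝ (u₂ z.1 z.2)), ?_, fun z => ?_⟩
  · have : (fun z : ℝ × ℝ => (ContinuousLinearMap.toSpanSingleton ℝ (u₁ z.1 z.2)).coprod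
      (ContinuousLinearMap.toSpanSingleton ℝ (u₂ z.1 z.2))) = fun z =>
        Function.uncurry u₁ z • ContinuousLinearMap.fst ℝ ℝ ℝ
        + Function.uncurry u₂ z • ContinuousLinearMap.snd ℝ ℝ ℝ := by
      funext z; ext <;> simp [Function.uncurry]
    rw [this]
    exact (s1.smul contDiff_const).add (s2.smul contDiff_const)
  · have hT : Continuous fun y : ℝ => ContinuousLinearMap.toSpanSingleton ℝ y := by
      have : (fun y : ℝ => ContinuousLinearMap.toSpanSingleton ℝ y)
        = fun y => y • ContinuousLinearMap.id ℝ ℝ := by funext y; ext; simp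
      rw [this]; fun_prop
    exact (hasStrictFDerivAt_uncurry_coprod (f := u) (u := z)
      (f₁ := fun t x => ContinuousLinearMap.toSpanSingleton ℝ (u₁ t x))
      (f₂ := fun t x => ContinuousLinearMap.toSpanSingleton ℝ (u₂ t x))
      (Eventually.of_forall fun v => (h1 v.1 v.2).hasFDerivAt)
      (Eventually.of_forall fun v => (h2 v.1 v.2).hasFDerivAt)
      (hT.comp c1).continuousAt (hT.comp c2).continuousAt).hasFDerivAt

theorem Sm.of_partial {u u₁ u₂ : ℝ → ℝ → ℝ} (h1 : ∀ t x, HasDerivAt (fun s => u s x) (u₁ t x) t)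
    (h2 : ∀ t x, HasDerivAt (u t) (u₂ t x) x) (s1 : Sm u₁) (s2 : Sm u₂) : Sm u := by
  have hle : ∀ n : ℕ, (n : WithTop ℕ∞) ≤ ((⊤ : ℕ∞) : WithTop ℕ∞) :=
    fun n => WithTop.coe_le_coe.2 le_top
  exact contDiff_infty.2 fun n => (contDiff_succ_of_partial h1 h2 n (ContDiff.of_le s1 (hle n))
    (ContDiff.of_le s2 (hle n))).of_le (by exact_mod_cast Nat.le_succ n)

/-- Continuous solutions of a first order system with smooth coefficients are smooth. -/
theorem Sm.of_system {f g a b c d e : ℝ → ℝ → ℝ} (hf : Continuous (Function.uncurry f))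
    (hg : Continuous (Function.uncurry g)) (ha : Sm a) (hb : Sm b) (hc : Sm c) (hd : Sm d)
    (he : Sm e) (hfx : ∀ t x, HasDerivAt (f t) (g t x) x)
    (hgx : ∀ t x, HasDerivAt (g t) (a t x * f t x) x)
    (hft : ∀ t x, HasDerivAt (fun s => f s x) (b t x * f t x + c t x * g t x) t)
    (hgt : ∀ t x, HasDerivAt (fun s => g s x) (d t x * f t x + e t x * g t x) t) :
    Sm f ∧ Sm g := by
  have main : ∀ n : ℕ, ContDiff ℝ n (Function.uncurry f) ∧ ContDiff ℝ n (Function.uncurry g) := by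
    intro n
    induction n with
    | zero => exact ⟨contDiff_zero.2 hf, contDiff_zero.2 hg⟩
    | succ n ih =>
      obtain ⟨i1, i2⟩ := ih
      have hle : (n : WithTop ℕ∞) ≤ ((⊤ : ℕ∞) : WithTop ℕ∞) := WithTop.coe_le_coe.2 le_top
      have A := ContDiff.of_le ha hle
      have B := ContDiff.of_le hb hle
      have C := ContDiff.of_le hc hle
      have D := ContDiff.of_le hd hle
      have E := ContDiff.of_le he hle
      push_cast
      constructor
      · exact contDiff_succ_of_partial hft hfx n
          ((B.mul i1).add (C.mul i2)) i2
      · exact contDiff_succ_of_partial hgt hgx n ((D.mul i1).add (E.mul i2)) (A.mul i1)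
  exact ⟨contDiff_infty.2 fun n => (main n).1, contDiff_infty.2 fun n => (main n).2⟩

/-- The KdV equation in the normalization `q_t = 6 q q_x - q_xxx`. -/
def KdV (q : ℝ → ℝ → ℝ) : Prop :=
  ∀ t x, dt q t x = 6 * q t x * dx q t x - dx (dx (dx q)) t x

/-- Solvability of the Lax system of a KdV solution. -/
theorem exists_lax {q : ℝ → ℝ → ℝ} (hq : Sm q) (hk : KdV q) (l t₀ a b : ℝ) :
    ∃ f : ℝ → ℝ → ℝ, Sm f ∧ f t₀ 0 = a ∧ dx f t₀ 0 = b ∧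
      (∀ t x, dx (dx f) t x = (q t x + l) * f t x) ∧
      ∀ t x, dt f t x = -dx q t x * f t x + (2 * q t x - 4 * l) * dx f t x := by
  let E₁₁ : ℝ × ℝ →L[ℝ] ℝ × ℝ :=
    (ContinuousLinearMap.inl ℝ ℝ ℝ).comp (ContinuousLinearMap.fst ℝ ℝ ℝ)
  let E₁₂ : ℝ × ℝ →L[ℝ] ℝ × ℝ :=
    (ContinuousLinearMap.inl ℝ ℝ ℝ).comp (ContinuousLinearMap.snd ℝ ℝ ℝ)
  let E₂₁ : ℝ × ℝ →L[ℝ] ℝ × ℝ :=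
    (ContinuousLinearMap.inr ℝ ℝ ℝ).comp (ContinuousLinearMap.fst ℝ ℝ ℝ)
  let E₂₂ : ℝ × ℝ →L[ℝ] ℝ × ℝ :=
    (ContinuousLinearMap.inr ℝ ℝ ℝ).comp (ContinuousLinearMap.snd ℝ ℝ ℝ)
  have cq := hq.continuous
  have cqx := hq.dx.continuous
  have cqxx := hq.dx.dx.continuous
  have cqxxx := hq.dx.dx.dx.continuous
  have cqt := hq.dt.continuous
  have hd0 := hq.hasDerivAt_x
  have hd1 := hq.dx.hasDerivAt_x
  have hd2 := hq.dx.dx.hasDerivAt_x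
  simp only [Function.uncurry_def] at cq cqx cqxx cqxxx cqt
  obtain ⟨Y, hYc, hY0, hYx, hYt⟩ := zero_curvature (E := ℝ × ℝ)
    (A := fun t x => E₁₂ + (q t x + l) • E₂₁) (A' := fun t x => dt q t x • E₂₁)
    (B := fun t x => (-dx q t x) • E₁₁ + (2 * q t x - 4 * l) • E₁₂
      + (-dx (dx q) t x + (2 * q t x - 4 * l) * (q t x + l)) • E₂₁ + dx q t x • E₂₂)
    (B' := fun t x => (-dx (dx q) t x) • E₁₁ + (2 * dx q t x) • E₁₂
      + (-dx (dx (dx q)) t x + (2 * dx q t x * (q t x + l) + (2 * q t x - 4 * l) * dx q t x)) • E₂₁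
      + dx (dx q) t x • E₂₂)
    (by simp only [Function.uncurry_def]; fun_prop)
    (by simp only [Function.uncurry_def]; fun_prop)
    (by simp only [Function.uncurry_def]; fun_prop)
    (by simp only [Function.uncurry_def]; fun_prop)
    (fun t x => by
      exact (((hq.hasDerivAt_t t x).add_const l).smul_const E₂₁).const_add E₁₂)
    (fun t x => by
      have e := ((hd0 t x).const_mul 2).sub_const (4 * l)
      exact ((((hd1 t x).neg.smul_const E₁₁).add (e.smul_const E₁₂)).add
        (((hd2 t x).neg.add (e.mul ((hd0 t x).add_const l))).smul_const E₂₁)).add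
        ((hd1 t x).smul_const E₂₂))
    (fun t x y => by
      have := hk t x
      ext
      · simp [E₁₁, E₁₂, E₂₁, E₂₂]; ring
      · simp [E₁₁, E₁₂, E₂₁, E₂₂]; rw [this]; ring)
    t₀ (a, b)
  have hx1 : ∀ t x, HasDerivAt (fun x => (Y t x).1) (Y t x).2 x := fun t x => by
    have := (ContinuousLinearMap.fst ℝ ℝ ℝ).hasFDerivAt.comp_hasDerivAt x (hYx t x)
    simpa [E₁₁, E₁₂, E₂₁, E₂₂, Function.comp_def] using this
  have hx2 : ∀ t x, HasDerivAt (fun x => (Y t x).2) ((q t x + l) * (Y t x).1) x := fun t x => by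
    have := (ContinuousLinearMap.snd ℝ ℝ ℝ).hasFDerivAt.comp_hasDerivAt x (hYx t x)
    simpa [E₁₁, E₁₂, E₂₁, E₂₂, Function.comp_def] using this
  have ht1 : ∀ t x, HasDerivAt (fun s => (Y s x).1)
      (-dx q t x * (Y t x).1 + (2 * q t x - 4 * l) * (Y t x).2) t := fun t x => by
    have := (ContinuousLinearMap.fst ℝ ℝ ℝ).hasFDerivAt.comp_hasDerivAt t (hYt t x)
    simpa [E₁₁, E₁₂, E₂₁, E₂₂, Function.comp_def] using this
  have ht2 : ∀ t x, HasDerivAt (fun s => (Y s x).2)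
      ((-dx (dx q) t x + (2 * q t x - 4 * l) * (q t x + l)) * (Y t x).1
        + dx q t x * (Y t x).2) t := fun t x => by
    have := (ContinuousLinearMap.snd ℝ ℝ ℝ).hasFDerivAt.comp_hasDerivAt t (hYt t x)
    simpa [E₁₁, E₁₂, E₂₁, E₂₂, Function.comp_def] using this
  obtain ⟨s1, s2⟩ := Sm.of_system (f := fun t x => (Y t x).1) (g := fun t x => (Y t x).2)
    (a := fun t x => q t x + l) (b := fun t x => -dx q t x)
    (c := fun t x => 2 * q t x - 4 * l)
    (d := fun t x => -dx (dx q) t x + (2 * q t x - 4 * l) * (q t x + l))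
    (e := fun t x => dx q t x)
    (continuous_fst.comp hYc) (continuous_snd.comp hYc) (hq.add (Sm.const l)) hq.dx.neg
    (((Sm.const 2).mul hq).sub (Sm.const _))
    (hq.dx.dx.neg.add ((((Sm.const 2).mul hq).sub (Sm.const _)).mul (hq.add (Sm.const l))))
    hq.dx hx1 hx2 ht1 ht2
  have e1 : dx (fun t x => (Y t x).1) = fun t x => (Y t x).2 := by
    funext t x; exact (hx1 t x).deriv
  refine ⟨fun t x => (Y t x).1, s1, by simp [hY0], by rw [e1]; simp [hY0], ?_, ?_⟩
  · intro t x; rw [e1]; exact (hx2 t x).deriv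
  · intro t x; rw [e1]; exact (ht1 t x).deriv

/-! ### Continuous square integrable functions -/

/-- Continuous square integrable functions. -/
def SqI (f : ℝ → ℝ) : Prop := Continuous f ∧ Integrable fun x => f x ^ 2

namespace SqI

variable {f g : ℝ → ℝ}

theorem iff_memLp (hf : Continuous f) : SqI f ↔ MemLp f 2 volume :=
  ⟨fun h => (memLp_two_iff_integrable_sq hf.aestronglyMeasurable).2 h.2,
    fun h => ⟨hf, (memLp_two_iff_integrable_sq hf.aestronglyMeasurable).1 h⟩⟩

theorem memLp (hf : SqI f) : MemLp f 2 volume := (iff_memLp hf.1).1 hf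

theorem add (hf : SqI f) (hg : SqI g) : SqI fun x => f x + g x :=
  (iff_memLp (hf.1.add hg.1)).2 (hf.memLp.add hg.memLp)

theorem sub (hf : SqI f) (hg : SqI g) : SqI fun x => f x - g x :=
  (iff_memLp (hf.1.sub hg.1)).2 (hf.memLp.sub hg.memLp)

theorem neg (hf : SqI f) : SqI fun x => -f x :=
  (iff_memLp hf.1.neg).2 hf.memLp.neg

theorem of_le (hg : SqI g) (hf : Continuous f) (h : ∀ x, |f x| ≤ |g x|) : SqI f :=
  (iff_memLp hf).2 (hg.memLp.mono hf.aestronglyMeasurable (Eventually.of_forall h))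

theorem const_mul (hf : SqI f) (c : ℝ) : SqI fun x => c * f x :=
  (iff_memLp (continuous_const.mul hf.1)).2 (hf.memLp.const_mul c)

theorem bdd_mul (hf : SqI f) (hg : Continuous g) {C : ℝ} (h : ∀ x, |g x| ≤ C) :
    SqI fun x => g x * f x :=
  (hf.const_mul C).of_le (hg.mul hf.1) fun x => by
    rw [abs_mul, abs_mul]
    exact mul_le_mul_of_nonneg_right ((h x).trans (le_abs_self C)) (abs_nonneg _)

theorem mul_int (hf : SqI f) (hg : SqI g) : Integrable fun x => f x * g x :=
  hf.memLp.integrable_mul hg.memLp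

theorem of_sq_le {F : ℝ → ℝ} (hF : Integrable F) (hf : Continuous f) (h : ∀ x, f x ^ 2 ≤ F x) :
    SqI f :=
  ⟨hf, hF.mono' (hf.pow 2).aestronglyMeasurable (Eventually.of_forall fun x => by
    rw [Real.norm_of_nonneg (sq_nonneg _)]; exact h x)⟩

theorem comp_add (hf : SqI f) (a : ℝ) : SqI fun x => f (x + a) :=
  ⟨hf.1.comp (by fun_prop), hf.2.comp_add_right a⟩

theorem comp_neg (hf : SqI f) : SqI fun x => f (-x) :=
  ⟨hf.1.comp (by fun_prop), hf.2.comp_neg⟩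

theorem sum {ι : Type*} (s : Finset ι) {F : ι → ℝ → ℝ} (h : ∀ i ∈ s, SqI (F i)) :
    SqI fun x => ∑ i ∈ s, F i x := by
  classical
  induction s using Finset.induction_on with
  | empty => simp [SqI, continuous_const]
  | insert a s ha ih =>
    simp only [Finset.sum_insert ha]
    exact (h a (by simp)).add (ih fun i hi => h i (by simp [hi]))

theorem integral_nonneg (f : ℝ → ℝ) : 0 ≤ ∫ x, f x ^ 2 := MeasureTheory.integral_nonneg fun _ => sq_nonneg _

/-- The Cauchy–Schwarz inequality. -/
theorem abs_integral_mul_le (hf : SqI f) (hg : SqI g) :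
    |∫ x, f x * g x| ≤ √(∫ x, f x ^ 2) * √(∫ x, g x ^ 2) := by
  have key : ∀ s : ℝ, 0 ≤ (∫ x, g x ^ 2) * (s * s) + (2 * ∫ x, f x * g x) * s + ∫ x, f x ^ 2 := by
    intro s
    have h0 : 0 ≤ ∫ x, (f x + s * g x) ^ 2 := integral_nonneg _
    have e : ∀ x, (f x + s * g x) ^ 2 = g x ^ 2 * (s * s) + f x * g x * (2 * s) + f x ^ 2 :=
      fun x => by ring
    simp only [e] at h0
    have i1 : Integrable fun x => g x ^ 2 * (s * s) := hg.2.mul_const _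
    have i2 : Integrable fun x => f x * g x * (2 * s) := (hf.mul_int hg).mul_const _
    have i3 : Integrable fun x => g x ^ 2 * (s * s) + f x * g x * (2 * s) := i1.add i2
    rw [integral_add i3 hf.2, integral_add i1 i2, integral_mul_const,
      integral_mul_const] at h0
    linarith
  have := discrim_le_zero key
  unfold discrim at this
  rw [← Real.sqrt_mul (integral_nonneg f)]
  exact Real.abs_le_sqrt (by nlinarith)

theorem integral_sq_add_le (hf : SqI f) (hg : SqI g) :
    ∫ x, (f x + g x) ^ 2 ≤ 2 * (∫ x, f x ^ 2) + 2 * ∫ x, g x ^ 2 := by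
  rw [← integral_const_mul, ← integral_const_mul,
    ← integral_add (hf.2.const_mul 2) (hg.2.const_mul 2)]
  refine integral_mono (hf.add hg).2 ((hf.2.const_mul 2).add (hg.2.const_mul 2)) fun x => ?_
  show (f x + g x) ^ 2 ≤ 2 * f x ^ 2 + 2 * g x ^ 2
  nlinarith [sq_nonneg (f x - g x)]

theorem setIntegral_le (hf : SqI f) (s : Set ℝ) : ∫ x in s, f x ^ 2 ≤ ∫ x, f x ^ 2 :=
  setIntegral_le_integral hf.2 (Eventually.of_forall fun _ => sq_nonneg _)

end SqI

theorem SqI.tendsto_zero {f f' : ℝ → ℝ} (hf : SqI f) (hf' : SqI f')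
    (hd : ∀ x, HasDerivAt f (f' x) x) : Tendsto f atTop (nhds 0) ∧ Tendsto f atBot (nhds 0) := by
  have hd2 : ∀ x, HasDerivAt (fun x => f x ^ 2) (2 * (f x * f' x)) x := fun x =>
    ((hd x).pow 2).congr_deriv (by simp; ring)
  have hi := (hf.mul_int hf').const_mul 2
  have h1 : Tendsto (fun x => f x ^ 2) atTop (nhds 0) :=
    tendsto_zero_of_hasDerivAt_of_integrableOn_Ioi (a := 0) (fun x _ => hd2 x)
      hi.integrableOn hf.2.integrableOn
  have h2 : Tendsto (fun x => f x ^ 2) atBot (nhds 0) :=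
    tendsto_zero_of_hasDerivAt_of_integrableOn_Iic (a := 0) (fun x _ => hd2 x)
      hi.integrableOn hf.2.integrableOn
  constructor
  · have := (Real.continuous_sqrt.tendsto 0).comp h1
    simp only [Function.comp_def, Real.sqrt_sq_eq_abs, Real.sqrt_zero] at this
    exact (tendsto_zero_iff_abs_tendsto_zero f).2 this
  · have := (Real.continuous_sqrt.tendsto 0).comp h2
    simp only [Function.comp_def, Real.sqrt_sq_eq_abs, Real.sqrt_zero] at this
    exact (tendsto_zero_iff_abs_tendsto_zero f).2 this

/-- The one dimensional Sobolev inequality. -/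
theorem SqI.sq_le {f f' : ℝ → ℝ} (hf : SqI f) (hf' : SqI f')
    (hd : ∀ x, HasDerivAt f (f' x) x) (x : ℝ) :
    f x ^ 2 ≤ (∫ x, f x ^ 2) + ∫ x, f' x ^ 2 := by
  have hd2 : ∀ x, HasDerivAt (fun x => f x ^ 2) (2 * (f x * f' x)) x := fun x =>
    ((hd x).pow 2).congr_deriv (by simp; ring)
  have hi := (hf.mul_int hf').const_mul 2
  have h2 : Tendsto (fun x => f x ^ 2) atBot (nhds 0) := by
    simpa using (hf.tendsto_zero hf' hd).2.pow 2
  have h3 : ∫ y in Set.Iic x, 2 * (f y * f' y) = f x ^ 2 - 0 :=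
    integral_Iic_of_hasDerivAt_of_tendsto' (fun y _ => hd2 y) hi.integrableOn h2
  rw [sub_zero] at h3
  rw [← h3, ← integral_add hf.2 hf'.2]
  refine (setIntegral_mono_on hi.integrableOn (hf.2.add hf'.2).integrableOn measurableSet_Iic
    (fun y _ => ?_)).trans (setIntegral_le_integral (hf.2.add hf'.2)
      (Eventually.of_forall fun y => ?_))
  · show 2 * (f y * f' y) ≤ f y ^ 2 + f' y ^ 2
    nlinarith [sq_nonneg (f y - f' y)]
  · show 0 ≤ f y ^ 2 + f' y ^ 2
    positivity

/-- A continuous nonnegative function with bounded integrals over intervals is integrable. -/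
theorem integrable_of_interval_bound {F : ℝ → ℝ} (hF : Continuous F) (h0 : ∀ x, 0 ≤ F x) {C : ℝ}
    (h : ∀ R > 0, ∫ x in (-R)..R, F x ≤ C) : Integrable F ∧ ∫ x, F x ≤ C := by
  have hb : Tendsto (fun n : ℕ => -((n : ℝ) + 1)) atTop atBot :=
    tendsto_neg_atTop_atBot.comp (tendsto_atTop_add_const_right _ _ tendsto_natCast_atTop_atTop)
  have ht : Tendsto (fun n : ℕ => (n : ℝ) + 1) atTop atTop :=
    tendsto_atTop_add_const_right _ _ tendsto_natCast_atTop_atTop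
  have hi : Integrable F := by
    refine integrable_of_intervalIntegral_norm_bounded (a := fun n : ℕ => -((n : ℝ) + 1))
      (b := fun n : ℕ => (n : ℝ) + 1) (l := atTop) C
      (fun n => (hF.integrableOn_Icc).mono_set Set.Ioc_subset_Icc_self) hb ht
      (Eventually.of_forall fun n => ?_)
    have e : ∀ x, ‖F x‖ = F x := fun x => Real.norm_of_nonneg (h0 x)
    simp only [e]
    exact h _ (by positivity)
  exact ⟨hi, le_of_tendsto (intervalIntegral_tendsto_integral hi hb ht)
    (Eventually.of_forall fun n => h _ (by positivity))⟩

/-! ### The Riccati equation -/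

/-- Global solutions of `v' = q + b² - v²`. -/
def Ric (q : ℝ → ℝ) (b : ℝ) (v : ℝ → ℝ) : Prop :=
  ∀ x, HasDerivAt v (q x + b ^ 2 - v x ^ 2) x

namespace Ric

variable {q v : ℝ → ℝ} {b K : ℝ}

theorem continuous (h : Ric q b v) : Continuous v :=
  continuous_iff_continuousAt.2 fun x => (h x).continuousAt

theorem reflect (h : Ric q b v) : Ric (fun x => q (-x)) b (fun x => -v (-x)) := fun x => by
  have := (h (-x)).scomp x (hasDerivAt_neg x)
  exact this.neg.congr_deriv (by simp)

/-- The positive function with logarithmic derivative `v`. -/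
noncomputable def expInt (v : ℝ → ℝ) (x : ℝ) : ℝ := exp (∫ s in (0 : ℝ)..x, v s)

theorem expInt_pos (v : ℝ → ℝ) (x : ℝ) : 0 < expInt v x := exp_pos _

theorem hasDerivAt_expInt (hv : Continuous v) (x : ℝ) :
    HasDerivAt (expInt v) (v x * expInt v x) x :=
  ((hv.integral_hasStrictDerivAt 0 x).hasDerivAt.exp).congr_deriv (by rw [expInt]; ring)

theorem hasDerivAt_mul_expInt (h : Ric q b v) (x : ℝ) :
    HasDerivAt (fun x => v x * expInt v x) ((q x + b ^ 2) * expInt v x) x :=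
  ((h x).mul (hasDerivAt_expInt h.continuous x)).congr_deriv (by ring)

theorem le_of_bound (h : Ric q b v) (hq : ∀ x, |q x| ≤ K) (x : ℝ) : v x ≤ √(K + b ^ 2) := by
  set C := √(K + b ^ 2) with hC
  have hK : 0 ≤ K := (abs_nonneg _).trans (hq 0)
  have hC2 : C ^ 2 = K + b ^ 2 := Real.sq_sqrt (by positivity)
  have hC0 : 0 ≤ C := Real.sqrt_nonneg _
  by_contra! hx
  set f := expInt v
  have hf := hasDerivAt_expInt h.continuous
  have hf' := h.hasDerivAt_mul_expInt
  have he : ∀ (a : ℝ) y, HasDerivAt (fun y => exp (a * y)) (a * exp (a * y)) y := fun a y => by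
    have := ((hasDerivAt_id y).const_mul a).exp
    exact this.congr_deriv (by simp; ring)
  have hanti : Antitone fun y => exp (C * y) * (v y * f y - C * f y) := by
    refine antitone_of_hasDerivAt_nonpos
      (fun y => (he C y).mul ((hf' y).sub ((hf y).const_mul C))) fun y => ?_
    have h1 : q y + b ^ 2 - C ^ 2 ≤ 0 := by rw [hC2]; linarith [(abs_le.1 (hq y)).2]
    have h2 : 0 < exp (C * y) * f y := mul_pos (exp_pos _) (expInt_pos v y)
    show _ ≤ (0 : ℝ)
    nlinarith
  set p := exp (C * x) * (v x * f x - C * f x) with hp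
  have hp0 : 0 < p := by
    have : 0 < f x := expInt_pos v x
    have : 0 < v x * f x - C * f x := by nlinarith
    positivity
  set p' := p * exp (-(2 * C * x)) with hp'
  have hp'0 : 0 < p' := by positivity
  have hmono : MonotoneOn (fun y => exp (-C * y) * f y - p' * y) (Set.Iic x) := by
    refine monotoneOn_of_hasDerivWithinAt_nonneg (convex_Iic x)
      (f' := fun y => -C * exp (-C * y) * f y + exp (-C * y) * (v y * f y) - p')
      (fun y _ => ?_) (fun y _ => ?_) (fun y hy => ?_)
    · exact (((he (-C) y).mul (hf y)).sub
        ((hasDerivAt_id y).const_mul p')).continuousAt.continuousWithinAt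
    · refine (((he (-C) y).mul (hf y)).sub
        ((hasDerivAt_id y).const_mul p')).hasDerivWithinAt.congr_deriv (by simp [f])
    · rw [interior_Iic] at hy
      have h1 : p ≤ exp (C * y) * (v y * f y - C * f y) := hanti (show y < x from hy).le
      have h2 : exp (-(2 * C * x)) ≤ exp (-(2 * C * y)) := by
        apply exp_le_exp.2
        have := (show y < x from hy).le
        nlinarith
      have h3 : exp (-(2 * C * y)) * exp (C * y) = exp (-C * y) := by
        rw [← exp_add]; congr 1; ring
      have h4 : p' ≤ exp (-(2 * C * y)) * (exp (C * y) * (v y * f y - C * f y)) := by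
        rw [hp', mul_comm]
        exact mul_le_mul h2 h1 hp0.le (exp_pos _).le
      rw [← mul_assoc, h3] at h4
      linarith
  set z := x - (exp (-C * x) * f x) / p' with hz
  have hpos : 0 < exp (-C * x) * f x := mul_pos (exp_pos _) (expInt_pos v x)
  have hzx : z ≤ x := by rw [hz]; linarith [div_pos hpos hp'0]
  have h5 := hmono hzx (le_refl x : x ∈ Set.Iic x) hzx
  have h6 : 0 < exp (-C * z) * f z := mul_pos (exp_pos _) (expInt_pos v z)
  have h7 : p' * z = p' * x - exp (-C * x) * f x := by rw [hz]; field_simp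
  simp only at h5
  linarith

theorem abs_le_of_bound (h : Ric q b v) (hq : ∀ x, |q x| ≤ K) (x : ℝ) : |v x| ≤ √(K + b ^ 2) := by
  rw [abs_le]
  have h2 := h.reflect.le_of_bound (fun x => hq (-x)) (-x)
  simp only [neg_neg] at h2
  exact ⟨by linarith, h.le_of_bound hq x⟩

/-- The primitive of `v² - b²` as a function of `v`. -/
noncomputable def cub (b s : ℝ) : ℝ := s ^ 3 / 3 - b ^ 2 * s

theorem hasDerivAt_cub (h : Ric q b v) (x : ℝ) :
    HasDerivAt (fun x => cub b (v x)) ((q x + b ^ 2 - v x ^ 2) * (v x ^ 2 - b ^ 2)) x := by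
  unfold cub
  exact ((((h x).pow 3).div_const 3).sub ((h x).const_mul (b ^ 2))).congr_deriv (by simp; ring)

theorem abs_cub_le {C : ℝ} {s : ℝ} (hs : |s| ≤ C) : |cub b s| ≤ C ^ 3 / 3 + b ^ 2 * C := by
  unfold cub
  refine (abs_sub _ _).trans ?_
  rw [abs_div, abs_pow, abs_mul, abs_of_nonneg (sq_nonneg b), abs_of_pos (by norm_num : (0:ℝ) < 3)]
  gcongr

theorem sqI_aux (h : Ric q b v) (hq : SqI q) {C : ℝ} (hv : ∀ x, |v x| ≤ C) :
    Integrable (fun x => (q x + b ^ 2 - v x ^ 2) ^ 2 + (v x ^ 2 - b ^ 2) ^ 2) ∧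
    ∫ x, ((q x + b ^ 2 - v x ^ 2) ^ 2 + (v x ^ 2 - b ^ 2) ^ 2)
      ≤ (∫ x, q x ^ 2) + 4 * (C ^ 3 / 3 + b ^ 2 * C) := by
  have hc := h.continuous
  have hqc := hq.1
  refine integrable_of_interval_bound (by fun_prop) (fun x => by positivity) fun R hR => ?_
  have e : ∀ x, (q x + b ^ 2 - v x ^ 2) ^ 2 + (v x ^ 2 - b ^ 2) ^ 2
      = q x ^ 2 - 2 * ((q x + b ^ 2 - v x ^ 2) * (v x ^ 2 - b ^ 2)) := fun x => by ring
  simp only [e]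
  rw [intervalIntegral.integral_sub ((by fun_prop : Continuous _).intervalIntegrable _ _)
    ((by fun_prop : Continuous _).intervalIntegrable _ _), intervalIntegral.integral_const_mul,
    intervalIntegral.integral_eq_sub_of_hasDerivAt (fun x _ => h.hasDerivAt_cub x)
    ((by fun_prop : Continuous _).intervalIntegrable _ _)]
  have h1 : ∫ x in (-R)..R, q x ^ 2 ≤ ∫ x, q x ^ 2 := by
    rw [intervalIntegral.integral_of_le (by linarith)]; exact hq.setIntegral_le _
  have h2 := abs_le.1 (abs_cub_le (b := b) (hv R))
  have h3 := abs_le.1 (abs_cub_le (b := b) (hv (-R)))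
  linarith

theorem sqI_deriv (h : Ric q b v) (hq : SqI q) (hb : ∀ x, |q x| ≤ K) :
    SqI fun x => q x + b ^ 2 - v x ^ 2 := by
  have hc := h.continuous
  have hqc := hq.1
  exact SqI.of_sq_le (h.sqI_aux hq (h.abs_le_of_bound hb)).1 (by fun_prop)
    fun x => by simp only [le_add_iff_nonneg_right]; positivity

theorem sqI_sq_sub (h : Ric q b v) (hq : SqI q) (hb : ∀ x, |q x| ≤ K) :
    SqI fun x => v x ^ 2 - b ^ 2 := by
  have hc := h.continuous
  have hqc := hq.1
  exact SqI.of_sq_le (h.sqI_aux hq (h.abs_le_of_bound hb)).1 (by fun_prop)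
    fun x => by simp only [le_add_iff_nonneg_left]; positivity

theorem sqI_darboux (h : Ric q b v) (hq : SqI q) (hb : ∀ x, |q x| ≤ K) :
    SqI fun x => 2 * (v x ^ 2 - b ^ 2) - q x :=
  ((h.sqI_sq_sub hq hb).const_mul 2).sub hq

theorem tendsto_sq_sub (h : Ric q b v) (hq : SqI q) (hb : ∀ x, |q x| ≤ K) :
    Tendsto (fun x => v x ^ 2 - b ^ 2) atTop (nhds 0) ∧
      Tendsto (fun x => v x ^ 2 - b ^ 2) atBot (nhds 0) := by
  have hc := h.continuous
  refine SqI.tendsto_zero (f' := fun x => 2 * v x * (q x + b ^ 2 - v x ^ 2))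
    (h.sqI_sq_sub hq hb) ((h.sqI_deriv hq hb).bdd_mul (C := 2 * √(K + b ^ 2)) (by fun_prop)
    fun x => ?_) fun x => ?_
  · rw [abs_mul, abs_two]; exact mul_le_mul_of_nonneg_left (h.abs_le_of_bound hb x) two_pos.le
  · exact (((h x).pow 2).sub_const (b ^ 2)).congr_deriv (by simp)

end Ric

theorem tendsto_or_of_sq_atTop {v : ℝ → ℝ} {b : ℝ} (hb : 0 < b) (hv : Continuous v)
    (h : Tendsto (fun x => v x ^ 2 - b ^ 2) atTop (nhds 0)) :
    Tendsto v atTop (nhds b) ∨ Tendsto v atTop (nhds (-b)) := by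
  have habs : Tendsto (fun x => |v x|) atTop (nhds b) := by
    have := (Real.continuous_sqrt.tendsto _).comp (h.add_const (b ^ 2))
    simpa [Function.comp_def, Real.sqrt_sq_eq_abs, abs_of_pos hb] using this
  obtain ⟨X, hX⟩ := eventually_atTop.1 (habs.eventually (lt_mem_nhds hb))
  have hne : ∀ x ∈ Set.Ici X, v x ≠ 0 := fun x hx => abs_pos.1 (hX x hx)
  have hs : (∀ x ∈ Set.Ici X, 0 < v x) ∨ (∀ x ∈ Set.Ici X, v x < 0) := by
    by_contra! hcon
    obtain ⟨⟨x, hx, hx0⟩, y, hy, hy0⟩ := hcon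
    have hord : Set.OrdConnected (Set.Ici X) := Set.ordConnected_Ici
    obtain ⟨z, hz, hz0⟩ := intermediate_value_uIcc (hv.continuousOn (s := Set.uIcc x y))
      (show (0 : ℝ) ∈ Set.uIcc (v x) (v y) from Set.mem_uIcc_of_le hx0 hy0)
    exact hne z (hord.uIcc_subset hx hy hz) hz0
  rcases hs with hs | hs
  · left
    exact habs.congr' (eventually_atTop.2 ⟨X, fun x hx => abs_of_pos (hs x hx)⟩)
  · right
    refine habs.neg.congr' (eventually_atTop.2 ⟨X, fun x hx => ?_⟩)
    rw [abs_of_neg (hs x hx), neg_neg]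

namespace Ric

variable {q v : ℝ → ℝ} {b K : ℝ}

theorem tendsto_atTop_or (h : Ric q b v) (hb : 0 < b) (hq : SqI q) (hK : ∀ x, |q x| ≤ K) :
    Tendsto v atTop (nhds b) ∨ Tendsto v atTop (nhds (-b)) :=
  tendsto_or_of_sq_atTop hb h.continuous (h.tendsto_sq_sub hq hK).1

theorem tendsto_atBot_or (h : Ric q b v) (hb : 0 < b) (hq : SqI q) (hK : ∀ x, |q x| ≤ K) :
    Tendsto v atBot (nhds b) ∨ Tendsto v atBot (nhds (-b)) := by
  have h1 := h.reflect.tendsto_atTop_or hb hq.comp_neg (fun x => hK (-x))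
  have key : ∀ {l : ℝ}, Tendsto (fun x => -v (-x)) atTop (nhds l) → Tendsto v atBot (nhds (-l)) := by
    intro l hl
    have := hl.neg.comp tendsto_neg_atBot_atTop
    simpa [Function.comp_def] using this
  rcases h1 with h1 | h1
  · right; exact key h1
  · left; simpa using key h1

theorem integral_darboux (h : Ric q b v) (hq : SqI q) (hK : ∀ x, |q x| ≤ K) {l r : ℝ}
    (hl : Tendsto v atBot (nhds l)) (hr : Tendsto v atTop (nhds r)) :
    ∫ x, (2 * (v x ^ 2 - b ^ 2) - q x) ^ 2 = (∫ x, q x ^ 2) - 4 * (cub b r - cub b l) := by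
  have hc : Continuous (cub b) := by unfold cub; fun_prop
  have h1 := integral_of_hasDerivAt_of_tendsto (fun x => h.hasDerivAt_cub x)
    ((h.sqI_deriv hq hK).mul_int (h.sqI_sq_sub hq hK))
    ((hc.tendsto l).comp hl) ((hc.tendsto r).comp hr)
  rw [← h1, ← integral_const_mul, ← integral_sub hq.2
    (((h.sqI_deriv hq hK).mul_int (h.sqI_sq_sub hq hK)).const_mul 4)]
  congr 1; ext x; ring

end Ric

/-- The coefficient matrix of `f'' = l f` written as a first order system. -/
noncomputable def schMat (l : ℝ) : ℝ × ℝ →L[ℝ] ℝ × ℝ :=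
  (ContinuousLinearMap.inl ℝ ℝ ℝ).comp (ContinuousLinearMap.snd ℝ ℝ ℝ) +
    l • (ContinuousLinearMap.inr ℝ ℝ ℝ).comp (ContinuousLinearMap.fst ℝ ℝ ℝ)

theorem schMat_apply (l : ℝ) (y : ℝ × ℝ) : schMat l y = (y.2, l * y.1) := by
  simp [schMat]

theorem continuous_schMat : Continuous schMat := by
  unfold schMat; fun_prop

theorem exists_schrodinger {q : ℝ → ℝ} (hq : Continuous q) :
    ∃ φ φ' : ℝ × ℝ → ℝ → ℝ, Continuous (Function.uncurry φ) ∧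
      Continuous (Function.uncurry φ') ∧ ∀ p, φ p 0 = 1 ∧ φ' p 0 = p.2 ∧
      ∀ x, HasDerivAt (φ p) (φ' p x) x ∧ HasDerivAt (φ' p) ((q x + p.1 ^ 2) * φ p x) x := by
  obtain ⟨Y, hYc, hY0, hYd⟩ := exists_linear_ode (E := ℝ × ℝ) (P := ℝ × ℝ)
    (A := fun p x => schMat (q x + p.1 ^ 2)) (y₀ := fun p => (1, p.2))
    (by
      refine continuous_schMat.comp (?_ : Continuous fun z : (ℝ × ℝ) × ℝ => q z.2 + z.1.1 ^ 2)
      fun_prop) (by fun_prop)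
  refine ⟨fun p x => (Y p x).1, fun p x => (Y p x).2, continuous_fst.comp hYc,
    continuous_snd.comp hYc, fun p => ⟨by simp [hY0], by simp [hY0], fun x => ⟨?_, ?_⟩⟩⟩
  · have := (ContinuousLinearMap.fst ℝ ℝ ℝ).hasFDerivAt.comp_hasDerivAt x (hYd p x)
    simpa [Function.comp_def, schMat_apply] using this
  · have := (ContinuousLinearMap.snd ℝ ℝ ℝ).hasFDerivAt.comp_hasDerivAt x (hYd p x)
    simpa [Function.comp_def, schMat_apply] using this

theorem schrodinger_unique {l φ φ' f f' : ℝ → ℝ} (hl : Continuous l)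
    (h1 : ∀ x, HasDerivAt φ (φ' x) x) (h2 : ∀ x, HasDerivAt φ' (l x * φ x) x)
    (h3 : ∀ x, HasDerivAt f (f' x) x) (h4 : ∀ x, HasDerivAt f' (l x * f x) x)
    (h0 : φ 0 = f 0) (h0' : φ' 0 = f' 0) (x : ℝ) : φ x = f x ∧ φ' x = f' x := by
  have := linear_ode_unique (A := fun x => schMat (l x)) (continuous_schMat.comp hl)
    (y := fun x => (φ x - f x, φ' x - f' x)) (fun x => ?_) (by simp [h0, h0']) x
  · simp only [Prod.mk_eq_zero, sub_eq_zero] at this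
    exact this
  · rw [schMat_apply]
    exact (((h1 x).sub (h3 x)).prodMk ((h2 x).sub (h4 x))).congr_deriv (by simp; ring)

theorem hasDerivAt_neg_arg {f : ℝ → ℝ} {f' x : ℝ} (h : HasDerivAt f f' (-x)) :
    HasDerivAt (fun y => f (-y)) (-f') x :=
  (h.comp x (hasDerivAt_neg x)).congr_deriv (by ring)

namespace Ric

variable {q v u : ℝ → ℝ} {b K : ℝ}

theorem expInt_zero (v : ℝ → ℝ) : expInt v 0 = 1 := by simp [expInt]

theorem of_sol {φ φ' : ℝ → ℝ} (h1 : ∀ x, HasDerivAt φ (φ' x) x)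
    (h2 : ∀ x, HasDerivAt φ' ((q x + b ^ 2) * φ x) x) (h0 : ∀ x, φ x ≠ 0) :
    Ric q b fun x => φ' x / φ x := fun x =>
  ((h2 x).div (h1 x) (h0 x)).congr_deriv (by have := h0 x; field_simp)

theorem sub_mul (h : Ric q b v) (h' : Ric q b u) (x : ℝ) :
    (v x - u x) * expInt (fun s => v s + u s) x = v 0 - u 0 := by
  have hd : ∀ x, HasDerivAt (fun x => (v x - u x) * expInt (fun s => v s + u s) x) 0 x := fun x =>
    (((h x).sub (h' x)).mul (hasDerivAt_expInt (h.continuous.add h'.continuous) x)).congr_deriv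
      (by simp only [Pi.sub_apply, Pi.add_apply]; ring)
  have := is_const_of_deriv_eq_zero (fun x => (hd x).differentiableAt) (fun x => (hd x).deriv) x 0
  simpa [expInt_zero] using this

theorem lt_of_lt (h : Ric q b v) (h' : Ric q b u) (h0 : v 0 < u 0) (x : ℝ) : v x < u x := by
  have := h.sub_mul h' x
  have h2 := expInt_pos (fun s => v s + u s) x
  by_contra! hc
  have : 0 ≤ (v x - u x) * expInt (fun s => v s + u s) x := mul_nonneg (by linarith) h2.le
  linarith

theorem le_of_le (h : Ric q b v) (h' : Ric q b u) (h0 : v 0 ≤ u 0) (x : ℝ) : v x ≤ u x := by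
  have := h.sub_mul h' x
  have h2 := expInt_pos (fun s => v s + u s) x
  by_contra! hc
  have : 0 < (v x - u x) * expInt (fun s => v s + u s) x := mul_pos (by linarith) h2
  linarith

theorem pos_of_super {φ φ' m m' : ℝ → ℝ} (h1 : ∀ x, HasDerivAt φ (φ' x) x)
    (h2 : ∀ x, HasDerivAt φ' ((q x + b ^ 2) * φ x) x) (hm : ∀ x, HasDerivAt m (m' x) x)
    (h : ∀ x, m' x + m x ^ 2 ≤ q x + b ^ 2) (h0 : φ 0 = 1) (h0' : φ' 0 = m 0) :
    ∀ x, 0 ≤ x → 0 < φ x ∧ m x * φ x ≤ φ' x := by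
  have hmc : Continuous m := continuous_iff_continuousAt.2 fun x => (hm x).continuousAt
  have hφc : Continuous φ := continuous_iff_continuousAt.2 fun x => (h1 x).continuousAt
  have hF := fun x => hasDerivAt_expInt hmc x
  have hW : ∀ x, HasDerivAt (fun x => (φ' x - m x * φ x) * expInt m x)
      (φ x * (q x + b ^ 2 - m' x - m x ^ 2) * expInt m x) x := fun x =>
    (((h2 x).sub ((hm x).mul (h1 x))).mul (hF x)).congr_deriv (by simp; ring)
  have hH : ∀ x, HasDerivAt (fun x => φ x * (expInt m x)⁻¹)
      ((φ' x - m x * φ x) * (expInt m x)⁻¹) x := fun x =>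
    ((h1 x).mul ((hF x).inv (expInt_pos m x).ne')).congr_deriv (by
      have := (expInt_pos m x).ne'
      simp only [Pi.inv_apply]; field_simp; ring)
  have key : ∀ X, 0 ≤ X → (∀ x ∈ Set.Ico 0 X, 0 < φ x) → 0 < φ X ∧ m X * φ X ≤ φ' X := by
    intro X hX hpos
    have hmono : MonotoneOn (fun x => (φ' x - m x * φ x) * expInt m x) (Set.Icc 0 X) := by
      refine monotoneOn_of_hasDerivWithinAt_nonneg (convex_Icc 0 X)
        (fun y _ => (hW y).continuousAt.continuousWithinAt)
        (fun y _ => (hW y).hasDerivWithinAt) fun y hy => ?_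
      rw [interior_Icc] at hy
      have := hpos y ⟨hy.1.le, hy.2⟩
      have := expInt_pos m y
      have : 0 ≤ q y + b ^ 2 - m' y - m y ^ 2 := by linarith [h y]
      positivity
    have hW0 : ∀ x ∈ Set.Icc 0 X, 0 ≤ φ' x - m x * φ x := by
      intro x hx
      have := hmono (Set.left_mem_Icc.2 hX) hx hx.1
      simp only [h0, h0', expInt_zero] at this
      exact nonneg_of_mul_nonneg_left (by linarith) (expInt_pos m x)
    have hmono2 : MonotoneOn (fun x => φ x * (expInt m x)⁻¹) (Set.Icc 0 X) := by
      refine monotoneOn_of_hasDerivWithinAt_nonneg (convex_Icc 0 X)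
        (fun y _ => (hH y).continuousAt.continuousWithinAt)
        (fun y _ => (hH y).hasDerivWithinAt) fun y hy => ?_
      exact mul_nonneg (hW0 y (interior_subset hy)) (inv_pos.2 (expInt_pos m y)).le
    have hX' : X ∈ Set.Icc 0 X := Set.right_mem_Icc.2 hX
    have h3 := hmono2 (Set.left_mem_Icc.2 hX) hX' hX
    simp only [h0, expInt_zero] at h3
    refine ⟨pos_of_mul_pos_left (by linarith) (inv_pos.2 (expInt_pos m X)).le, ?_⟩
    linarith [hW0 X hX']
  have hpos : ∀ x, 0 ≤ x → 0 < φ x := by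
    by_contra! hcon
    obtain ⟨x, hx, hx0⟩ := hcon
    have hcl : IsCompact (Set.Icc 0 x ∩ {y | φ y ≤ 0}) :=
      isCompact_Icc.inter_right (isClosed_le hφc continuous_const)
    obtain ⟨z, hz, hzmin⟩ := hcl.exists_isLeast ⟨x, ⟨hx, le_rfl⟩, hx0⟩
    have := key z hz.1.1 fun y hy => by
      by_contra! hy0
      have := hzmin (⟨⟨hy.1, (hy.2.trans_le hz.1.2).le⟩, hy0⟩ : y ∈ Set.Icc 0 x ∩ {y | φ y ≤ 0})
      linarith [hy.2]
    exact absurd hz.2 (not_le.2 this.1)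
  exact fun x hx => key x hx fun y hy => hpos y hy.1

/-- A Riccati supersolution yields a Riccati solution. -/
theorem exists_of_super {m m' : ℝ → ℝ} (hq : Continuous q) (hm : ∀ x, HasDerivAt m (m' x) x)
    (h : ∀ x, m' x + m x ^ 2 ≤ q x + b ^ 2) :
    ∃ v, Ric q b v ∧ v 0 = m 0 ∧ ∀ x, 0 ≤ x → m x ≤ v x := by
  obtain ⟨φ, φ', -, -, hφ⟩ := exists_schrodinger hq
  obtain ⟨h0, h0', hd⟩ := hφ (b, m 0)
  have h1 := pos_of_super (fun x => (hd x).1) (fun x => (hd x).2) hm h h0 h0'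
  have h2 := pos_of_super (q := fun x => q (-x)) (b := b) (φ := fun x => φ (b, m 0) (-x))
    (φ' := fun x => -φ' (b, m 0) (-x)) (m := fun x => -m (-x)) (m' := fun x => m' (-x))
    (fun x => (hasDerivAt_neg_arg (hd (-x)).1).congr_deriv (by simp))
    (fun x => ((hasDerivAt_neg_arg (hd (-x)).2).neg).congr_deriv (by simp))
    (fun x => ((hasDerivAt_neg_arg (hm (-x))).neg).congr_deriv (by simp))
    (fun x => by simpa using h (-x)) (by simpa using h0) (by simpa using h0')
  have hpos : ∀ x, 0 < φ (b, m 0) x := fun x => by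
    rcases le_total 0 x with hx | hx
    · exact (h1 x hx).1
    · simpa using (h2 (-x) (by linarith)).1
  refine ⟨_, of_sol (fun x => (hd x).1) (fun x => (hd x).2) fun x => (hpos x).ne', ?_, ?_⟩
  · simp [h0, h0']
  · intro x hx
    rw [le_div_iff₀ (hpos x)]
    exact (h1 x hx).2

/-- Limits of Riccati solutions. -/
theorem exists_of_tendsto (hq : Continuous q) (hK : ∀ x, |q x| ≤ K) {B : ℕ → ℝ}
    {V : ℕ → ℝ → ℝ} (h : ∀ n, Ric q (B n) (V n)) {a : ℝ} (hB : Tendsto B atTop (nhds b))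
    (hV : Tendsto (fun n => V n 0) atTop (nhds a)) : ∃ v, Ric q b v ∧ v 0 = a := by
  obtain ⟨φ, φ', hc, -, hφ⟩ := exists_schrodinger hq
  have heq : ∀ n x, φ (B n, V n 0) x = expInt (V n) x := fun n x => by
    obtain ⟨h0, h0', hd⟩ := hφ (B n, V n 0)
    refine (schrodinger_unique (l := fun x => q x + (B n) ^ 2) (by fun_prop) (fun x => (hd x).1)
      (fun x => (hd x).2) (fun x => hasDerivAt_expInt (h n).continuous x)
      (fun x => (h n).hasDerivAt_mul_expInt x) ?_ ?_ x).1
    · simp [h0, expInt_zero]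
    · simp [h0', expInt_zero]
  have hlim : ∀ x, Tendsto (fun n => expInt (V n) x) atTop (nhds (φ (b, a) x)) := fun x => by
    have h1 : Continuous fun p : ℝ × ℝ => φ p x := hc.comp (by fun_prop : Continuous fun p => (p, x))
    have := (h1.tendsto (b, a)).comp (hB.prodMk_nhds hV)
    refine this.congr fun n => heq n x
  have hpos : ∀ x, 0 < φ (b, a) x := fun x => by
    have hC : ∀ n s, |V n s| ≤ √(K + (B n) ^ 2) := fun n s => (h n).abs_le_of_bound hK s
    have h1 : Tendsto (fun n => exp (-(√(K + (B n) ^ 2) * |x|))) atTop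
        (nhds (exp (-(√(K + b ^ 2) * |x|)))) := by
      have : Continuous fun c : ℝ => exp (-(√(K + c ^ 2) * |x|)) := by fun_prop
      exact (this.tendsto b).comp hB
    refine (exp_pos _).trans_le (le_of_tendsto_of_tendsto' h1 (hlim x) fun n => ?_)
    refine exp_le_exp.2 (neg_le_of_abs_le ?_)
    have := intervalIntegral.norm_integral_le_of_norm_le_const (a := 0) (b := x)
      (f := V n) (C := √(K + (B n) ^ 2)) fun s _ => hC n s
    simpa using this
  obtain ⟨h0, h0', hd⟩ := hφ (b, a)
  exact ⟨_, of_sol (fun x => (hd x).1) (fun x => (hd x).2) fun x => (hpos x).ne', by simp [h0, h0']⟩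

end Ric

namespace Ric

variable {q v u : ℝ → ℝ} {b K : ℝ}

/-- Subtracting a multiple of the second solution. -/
theorem exists_lt_of_tendsto (h : Ric q b v) (hb : 0 < b) (hv : Tendsto v atTop (nhds b)) :
    ∃ u, Ric q b u ∧ u 0 < v 0 := by
  have hc := h.continuous
  have hEc : Continuous (expInt v) :=
    continuous_iff_continuousAt.2 fun x => (hasDerivAt_expInt hc x).continuousAt
  set k : ℝ → ℝ := fun x => (expInt v x ^ 2)⁻¹ with hk
  have hkpos : ∀ x, 0 < k x := fun x => by have := expInt_pos v x; positivity
  have hkc : Continuous k := (hEc.pow 2).inv₀ fun x => (pow_pos (expInt_pos v x) 2).ne'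
  have hkd : ∀ x, HasDerivAt k (-(2 * v x) * k x) x := fun x =>
    (((hasDerivAt_expInt hc x).pow 2).inv (pow_pos (expInt_pos v x) 2).ne').congr_deriv (by
      have := (expInt_pos v x).ne'
      simp only [hk, Pi.pow_apply]; field_simp; try ring)
  set P : ℝ → ℝ := fun x => ∫ s in (0 : ℝ)..x, k s with hP
  have hPd : ∀ x, HasDerivAt P (k x) x := fun x => (hkc.integral_hasStrictDerivAt 0 x).hasDerivAt
  obtain ⟨X, hX⟩ := eventually_atTop.1 (hv.eventually (lt_mem_nhds (show b / 2 < b by linarith)))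
  set Y := max X 0
  have hbound : ∀ x, P x ≤ P Y + k Y / b := by
    intro x
    rcases le_total x Y with hx | hx
    · have : Monotone P := monotone_of_hasDerivAt_nonneg hPd fun x => (hkpos x).le
      have h1 := this hx
      have : 0 ≤ k Y / b := (div_pos (hkpos Y) hb).le
      linarith
    · have hanti : AntitoneOn (fun x => P x + k x / b) (Set.Ici Y) := by
        refine antitoneOn_of_hasDerivWithinAt_nonpos (convex_Ici Y)
          (f' := fun x => k x + (-(2 * v x) * k x) / b)
          (fun y _ => ((hPd y).add ((hkd y).div_const b)).continuousAt.continuousWithinAt)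
          (fun y _ => ((hPd y).add ((hkd y).div_const b)).hasDerivWithinAt) fun y hy => ?_
        rw [interior_Ici] at hy
        have h1 : b / 2 < v y := hX y ((le_max_left _ _).trans (show Y < y from hy).le)
        have h2 := hkpos y
        have : k y + -(2 * v y) * k y / b = k y * (b - 2 * v y) / b := by field_simp; ring
        rw [this]
        exact div_nonpos_of_nonpos_of_nonneg (by nlinarith) hb.le
      have h1 := hanti Set.self_mem_Ici hx hx
      have : 0 ≤ k x / b := (div_pos (hkpos x) hb).le
      simp only at h1
      linarith
  set C := P Y + k Y / b
  have hC : 0 < C := by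
    have h1 := hbound 0
    have h0 : 0 ≤ P Y := intervalIntegral.integral_nonneg (le_max_right _ _) fun s _ => (hkpos s).le
    have : 0 < k Y / b := div_pos (hkpos Y) hb
    positivity
  have hden : ∀ x, 0 < 2 * C - P x := fun x => by linarith [hbound x]
  refine ⟨fun x => v x - k x / (2 * C - P x), fun x => ?_, ?_⟩
  · refine ((h x).sub ((hkd x).div ((hPd x).const_sub (2 * C)) (hden x).ne')).congr_deriv ?_
    have := (hden x).ne'
    field_simp
    ring
  · have := div_pos (hkpos 0) (hden 0)
    linarith

theorem exists_min (hb : 0 < b) (hq : SqI q) (hK : ∀ x, |q x| ≤ K) (hne : ∃ v, Ric q b v) :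
    ∃ v, Ric q b v ∧ Tendsto v atTop (nhds (-b)) ∧ ∀ u, Ric q b u → ∀ x, v x ≤ u x := by
  set S : Set ℝ := {a | ∃ v, Ric q b v ∧ v 0 = a}
  have hbd : BddBelow S := ⟨-√(K + b ^ 2), by
    rintro _ ⟨v, hv, rfl⟩
    exact (abs_le.1 (hv.abs_le_of_bound hK 0)).1⟩
  obtain ⟨v₀, hv₀⟩ := hne
  obtain ⟨A, -, hA, hAS⟩ := exists_seq_tendsto_sInf (S := S) ⟨_, v₀, hv₀, rfl⟩ hbd
  choose V hV hV0 using hAS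
  obtain ⟨v, hv, hv0⟩ := exists_of_tendsto hq.1 hK (B := fun _ => b) hV (a := sInf S)
    tendsto_const_nhds (by simpa [hV0] using hA)
  refine ⟨v, hv, ?_, fun u hu => hv.le_of_le hu (hv0 ▸ csInf_le hbd ⟨u, hu, rfl⟩)⟩
  rcases hv.tendsto_atTop_or hb hq hK with h1 | h1
  · obtain ⟨u, hu, hlt⟩ := hv.exists_lt_of_tendsto hb h1
    have := csInf_le hbd ⟨u, hu, rfl⟩
    linarith
  · exact h1

theorem exists_max (hb : 0 < b) (hq : SqI q) (hK : ∀ x, |q x| ≤ K) (hne : ∃ v, Ric q b v) :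
    ∃ v, Ric q b v ∧ Tendsto v atBot (nhds b) ∧ ∀ u, Ric q b u → ∀ x, u x ≤ v x := by
  obtain ⟨v₀, hv₀⟩ := hne
  obtain ⟨v, hv, hl, hmin⟩ := exists_min hb hq.comp_neg (fun x => hK (-x)) ⟨_, hv₀.reflect⟩
  refine ⟨_, by simpa using hv.reflect, ?_, fun u hu x => ?_⟩
  · simpa [Function.comp_def] using (hl.comp tendsto_neg_atBot_atTop).neg
  · have := hmin _ hu.reflect (-x)
    simp only [neg_neg] at this
    linarith

/-- Distinct Riccati solutions cannot both tend to `-b` at `∞`. -/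
theorem not_tendsto_atTop_neg (h : Ric q b v) (h' : Ric q b u) (hb : 0 < b) (hlt : v 0 < u 0)
    (hv : Tendsto v atTop (nhds (-b))) : ¬ Tendsto u atTop (nhds (-b)) := by
  intro hu
  have hd : ∀ x, HasDerivAt (fun x => u x - v x) (-(u x + v x) * (u x - v x)) x := fun x =>
    ((h' x).sub (h x)).congr_deriv (by ring)
  have hs : Tendsto (fun x => u x + v x) atTop (nhds (-b + -b)) := hu.add hv
  obtain ⟨X, hX⟩ := eventually_atTop.1 (hs.eventually (gt_mem_nhds (show -b + -b < 0 by linarith)))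
  have hmono : MonotoneOn (fun x => u x - v x) (Set.Ici X) := by
    refine monotoneOn_of_hasDerivWithinAt_nonneg (convex_Ici X)
      (fun y _ => (hd y).continuousAt.continuousWithinAt)
      (fun y _ => (hd y).hasDerivWithinAt) fun y hy => ?_
    have h1 := hX y (interior_subset hy)
    have h2 := h.lt_of_lt h' hlt y
    exact mul_nonneg (by linarith) (by linarith)
  have h0 : Tendsto (fun x => u x - v x) atTop (nhds 0) := by simpa using hu.sub hv
  have h1 := h.lt_of_lt h' hlt X
  have : u X - v X ≤ 0 := ge_of_tendsto h0 (eventually_atTop.2 ⟨X, fun x hx =>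
    hmono Set.self_mem_Ici hx hx⟩)
  linarith

/-- Existence of a ground state. -/
theorem exists_ground {γ : ℝ} (hq : SqI q) (hK : ∀ x, |q x| ≤ K) (hγ : 0 < γ)
    (hlow : ∀ b v, 0 < b → Ric q b v → γ ≤ b) :
    ∃ b v, γ ≤ b ∧ Ric q b v ∧ Tendsto v atBot (nhds b) ∧ Tendsto v atTop (nhds (-b)) := by
  set S : Set ℝ := {b | 0 < b ∧ ∃ v, Ric q b v}
  have hbd : BddBelow S := ⟨γ, fun b hb => hlow b _ hb.1 hb.2.choose_spec⟩
  have hK0 : 0 ≤ K := (abs_nonneg _).trans (hK 0)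
  have hne : S.Nonempty := by
    refine ⟨√K + 1, by positivity, ?_⟩
    obtain ⟨v, hv, -⟩ := exists_of_super (q := q) (b := √K + 1) (m := fun _ => 0)
      (m' := fun _ => 0) hq.1
      (fun x => hasDerivAt_const x 0) fun x => by
        have := (abs_le.1 (hK x)).1
        have h2 := Real.sq_sqrt hK0
        have := Real.sqrt_nonneg K
        nlinarith
    exact ⟨v, hv⟩
  obtain ⟨B, -, hB, hBS⟩ := exists_seq_tendsto_sInf hne hbd
  have hBS2 := fun n => (hBS n).2
  choose V hV using hBS2
  set b := sInf S
  have hbγ : γ ≤ b := le_csInf hne fun c hc => hlow c _ hc.1 hc.2.choose_spec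
  have hb : 0 < b := hγ.trans_le hbγ
  obtain ⟨M, hM⟩ := hB.bddAbove_range
  have hVb : ∀ n, V n 0 ∈ Set.Icc (-√(K + M ^ 2)) (√(K + M ^ 2)) := fun n => by
    have h1 := (hV n).abs_le_of_bound hK 0
    have h2 : B n ≤ M := hM ⟨n, rfl⟩
    have h3 : √(K + B n ^ 2) ≤ √(K + M ^ 2) :=
      Real.sqrt_le_sqrt (by have := (hBS n).1; nlinarith)
    exact abs_le.1 (h1.trans h3)
  obtain ⟨a, -, φ, hφ, ha⟩ := isCompact_Icc.tendsto_subseq hVb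
  obtain ⟨v₀, hv₀, -⟩ := exists_of_tendsto hq.1 hK (fun n => hV (φ n)) (hB.comp hφ.tendsto_atTop) ha
  obtain ⟨v, hv, hvt, hvmin⟩ := exists_min hb hq hK ⟨v₀, hv₀⟩
  obtain ⟨u, hu, hut, humax⟩ := exists_max hb hq hK ⟨v₀, hv₀⟩
  rcases (hvmin u hu 0).lt_or_eq with hlt | heq
  · exfalso
    have hpos : ∀ x, 0 < u x - v x := fun x => sub_pos.2 (hv.lt_of_lt hu hlt x)
    have hutop : Tendsto u atTop (nhds b) :=
      (hu.tendsto_atTop_or hb hq hK).resolve_right (hv.not_tendsto_atTop_neg hu hb hlt hvt)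
    have hvbot : Tendsto v atBot (nhds (-b)) := by
      refine (hv.tendsto_atBot_or hb hq hK).resolve_left fun hvb => ?_
      refine hu.reflect.not_tendsto_atTop_neg hv.reflect hb (by simpa using hlt) ?_ ?_
      · exact (hut.comp tendsto_neg_atTop_atBot).neg
      · exact (hvb.comp tendsto_neg_atTop_atBot).neg
    have hdc : Continuous fun x => u x - v x := hu.continuous.sub hv.continuous
    obtain ⟨e, he, hed⟩ : ∃ e > 0, ∀ x, e ≤ u x - v x := by
      have ht : Tendsto (fun x => u x - v x) atTop (nhds (b - -b)) := hutop.sub hvt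
      have hbt : Tendsto (fun x => u x - v x) atBot (nhds (b - -b)) := hut.sub hvbot
      have hbb : b < b - -b := by linarith
      obtain ⟨X, hX⟩ := eventually_atTop.1 (ht.eventually (lt_mem_nhds hbb))
      obtain ⟨Y, hY⟩ := eventually_atBot.1 (hbt.eventually (lt_mem_nhds hbb))
      obtain ⟨z, -, hz⟩ := (isCompact_Icc (a := min X Y) (b := max X Y)).exists_isMinOn
        ⟨X, min_le_left _ _, le_max_left _ _⟩ hdc.continuousOn
      refine ⟨min b (u z - v z), lt_min hb (hpos z), fun x => ?_⟩
      by_cases h1 : X ≤ x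
      · exact (min_le_left _ _).trans (hX x h1).le
      by_cases h2 : x ≤ Y
      · exact (min_le_left _ _).trans (hY x h2).le
      · exact (min_le_right _ _).trans (hz ⟨(min_le_right _ _).trans (not_le.1 h2).le,
          (not_le.1 h1).le.trans (le_max_left _ _)⟩)
    set e' := min (e / 2) (b / 2)
    have he' : 0 < e' := lt_min (by linarith) (by linarith)
    have he1 : e' ≤ e / 2 := min_le_left _ _
    have he2 : e' ≤ b / 2 := min_le_right _ _
    have hsq : 0 < b ^ 2 - e' ^ 2 := by nlinarith
    obtain ⟨w, hw, -⟩ := exists_of_super (q := q) (b := √(b ^ 2 - e' ^ 2))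
      (m := fun x => (u x + v x) / 2) hq.1 (fun x => ((hu x).add (hv x)).div_const 2) fun x => by
        rw [Real.sq_sqrt hsq.le]
        have := hed x
        nlinarith [mul_self_le_mul_self (show 0 ≤ 2 * e' by linarith)
          (show 2 * e' ≤ u x - v x by linarith)]
    have h1 : b ≤ √(b ^ 2 - e' ^ 2) := csInf_le hbd ⟨Real.sqrt_pos.2 hsq, w, hw⟩
    have h2 : √(b ^ 2 - e' ^ 2) < b := by
      rw [Real.sqrt_lt' hb]; nlinarith
    linarith
  · refine ⟨b, v, hbγ, hv, ?_, hvt⟩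
    have : v = u := funext fun x => le_antisymm (hv.le_of_le hu heq.le x) (hu.le_of_le hv heq.ge x)
    rwa [this]

end Ric

/-- Compactly supported `C¹` functions. -/
def Cc1 (g : ℝ → ℝ) : Prop := ContDiff ℝ 1 g ∧ HasCompactSupport g

namespace Cc1

variable {g f q : ℝ → ℝ}

theorem continuous (hg : Cc1 g) : Continuous g := hg.1.continuous

theorem continuous_deriv (hg : Cc1 g) : Continuous (deriv g) := hg.1.continuous_deriv le_rfl

theorem hasDerivAt (hg : Cc1 g) (x : ℝ) : HasDerivAt g (deriv g x) x :=
  (hg.1.differentiable one_ne_zero x).hasDerivAt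

theorem integrable_mul (hg : Cc1 g) {h : ℝ → ℝ} (hh : Continuous h) :
    Integrable fun x => g x * h x :=
  (hg.continuous.mul hh).integrable_of_hasCompactSupport hg.2.mul_right

theorem integrable_deriv_mul (hg : Cc1 g) {h : ℝ → ℝ} (hh : Continuous h) :
    Integrable fun x => deriv g x * h x :=
  (hg.continuous_deriv.mul hh).integrable_of_hasCompactSupport hg.2.deriv.mul_right

theorem sqI (hg : Cc1 g) : SqI g :=
  ⟨hg.continuous, by simpa [sq] using hg.integrable_mul hg.continuous⟩

theorem sqI_deriv (hg : Cc1 g) : SqI (deriv g) :=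
  ⟨hg.continuous_deriv, by simpa [sq] using hg.integrable_deriv_mul hg.continuous_deriv⟩

theorem integral_eq_zero (hg : Cc1 g) {h h' : ℝ → ℝ} (hh : ∀ x, HasDerivAt h (h' x) x)
    (hh' : Continuous h') : ∫ x, (deriv g x * h x + g x * h' x) = 0 := by
  have hc : Continuous h := continuous_iff_continuousAt.2 fun x => (hh x).continuousAt
  exact integral_eq_zero_of_hasDerivAt_of_integrable (f := fun x => g x * h x)
    (fun x => (hg.hasDerivAt x).mul (hh x))
    ((hg.integrable_deriv_mul hc).add (hg.integrable_mul hh')) (hg.integrable_mul hc)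

theorem integral_sq_pos (hg : Cc1 g) (h : g ≠ 0) : 0 < ∫ x, g x ^ 2 := by
  obtain ⟨x, hx⟩ := Function.ne_iff.1 h
  refine Continuous.integral_pos_of_hasCompactSupport_nonneg_nonzero (x := x)
    (hg.continuous.pow 2) ?_ (fun _ => sq_nonneg _) (pow_ne_zero 2 hx)
  simpa [sq, Pi.mul_def] using hg.2.mul_right (f' := g)

/-- Completing the square with a Riccati solution. -/
theorem integral_energy (hg : Cc1 g) {v v' : ℝ → ℝ} (hv : ∀ x, HasDerivAt v (v' x) x)
    (hv' : Continuous v') :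
    ∫ x, (deriv g x - v x * g x) ^ 2 = ∫ x, (deriv g x ^ 2 + (v' x + v x ^ 2) * g x ^ 2) := by
  have hvc : Continuous v := continuous_iff_continuousAt.2 fun x => (hv x).continuousAt
  have hgc := hg.continuous
  have hgc' := hg.continuous_deriv
  have h0 := hg.integral_eq_zero (h := fun x => v x * g x)
    (fun x => (hv x).mul (hg.hasDerivAt x)) (by fun_prop)
  have i1 : Integrable fun x => deriv g x * (v x * g x) + g x * (v' x * g x + v x * deriv g x) :=
    (hg.integrable_deriv_mul (by fun_prop)).add (hg.integrable_mul (by fun_prop))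
  have i2 : Integrable fun x => deriv g x ^ 2 + (v' x + v x ^ 2) * g x ^ 2 :=
    hg.sqI_deriv.2.add (((hg.integrable_mul (h := fun x => (v' x + v x ^ 2) * g x)
      (by fun_prop))).congr (ae_of_all _ fun x => by ring))
  rw [← sub_zero (∫ x, (deriv g x ^ 2 + (v' x + v x ^ 2) * g x ^ 2)), ← h0, ← integral_sub i2 i1]
  congr 1; ext x; ring

end Cc1

/-- A `d`-dimensional space of trial functions on which `-∂² + q < -γ²`. -/
def Trial (q : ℝ → ℝ) (γ : ℝ) (d : ℕ) : Prop :=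
  ∃ E : (Fin d → ℝ) →ₗ[ℝ] (ℝ → ℝ), ∀ a, Cc1 (E a) ∧ (a ≠ 0 →
    ∫ x, (deriv (E a) x ^ 2 + q x * E a x ^ 2) < -γ ^ 2 * ∫ x, E a x ^ 2)

namespace Ric

variable {q v : ℝ → ℝ} {b γ : ℝ}

theorem integral_energy (h : Ric q b v) (hq : Continuous q) {g : ℝ → ℝ} (hg : Cc1 g) :
    ∫ x, (deriv g x - v x * g x) ^ 2 =
      (∫ x, (deriv g x ^ 2 + q x * g x ^ 2)) + b ^ 2 * ∫ x, g x ^ 2 := by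
  have hc := h.continuous
  have hgc := hg.continuous
  have i1 : Integrable fun x => deriv g x ^ 2 + q x * g x ^ 2 :=
    hg.sqI_deriv.2.add (((hg.integrable_mul (h := fun x => q x * g x)
      (by fun_prop))).congr (ae_of_all _ fun x => by ring))
  rw [hg.integral_energy h (by fun_prop), ← integral_const_mul, ← integral_add i1
    (hg.sqI.2.const_mul _)]
  congr 1; ext x; ring

theorem le_of_trial (h : Ric q b v) (hq : Continuous q) (hb : 0 < b) (ht : Trial q γ 1) :
    γ ≤ b := by
  obtain ⟨E, hE⟩ := ht
  obtain ⟨hg, h1⟩ := hE 1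
  replace h1 := h1 one_ne_zero
  have h2 := h.integral_energy hq hg
  have h3 := SqI.integral_nonneg fun x => deriv (E 1) x - v x * E 1 x
  have h4 := SqI.integral_nonneg (E 1)
  by_contra! hc
  nlinarith [mul_self_lt_mul_self hb.le hc]

theorem trial_darboux (h : Ric q b v) (hq : Continuous q) {d : ℕ} (ht : Trial q γ (d + 1)) :
    Trial (fun x => 2 * (v x ^ 2 - b ^ 2) - q x) γ d := by
  obtain ⟨E, hE⟩ := ht
  have hc := h.continuous
  have hφd := fun x => hasDerivAt_expInt hc x
  have hφ : Continuous (expInt v) := continuous_iff_continuousAt.2 fun x => (hφd x).continuousAt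
  have hφpos := expInt_pos v
  have hEi : ∀ a, Integrable fun x => E a x * expInt v x := fun a => (hE a).1.integrable_mul hφ
  let ℓ : (Fin (d + 1) → ℝ) →ₗ[ℝ] ℝ :=
    { toFun := fun a => ∫ x, E a x * expInt v x
      map_add' := fun a a' => by
        rw [← integral_add (hEi a) (hEi a')]
        congr 1; ext x; simp [add_mul]
      map_smul' := fun r a => by
        simp only [map_smul, Pi.smul_apply, smul_eq_mul, RingHom.id_apply]
        rw [← integral_const_mul]
        congr 1; ext x; ring }
  obtain ⟨J, hJ, hJℓ⟩ : ∃ J : (Fin d → ℝ) →ₗ[ℝ] (Fin (d + 1) → ℝ),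
      Function.Injective J ∧ ∀ a, ℓ (J a) = 0 := by
    have h1 : d ≤ Module.finrank ℝ (LinearMap.ker ℓ) := by
      have h2 := LinearMap.finrank_range_add_finrank_ker ℓ
      have h3 : Module.finrank ℝ (LinearMap.range ℓ) ≤ 1 := by
        simpa using Submodule.finrank_le (LinearMap.range ℓ)
      simp at h2
      omega
    let B := Module.finBasis ℝ (LinearMap.ker ℓ)
    let J := Fintype.linearCombination ℝ (fun i => B (Fin.castLE h1 i))
    have hJ : Function.Injective J := linearIndependent_iff_injective_fintypeLinearCombination.1
      (B.linearIndependent.comp _ (Fin.castLE_injective h1))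
    exact ⟨(LinearMap.ker ℓ).subtype.comp J, Subtype.val_injective.comp hJ, fun a => (J a).2⟩
  let F : (Fin d → ℝ) →ₗ[ℝ] (ℝ → ℝ) :=
    { toFun := fun a x => -(expInt v x)⁻¹ * ∫ s in Set.Iic x, E (J a) s * expInt v s
      map_add' := fun a a' => by
        ext x
        simp only [map_add, Pi.add_apply, add_mul]
        rw [integral_add (hEi _).integrableOn (hEi _).integrableOn]
        ring
      map_smul' := fun r a => by
        ext x
        simp only [map_smul, Pi.smul_apply, smul_eq_mul, RingHom.id_apply, mul_assoc]
        rw [integral_const_mul]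
        ring }
  refine ⟨F, fun a => ?_⟩
  obtain ⟨hf, hlt⟩ := hE (J a)
  set f := E (J a) with hfdef
  have hfc := hf.continuous
  have hFd : ∀ x, HasDerivAt (F a) (-f x - v x * F a x) x := by
    intro x
    have hG : HasDerivAt (fun x => ∫ s in Set.Iic x, f s * expInt v s) (f x * expInt v x) x := by
      have h1 := (((hfc.mul hφ).integral_hasStrictDerivAt 0 x).hasDerivAt).const_add
        (∫ s in Set.Iic 0, f s * expInt v s)
      refine h1.congr_of_eventuallyEq (Eventually.of_forall fun y => ?_)
      have := intervalIntegral.integral_Iic_sub_Iic (a := 0) (b := y)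
        (hEi (J a)).integrableOn (hEi (J a)).integrableOn
      simp only [Pi.mul_apply, ← hfdef] at this ⊢
      linarith
    have h2 : HasDerivAt (F a) _ x := ((hφd x).inv (hφpos x).ne').neg.mul hG
    refine h2.congr_deriv ?_
    have := (hφpos x).ne'
    simp only [F, LinearMap.coe_mk, AddHom.coe_mk, Pi.neg_apply, Pi.inv_apply, ← hfdef]
    field_simp
    ring
  have hFc : Continuous (F a) := continuous_iff_continuousAt.2 fun x => (hFd x).continuousAt
  have hFd' : deriv (F a) = fun x => -f x - v x * F a x := funext fun x => (hFd x).deriv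
  have hF : Cc1 (F a) := by
    refine ⟨contDiff_one_iff_deriv.2 ⟨fun x => (hFd x).differentiableAt, ?_⟩, ?_⟩
    · rw [hFd']; fun_prop
    · obtain ⟨R, hR⟩ := hf.2.isCompact.isBounded.subset_closedBall 0
      have hf0 : ∀ x, R < |x| → f x = 0 := fun x hx => by
        by_contra hne
        have := hR (subset_tsupport f hne)
        simp at this
        linarith
      refine HasCompactSupport.intro (isCompact_closedBall 0 R) fun x hx => ?_
      simp only [Metric.mem_closedBall, dist_zero_right, Real.norm_eq_abs, not_le] at hx
      have h0 : ∫ s in Set.Iic x, f s * expInt v s = 0 := by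
        rcases le_total x 0 with hx0 | hx0
        · rw [abs_of_nonpos hx0] at hx
          refine setIntegral_eq_zero_of_forall_eq_zero fun s hs => ?_
          have hs : s ≤ x := hs
          rw [hf0 s (by rw [abs_of_nonpos (by linarith)]; linarith), zero_mul]
        · rw [abs_of_nonneg hx0] at hx
          have h1 := integral_add_compl (measurableSet_Iic (a := x)) (hEi (J a))
          have h2 : ∫ s in (Set.Iic x)ᶜ, f s * expInt v s = 0 := by
            refine setIntegral_eq_zero_of_forall_eq_zero fun s hs => ?_
            have hs : x < s := by simpa using hs
            rw [hf0 s (by rw [abs_of_nonneg (by linarith)]; linarith), zero_mul]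
          have h3 : ∫ s, f s * expInt v s = 0 := hJℓ a
          rw [← hfdef, h2, h3] at h1
          linarith
      simp only [F, LinearMap.coe_mk, AddHom.coe_mk, ← hfdef, h0, mul_zero]
  refine ⟨hF, fun ha => ?_⟩
  have hJa : J a ≠ 0 := fun h0 => ha (hJ (by rw [h0, map_zero]))
  have h1 := hlt hJa
  have e1 := h.integral_energy hq hf
  have e2 := hF.integral_energy (v := fun x => -v x) (fun x => (h x).neg) (by fun_prop)
  simp only [hFd'] at e2
  have e2' : ∫ x, f x ^ 2 = (∫ x, ((-f x - v x * F a x) ^ 2 +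
      (2 * (v x ^ 2 - b ^ 2) - q x) * F a x ^ 2)) + b ^ 2 * ∫ x, F a x ^ 2 := by
    have i1 : Integrable fun x => (-f x - v x * F a x) ^ 2 +
        (2 * (v x ^ 2 - b ^ 2) - q x) * F a x ^ 2 := by
      have i2 := hF.sqI_deriv.2
      rw [hFd'] at i2
      exact i2.add (((hF.integrable_mul (h := fun x => (2 * (v x ^ 2 - b ^ 2) - q x) * F a x)
      (by fun_prop))).congr (ae_of_all _ fun x => by ring))
    rw [← integral_const_mul, ← integral_add i1 (hF.sqI.2.const_mul _)]
    calc _ = ∫ x, (-f x - v x * F a x - -v x * F a x) ^ 2 := by congr 1; ext x; ring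
      _ = _ := e2
      _ = _ := by congr 1; ext x; ring
  have e3 : ∫ x, f x ^ 2 = ∫ x, (deriv f x - v x * f x) * F a x := by
    have h0 := hf.integral_eq_zero hFd (by fun_prop)
    have i2 : Integrable fun x => (deriv f x - v x * f x) * F a x :=
      (((hF.integrable_mul (h := fun x => deriv f x - v x * f x)
        (by have := hf.continuous_deriv; fun_prop))).congr (ae_of_all _ fun x => by ring))
    have i3 : Integrable fun x => deriv f x * F a x + f x * (-f x - v x * F a x) :=
      (hf.integrable_deriv_mul hFc).add (hf.integrable_mul (by fun_prop))
    rw [← sub_zero (∫ x, (deriv f x - v x * f x) * F a x), ← h0, ← integral_sub i2 i3]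
    congr 1; ext x; ring
  have hS : SqI fun x => deriv f x - v x * f x := by
    refine hf.sqI_deriv.sub ⟨by fun_prop, ?_⟩
    exact ((hf.integrable_mul (h := fun x => v x ^ 2 * f x) (by fun_prop))).congr
      (ae_of_all _ fun x => by ring)
  have e4 := hS.abs_integral_mul_le hF.sqI
  rw [← e3, ← Real.sqrt_mul (SqI.integral_nonneg _)] at e4
  have hfne : f ≠ 0 := by
    intro h0
    rw [h0] at h1
    simp at h1
  have hfpos := hf.integral_sq_pos hfne
  rw [abs_of_pos hfpos, Real.le_sqrt hfpos.le (mul_nonneg (SqI.integral_nonneg _)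
    (SqI.integral_nonneg _))] at e4
  have hA := SqI.integral_nonneg fun x => deriv f x - v x * f x
  have hG := SqI.integral_nonneg (F a)
  set A := ∫ x, (deriv f x - v x * f x) ^ 2
  set G := ∫ x, F a x ^ 2
  set N := ∫ x, f x ^ 2
  have hAμ : A < (b ^ 2 - γ ^ 2) * N := by linarith
  simp only [hFd']
  have hGpos : 0 < G := by
    rcases hG.lt_or_eq with h | h
    · exact h
    · rw [← h, mul_zero] at e4; nlinarith
  have hNG : N < (b ^ 2 - γ ^ 2) * G := by
    by_contra! hcon
    have : A * G < (b ^ 2 - γ ^ 2) * N * G := mul_lt_mul_of_pos_right hAμ hGpos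
    nlinarith
  linarith

end Ric

/-! ### Characteristics -/

theorem exists_characteristic {V : ℝ → ℝ → ℝ} (hV : Sm V) {a b C : ℝ} {t₁ : ℝ}
    (ht₁ : t₁ ∈ Set.Icc a b) (hC : ∀ t ∈ Set.Icc a b, ∀ x, |V t x| ≤ C) (x₁ : ℝ) :
    ∃ X : ℝ → ℝ, X t₁ = x₁ ∧ ∀ t ∈ Set.Icc a b, HasDerivWithinAt X (V t (X t)) (Set.Icc a b) t := by
  have hC0 : 0 ≤ C := (abs_nonneg _).trans (hC t₁ ht₁ x₁)
  have hab : a ≤ b := ht₁.1.trans ht₁.2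
  have hr : 0 ≤ C * (b - a) := mul_nonneg hC0 (by linarith)
  have hK : IsCompact (Set.Icc a b ×ˢ Metric.closedBall x₁ (C * (b - a))) :=
    isCompact_Icc.prod (isCompact_closedBall x₁ _)
  obtain ⟨M, hM⟩ := hK.exists_bound_of_continuousOn hV.dx.continuous.continuousOn
  have hM0 : 0 ≤ M := (norm_nonneg _).trans
    (hM (t₁, x₁) ⟨ht₁, Metric.mem_closedBall_self hr⟩)
  have hPL : IsPicardLindelof V (⟨t₁, ht₁⟩ : Set.Icc a b) x₁ ⟨C * (b - a), hr⟩ 0 ⟨C, hC0⟩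
      ⟨M, hM0⟩ :=
    { lipschitzOnWith := fun t ht =>
        (convex_closedBall x₁ (C * (b - a))).lipschitzOnWith_of_nnnorm_hasDerivWithin_le
          (fun x _ => (hV.hasDerivAt_x t x).hasDerivWithinAt) fun x hx => hM (t, x) ⟨ht, hx⟩
      continuousOn := fun x _ => (hV.ct x).continuousOn
      norm_le := fun t ht x _ => hC t ht x
      mul_max_le := by
        simp only [NNReal.coe_zero, sub_zero]
        exact mul_le_mul_of_nonneg_left
          (max_le (by linarith [ht₁.1]) (by linarith [ht₁.2])) hC0 }
  exact hPL.exists_eq_forall_mem_Icc_hasDerivWithinAt₀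

theorem Sm.hasDerivWithinAt_along {f : ℝ → ℝ → ℝ} (hf : Sm f) {X : ℝ → ℝ} {X' t : ℝ} {s : Set ℝ}
    (hX : HasDerivWithinAt X X' s t) :
    HasDerivWithinAt (fun t => f t (X t)) (_root_.dt f t (X t) + _root_.dx f t (X t) * X') s t := by
  have h1 : HasDerivWithinAt (fun t => (t, X t)) (1, X') s t :=
    (hasDerivWithinAt_id t s).prodMk hX
  have h2 := (hf.hasFDerivAt t (X t)).comp_hasDerivWithinAt t h1
  refine h2.congr_deriv ?_
  rw [hf.dt_eq, hf.dx_eq]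
  have : ((1 : ℝ), X') = (1, 0) + X' • (0, 1) := by simp
  rw [this, map_add, map_smul, smul_eq_mul, mul_comm]

/-! ### Positive solutions of the Lax system -/

/-- Solutions of the Lax system associated with a KdV solution `q`. -/
structure Lax (q : ℝ → ℝ → ℝ) (l : ℝ) (f : ℝ → ℝ → ℝ) : Prop where
  sm : Sm f
  xx : ∀ t x, dx (dx f) t x = (q t x + l) * f t x
  t : ∀ t x, dt f t x = -dx q t x * f t x + (2 * q t x - 4 * l) * dx f t x

theorem exists_lax_of_ric {q : ℝ → ℝ → ℝ} (hq : Sm q) (hk : KdV q) {b t₀ : ℝ} {v : ℝ → ℝ}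
    (hv : Ric (q t₀) b v) : ∃ f, Lax q (b ^ 2) f ∧ ∀ x, f t₀ x = Ric.expInt v x := by
  obtain ⟨f, hf, h0, h0', hxx, ht⟩ := exists_lax hq hk (b ^ 2) t₀ 1 (v 0)
  refine ⟨f, ⟨hf, hxx, ht⟩, fun x => ?_⟩
  refine (schrodinger_unique (l := fun x => q t₀ x + b ^ 2) (φ' := dx f t₀)
    (by have := hq.cx t₀; fun_prop) (fun x => hf.hasDerivAt_x t₀ x)
    (fun x => (hf.dx.hasDerivAt_x t₀ x).congr_deriv (hxx t₀ x))
    (fun x => Ric.hasDerivAt_expInt hv.continuous x) (fun x => hv.hasDerivAt_mul_expInt x)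
    ?_ ?_ x).1
  · rw [h0, Ric.expInt_zero]
  · rw [h0', Ric.expInt_zero, mul_one]

namespace Lax

variable {q f : ℝ → ℝ → ℝ} {b l K : ℝ} {U : Set ℝ}

theorem pos (hf : Lax q l f) (hq : Sm q) (hU : U.OrdConnected)
    (hK : ∀ t ∈ U, ∀ x, |q t x| ≤ K) {t₀ : ℝ} (ht₀ : t₀ ∈ U) (h0 : ∀ x, 0 < f t₀ x) :
    ∀ t ∈ U, ∀ x, 0 < f t x := by
  intro t₁ ht₁ x₁
  have hsub : Set.Icc (min t₀ t₁) (max t₀ t₁) ⊆ U := hU.uIcc_subset ht₀ ht₁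
  have hV : Sm fun t x => -(2 * q t x - 4 * l) :=
    (((Sm.const 2).mul hq).sub (Sm.const (4 * l))).neg
  have ht₁' : t₁ ∈ Set.Icc (min t₀ t₁) (max t₀ t₁) := ⟨min_le_right _ _, le_max_right _ _⟩
  have ht₀' : t₀ ∈ Set.Icc (min t₀ t₁) (max t₀ t₁) := ⟨min_le_left _ _, le_max_left _ _⟩
  obtain ⟨X, hX1, hX⟩ := exists_characteristic hV (C := 2 * K + 4 * |l|) ht₁' (fun t ht x => by
    have := hK t (hsub ht) x
    rw [abs_neg]
    refine (abs_sub _ _).trans ?_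
    rw [abs_mul, abs_mul, abs_two, abs_of_pos (four_pos (α := ℝ))]
    linarith) x₁
  have hab : min t₀ t₁ ≤ max t₀ t₁ := min_le_max
  have hXc : ContinuousOn X (Set.Icc (min t₀ t₁) (max t₀ t₁)) := fun t ht =>
    (hX t ht).continuousWithinAt
  have hXc' : Continuous (Set.IccExtend hab ((Set.Icc (min t₀ t₁) (max t₀ t₁)).domRestrict X)) :=
    (continuousOn_iff_continuous_domRestrict.1 hXc).Icc_extend'
  set Y := Set.IccExtend hab ((Set.Icc (min t₀ t₁) (max t₀ t₁)).domRestrict X)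
  have hYX : ∀ t ∈ Set.Icc (min t₀ t₁) (max t₀ t₁), Y t = X t := fun t ht =>
    Set.IccExtend_of_mem hab _ ht
  set k : ℝ → ℝ := fun t => dx q t (Y t)
  have hkc : Continuous k := hq.dx.continuous.comp (by fun_prop : Continuous fun t => (t, Y t))
  set g : ℝ → ℝ := fun t => f t (X t) * Ric.expInt k t
  have hg : ∀ t ∈ Set.Icc (min t₀ t₁) (max t₀ t₁),
      HasDerivWithinAt g 0 (Set.Icc (min t₀ t₁) (max t₀ t₁)) t := fun t ht => by
    refine ((hf.sm.hasDerivWithinAt_along (hX t ht)).mul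
      (Ric.hasDerivAt_expInt hkc t).hasDerivWithinAt).congr_deriv ?_
    rw [hf.t]
    simp only [k, hYX t ht]
    ring
  have := (convex_Icc _ _).norm_image_sub_le_of_norm_hasDerivWithin_le hg
    (C := 0) (fun x _ => by simp) ht₀' ht₁'
  rw [zero_mul] at this
  have heq : g t₁ = g t₀ := sub_eq_zero.1 (norm_le_zero_iff.1 this)
  simp only [g, hX1] at heq
  have : 0 < f t₁ x₁ * Ric.expInt k t₁ := heq ▸ mul_pos (h0 _) (Ric.expInt_pos _ _)
  exact pos_of_mul_pos_left this (Ric.expInt_pos _ _).le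

/-- The logarithmic derivative. -/
theorem ric (hf : Lax q (b ^ 2) f) {t : ℝ} (h : ∀ x, 0 < f t x) :
    Ric (q t) b fun x => dx f t x / f t x :=
  Ric.of_sol (fun x => hf.sm.hasDerivAt_x t x)
    (fun x => (hf.sm.dx.hasDerivAt_x t x).congr_deriv (hf.xx t x)) fun x => (h x).ne'

theorem hasDerivAt_log (hf : Lax q l f) {t x : ℝ} (h : 0 < f t x) :
    HasDerivAt (fun t => Real.log (f t x))
      (-dx q t x + (2 * q t x - 4 * l) * (dx f t x / f t x)) t :=
  ((hf.sm.hasDerivAt_t t x).log h.ne').congr_deriv (by rw [hf.t]; field_simp)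

theorem hasDerivAt_log_x (hf : Lax q l f) {t x : ℝ} (h : 0 < f t x) :
    HasDerivAt (fun x => Real.log (f t x)) (dx f t x / f t x) x :=
  (hf.sm.hasDerivAt_x t x).log h.ne'

theorem hasDerivAt_logDeriv (hf : Lax q l f) (hq : Sm q) {t x : ℝ} (h : 0 < f t x) :
    HasDerivAt (fun t => dx f t x / f t x)
      (-dx (dx q) t x + 2 * dx q t x * (dx f t x / f t x)
        + (2 * q t x - 4 * l) * (q t x + l - (dx f t x / f t x) ^ 2)) t := by
  have e : dt (dx f) t x = -dx (dx q) t x * f t x + dx q t x * dx f t x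
      + (2 * q t x - 4 * l) * ((q t x + l) * f t x) := by
    rw [hf.sm.dt_dx]
    have hfun : dt f t = fun x => -dx q t x * f t x + (2 * q t x - 4 * l) * dx f t x :=
      funext fun x => hf.t t x
    have h1 := ((hq.dx.hasDerivAt_x t x).neg.mul (hf.sm.hasDerivAt_x t x)).add
      ((((hq.hasDerivAt_x t x).const_mul 2).sub_const (4 * l)).mul (hf.sm.dx.hasDerivAt_x t x))
    show deriv (dt f t) x = _
    rw [hfun]
    refine h1.deriv.trans ?_
    rw [hf.xx]
    simp only [Pi.neg_apply]
    ring
  refine ((hf.sm.dx.hasDerivAt_t t x).div (hf.sm.hasDerivAt_t t x) h.ne').congr_deriv ?_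
  rw [e, hf.t]
  field_simp
  ring

theorem abs_log_sub_le_of_isOpen (hf : Lax q (b ^ 2) f) (hq : Sm q) (hU : IsOpen U) (hUc : U.OrdConnected)
    (hK : ∀ t ∈ U, ∀ x, |q t x| ≤ K) (hpos : ∀ t ∈ U, ∀ x, 0 < f t x) {t t' : ℝ} (ht : t ∈ U)
    (ht' : t' ∈ U) (x : ℝ) :
    |Real.log (f t x) - Real.log (f t' x)| ≤ 2 * √(K + b ^ 2) +
      (2 * K + (2 * K + 4 * b ^ 2) * √(K + b ^ 2)) * |t - t'| := by
  set C := √(K + b ^ 2)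
  have hC0 : 0 ≤ C := Real.sqrt_nonneg _
  have hK0 : 0 ≤ K := (abs_nonneg _).trans (hK t ht 0)
  have hv : ∀ t ∈ U, ∀ x, |dx f t x / f t x| ≤ C := fun t ht x =>
    (hf.ric (hpos t ht)).abs_le_of_bound (hK t ht) x
  have hVv : ∀ t ∈ U, ∀ x, |(2 * q t x - 4 * b ^ 2) * (dx f t x / f t x)| ≤
      (2 * K + 4 * b ^ 2) * C := fun t ht x => by
    rw [abs_mul]
    refine mul_le_mul ?_ (hv t ht x) (abs_nonneg _) (by positivity)
    refine (abs_sub _ _).trans ?_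
    rw [abs_mul, abs_two, abs_of_nonneg (show 0 ≤ 4 * b ^ 2 by positivity)]
    linarith [hK t ht x]
  have hcv : ∀ t ∈ U, Continuous fun x => dx f t x / f t x := fun t ht =>
    (hf.ric (hpos t ht)).continuous
  have hG : ∀ t ∈ U, HasDerivAt (fun t => ∫ s in x..x + 1, Real.log (f t s))
      (∫ s in x..x + 1, (-dx q t s + (2 * q t s - 4 * b ^ 2) * (dx f t s / f t s))) t := by
    intro t ht
    refine hasDerivAt_intervalIntegral_param_on (F := fun s t => Real.log (f t s))
      (F' := fun s t => -dx q t s + (2 * q t s - 4 * b ^ 2) * (dx f t s / f t s)) hU ?_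
      (fun s t ht => hf.hasDerivAt_log (hpos t ht s)) (fun t ht => ?_) _ _ ht
    · have hsw : ∀ {g : ℝ → ℝ → ℝ}, Sm g → Continuous fun p : ℝ × ℝ => g p.2 p.1 := fun hg =>
        hg.continuous.comp continuous_swap
      have h1 := hsw hq.dx
      have h2 := hsw hq
      have h3 := hsw hf.sm.dx
      have h4 := hsw hf.sm
      have h5 : ContinuousOn (fun p : ℝ × ℝ => dx f p.2 p.1 / f p.2 p.1) (Set.univ ×ˢ U) :=
        h3.continuousOn.div h4.continuousOn fun p hp => (hpos p.2 hp.2 p.1).ne'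
      exact h1.neg.continuousOn.add (((h2.const_mul 2).sub continuous_const).continuousOn.mul h5)
    · exact (hf.sm.cx t).log fun s => (hpos t ht s).ne'
  have hG' : ∀ t ∈ U, |∫ s in x..x + 1, (-dx q t s + (2 * q t s - 4 * b ^ 2) *
      (dx f t s / f t s))| ≤ 2 * K + (2 * K + 4 * b ^ 2) * C := by
    intro t ht
    have hqc := hq.cx t
    have hqc' := hq.dx.cx t
    have hc := hcv t ht
    have i1 : IntervalIntegrable (fun s => -dx q t s) volume x (x + 1) :=
      (hqc'.neg).intervalIntegrable _ _
    have i2 : IntervalIntegrable (fun s => (2 * q t s - 4 * b ^ 2) * (dx f t s / f t s))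
        volume x (x + 1) :=
      (((hqc.const_mul 2).sub continuous_const).mul hc).intervalIntegrable _ _
    rw [intervalIntegral.integral_add i1 i2, intervalIntegral.integral_neg,
      intervalIntegral.integral_eq_sub_of_hasDerivAt (fun s _ => hq.hasDerivAt_x t s)
        (hqc'.intervalIntegrable _ _)]
    have h1 := intervalIntegral.norm_integral_le_of_norm_le_const (a := x) (b := x + 1)
      (f := fun s => (2 * q t s - 4 * b ^ 2) * (dx f t s / f t s))
      (C := (2 * K + 4 * b ^ 2) * C) fun s _ => hVv t ht s
    simp only [add_sub_cancel_left, abs_one, mul_one, Real.norm_eq_abs] at h1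
    have h2 := abs_le.1 (hK t ht x)
    have h3 := abs_le.1 (hK t ht (x + 1))
    rw [abs_le] at h1 ⊢
    constructor <;> linarith
  have hosc : ∀ t ∈ U, |(∫ s in x..x + 1, Real.log (f t s)) - Real.log (f t x)| ≤ C := by
    intro t ht
    have hlc : Continuous fun s => Real.log (f t s) :=
      (hf.sm.cx t).log fun s => (hpos t ht s).ne'
    have e : (∫ s in x..x + 1, Real.log (f t s)) - Real.log (f t x) =
        ∫ s in x..x + 1, (Real.log (f t s) - Real.log (f t x)) := by
      rw [intervalIntegral.integral_sub (hlc.intervalIntegrable _ _) (by simp)]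
      simp
    rw [e]
    have h1 := intervalIntegral.norm_integral_le_of_norm_le_const (a := x) (b := x + 1)
      (f := fun s => Real.log (f t s) - Real.log (f t x)) (C := C) fun s hs => ?_
    · simpa using h1
    · have h2 := convex_univ.norm_image_sub_le_of_norm_hasDerivWithin_le (x := x) (y := s)
        (fun y _ => (hf.hasDerivAt_log_x (hpos t ht y)).hasDerivWithinAt)
        (fun y _ => hv t ht y) (Set.mem_univ _) (Set.mem_univ _)
      rw [Set.uIoc_of_le (by linarith)] at hs
      refine h2.trans ?_
      rw [Real.norm_of_nonneg (by linarith [hs.1])]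
      nlinarith [hs.2]
  have h1 := hUc.convex.norm_image_sub_le_of_norm_hasDerivWithin_le
    (fun t ht => (hG t ht).hasDerivWithinAt) hG' ht' ht
  have h2 := abs_le.1 (hosc t ht)
  have h3 := abs_le.1 (hosc t' ht')
  rw [Real.norm_eq_abs, Real.norm_eq_abs] at h1
  have h4 := abs_le.1 h1
  rw [abs_le]
  constructor <;> linarith

theorem abs_log_sub_le (hf : Lax q (b ^ 2) f) (hq : Sm q) (hU : U ⊆ closure (interior U))
    (hUc : U.OrdConnected) (hK : ∀ t ∈ U, ∀ x, |q t x| ≤ K) (hpos : ∀ t ∈ U, ∀ x, 0 < f t x)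
    {t t' : ℝ} (ht : t ∈ U) (ht' : t' ∈ U) (x : ℝ) :
    |Real.log (f t x) - Real.log (f t' x)| ≤ 2 * √(K + b ^ 2) +
      (2 * K + (2 * K + 4 * b ^ 2) * √(K + b ^ 2)) * |t - t'| := by
  have hUi : (interior U).OrdConnected := hUc.interior
  have hs : interior U ⊆ U := interior_subset
  have hne : ∀ {t}, t ∈ U → NeBot (nhdsWithin t (interior U)) := fun ht =>
    mem_closure_iff_nhdsWithin_neBot.1 (hU ht)
  have hlog : ∀ {t}, t ∈ U → Tendsto (fun s => Real.log (f s x)) (nhdsWithin t (interior U))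
      (nhds (Real.log (f t x))) := fun {t} ht =>
    (((hf.sm.ct x).continuousAt.log (hpos t ht x).ne').tendsto).mono_left nhdsWithin_le_nhds
  have hid : ∀ t : ℝ, Tendsto (fun s : ℝ => s) (nhdsWithin t (interior U)) (nhds t) := fun t =>
    tendsto_id.mono_left nhdsWithin_le_nhds
  have step : ∀ s ∈ interior U, |Real.log (f t x) - Real.log (f s x)| ≤ 2 * √(K + b ^ 2) +
      (2 * K + (2 * K + 4 * b ^ 2) * √(K + b ^ 2)) * |t - s| := fun s hs' => by
    have := hne ht
    refine le_of_tendsto_of_tendsto ((hlog ht).sub_const _).abs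
      ((((hid t).sub_const s).abs.const_mul _).const_add _)
      (eventually_mem_nhdsWithin.mono fun r hr => ?_)
    exact hf.abs_log_sub_le_of_isOpen hq isOpen_interior hUi (fun t ht => hK t (hs ht))
      (fun t ht => hpos t (hs ht)) hr hs' x
  have := hne ht'
  exact le_of_tendsto_of_tendsto ((hlog ht').const_sub _).abs
    ((((hid t').const_sub t).abs.const_mul _).const_add _)
    (eventually_mem_nhdsWithin.mono step)

end Lax

/-! ### Persistence of the asymptotics in time -/

theorem eq_zero_of_tendsto_deriv {g g' : ℝ → ℝ} (hg : ∀ x, HasDerivAt g (g' x) x) {C l : ℝ}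
    (hC : ∀ x, |g x| ≤ C) (h : Tendsto g' atTop (nhds l)) : l = 0 := by
  have key : ∀ n : ℕ, ∃ y : ℝ, (n : ℝ) ≤ y ∧ |g' y| ≤ 2 * C / (n + 1) := fun n => by
    have hn : (0 : ℝ) < n + 1 := by positivity
    obtain ⟨y, hy, he⟩ := exists_hasDerivAt_eq_slope g g' (a := (n : ℝ)) (b := n + (n + 1))
      (by linarith) (fun x _ => (hg x).continuousAt.continuousWithinAt) (fun x _ => hg x)
    refine ⟨y, hy.1.le, ?_⟩
    rw [he, add_sub_cancel_left, abs_div, abs_of_pos hn]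
    gcongr
    refine (abs_sub _ _).trans ?_
    linarith [hC ((n : ℝ) + (n + 1)), hC (n : ℝ)]
  choose y hy hy' using key
  have h1 : Tendsto y atTop atTop := tendsto_atTop_mono hy tendsto_natCast_atTop_atTop
  have h2 : Tendsto (fun n : ℕ => 2 * C / ((n : ℝ) + 1)) atTop (nhds 0) :=
    tendsto_const_nhds.div_atTop (tendsto_atTop_add_const_right _ _ tendsto_natCast_atTop_atTop)
  exact tendsto_nhds_unique (h.comp h1) (squeeze_zero_norm hy' h2)

theorem eq_zero_of_tendsto_deriv_atBot {g g' : ℝ → ℝ} (hg : ∀ x, HasDerivAt g (g' x) x) {C l : ℝ}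
    (hC : ∀ x, |g x| ≤ C) (h : Tendsto g' atBot (nhds l)) : l = 0 := by
  have h1 := eq_zero_of_tendsto_deriv (g := fun x => g (-x)) (g' := fun x => -g' (-x)) (l := -l)
    (fun x => ((hg (-x)).comp x (hasDerivAt_neg x)).congr_deriv (by ring)) (fun x => hC (-x))
    (h.comp tendsto_neg_atTop_atBot).neg
  linarith

/-- KdV solutions on a set of times with uniformly bounded energy. -/
structure SolOn (U : Set ℝ) (q : ℝ → ℝ → ℝ) : Prop where
  sm : Sm q
  kdv : KdV q
  sqI : ∀ t ∈ U, SqI (q t)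
  sqI' : ∀ t ∈ U, SqI (dx q t)
  bdd : ∃ C, ∀ t ∈ U, (∫ x, q t x ^ 2) + ∫ x, dx q t x ^ 2 ≤ C

theorem SolOn.exists_bound {U : Set ℝ} {q : ℝ → ℝ → ℝ} (h : SolOn U q) :
    ∃ K, 0 ≤ K ∧ ∀ t ∈ U, ∀ x, |q t x| ≤ K := by
  obtain ⟨C, hC⟩ := h.bdd
  refine ⟨√C, Real.sqrt_nonneg _, fun t ht x => ?_⟩
  rw [← Real.sqrt_sq_eq_abs]
  exact Real.sqrt_le_sqrt (((h.sqI t ht).sq_le (h.sqI' t ht)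
    (fun x => h.sm.hasDerivAt_x t x) x).trans (hC t ht))

namespace Lax

variable {q f : ℝ → ℝ → ℝ} {b K l : ℝ} {U : Set ℝ}

theorem tendsto_atTop (hf : Lax q (b ^ 2) f) (hb : 0 < b) (hq : SolOn U q) (hU : U ⊆ closure (interior U))
    (hUc : U.OrdConnected) (hpos : ∀ t ∈ U, ∀ x, 0 < f t x) {t t₀ : ℝ} (ht : t ∈ U) (ht₀ : t₀ ∈ U)
    (h : Tendsto (fun x => dx f t₀ x / f t₀ x) atTop (nhds l)) :
    Tendsto (fun x => dx f t x / f t x) atTop (nhds l) := by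
  obtain ⟨K, hK0, hK⟩ := hq.exists_bound
  have key : ∀ {l' : ℝ}, Tendsto (fun x => dx f t x / f t x) atTop (nhds l') → l' = l := by
    intro l' h'
    have := eq_zero_of_tendsto_deriv (fun x => (hf.hasDerivAt_log_x (hpos t ht x)).sub
      (hf.hasDerivAt_log_x (hpos t₀ ht₀ x)))
      (fun x => hf.abs_log_sub_le hq.sm hU hUc hK hpos ht ht₀ x) (h'.sub h)
    linarith
  rcases (hf.ric (hpos t ht)).tendsto_atTop_or hb (hq.sqI t ht) (hK t ht) with h1 | h1 <;>
  · have := key h1; rwa [this] at h1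

theorem tendsto_atBot (hf : Lax q (b ^ 2) f) (hb : 0 < b) (hq : SolOn U q) (hU : U ⊆ closure (interior U))
    (hUc : U.OrdConnected) (hpos : ∀ t ∈ U, ∀ x, 0 < f t x) {t t₀ : ℝ} (ht : t ∈ U) (ht₀ : t₀ ∈ U)
    (h : Tendsto (fun x => dx f t₀ x / f t₀ x) atBot (nhds l)) :
    Tendsto (fun x => dx f t x / f t x) atBot (nhds l) := by
  obtain ⟨K, hK0, hK⟩ := hq.exists_bound
  have key : ∀ {l' : ℝ}, Tendsto (fun x => dx f t x / f t x) atBot (nhds l') → l' = l := by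
    intro l' h'
    have := eq_zero_of_tendsto_deriv_atBot (fun x => (hf.hasDerivAt_log_x (hpos t ht x)).sub
      (hf.hasDerivAt_log_x (hpos t₀ ht₀ x)))
      (fun x => hf.abs_log_sub_le hq.sm hU hUc hK hpos ht ht₀ x) (h'.sub h)
    linarith
  rcases (hf.ric (hpos t ht)).tendsto_atBot_or hb (hq.sqI t ht) (hK t ht) with h1 | h1 <;>
  · have := key h1; rwa [this] at h1

end Lax

/-! ### The Darboux transformation -/

/-- A global solution `q` with a ground state `f` of energy `-b ^ 2` evolving along the flow. -/
structure Dar (q : ℝ → ℝ → ℝ) (b : ℝ) (f : ℝ → ℝ → ℝ) : Prop where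
  hb : 0 < b
  sol : SolOn Set.univ q
  lax : Lax q (b ^ 2) f
  pos : ∀ t x, 0 < f t x
  bot : ∀ t, Tendsto (fun x => dx f t x / f t x) atBot (nhds b)
  top : ∀ t, Tendsto (fun x => dx f t x / f t x) atTop (nhds (-b))

theorem SolOn.exists_dar {q : ℝ → ℝ → ℝ} (hq : SolOn Set.univ q) {b : ℝ} (hb : 0 < b) {v : ℝ → ℝ}
    (hv : Ric (q 0) b v) (hl : Tendsto v atBot (nhds b)) (hr : Tendsto v atTop (nhds (-b))) :
    ∃ f, Dar q b f ∧ ∀ x, dx f 0 x / f 0 x = v x := by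
  obtain ⟨f, hf, h0⟩ := exists_lax_of_ric hq.sm hq.kdv hv
  obtain ⟨K, hK0, hK⟩ := hq.exists_bound
  have hpos := hf.pos hq.sm Set.ordConnected_univ hK (Set.mem_univ 0)
    (fun x => by rw [h0]; exact Ric.expInt_pos _ _)
  have hv0 : (fun x => dx f 0 x / f 0 x) = v := by
    have e : f 0 = Ric.expInt v := funext h0
    ext x
    have : dx f 0 x = v x * Ric.expInt v x := by
      show deriv (f 0) x = _
      rw [e]; exact (Ric.hasDerivAt_expInt hv.continuous x).deriv
    rw [this, h0, mul_div_cancel_right₀ _ (Ric.expInt_pos _ _).ne']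
  refine ⟨f, ⟨hb, hq, hf, fun t x => hpos t (Set.mem_univ t) x, fun t => ?_, fun t => ?_⟩,
    fun x => congrFun hv0 x⟩
  · exact hf.tendsto_atBot hb hq (by simp) Set.ordConnected_univ hpos (Set.mem_univ t)
      (Set.mem_univ 0) (hv0 ▸ hl)
  · exact hf.tendsto_atTop hb hq (by simp) Set.ordConnected_univ hpos (Set.mem_univ t)
      (Set.mem_univ 0) (hv0 ▸ hr)

namespace Dar

/-- The logarithmic derivative of the ground state. -/
noncomputable def v (f : ℝ → ℝ → ℝ) (t x : ℝ) : ℝ := dx f t x / f t x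

/-- The Darboux transform. -/
noncomputable def w (q : ℝ → ℝ → ℝ) (b : ℝ) (f : ℝ → ℝ → ℝ) (t x : ℝ) : ℝ :=
  2 * (v f t x ^ 2 - b ^ 2) - q t x

variable {q f : ℝ → ℝ → ℝ} {b : ℝ}

theorem ric (h : Dar q b f) (t : ℝ) : Ric (q t) b (v f t) := h.lax.ric (h.pos t)

theorem sm_v (h : Dar q b f) : Sm (v f) := h.lax.sm.dx.div h.lax.sm fun t x => (h.pos t x).ne'

theorem hasDerivAt_v_t (h : Dar q b f) (t x : ℝ) : HasDerivAt (fun t => v f t x)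
    (-dx (dx q) t x + 2 * dx q t x * v f t x
      + (2 * q t x - 4 * b ^ 2) * (q t x + b ^ 2 - v f t x ^ 2)) t :=
  h.lax.hasDerivAt_logDeriv h.sol.sm (h.pos t x)

theorem sm_w (h : Dar q b f) : Sm (w q b f) :=
  ((Sm.const 2).mul ((h.sm_v.pow 2).sub (Sm.const (b ^ 2)))).sub h.sol.sm

theorem dx_w (h : Dar q b f) : dx (w q b f) = fun t x =>
    4 * v f t x * (q t x + b ^ 2 - v f t x ^ 2) - dx q t x := by
  ext t x
  refine HasDerivAt.deriv ((((((h.ric t x).pow 2).sub_const (b ^ 2)).const_mul 2).sub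
    (h.sol.sm.hasDerivAt_x t x)).congr_deriv ?_)
  simp; ring

theorem kdv_w (h : Dar q b f) : KdV (w q b f) := by
  have hv := fun t x => h.ric t x
  have hq := h.sol.sm
  have d1 := h.dx_w
  have d2 : dx (dx (w q b f)) = fun t x => 4 * (q t x + b ^ 2 - v f t x ^ 2) ^ 2
      + 4 * v f t x * (dx q t x - 2 * v f t x * (q t x + b ^ 2 - v f t x ^ 2))
      - dx (dx q) t x := by
    rw [d1]
    ext t x
    refine HasDerivAt.deriv (((((hv t x).const_mul 4).mul
      (((hq.hasDerivAt_x t x).add_const (b ^ 2)).sub ((hv t x).pow 2))).sub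
      (hq.dx.hasDerivAt_x t x)).congr_deriv ?_)
    simp; ring
  have d3 : dx (dx (dx (w q b f))) = fun t x =>
      12 * (q t x + b ^ 2 - v f t x ^ 2) * (dx q t x - 2 * v f t x * (q t x + b ^ 2 - v f t x ^ 2))
      + 4 * v f t x * (dx (dx q) t x - 2 * (q t x + b ^ 2 - v f t x ^ 2) ^ 2
        - 2 * v f t x * (dx q t x - 2 * v f t x * (q t x + b ^ 2 - v f t x ^ 2)))
      - dx (dx (dx q)) t x := by
    rw [d2]
    ext t x
    have hR := ((hq.hasDerivAt_x t x).add_const (b ^ 2)).sub ((hv t x).pow 2)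
    refine HasDerivAt.deriv (((((hR.pow 2).const_mul 4).add (((hv t x).const_mul 4).mul
      ((hq.dx.hasDerivAt_x t x).sub (((hv t x).const_mul 2).mul hR)))).sub
      (hq.dx.dx.hasDerivAt_x t x)).congr_deriv ?_)
    simp; ring
  intro t x
  have ht : dt (w q b f) t x = 4 * v f t x * (-dx (dx q) t x + 2 * dx q t x * v f t x
      + (2 * q t x - 4 * b ^ 2) * (q t x + b ^ 2 - v f t x ^ 2)) - dt q t x := by
    refine HasDerivAt.deriv ((((((h.hasDerivAt_v_t t x).pow 2).sub_const (b ^ 2)).const_mul 2).sub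
      (hq.hasDerivAt_t t x)).congr_deriv ?_)
    simp; ring
  rw [d3, d1, ht, h.sol.kdv t x]
  unfold w
  ring

theorem integral_w (h : Dar q b f) (t : ℝ) :
    ∫ x, w q b f t x ^ 2 = (∫ x, q t x ^ 2) - 16 / 3 * b ^ 3 := by
  obtain ⟨K, hK0, hK⟩ := h.sol.exists_bound
  have := (h.ric t).integral_darboux (h.sol.sqI t (Set.mem_univ t)) (hK t (Set.mem_univ t))
    (h.bot t) (h.top t)
  unfold w
  rw [this, Ric.cub, Ric.cub]
  ring

theorem exists_bound (h : Dar q b f) : ∃ K, 0 ≤ K ∧ (∀ t x, |q t x| ≤ K) ∧ ∀ t x, |v f t x| ≤ K := by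
  obtain ⟨K, hK0, hK⟩ := h.sol.exists_bound
  refine ⟨K + √(K + b ^ 2), by positivity, fun t x => ?_, fun t x => ?_⟩
  · linarith [hK t (Set.mem_univ t) x, Real.sqrt_nonneg (K + b ^ 2)]
  · linarith [(h.ric t).abs_le_of_bound (hK t (Set.mem_univ t)) x]

theorem sol_w (h : Dar q b f) : SolOn Set.univ (w q b f) := by
  obtain ⟨K, hK0, hK, hKv⟩ := h.exists_bound
  obtain ⟨C, hC⟩ := h.sol.bdd
  have hsq : ∀ t, SqI (q t) := fun t => h.sol.sqI t (Set.mem_univ t)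
  have hsq' : ∀ t, SqI (dx q t) := fun t => h.sol.sqI' t (Set.mem_univ t)
  have hw : ∀ t, SqI (w q b f t) := fun t => (h.ric t).sqI_darboux (hsq t) (hK t)
  have e : ∀ t x, dx (w q b f) t x = (2 * v f t x) * q t x - (2 * v f t x) * w q b f t x
      - dx q t x := fun t x => by rw [h.dx_w]; unfold w; ring
  have hcv : ∀ t, Continuous fun x => 2 * v f t x := fun t => (h.sm_v.cx t).const_mul 2
  have hbv : ∀ t x, |2 * v f t x| ≤ 2 * K := fun t x => by
    rw [abs_mul, abs_two]; linarith [hKv t x]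
  have hw' : ∀ t, SqI (dx (w q b f) t) := fun t => by
    rw [funext (e t)]
    exact (((hsq t).bdd_mul (hcv t) (hbv t)).sub ((hw t).bdd_mul (hcv t) (hbv t))).sub (hsq' t)
  refine ⟨h.sm_w, h.kdv_w, fun t _ => hw t, fun t _ => hw' t,
    C + (3 * (4 * K ^ 2 * C) + 3 * (4 * K ^ 2 * C) + 3 * C), fun t _ => ?_⟩
  have hCt := hC t (Set.mem_univ t)
  have hn1 := SqI.integral_nonneg (q t)
  have hn2 := SqI.integral_nonneg (dx q t)
  have hi := h.integral_w t
  have hb3 : 0 < b ^ 3 := pow_pos h.hb 3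
  have hle : ∫ x, dx (w q b f) t x ^ 2 ≤ ∫ x, (3 * (4 * K ^ 2) * q t x ^ 2
      + 3 * (4 * K ^ 2) * w q b f t x ^ 2 + 3 * dx q t x ^ 2) := by
    refine integral_mono (hw' t).2 ((((hsq t).2.const_mul _).add ((hw t).2.const_mul _)).add
      ((hsq' t).2.const_mul _)) fun x => ?_
    have h1 : (2 * v f t x) ^ 2 ≤ 4 * K ^ 2 := by
      have := sq_le_sq' (abs_le.1 (hKv t x)).1 (abs_le.1 (hKv t x)).2
      linarith
    simp only [e]
    have h2 := mul_le_mul_of_nonneg_right h1 (sq_nonneg (q t x))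
    have h3 := mul_le_mul_of_nonneg_right h1 (sq_nonneg (w q b f t x))
    nlinarith [sq_nonneg (2 * v f t x * q t x + 2 * v f t x * w q b f t x),
      sq_nonneg (2 * v f t x * q t x + dx q t x), sq_nonneg (2 * v f t x * w q b f t x - dx q t x)]
  have i1 : Integrable fun x => 3 * (4 * K ^ 2) * q t x ^ 2 := (hsq t).2.const_mul _
  have i2 : Integrable fun x => 3 * (4 * K ^ 2) * w q b f t x ^ 2 := (hw t).2.const_mul _
  have i3 : Integrable fun x => 3 * (4 * K ^ 2) * q t x ^ 2 + 3 * (4 * K ^ 2) * w q b f t x ^ 2 :=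
    i1.add i2
  rw [integral_add i3 ((hsq' t).2.const_mul _), integral_add i1 i2, integral_const_mul,
    integral_const_mul, integral_const_mul] at hle
  have h1 : ∫ x, q t x ^ 2 ≤ C := by linarith
  have h2 : ∫ x, w q b f t x ^ 2 ≤ C := by linarith
  have h3 : ∫ x, dx q t x ^ 2 ≤ C := by linarith
  have h4 := mul_le_mul_of_nonneg_left h1 (show 0 ≤ 3 * (4 * K ^ 2) by positivity)
  have h5 := mul_le_mul_of_nonneg_left h2 (show 0 ≤ 3 * (4 * K ^ 2) by positivity)
  linarith

end Dar

/-! ### Conservation laws -/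

theorem SqI.int_bdd_mul {f g k : ℝ → ℝ} (hf : SqI f) (hg : SqI g) (hk : Continuous k) {C : ℝ}
    (h : ∀ x, |k x| ≤ C) : Integrable fun x => k x * (f x * g x) := by
  refine ((hf.bdd_mul hk h).mul_int hg).congr (Eventually.of_forall fun x => ?_)
  ring

theorem tendsto_integral_cutoff {F : ℝ → ℝ} (hF : Integrable F) :
    Tendsto (fun R : ℝ => ∫ x in -R..R, F x * (1 - (x / R) ^ 2)) atTop (nhds (∫ x, F x)) := by
  have h1 : Tendsto (fun R : ℝ => ∫ x, (Set.Ioc (-R) R).indicator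
      (fun x => F x * (1 - (x / R) ^ 2)) x) atTop (nhds (∫ x, F x)) := by
    refine tendsto_integral_filter_of_dominated_convergence (fun x => ‖F x‖) ?_ ?_ hF.norm ?_
    · exact Eventually.of_forall fun R =>
        (hF.aestronglyMeasurable.mul (by fun_prop : Continuous fun x : ℝ =>
          1 - (x / R) ^ 2).aestronglyMeasurable).indicator measurableSet_Ioc
    · refine (eventually_gt_atTop 0).mono fun R hR => Eventually.of_forall fun x => ?_
      by_cases hx : x ∈ Set.Ioc (-R) R
      · rw [Set.indicator_of_mem hx, norm_mul]
        refine mul_le_of_le_one_right (norm_nonneg _) ?_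
        have h1 : |x / R| ≤ 1 := by
          rw [abs_div, abs_of_pos hR, div_le_one hR, abs_le]
          exact ⟨hx.1.le, hx.2⟩
        have h2 := (sq_le_one_iff_abs_le_one _).2 h1
        rw [Real.norm_eq_abs, abs_le]
        constructor <;> nlinarith [sq_nonneg (x / R)]
      · rw [Set.indicator_of_notMem hx, norm_zero]; exact norm_nonneg _
    · refine Eventually.of_forall fun x => ?_
      have h2 : Tendsto (fun R : ℝ => F x * (1 - (x / R) ^ 2)) atTop (nhds (F x * (1 - 0 ^ 2))) :=
        (((tendsto_const_nhds.div_atTop tendsto_id).pow 2).const_sub 1).const_mul _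
      simp only [ne_eq, OfNat.ofNat_ne_zero, not_false_eq_true, zero_pow, sub_zero, mul_one] at h2
      refine h2.congr' ((eventually_gt_atTop |x|).mono fun R hR => ?_)
      have := abs_lt.1 hR
      have hx : x ∈ Set.Ioc (-R) R := ⟨this.1, this.2.le⟩
      exact (Set.indicator_of_mem hx fun x => F x * (1 - (x / R) ^ 2)).symm
  refine h1.congr' ((eventually_ge_atTop 0).mono fun R hR => ?_)
  dsimp only
  rw [integral_indicator measurableSet_Ioc, intervalIntegral.integral_of_le (by linarith)]

theorem integral_eq_of_flux {U : Set ℝ} (hUc : U.OrdConnected)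
    {ρ ρ' J : ℝ → ℝ → ℝ} {C C' : ℝ} (hρ : ∀ t ∈ U, Continuous (ρ t))
    (hi : ∀ t ∈ U, Integrable (ρ t)) (hb : ∀ t ∈ U, ∀ x, |ρ t x| ≤ C)
    (hρt : ∀ t ∈ U, ∀ x, HasDerivAt (fun t => ρ t x) (ρ' t x) t)
    (hρc : ContinuousOn (fun p : ℝ × ℝ => ρ' p.2 p.1) (Set.univ ×ˢ U))
    (hJ : ∀ t ∈ U, ∀ x, HasDerivAt (J t) (ρ' t x) x) (hJi : ∀ t ∈ U, Integrable (J t))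
    (hJb : ∀ t ∈ U, ∫ x, |J t x| ≤ C') {t t' : ℝ} (ht : t ∈ U) (ht' : t' ∈ U) :
    ∫ x, ρ t x = ∫ x, ρ t' x := by
  have hs : interior U ⊆ U := interior_subset
  set F : ℝ → ℝ → ℝ := fun R t => ∫ x in -R..R, ρ t x * (1 - (x / R) ^ 2)
  have hFd : ∀ R, 0 < R → ∀ t ∈ interior U, HasDerivAt (F R)
      (∫ x in -R..R, J t x * (2 * x / R ^ 2)) t := fun R hR t ht => by
    have h1 := hasDerivAt_intervalIntegral_param_on (F := fun x t => ρ t x * (1 - (x / R) ^ 2))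
      (F' := fun x t => ρ' t x * (1 - (x / R) ^ 2)) isOpen_interior
      ((hρc.mono (Set.prod_mono le_rfl hs)).mul (by fun_prop))
      (fun x t ht => (hρt t (hs ht) x).mul_const _)
      (fun t ht => (hρ t (hs ht)).mul (by fun_prop)) (-R) R ht
    refine h1.congr_deriv ?_
    have hcJ : Continuous (ρ' t) := by
      have := (hρc.comp (g := fun p : ℝ × ℝ => ρ' p.2 p.1) (f := fun x : ℝ => (x, t))
        (by fun_prop : Continuous fun x : ℝ => (x, t)).continuousOn
        (s := Set.univ) (fun x _ => ⟨Set.mem_univ _, hs ht⟩))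
      exact continuousOn_univ.1 this
    have h2 := intervalIntegral.integral_mul_deriv_eq_deriv_mul (a := -R) (b := R)
      (u := fun x => 1 - (x / R) ^ 2) (u' := fun x => -(2 * x / R ^ 2)) (v := J t) (v' := ρ' t)
      (fun x _ => ((((hasDerivAt_id x).div_const R).pow 2).const_sub 1).congr_deriv (by
        simp; field_simp)) (fun x _ => hJ t (hs ht) x)
      ((by fun_prop : Continuous fun x : ℝ => -(2 * x / R ^ 2)).intervalIntegrable _ _)
      (hcJ.intervalIntegrable _ _)
    have e1 : (fun x => ρ' t x * (1 - (x / R) ^ 2)) = fun x => (1 - (x / R) ^ 2) * ρ' t x := by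
      ext x; ring
    rw [e1, h2]
    simp only [neg_div, div_self hR.ne', neg_mul, intervalIntegral.integral_neg]
    norm_num
    congr 1; ext x; ring
  have hFb : ∀ R, 0 < R → ∀ t ∈ interior U, |∫ x in -R..R, J t x * (2 * x / R ^ 2)| ≤
      2 / R * C' := fun R hR t ht => by
    have hle : -R ≤ R := by linarith
    have h1 : ‖∫ x in -R..R, J t x * (2 * x / R ^ 2)‖ ≤ ∫ x in -R..R, 2 / R * |J t x| := by
      refine intervalIntegral.norm_integral_le_of_norm_le hle
        (Eventually.of_forall fun x hx => ?_) ((hJi t (hs ht)).abs.const_mul _).intervalIntegrable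
      rw [norm_mul, mul_comm, Real.norm_eq_abs, Real.norm_eq_abs]
      refine mul_le_mul_of_nonneg_right ?_ (abs_nonneg _)
      rw [abs_div, abs_mul, abs_two, abs_of_pos (pow_pos hR 2), div_le_div_iff₀ (by positivity) hR]
      have : |x| ≤ R := abs_le.2 ⟨hx.1.le, hx.2⟩
      nlinarith
    refine h1.trans ?_
    rw [intervalIntegral.integral_const_mul, intervalIntegral.integral_of_le hle]
    refine mul_le_mul_of_nonneg_left (le_trans ?_ (hJb t (hs ht))) (by positivity)
    exact setIntegral_le_integral (hJi t (hs ht)).abs (Eventually.of_forall fun x => abs_nonneg _)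
  have hFc : ∀ R, 0 < R → ContinuousOn (F R) U := fun R hR t ht => by
    refine intervalIntegral.continuousWithinAt_of_dominated_interval (bound := fun _ => C) ?_ ?_
      (by simp) (Eventually.of_forall fun x _ => ?_)
    · exact eventually_mem_nhdsWithin.mono fun t ht =>
        ((hρ t ht).mul (by fun_prop)).aestronglyMeasurable
    · refine eventually_mem_nhdsWithin.mono fun t ht => Eventually.of_forall fun x hx => ?_
      rw [Set.uIoc_of_le (by linarith)] at hx
      rw [norm_mul]
      refine (mul_le_of_le_one_right (norm_nonneg _) ?_).trans (hb t ht x)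
      have h1 : |x / R| ≤ 1 := by
        rw [abs_div, abs_of_pos hR, div_le_one hR, abs_le]
        exact ⟨hx.1.le, hx.2⟩
      have h2 := (sq_le_one_iff_abs_le_one _).2 h1
      rw [Real.norm_eq_abs, abs_le]
      constructor <;> nlinarith [sq_nonneg (x / R)]
    · exact ((hρt t ht x).mul_const _).continuousAt.continuousWithinAt
  have key : ∀ R, 0 < R → ∀ {t t'}, t ∈ U → t' ∈ U → t ≤ t' →
      |F R t' - F R t| ≤ 2 / R * C' * (t' - t) := fun R hR t t' ht ht' hle => by
    have hd : DifferentiableOn ℝ (F R) (interior U) := fun s hs' =>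
      (hFd R hR s hs').differentiableAt.differentiableWithinAt
    have h1 := hUc.convex.image_sub_le_mul_sub_of_deriv_le (hFc R hR) hd
      (C := 2 / R * C') (fun s hs' => by
        rw [(hFd R hR s hs').deriv]; exact (abs_le.1 (hFb R hR s hs')).2) t ht t' ht' hle
    have h2 := hUc.convex.mul_sub_le_image_sub_of_le_deriv (hFc R hR) hd
      (C := -(2 / R * C')) (fun s hs' => by
        rw [(hFd R hR s hs').deriv]; exact (abs_le.1 (hFb R hR s hs')).1) t ht t' ht' hle
    rw [abs_le]
    constructor <;> linarith
  have main : ∀ {t t'}, t ∈ U → t' ∈ U → t ≤ t' → ∫ x, ρ t x = ∫ x, ρ t' x := by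
    intro t t' ht ht' hle
    have h1 := ((tendsto_integral_cutoff (hi t' ht')).sub (tendsto_integral_cutoff (hi t ht))).abs
    have h2 : Tendsto (fun R : ℝ => 2 / R * C' * (t' - t)) atTop (nhds (0 * C' * (t' - t))) :=
      ((tendsto_const_nhds.div_atTop tendsto_id).mul_const _).mul_const _
    have h3 := le_of_tendsto_of_tendsto h1 h2 ((eventually_gt_atTop 0).mono fun R hR =>
      key R hR ht ht' hle)
    rw [zero_mul, zero_mul] at h3
    linarith [abs_nonpos_iff.1 h3]
  rcases le_total t t' with h | h
  · exact main ht ht' h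
  · exact (main ht' ht h).symm

/-! ### Jost solutions at large negative energy -/

namespace Ric

variable {q v : ℝ → ℝ} {b K : ℝ}

theorem ge_of_tendsto_atBot (h : Ric q b v) {m l : ℝ} (hm : ∀ x, m ^ 2 ≤ q x + b ^ 2)
    (hl : Tendsto v atBot (nhds l)) (hml : m < l) (x : ℝ) : m ≤ v x := by
  have hmono : Monotone fun x => (v x - m) * expInt (fun s => v s + m) x := by
    refine monotone_of_hasDerivAt_nonneg (fun x => ((h x).sub_const m).mul
      (hasDerivAt_expInt (by have := h.continuous; fun_prop) x)) fun x => ?_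
    have h1 := expInt_pos (fun s => v s + m) x
    have : (q x + b ^ 2 - v x ^ 2) * expInt (fun s => v s + m) x
        + (v x - m) * ((v x + m) * expInt (fun s => v s + m) x)
        = (q x + b ^ 2 - m ^ 2) * expInt (fun s => v s + m) x := by ring
    simp only [Pi.zero_apply, this]
    exact mul_nonneg (by linarith [hm x]) h1.le
  obtain ⟨y, hy⟩ := eventually_atBot.1 (hl.eventually (lt_mem_nhds hml))
  have h1 := hmono (min_le_right y x)
  have h2 : 0 ≤ (v (min y x) - m) * expInt (fun s => v s + m) (min y x) :=
    mul_nonneg (by linarith [hy _ (min_le_left y x)]) (expInt_pos _ _).le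
  by_contra! hc
  have := mul_neg_of_neg_of_pos (sub_neg.2 hc) (expInt_pos (fun s => v s + m) x)
  simp only at h1
  linarith

theorem abs_sub_le_of_tendsto_atBot (h : Ric q b v) (hK : ∀ x, |q x| ≤ K) (hK0 : 0 < K)
    (hb : 0 < b) (hKb : K ≤ b ^ 2) (hl : Tendsto v atBot (nhds b)) (x : ℝ) :
    |v x - b| ≤ K / b ∧ 0 ≤ v x := by
  have hp : 0 < K / b := div_pos hK0 hb
  have e : K / b * b = K := div_mul_cancel₀ _ hb.ne'
  have h0 : K / b ≤ b := by rw [div_le_iff₀ hb]; nlinarith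
  have h1 := h.ge_of_tendsto_atBot (m := b - K / b) (fun x => by
    have := (abs_le.1 (hK x)).1
    nlinarith) hl (by linarith) x
  have h2 : v x ≤ b + K / b := by
    refine (h.le_of_bound hK x).trans ?_
    rw [Real.sqrt_le_left (by positivity)]
    nlinarith
  exact ⟨abs_le.2 ⟨by linarith, by linarith⟩, by linarith⟩

theorem exists_jost (hq : SqI q) (hK : ∀ x, |q x| ≤ K) (hK0 : 0 < K) (hb : 0 < b)
    (hKb : K ≤ b ^ 2) :
    ∃ v, Ric q b v ∧ Tendsto v atBot (nhds b) ∧ Tendsto v atTop (nhds b) := by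
  obtain ⟨v₀, hv₀, -⟩ := exists_of_super (b := b) (m := fun _ => 0) (m' := fun _ => 0) hq.1
    (fun x => hasDerivAt_const x 0) fun x => by
      have := (abs_le.1 (hK x)).1
      simp only [ne_eq, OfNat.ofNat_ne_zero, not_false_eq_true, zero_pow, add_zero]
      linarith
  obtain ⟨v, hv, hl, -⟩ := exists_max hb hq hK ⟨v₀, hv₀⟩
  refine ⟨v, hv, hl, (hv.tendsto_atTop_or hb hq hK).resolve_right fun hr => ?_⟩
  have : ∀ x, 0 ≤ v x := fun x => (hv.abs_sub_le_of_tendsto_atBot hK hK0 hb hKb hl x).2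
  have := ge_of_tendsto' hr this
  linarith

theorem sqI_sub (h : Ric q b v) (hq : SqI q) (hK : ∀ x, |q x| ≤ K) (hb : 0 < b)
    (h0 : ∀ x, 0 ≤ v x) : SqI fun x => v x - b := by
  refine ((h.sqI_sq_sub hq hK).const_mul b⁻¹).of_le (h.continuous.sub continuous_const) fun x => ?_
  rw [show b⁻¹ * (v x ^ 2 - b ^ 2) = (v x - b) * ((v x + b) / b) by field_simp; ring, abs_mul]
  refine le_mul_of_one_le_right (abs_nonneg _) ((le_abs_self _).trans' ?_)
  rw [one_le_div hb]
  linarith [h0 x]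

/-- The mass identity for a Jost solution. -/
theorem integral_sq_eq (h : Ric q b v) (hq : SqI q) (hK : ∀ x, |q x| ≤ K)
    (hl : Tendsto v atBot (nhds b)) (hr : Tendsto v atTop (nhds b)) :
    ∫ x, q x ^ 2 = ∫ x, ((v x ^ 2 - b ^ 2) ^ 2 + (q x - (v x ^ 2 - b ^ 2)) ^ 2) := by
  have h1 := h.integral_darboux hq hK hl hr
  rw [sub_self, mul_zero, sub_zero] at h1
  have i1 := (h.sqI_darboux hq hK).2
  have h2 : ∫ x, ((v x ^ 2 - b ^ 2) ^ 2 + (q x - (v x ^ 2 - b ^ 2)) ^ 2) =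
      ∫ x, (1 / 2 * q x ^ 2 + 1 / 2 * (2 * (v x ^ 2 - b ^ 2) - q x) ^ 2) := by
    congr 1; ext x; ring
  rw [h2, integral_add (hq.2.const_mul _) (i1.const_mul _), integral_const_mul, integral_const_mul,
    h1]
  ring

end Ric

theorem SqI.integral_deriv_mul_eq_zero {f g f' g' : ℝ → ℝ} (hf : SqI f) (hg : SqI g)
    (hf' : SqI f') (hg' : SqI g') (h1 : ∀ x, HasDerivAt f (f' x) x)
    (h2 : ∀ x, HasDerivAt g (g' x) x) : ∫ x, (f' x * g x + f x * g' x) = 0 :=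
  integral_eq_zero_of_hasDerivAt_of_integrable (fun x => (h1 x).mul (h2 x))
    ((hf'.mul_int hg).add (hf.mul_int hg')) (hf.mul_int hg)

theorem abs_jost_density_le {K e g g₁ q q₂ s : ℝ} (hK0 : 0 ≤ K) (he : 0 < e) (he1 : e ≤ 1)
    (hK : |q| ≤ K) (hgK : |g| ≤ 2 * K) (hs : s = -(g₁ + e * g ^ 2)) :
    |e * g ^ 4 + 2 * s * (g ^ 2 + g * q + q ^ 2) - 2 * e * (g * g₁ ^ 2) - q₂ * s| ≤
      q₂ ^ 2 + (16 * K + 2) * g₁ ^ 2 + (3 * K + 8 * K ^ 2 + 48 * K ^ 3) * g ^ 2 + 3 * K * q ^ 2 := by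
  have hg2 : g ^ 2 ≤ 4 * K ^ 2 := by
    have := sq_le_sq' (abs_le.1 hgK).1 (abs_le.1 hgK).2; linarith
  have hg4 : g ^ 4 ≤ 4 * K ^ 2 * g ^ 2 := by
    have := mul_le_mul_of_nonneg_right hg2 (sq_nonneg (g)); nlinarith
  have he2 : e ^ 2 ≤ 1 := by nlinarith
  have hs2 : s ^ 2 ≤ 2 * g₁ ^ 2 + 8 * K ^ 2 * g ^ 2 := by
    have h1 : s ^ 2 ≤ 2 * g₁ ^ 2 + 2 * (e ^ 2 * g ^ 4) := by
      rw [hs]; nlinarith [sq_nonneg (g₁ - e * g ^ 2)]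
    have h2 := mul_le_mul he2 hg4 (by positivity) zero_le_one
    linarith
  have t1 : |e * g ^ 4| ≤ 4 * K ^ 2 * g ^ 2 := by
    rw [abs_of_nonneg (by positivity)]
    have : e * g ^ 4 ≤ 1 * g ^ 4 := mul_le_mul_of_nonneg_right he1 (by positivity)
    linarith
  have t2 : |2 * s * (g ^ 2 + g * q + q ^ 2)| ≤
      3 * K * (2 * s ^ 2 + g ^ 2 + q ^ 2) := by
    have h1 : |g ^ 2 + g * q + q ^ 2| ≤ 3 * K * (|g| + |q|) := by
      rw [abs_le]
      have ha := abs_nonneg (g)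
      have hb := abs_nonneg (q)
      have h5 : |g| ^ 2 ≤ 2 * K * |g| := by nlinarith [hgK]
      have h6 : |q| ^ 2 ≤ K * |q| := by nlinarith [hK]
      have h7 : |g| * |q| ≤ K * |g| := by nlinarith [hK]
      rw [sq_abs] at h5 h6
      rw [← abs_mul] at h7
      have h8 := abs_le.1 h7
      constructor <;> nlinarith [sq_nonneg (g), sq_nonneg (q)]
    rw [abs_mul, abs_mul, abs_two]
    have h2 := mul_le_mul_of_nonneg_left h1 (show 0 ≤ 2 * |s| by positivity)
    refine h2.trans ?_
    have h3 : 2 * |s| * (|g| + |q|) ≤ 2 * s ^ 2 + g ^ 2 + q ^ 2 := by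
      rw [← sq_abs (s), ← sq_abs (g), ← sq_abs (q)]
      nlinarith [sq_nonneg (|s| - |g|), sq_nonneg (|s| - |q|)]
    have h4 := mul_le_mul_of_nonneg_left h3 (show 0 ≤ 3 * K by positivity)
    linarith
  have t3 : |2 * e * (g * g₁ ^ 2)| ≤ 4 * K * g₁ ^ 2 := by
    rw [abs_mul, abs_mul (g), abs_of_nonneg (sq_nonneg (g₁)), abs_of_pos (by positivity),
      ← mul_assoc]
    refine mul_le_mul_of_nonneg_right ?_ (sq_nonneg _)
    have := mul_le_mul he1 hgK (abs_nonneg _) zero_le_one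
    linarith
  have t4 : |q₂ * s| ≤ 1 / 2 * (q₂ ^ 2 + s ^ 2) := by
    rw [abs_le]
    constructor <;> nlinarith [sq_nonneg (q₂ - s), sq_nonneg (q₂ + s)]
  have hK3 : 3 * K * (2 * s ^ 2) ≤ 3 * K * (2 * (2 * g₁ ^ 2 + 8 * K ^ 2 * g ^ 2)) := by
    gcongr
  have a1 := abs_le.1 t1
  have a2 := abs_le.1 t2
  have a3 := abs_le.1 t3
  have a4 := abs_le.1 t4
  have p1 := mul_nonneg hK0 (sq_nonneg (g₁))
  have p2 := sq_nonneg (q₂)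
  have p3 := sq_nonneg (g₁)
  rw [abs_le]
  constructor <;> linarith

/-- Quantitative convergence of the rescaled Jost energy to the second KdV energy. -/
theorem abs_jost_energy_sub_le {q q₁ q₂ g g₁ : ℝ → ℝ} {K e : ℝ} (hq : SqI q) (hq₁ : SqI q₁)
    (hq₂ : SqI q₂) (hg : SqI g) (hg₁ : SqI g₁) (dq : ∀ x, HasDerivAt q (q₁ x) x)
    (dq₁ : ∀ x, HasDerivAt q₁ (q₂ x) x) (dg : ∀ x, HasDerivAt g (g₁ x) x)
    (hric : ∀ x, e * g₁ x + g x + e ^ 2 * g x ^ 2 = q x) (hK : ∀ x, |q x| ≤ K)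
    (hgK : ∀ x, |g x| ≤ 2 * K) (he : 0 < e) (he1 : e ≤ 1) (heK : 8 * K * e ^ 2 ≤ 1)
    (hM : ∫ x, (g x + e ^ 2 * g x ^ 2) ^ 2 ≤ ∫ x, q x ^ 2) :
    |(∫ x, (g₁ x ^ 2 + e ^ 2 * g x ^ 4 + 2 * g x ^ 3)) - ∫ x, (q₁ x ^ 2 + 2 * q x ^ 3)| ≤
      e * ((∫ x, q₂ x ^ 2) + (64 * K + 100) * (∫ x, q₁ x ^ 2)
        + 1000 * (K + K ^ 2 + K ^ 3) * ∫ x, q x ^ 2) := by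
  have hK0 : 0 ≤ K := (abs_nonneg _).trans (hK 0)
  have hc := hg.1
  have hc₁ := hg₁.1
  have hcq := hq.1
  set g₂ : ℝ → ℝ := fun x => e⁻¹ * (q₁ x - g₁ x - 2 * e ^ 2 * (g x * g₁ x)) with hg₂
  have hgg₁ : SqI fun x => g x * g₁ x := hg₁.bdd_mul hc hgK
  have sg₂ : SqI g₂ := ((hq₁.sub hg₁).sub (hgg₁.const_mul (2 * e ^ 2))).const_mul e⁻¹
  have dg₁ : ∀ x, HasDerivAt g₁ (g₂ x) x := fun x => by
    have e1 : g₁ = fun x => e⁻¹ * (q x - g x - e ^ 2 * g x ^ 2) := by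
      ext x; rw [← hric x]; field_simp; ring
    have := ((((dq x).sub (dg x)).sub (((dg x).pow 2).const_mul (e ^ 2))).const_mul e⁻¹)
    rw [show (e⁻¹ * (q₁ x - g₁ x - e ^ 2 * (((2 : ℕ) : ℝ) * g x ^ (2 - 1) * g₁ x))) = g₂ x by
      simp [hg₂]; left; ring] at this
    rw [e1]; exact this
  have z1 := hg₁.integral_deriv_mul_eq_zero hg₁ sg₂ sg₂ dg₁ dg₁
  have z2 := hq₁.integral_deriv_mul_eq_zero (hg.sub hq) hq₂ (hg₁.sub hq₁) dq₁
    fun x => (dg x).sub (dq x)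
  have i1 : Integrable fun x => q₁ x * g₁ x := hq₁.mul_int hg₁
  have i2 : Integrable fun x => g x * (g₁ x * g₁ x) := hg₁.int_bdd_mul hg₁ hc hgK
  have z1' : ∫ x, (q₁ x * g₁ x - g₁ x ^ 2 - 2 * e ^ 2 * (g x * (g₁ x * g₁ x))) = 0 := by
    have : ∫ x, (g₂ x * g₁ x + g₁ x * g₂ x) = 2 * e⁻¹ *
        ∫ x, (q₁ x * g₁ x - g₁ x ^ 2 - 2 * e ^ 2 * (g x * (g₁ x * g₁ x))) := by
      rw [← integral_const_mul]; congr 1; ext x; simp only [hg₂]; ring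
    rw [this] at z1
    exact (mul_eq_zero.1 z1).resolve_left (by positivity)
  have hgb : ∀ x, 2 * e ^ 2 * |g x| ≤ 1 / 2 := fun x => by nlinarith [hgK x, sq_nonneg e]
  have iz1 : Integrable fun x => q₁ x * g₁ x - g₁ x ^ 2 - 2 * e ^ 2 * (g x * (g₁ x * g₁ x)) :=
    (i1.sub hg₁.2).sub (i2.const_mul _)
  have hN : ∫ x, g₁ x ^ 2 ≤ 4 * ∫ x, q₁ x ^ 2 := by
    have : ∫ x, (q₁ x * g₁ x - g₁ x ^ 2 - 2 * e ^ 2 * (g x * (g₁ x * g₁ x))) ≤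
        ∫ x, (q₁ x ^ 2 - 1 / 4 * g₁ x ^ 2) := by
      refine integral_mono iz1 (hq₁.2.sub (hg₁.2.const_mul _)) fun x => ?_
      have h1 := abs_le.1 (show |2 * e ^ 2 * g x| ≤ 1 / 2 by
        rw [abs_mul, abs_of_nonneg (by positivity : (0 : ℝ) ≤ 2 * e ^ 2)]; exact hgb x)
      nlinarith [sq_nonneg (q₁ x - g₁ x / 2), mul_nonneg (sub_nonneg.2 h1.1) (sq_nonneg (g₁ x))]
    rw [z1', integral_sub hq₁.2 (hg₁.2.const_mul _), integral_const_mul] at this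
    linarith
  have sg2 : SqI fun x => g x + e ^ 2 * g x ^ 2 :=
    hg.add (((hg.bdd_mul hc hgK).const_mul (e ^ 2)).of_le (by fun_prop) fun x => by
      rw [sq (g x)])
  have hG : ∫ x, g x ^ 2 ≤ 4 * ∫ x, q x ^ 2 := by
    have : ∫ x, g x ^ 2 ≤ ∫ x, 4 * (g x + e ^ 2 * g x ^ 2) ^ 2 := by
      refine integral_mono hg.2 (sg2.2.const_mul 4) fun x => ?_
      have h1 := abs_le.1 (show |2 * e ^ 2 * g x| ≤ 1 / 2 by
        rw [abs_mul, abs_of_nonneg (by positivity : (0 : ℝ) ≤ 2 * e ^ 2)]; exact hgb x)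
      have h2 : (1 : ℝ) / 2 ≤ (1 + e ^ 2 * g x) := by linarith
      have h3 : (1 : ℝ) / 4 ≤ (1 + e ^ 2 * g x) ^ 2 := by nlinarith
      have h4 := mul_le_mul_of_nonneg_right h3 (sq_nonneg (g x))
      nlinarith
    rw [integral_const_mul] at this
    linarith
  set s : ℝ → ℝ := fun x => -(g₁ x + e * g x ^ 2)
  have hs : ∀ x, g x - q x = e * s x := fun x => by rw [← hric x]; simp only [s]; ring
  set D : ℝ → ℝ := fun x => e * (e * g x ^ 4 + 2 * s x * (g x ^ 2 + g x * q x + q x ^ 2)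
    - 2 * e * (g x * g₁ x ^ 2) - q₂ x * s x)
  have hDb : ∀ x, |D x| ≤ e * (q₂ x ^ 2 + (16 * K + 2) * g₁ x ^ 2
      + (3 * K + 8 * K ^ 2 + 48 * K ^ 3) * g x ^ 2 + 3 * K * q x ^ 2) := fun x => by
    simp only [D]
    rw [abs_mul, abs_of_pos he]
    refine mul_le_mul_of_nonneg_left ?_ he.le
    exact abs_jost_density_le hK0 he he1 (hK x) (hgK x) rfl
  have iD : Integrable fun x => e * (q₂ x ^ 2 + (16 * K + 2) * g₁ x ^ 2
      + (3 * K + 8 * K ^ 2 + 48 * K ^ 3) * g x ^ 2 + 3 * K * q x ^ 2) :=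
    (((hq₂.2.add (hg₁.2.const_mul _)).add (hg.2.const_mul _)).add (hq.2.const_mul _)).const_mul e
  have hDint : |∫ x, D x| ≤ e * ((∫ x, q₂ x ^ 2) + (16 * K + 2) * (∫ x, g₁ x ^ 2)
      + (3 * K + 8 * K ^ 2 + 48 * K ^ 3) * (∫ x, g x ^ 2) + 3 * K * ∫ x, q x ^ 2) := by
    refine (norm_integral_le_of_norm_le (f := D) iD (Eventually.of_forall fun x => hDb x)).trans_eq ?_
    have j1 : Integrable fun x => q₂ x ^ 2 + (16 * K + 2) * g₁ x ^ 2 :=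
      hq₂.2.add (hg₁.2.const_mul _)
    have j2 : Integrable fun x => q₂ x ^ 2 + (16 * K + 2) * g₁ x ^ 2
        + (3 * K + 8 * K ^ 2 + 48 * K ^ 3) * g x ^ 2 := j1.add (hg.2.const_mul _)
    rw [integral_const_mul, integral_add j2 (hq.2.const_mul _), integral_add j1 (hg.2.const_mul _),
      integral_add hq₂.2 (hg₁.2.const_mul _), integral_const_mul, integral_const_mul,
      integral_const_mul]
  have k3 : ∀ {f : ℝ → ℝ}, SqI f → (∀ x, |f x| ≤ 2 * K) → Integrable fun x => f x ^ 3 :=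
    fun {f} hf h => (hf.int_bdd_mul hf hf.1 h).congr (Eventually.of_forall fun x => by
      simp only; ring)
  have k4 : Integrable fun x => g x ^ 4 := by
    refine ((hg.bdd_mul hc hgK).2).congr (Eventually.of_forall fun x => ?_)
    simp only; ring
  have hqK2 : ∀ x, |q x| ≤ 2 * K := fun x => by linarith [hK x]
  have heq : (∫ x, (g₁ x ^ 2 + e ^ 2 * g x ^ 4 + 2 * g x ^ 3)) - ∫ x, (q₁ x ^ 2 + 2 * q x ^ 3)
      = ∫ x, D x := by
    have j1 : Integrable fun x => g₁ x ^ 2 + e ^ 2 * g x ^ 4 + 2 * g x ^ 3 :=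
      (hg₁.2.add (k4.const_mul _)).add ((k3 hg hgK).const_mul _)
    have j2 : Integrable fun x => q₁ x ^ 2 + 2 * q x ^ 3 :=
      hq₁.2.add ((k3 hq hqK2).const_mul _)
    have j3 : Integrable fun x => q₂ x * (g x - q x) + q₁ x * (g₁ x - q₁ x) :=
      (hq₂.mul_int (hg.sub hq)).add (hq₁.mul_int (hg₁.sub hq₁))
    have e1 : ∫ x, D x = ((∫ x, (g₁ x ^ 2 + e ^ 2 * g x ^ 4 + 2 * g x ^ 3))
        - ∫ x, (q₁ x ^ 2 + 2 * q x ^ 3)) + (∫ x, (q₁ x * g₁ x - g₁ x ^ 2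
          - 2 * e ^ 2 * (g x * (g₁ x * g₁ x))))
        - ∫ x, (q₂ x * (g x - q x) + q₁ x * (g₁ x - q₁ x)) := by
      have j4 : Integrable fun x => (g₁ x ^ 2 + e ^ 2 * g x ^ 4 + 2 * g x ^ 3)
          - (q₁ x ^ 2 + 2 * q x ^ 3) := j1.sub j2
      have j5 : Integrable fun x => ((g₁ x ^ 2 + e ^ 2 * g x ^ 4 + 2 * g x ^ 3)
          - (q₁ x ^ 2 + 2 * q x ^ 3)) + (q₁ x * g₁ x - g₁ x ^ 2
            - 2 * e ^ 2 * (g x * (g₁ x * g₁ x))) := j4.add iz1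
      rw [← integral_sub j1 j2, ← integral_add j4 iz1, ← integral_sub j5 j3]
      congr 1; ext x
      have h1 : e * (2 * s x * (g x ^ 2 + g x * q x + q x ^ 2)) = 2 * (g x ^ 3 - q x ^ 3) := by
        rw [show e * (2 * s x * (g x ^ 2 + g x * q x + q x ^ 2)) =
          2 * (e * s x) * (g x ^ 2 + g x * q x + q x ^ 2) by ring, ← hs]; ring
      have h2 : e * (q₂ x * s x) = q₂ x * (g x - q x) := by rw [hs]; ring
      simp only [D]
      linear_combination h1 - h2
    rw [e1, z1', z2]; ring
  rw [heq]
  refine hDint.trans (mul_le_mul_of_nonneg_left ?_ he.le)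
  have n1 := SqI.integral_nonneg q
  have n2 := SqI.integral_nonneg q₁
  have m1 := mul_le_mul_of_nonneg_left hN (show 0 ≤ 16 * K + 2 by positivity)
  have m2 := mul_le_mul_of_nonneg_left hG (show 0 ≤ 3 * K + 8 * K ^ 2 + 48 * K ^ 3 by positivity)
  have m3 : 0 ≤ K * ∫ x, q x ^ 2 := by positivity
  have m4 : 0 ≤ K ^ 2 * ∫ x, q x ^ 2 := by positivity
  have m5 : 0 ≤ K ^ 3 * ∫ x, q x ^ 2 := by positivity
  linarith

namespace Ric

variable {q v : ℝ → ℝ} {b K : ℝ}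

theorem integral_sq_sub_le (h : Ric q b v) (hq : SqI q) (hK : ∀ x, |q x| ≤ K)
    (hl : Tendsto v atBot (nhds b)) (hr : Tendsto v atTop (nhds b)) :
    ∫ x, (v x ^ 2 - b ^ 2) ^ 2 ≤ ∫ x, q x ^ 2 := by
  rw [h.integral_sq_eq hq hK hl hr]
  have s := h.sqI_sq_sub hq hK
  exact integral_mono s.2 (s.2.add (hq.sub s).2) fun x => le_add_of_nonneg_right (sq_nonneg _)

theorem integral_sub_sq_le (h : Ric q b v) (hq : SqI q) (hK : ∀ x, |q x| ≤ K) (hb : 0 < b)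
    (h0 : ∀ x, 0 ≤ v x) (hl : Tendsto v atBot (nhds b)) (hr : Tendsto v atTop (nhds b)) :
    b ^ 2 * ∫ x, (v x - b) ^ 2 ≤ ∫ x, q x ^ 2 := by
  refine le_trans ?_ (h.integral_sq_sub_le hq hK hl hr)
  rw [← integral_const_mul]
  refine integral_mono ((h.sqI_sub hq hK hb h0).2.const_mul _) (h.sqI_sq_sub hq hK).2 fun x => ?_
  have h1 : b ^ 2 ≤ (v x + b) ^ 2 := by nlinarith [h0 x, mul_nonneg (h0 x) hb.le]
  have := mul_le_mul_of_nonneg_right h1 (sq_nonneg (v x - b))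
  simp only
  nlinarith

theorem abs_jost_sub_le {q₁ q₂ : ℝ → ℝ} (h : Ric q b v) (hq : SqI q) (hq₁ : SqI q₁)
    (hq₂ : SqI q₂) (dq : ∀ x, HasDerivAt q (q₁ x) x) (dq₁ : ∀ x, HasDerivAt q₁ (q₂ x) x)
    (hK : ∀ x, |q x| ≤ K) (hK0 : 0 < K) (hb : 1 ≤ b) (hKb : 2 * K ≤ b ^ 2)
    (hl : Tendsto v atBot (nhds b)) (hr : Tendsto v atTop (nhds b)) :
    |4 * b ^ 2 * ((∫ x, q x ^ 2) - 4 * b ^ 2 * ∫ x, (v x - b) ^ 2)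
        - ∫ x, (q₁ x ^ 2 + 2 * q x ^ 3)| ≤
      ((∫ x, q₂ x ^ 2) + (64 * K + 100) * (∫ x, q₁ x ^ 2)
        + 1000 * (K + K ^ 2 + K ^ 3) * ∫ x, q x ^ 2) / b := by
  have hb0 : 0 < b := by linarith
  have hest := h.abs_sub_le_of_tendsto_atBot hK hK0 hb0 (by linarith) hl
  have sh := h.sqI_sub hq hK hb0 fun x => (hest x).2
  have hlb := h.integral_sq_sub_le hq hK hl hr
  obtain ⟨e, he⟩ : ∃ e, e = 1 / (2 * b) := ⟨_, rfl⟩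
  have he0 : 0 < e := by rw [he]; positivity
  have heb : e * (2 * b) = 1 := by rw [he]; field_simp
  have heb2 : e ^ 2 * (4 * b ^ 2) = 1 := by
    rw [show e ^ 2 * (4 * b ^ 2) = (e * (2 * b)) ^ 2 by ring, heb, one_pow]
  set g : ℝ → ℝ := fun x => 2 * b * (v x - b) with hg
  set g₁ : ℝ → ℝ := fun x => 2 * b * (q x + b ^ 2 - v x ^ 2) with hg₁
  have sg : SqI g := sh.const_mul _
  have sg₁ : SqI g₁ := (h.sqI_deriv hq hK).const_mul _
  have dg : ∀ x, HasDerivAt g (g₁ x) x := fun x => ((h x).sub_const b).const_mul _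
  have e1 : ∀ x, e * g₁ x = q x - (v x ^ 2 - b ^ 2) := fun x => by
    simp only [hg₁]; linear_combination (q x + b ^ 2 - v x ^ 2) * heb
  have e2 : ∀ x, g x + e ^ 2 * g x ^ 2 = v x ^ 2 - b ^ 2 := fun x => by
    simp only [hg]; linear_combination (v x - b) ^ 2 * heb2
  have hric : ∀ x, e * g₁ x + g x + e ^ 2 * g x ^ 2 = q x := fun x => by
    rw [add_assoc, e1, e2]; ring
  have hgK : ∀ x, |g x| ≤ 2 * K := fun x => by
    simp only [hg]
    rw [abs_mul, abs_of_pos (by positivity : 0 < 2 * b)]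
    have := mul_le_mul_of_nonneg_left (hest x).1 (by positivity : 0 ≤ 2 * b)
    rwa [show 2 * b * (K / b) = 2 * K by field_simp] at this
  have key := abs_jost_energy_sub_le (e := e) hq hq₁ hq₂ sg sg₁ dq dq₁ dg hric hK hgK he0
    (by rw [he, div_le_one (by positivity)]; linarith)
    (by nlinarith [sq_nonneg e]) (by simp only [e2]; exact hlb)
  have k3 : Integrable fun x => g x ^ 3 :=
    (sg.int_bdd_mul sg sg.1 hgK).congr (Eventually.of_forall fun x => by simp only; ring)
  have k4 : Integrable fun x => g x ^ 4 :=
    ((sg.bdd_mul sg.1 hgK).2).congr (Eventually.of_forall fun x => by simp only; ring)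
  have j1 : Integrable fun x => g₁ x ^ 2 + e ^ 2 * g x ^ 4 + 2 * g x ^ 3 :=
    (sg₁.2.add (k4.const_mul _)).add (k3.const_mul _)
  have e3 : ∫ x, q x ^ 2 = 4 * b ^ 2 * (∫ x, (v x - b) ^ 2)
      + e ^ 2 * ∫ x, (g₁ x ^ 2 + e ^ 2 * g x ^ 4 + 2 * g x ^ 3) := by
    have j2 : Integrable fun x => 4 * b ^ 2 * (v x - b) ^ 2 := sh.2.const_mul _
    rw [h.integral_sq_eq hq hK hl hr, ← integral_const_mul, ← integral_const_mul,
      ← integral_add j2 (j1.const_mul _)]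
    congr 1; ext x
    rw [← e1, ← e2]
    simp only [hg]; ring
  have e4 : 4 * b ^ 2 * ((∫ x, q x ^ 2) - 4 * b ^ 2 * ∫ x, (v x - b) ^ 2)
      = ∫ x, (g₁ x ^ 2 + e ^ 2 * g x ^ 4 + 2 * g x ^ 3) := by
    rw [e3]; linear_combination (∫ x, (g₁ x ^ 2 + e ^ 2 * g x ^ 4 + 2 * g x ^ 3)) * heb2
  rw [e4]
  refine key.trans ?_
  have n1 := SqI.integral_nonneg q
  have n2 := SqI.integral_nonneg q₁
  have n3 := SqI.integral_nonneg q₂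
  rw [div_eq_inv_mul]
  refine mul_le_mul_of_nonneg_right ?_ (by positivity)
  rw [he, ← one_div]
  exact one_div_le_one_div_of_le hb0 (by linarith)

end Ric

theorem eq_zero_of_abs_sq_mul_sub_le {a c C B : ℝ} (h : ∀ b, B ≤ b → |4 * b ^ 2 * a - c| ≤ C / b) :
    a = 0 ∧ c = 0 := by
  have t1 : Tendsto (fun b : ℝ => C / b) atTop (nhds 0) := tendsto_const_nhds.div_atTop tendsto_id
  have t2 : Tendsto (fun b : ℝ => 4 * b ^ 2 * a - c) atTop (nhds 0) :=
    squeeze_zero_norm' ((eventually_ge_atTop B).mono fun b hb => h b hb) t1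
  have t3 : Tendsto (fun b : ℝ => (4 * b ^ 2)⁻¹) atTop (nhds 0) :=
    tendsto_inv_atTop_zero.comp (Tendsto.const_mul_atTop (by norm_num)
      (tendsto_pow_atTop (by norm_num)))
  have t4 := (t2.add_const c).mul t3
  have ha : a = 0 := by
    refine tendsto_nhds_unique (f := fun _ : ℝ => a) (l := atTop) tendsto_const_nhds ?_
    rw [zero_add, mul_zero] at t4
    refine t4.congr' ((eventually_gt_atTop 0).mono fun b hb => ?_)
    field_simp; ring
  subst ha
  refine ⟨rfl, ?_⟩
  have := tendsto_nhds_unique t2 (tendsto_const_nhds.congr fun b => by ring : Tendsto _ atTop (nhds (-c)))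
  linarith

/-- Conservation of the `L²` norm and of the energy for KdV solutions bounded in `H¹`. -/
theorem SolOn.conserved {U : Set ℝ} {q : ℝ → ℝ → ℝ} (hq : SolOn U q)
    (hU : U ⊆ closure (interior U)) (hUc : U.OrdConnected)
    (hq₂ : ∀ t ∈ U, SqI (dx (dx q) t)) {t t' : ℝ} (ht : t ∈ U) (ht' : t' ∈ U) :
    ∫ x, q t x ^ 2 = ∫ x, q t' x ^ 2 ∧
      ∫ x, (dx q t x ^ 2 + 2 * q t x ^ 3) = ∫ x, (dx q t' x ^ 2 + 2 * q t' x ^ 3) := by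
  obtain ⟨K', hK0', hK'⟩ := hq.exists_bound
  obtain ⟨K, hK0, hK⟩ : ∃ K, 0 < K ∧ ∀ t ∈ U, ∀ x, |q t x| ≤ K :=
    ⟨K' + 1, by linarith, fun t ht x => by linarith [hK' t ht x]⟩
  obtain ⟨C₀, hC₀⟩ := hq.bdd
  set R : ℝ → ℝ := fun t => (∫ x, dx (dx q) t x ^ 2) + (64 * K + 100) * (∫ x, dx q t x ^ 2)
        + 1000 * (K + K ^ 2 + K ^ 3) * ∫ x, q t x ^ 2 with hR
  have main : ∀ b, max 1 (2 * K) ≤ b → |4 * b ^ 2 * ((∫ x, q t x ^ 2) - ∫ x, q t' x ^ 2)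
      - ((∫ x, (dx q t x ^ 2 + 2 * q t x ^ 3)) - ∫ x, (dx q t' x ^ 2 + 2 * q t' x ^ 3))|
      ≤ (R t + R t') / b := by
    intro b hb
    have hb1 : 1 ≤ b := (le_max_left _ _).trans hb
    have hb0 : 0 < b := by linarith
    have hKb : 2 * K ≤ b ^ 2 := by
      have := (le_max_right _ _).trans hb
      nlinarith
    have hKb' : K ≤ b ^ 2 := by linarith
    obtain ⟨v₀, hv₀, hl₀, hr₀⟩ := Ric.exists_jost (hq.sqI t' ht') (hK t' ht') hK0 hb0 hKb'
    obtain ⟨f, hf, hf0⟩ := exists_lax_of_ric hq.sm hq.kdv hv₀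
    have hpos := hf.pos hq.sm hUc hK ht' fun x => by rw [hf0]; exact Ric.expInt_pos _ _
    have ev : (fun x => dx f t' x / f t' x) = v₀ := by
      ext x
      have e1 : f t' = Ric.expInt v₀ := funext hf0
      have e2 : dx f t' x = v₀ x * Ric.expInt v₀ x := by
        unfold dx; rw [e1]; exact (Ric.hasDerivAt_expInt hv₀.continuous x).deriv
      rw [e2, hf0, mul_div_assoc, div_self (Ric.expInt_pos _ _).ne', mul_one]
    have hl : ∀ s ∈ U, Tendsto (fun x => dx f s x / f s x) atBot (nhds b) := fun s hs =>
      hf.tendsto_atBot hb0 hq hU hUc hpos hs ht' (by rw [ev]; exact hl₀)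
    have hr : ∀ s ∈ U, Tendsto (fun x => dx f s x / f s x) atTop (nhds b) := fun s hs =>
      hf.tendsto_atTop hb0 hq hU hUc hpos hs ht' (by rw [ev]; exact hr₀)
    set V : ℝ → ℝ → ℝ := fun s x => dx f s x / f s x with hV
    have ric : ∀ s ∈ U, Ric (q s) b (V s) := fun s hs => hf.ric (hpos s hs)
    have est := fun s hs => (ric s hs).abs_sub_le_of_tendsto_atBot (hK s hs) hK0 hb0 hKb' (hl s hs)
    have sh : ∀ s ∈ U, SqI fun x => V s x - b := fun s hs =>
      (ric s hs).sqI_sub (hq.sqI s hs) (hK s hs) hb0 fun x => (est s hs x).2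
    have bh : ∀ s ∈ U, b ^ 2 * ∫ x, (V s x - b) ^ 2 ≤ ∫ x, q s x ^ 2 := fun s hs =>
      (ric s hs).integral_sub_sq_le (hq.sqI s hs) (hK s hs) hb0 (fun x => (est s hs x).2)
        (hl s hs) (hr s hs)
    have cons : ∫ x, (V t x - b) ^ 2 = ∫ x, (V t' x - b) ^ 2 := by
      have dq : ∀ s x, HasDerivAt (q s) (dx q s x) x := hq.sm.hasDerivAt_x
      have dq₁ : ∀ s x, HasDerivAt (dx q s) (dx (dx q) s x) x := hq.sm.dx.hasDerivAt_x
      have hVc : ContinuousOn (fun p : ℝ × ℝ => V p.2 p.1) (Set.univ ×ˢ U) := by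
        refine ContinuousOn.div ?_ ?_ fun p hp => (hpos p.2 hp.2 p.1).ne'
        · exact (hf.sm.dx.continuous.comp continuous_swap).continuousOn
        · exact (hf.sm.continuous.comp continuous_swap).continuousOn
      have swp : ∀ {k : ℝ → ℝ → ℝ}, Sm k →
          ContinuousOn (fun p : ℝ × ℝ => k p.2 p.1) (Set.univ ×ˢ U) := fun hk =>
        (hk.continuous.comp continuous_swap).continuousOn
      refine integral_eq_of_flux hUc (ρ := fun s x => (V s x - b) ^ 2)
        (ρ' := fun s x => 2 * (V s x - b) * (-dx (dx q) s x + 2 * dx q s x * V s x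
          + (2 * q s x - 4 * b ^ 2) * (q s x + b ^ 2 - V s x ^ 2)))
        (J := fun s x => q s x ^ 2 + 2 * q s x * (V s x - b) ^ 2 - 4 * b ^ 2 * (V s x - b) ^ 2
          - 2 * dx q s x * (V s x - b))
        (C := (K / b) ^ 2) (C' := (2 * K + 4 * b ^ 2 + 2) * C₀)
        (fun s hs => ((sh s hs).1.pow 2)) (fun s hs => (sh s hs).2) (fun s hs x => ?_)
        (fun s hs x => ?_) ?_ (fun s hs x => ?_) (fun s hs => ?_) (fun s hs => ?_) ht ht'
      · rw [abs_pow]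
        exact pow_le_pow_left₀ (abs_nonneg _) (est s hs x).1 2
      · have := ((hf.hasDerivAt_logDeriv hq.sm (hpos s hs x)).sub_const b).pow 2
        refine this.congr_deriv ?_
        simp [hV]
      · exact ((continuousOn_const.mul (hVc.sub continuousOn_const)).mul
          (((swp hq.sm.dx.dx).neg.add ((continuousOn_const.mul (swp hq.sm.dx)).mul hVc)).add
          (((continuousOn_const.mul (swp hq.sm)).sub continuousOn_const).mul
            (((swp hq.sm).add continuousOn_const).sub (hVc.pow 2)))))
      · have d1 := (ric s hs x).sub_const b
        have := ((((dq s x).pow 2).add (((dq s x).const_mul 2).mul (d1.pow 2))).sub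
          ((d1.pow 2).const_mul (4 * b ^ 2))).sub (((dq₁ s x).const_mul 2).mul d1)
        refine this.congr_deriv ?_
        simp only [Pi.pow_apply]
        push_cast
        ring
      · have h1 : Integrable fun x => q s x * ((V s x - b) * (V s x - b)) :=
          (sh s hs).int_bdd_mul (sh s hs) (hq.sm.cx s) (hK s hs)
        have h2 : Integrable fun x => dx q s x * (V s x - b) := (hq.sqI' s hs).mul_int (sh s hs)
        refine ((((hq.sqI s hs).2.add (h1.const_mul 2)).sub
          ((sh s hs).2.const_mul (4 * b ^ 2))).sub (h2.const_mul 2)).congr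
          (Eventually.of_forall fun x => ?_)
        simp only [Pi.add_apply, Pi.sub_apply]; ring
      · have i1 := (hq.sqI s hs).2
        have i2 := (hq.sqI' s hs).2
        have i3 : Integrable fun x => (2 * K + 4 * b ^ 2 + 1) * (V s x - b) ^ 2 :=
          (sh s hs).2.const_mul _
        have i4 : Integrable fun x => q s x ^ 2 + dx q s x ^ 2 := i1.add i2
        have : ∫ x, |q s x ^ 2 + 2 * q s x * (V s x - b) ^ 2 - 4 * b ^ 2 * (V s x - b) ^ 2
          - 2 * dx q s x * (V s x - b)| ≤ ∫ x, ((q s x ^ 2 + dx q s x ^ 2)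
            + (2 * K + 4 * b ^ 2 + 1) * (V s x - b) ^ 2) := by
          refine integral_mono_of_nonneg (Eventually.of_forall fun x => abs_nonneg _)
            (i4.add i3) (Eventually.of_forall fun x => ?_)
          obtain ⟨k1, k2⟩ := abs_le.1 (hK s hs x)
          have m1 := mul_nonneg (sub_nonneg.2 k2) (sq_nonneg (V s x - b))
          have m2 := mul_nonneg (sub_nonneg.2 k1) (sq_nonneg (V s x - b))
          have m3 := mul_nonneg (sq_nonneg b) (sq_nonneg (V s x - b))
          have m4 := sq_nonneg (dx q s x - (V s x - b))
          have m5 := sq_nonneg (dx q s x + (V s x - b))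
          have m6 := sq_nonneg (q s x)
          simp only
          rw [abs_le]
          constructor <;> linarith
        refine this.trans ?_
        rw [integral_add i4 i3, integral_add i1 i2, integral_const_mul]
        have n1 := hC₀ s hs
        have n2 := bh s hs
        have n3 := SqI.integral_nonneg (q s)
        have n4 := SqI.integral_nonneg (dx q s)
        have n5 := SqI.integral_nonneg fun x => V s x - b
        have n6 : ∫ x, (V s x - b) ^ 2 ≤ b ^ 2 * ∫ x, (V s x - b) ^ 2 :=
          le_mul_of_one_le_left n5 (by nlinarith)
        have n7 : ∫ x, (V s x - b) ^ 2 ≤ C₀ := by linarith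
        have n8 := mul_le_mul_of_nonneg_left n7 (show 0 ≤ 2 * K + 4 * b ^ 2 + 1 by positivity)
        linarith
    have a1 := (ric t ht).abs_jost_sub_le (hq.sqI t ht) (hq.sqI' t ht) (hq₂ t ht)
      (hq.sm.hasDerivAt_x t) (hq.sm.dx.hasDerivAt_x t) (hK t ht) hK0 hb1 hKb (hl t ht) (hr t ht)
    have a2 := (ric t' ht').abs_jost_sub_le (hq.sqI t' ht') (hq.sqI' t' ht') (hq₂ t' ht')
      (hq.sm.hasDerivAt_x t') (hq.sm.dx.hasDerivAt_x t') (hK t' ht') hK0 hb1 hKb (hl t' ht')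
      (hr t' ht')
    rw [cons] at a1
    rw [add_div]
    have a1' := abs_le.1 a1
    have a2' := abs_le.1 a2
    simp only [hR]
    rw [abs_le]
    constructor <;> linarith
  have := eq_zero_of_abs_sq_mul_sub_le main
  exact ⟨by linarith [this.1], by linarith [this.2]⟩

/-- The squared `H¹` norm at time `t`. -/
noncomputable def h1sq (q : ℝ → ℝ → ℝ) (t : ℝ) : ℝ := (∫ x, q t x ^ 2) + ∫ x, dx q t x ^ 2

/-- The KdV energy at time `t`. -/
noncomputable def energy (q : ℝ → ℝ → ℝ) (t : ℝ) : ℝ := ∫ x, (dx q t x ^ 2 + 2 * q t x ^ 3)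

/-- A KdV solution which is in `H²` for each time. -/
structure SliceSol (q : ℝ → ℝ → ℝ) : Prop where
  sm : Sm q
  kdv : KdV q
  sqI : ∀ t, SqI (q t)
  sqI' : ∀ t, SqI (dx q t)
  sqI'' : ∀ t, SqI (dx (dx q) t)

namespace SliceSol

variable {q : ℝ → ℝ → ℝ}

theorem abs_le_sqrt (h : SliceSol q) (t x : ℝ) : |q t x| ≤ √(h1sq q t) :=
  Real.abs_le_sqrt ((h.sqI t).sq_le (h.sqI' t) (h.sm.hasDerivAt_x t) x)

theorem abs_cubic_le (h : SliceSol q) (t : ℝ) :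
    |∫ x, q t x ^ 3| ≤ √(h1sq q t) * ∫ x, q t x ^ 2 := by
  rw [← integral_const_mul, ← Real.norm_eq_abs]
  refine norm_integral_le_of_norm_le ((h.sqI t).2.const_mul _) (Eventually.of_forall fun x => ?_)
  rw [Real.norm_eq_abs, pow_succ', abs_mul, abs_of_nonneg (sq_nonneg (q t x))]
  exact mul_le_mul_of_nonneg_right (h.abs_le_sqrt t x) (sq_nonneg _)

theorem energy_eq (h : SliceSol q) (t : ℝ) :
    energy q t = (∫ x, dx q t x ^ 2) + 2 * ∫ x, q t x ^ 3 := by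
  have i : Integrable fun x => q t x ^ 3 :=
    ((h.sqI t).int_bdd_mul (h.sqI t) (h.sqI t).1 (h.abs_le_sqrt t)).congr
      (Eventually.of_forall fun x => by simp only; ring)
  rw [energy, integral_add (h.sqI' t).2 (i.const_mul 2), integral_const_mul]

theorem h1sq_le (h : SliceSol q) (t : ℝ) :
    h1sq q t ≤ 2 * (∫ x, q t x ^ 2) + 2 * energy q t + 4 * (∫ x, q t x ^ 2) ^ 2 := by
  have h1 := (abs_le.1 (h.abs_cubic_le t)).1
  have h2 := h.energy_eq t
  have n1 := SqI.integral_nonneg (q t)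
  have n2 := SqI.integral_nonneg (dx q t)
  have h3 : 0 ≤ h1sq q t := add_nonneg n1 n2
  have h4 := Real.sq_sqrt h3
  have h5 : h1sq q t = (∫ x, q t x ^ 2) + ∫ x, dx q t x ^ 2 := rfl
  nlinarith [sq_nonneg (√(h1sq q t) - 2 * ∫ x, q t x ^ 2)]

theorem energy_le (h : SliceSol q) {t n : ℝ} (hn : h1sq q t ≤ n) :
    (∫ x, q t x ^ 2) ≤ n ∧ energy q t ≤ n + 2 * (√n * n) := by
  have h1 := (abs_le.1 (h.abs_cubic_le t)).2
  have h2 := h.energy_eq t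
  have n1 := SqI.integral_nonneg (q t)
  have n2 := SqI.integral_nonneg (dx q t)
  have h5 : h1sq q t = (∫ x, q t x ^ 2) + ∫ x, dx q t x ^ 2 := rfl
  have h6 : ∫ x, q t x ^ 2 ≤ n := by linarith
  have h7 := mul_le_mul (Real.sqrt_le_sqrt hn) h6 n1 (Real.sqrt_nonneg n)
  exact ⟨h6, by linarith⟩

theorem isClosed_h1sq_le (h : SliceSol q) (n : ℝ) : IsClosed {t | h1sq q t ≤ n} := by
  have hc : Continuous (Function.uncurry fun t x => q t x ^ 2 + dx q t x ^ 2) :=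
    (h.sm.continuous.pow 2).add (h.sm.dx.continuous.pow 2)
  have hi : ∀ t, Integrable fun x => q t x ^ 2 + dx q t x ^ 2 := fun t =>
    (h.sqI t).2.add (h.sqI' t).2
  have e1 : ∀ t, h1sq q t = ∫ x, (q t x ^ 2 + dx q t x ^ 2) := fun t =>
    (integral_add (h.sqI t).2 (h.sqI' t).2).symm
  have e2 : {t | h1sq q t ≤ n} =
      ⋂ R : {R : ℝ // 0 < R}, {t | ∫ x in (-R.1)..R.1, (q t x ^ 2 + dx q t x ^ 2) ≤ n} := by
    ext t
    simp only [Set.mem_ofPred_eq, Set.mem_iInter, Subtype.forall, e1]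
    constructor
    · intro ht R hR
      refine le_trans ?_ ht
      rw [intervalIntegral.integral_of_le (by linarith)]
      exact setIntegral_le_integral (hi t) (Eventually.of_forall fun x => by positivity)
    · intro ht
      exact (integrable_of_interval_bound (by
        exact hc.comp (Continuous.prodMk_right t)) (fun x => by positivity) ht).2
  rw [e2]
  exact isClosed_iInter fun R => isClosed_le
    (intervalIntegral.continuous_parametric_intervalIntegral_of_continuous' hc _ _)
    continuous_const

theorem solOn (h : SliceSol q) {U : Set ℝ} {C : ℝ} (hC : ∀ t ∈ U, h1sq q t ≤ C) : SolOn U q :=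
  ⟨h.sm, h.kdv, fun t _ => h.sqI t, fun t _ => h.sqI' t, C, hC⟩

theorem uIcc_subset_closure_interior {s t : ℝ} (h : s ≠ t) :
    Set.uIcc s t ⊆ closure (interior (Set.uIcc s t)) := by
  unfold Set.uIcc
  rw [interior_Icc, closure_Ioo]
  rcases lt_or_gt_of_ne h with h | h <;> simp [h.ne, h.le]

theorem conserved_uIcc (h : SliceSol q) {s t C : ℝ} (hC : ∀ r ∈ Set.uIcc s t, h1sq q r ≤ C) :
    ∫ x, q s x ^ 2 = ∫ x, q t x ^ 2 ∧ energy q s = energy q t := by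
  by_cases hst : s = t
  · subst hst; exact ⟨rfl, rfl⟩
  · exact (h.solOn hC).conserved (uIcc_subset_closure_interior hst) Set.ordConnected_uIcc
      (fun r _ => h.sqI'' r) Set.left_mem_uIcc Set.right_mem_uIcc

theorem conserved_of_locally (h : SliceSol q) {s t : ℝ}
    (hG : ∀ r ∈ Set.uIcc s t, ∃ n : ℝ, ∀ᶠ r' in nhds r, h1sq q r' ≤ n) :
    ∫ x, q s x ^ 2 = ∫ x, q t x ^ 2 ∧ energy q s = energy q t := by
  obtain ⟨C, hC⟩ : ∃ C, ∀ r ∈ Set.uIcc s t, h1sq q r ≤ C := by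
    refine isCompact_uIcc.induction_on (p := fun S => ∃ C, ∀ r ∈ S, h1sq q r ≤ C)
      ⟨0, fun r hr => hr.elim⟩ (fun S T hST ⟨C, hC⟩ => ⟨C, fun r hr => hC r (hST hr)⟩)
      (fun S T ⟨C, hC⟩ ⟨C', hC'⟩ => ⟨max C C', fun r hr => ?_⟩) (fun r hr => ?_)
    · rcases hr with hr | hr
      · exact (hC r hr).trans (le_max_left _ _)
      · exact (hC' r hr).trans (le_max_right _ _)
    · obtain ⟨n, hn⟩ := hG r hr
      exact ⟨_, mem_nhdsWithin_of_mem_nhds hn, n, fun r' hr' => hr'⟩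
  exact h.conserved_uIcc hC

theorem h1sq_le_of_gap (h : SliceSol q) {s t n : ℝ} (hs : h1sq q s ≤ n)
    (hG : ∀ r ∈ Set.uIcc s t, r ≠ s → ∃ n : ℝ, ∀ᶠ r' in nhds r, h1sq q r' ≤ n) :
    h1sq q t ≤ 2 * n + 2 * (n + 2 * (√n * n)) + 4 * n ^ 2 := by
  have h1 : ∀ r ∈ Set.uIcc s t, r ≠ s →
      ∫ x, q r x ^ 2 = ∫ x, q t x ^ 2 ∧ energy q r = energy q t := by
    intro r hr hrs
    refine h.conserved_of_locally fun r' hr' => hG r' ?_ ?_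
    · exact Set.uIcc_subset_uIcc hr Set.right_mem_uIcc hr'
    · rintro rfl
      rcases Set.mem_uIcc.1 hr with ⟨a, b⟩ | ⟨a, b⟩ <;> rcases Set.mem_uIcc.1 hr' with ⟨c, d⟩ | ⟨c, d⟩
      · exact hrs (le_antisymm c a)
      · exact hrs (le_antisymm (by linarith) a)
      · exact hrs (le_antisymm b (by linarith))
      · exact hrs (le_antisymm b d)
  obtain ⟨e1, e2⟩ := h.conserved_uIcc (s := s) (t := t)
    (C := max n (2 * (∫ x, q t x ^ 2) + 2 * energy q t + 4 * (∫ x, q t x ^ 2) ^ 2)) fun r hr => by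
      by_cases hrs : r = s
      · rw [hrs]; exact hs.trans (le_max_left _ _)
      · refine le_trans ?_ (le_max_right _ _)
        have := h.h1sq_le r
        rwa [(h1 r hr hrs).1, (h1 r hr hrs).2] at this
  have h2 := h.h1sq_le t
  rw [← e1, ← e2] at h2
  obtain ⟨h3, h4⟩ := h.energy_le hs
  have := pow_le_pow_left₀ (SqI.integral_nonneg (q s)) h3 2
  linarith

/-- A KdV solution in `H²` for each time is bounded in `H¹` uniformly in time. -/
theorem solOn_univ (h : SliceSol q) : SolOn Set.univ q := by
  set G : Set ℝ := {t | ∃ n : ℝ, ∀ᶠ s in nhds t, h1sq q s ≤ n} with hG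
  have hGo : IsOpen G := by
    rw [isOpen_iff_mem_nhds]
    rintro t ⟨n, hn⟩
    exact (eventually_eventually_nhds.2 hn).mono fun s hs => ⟨n, hs⟩
  have hGu : G = Set.univ := by
    by_contra hne
    have hB : (Gᶜ).Nonempty := Set.nonempty_compl.2 hne
    have hBc : IsClosed Gᶜ := hGo.isClosed_compl
    have : Nonempty ↥Gᶜ := hB.to_subtype
    have : CompleteSpace ↥Gᶜ := hBc.completeSpace_coe
    obtain ⟨n, ⟨t₀, hBt⟩, h_integral⟩ := nonempty_interior_of_iUnion_of_closed
      (f := fun n : ℕ => {t : ↥Gᶜ | h1sq q t ≤ n})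
      (fun n => (h.isClosed_h1sq_le n).preimage continuous_subtype_val) (by
        ext t
        simp only [Set.mem_iUnion, Set.mem_ofPred_eq, Set.mem_univ, iff_true]
        exact exists_nat_ge _)
    rw [mem_interior_iff_mem_nhds, Metric.mem_nhds_iff] at h_integral
    obtain ⟨ε, hε, hball⟩ := h_integral
    have hn : ∀ s ∈ Gᶜ, |s - t₀| < ε → h1sq q s ≤ n := fun s hs hst =>
      hball (show (⟨s, hs⟩ : ↥Gᶜ) ∈ Metric.ball ⟨t₀, hBt⟩ ε from hst)
    refine hBt ⟨2 * n + 2 * (n + 2 * (√n * n)) + 4 * (n : ℝ) ^ 2, ?_⟩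
    filter_upwards [Metric.ball_mem_nhds t₀ hε] with t ht
    have ht' : |t - t₀| < ε := ht
    rw [abs_lt] at ht'
    rcases le_total t t₀ with htt | htt
    · have hcl : IsClosed (Gᶜ ∩ Set.Icc t t₀) := hBc.inter isClosed_Icc
      have hm := hcl.csInf_mem ⟨t₀, hBt, htt, le_rfl⟩ ⟨t, fun s hs => hs.2.1⟩
      refine h.h1sq_le_of_gap (s := sInf (Gᶜ ∩ Set.Icc t t₀)) (hn _ hm.1 ?_) fun r hr hrs => ?_
      · have := hm.2.1
        have := hm.2.2
        rw [abs_lt]; constructor <;> linarith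
      · rw [Set.uIcc_of_ge hm.2.1] at hr
        by_contra hrG
        exact hrs (le_antisymm hr.2 (csInf_le ⟨t, fun s hs => hs.2.1⟩
          ⟨hrG, hr.1, hr.2.trans hm.2.2⟩))
    · have hcl : IsClosed (Gᶜ ∩ Set.Icc t₀ t) := hBc.inter isClosed_Icc
      have hm := hcl.csSup_mem ⟨t₀, hBt, le_rfl, htt⟩ ⟨t, fun s hs => hs.2.2⟩
      refine h.h1sq_le_of_gap (s := sSup (Gᶜ ∩ Set.Icc t₀ t)) (hn _ hm.1 ?_) fun r hr hrs => ?_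
      · have := hm.2.1
        have := hm.2.2
        rw [abs_lt]; constructor <;> linarith
      · rw [Set.uIcc_of_le hm.2.2] at hr
        by_contra hrG
        exact hrs (le_antisymm (le_csSup ⟨t, fun s hs => hs.2.2⟩
          ⟨hrG, hm.2.1.trans hr.1, hr.2⟩) hr.1)
  refine h.solOn (C := 2 * (∫ x, q 0 x ^ 2) + 2 * energy q 0 + 4 * (∫ x, q 0 x ^ 2) ^ 2)
    fun t _ => ?_
  have h1 := h.conserved_of_locally (s := t) (t := 0) fun r _ => by
    have : r ∈ G := hGu ▸ Set.mem_univ r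
    exact this
  rw [← h1.1, ← h1.2]
  exact h.h1sq_le t

theorem integral_sq_eq (h : SliceSol q) (s t : ℝ) : ∫ x, q s x ^ 2 = ∫ x, q t x ^ 2 := by
  obtain ⟨C, hC⟩ := h.solOn_univ.bdd
  exact (h.conserved_uIcc fun r _ => hC r (Set.mem_univ r)).1

end SliceSol

/-- The localized `L²` identity for KdV. -/
theorem hasDerivAt_weighted_mass {w : ℝ → ℝ → ℝ} (hw : Sm w) (hk : KdV w) {Θ Θt : ℝ → ℝ → ℝ}
    {Θ₁ Θ₂ Θ₃ : ℝ → ℝ} {t R : ℝ} (hc : Continuous (Function.uncurry Θ))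
    (hct : Continuous (Function.uncurry Θt)) (ht : ∀ t x, HasDerivAt (fun t => Θ t x) (Θt t x) t)
    (h1 : ∀ x, HasDerivAt (Θ t) (Θ₁ x) x) (h2 : ∀ x, HasDerivAt Θ₁ (Θ₂ x) x)
    (h3 : ∀ x, HasDerivAt Θ₂ (Θ₃ x) x) (hc3 : Continuous Θ₃)
    (z0 : Θ t R = 0 ∧ Θ t (-R) = 0) (z1 : Θ₁ R = 0 ∧ Θ₁ (-R) = 0) (z2 : Θ₂ R = 0 ∧ Θ₂ (-R) = 0) :
    HasDerivAt (fun t => ∫ x in (-R)..R, w t x ^ 2 * Θ t x)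
      (∫ x in (-R)..R, (w t x ^ 2 * (Θt t x + Θ₃ x) - 3 * dx w t x ^ 2 * Θ₁ x
        - 4 * w t x ^ 3 * Θ₁ x)) t := by
  have swp : ∀ {k : ℝ → ℝ → ℝ}, Continuous (Function.uncurry k) →
      Continuous (fun p : ℝ × ℝ => k p.2 p.1) := fun hk => hk.comp continuous_swap
  have cF' : Continuous (Function.uncurry fun x t => 2 * w t x * dt w t x * Θ t x
      + w t x ^ 2 * Θt t x) :=
    (((continuous_const.mul (swp hw.continuous)).mul (swp hw.dt.continuous)).mul (swp hc)).add
      (((swp hw.continuous).pow 2).mul (swp hct))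
  have key := hasDerivAt_intervalIntegral_param (F := fun x t => w t x ^ 2 * Θ t x) cF'
    (fun x t => by
      have := ((hw.hasDerivAt_t t x).pow 2).mul (ht t x)
      refine this.congr_deriv ?_
      simp) (fun t => ((hw.cx t).pow 2).mul (by exact hc.comp (Continuous.prodMk_right t))) (-R) R t
  refine key.congr_deriv ?_
  have d0 := hw.hasDerivAt_x t
  have d1 := hw.dx.hasDerivAt_x t
  have d2 := hw.dx.dx.hasDerivAt_x t
  have cΘ : Continuous (Θ t) := hc.comp (Continuous.prodMk_right t)
  have cΘt : Continuous (Θt t) := hct.comp (Continuous.prodMk_right t)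
  have cΘ₁ : Continuous Θ₁ := continuous_iff_continuousAt.2 fun x => (h2 x).continuousAt
  have cΘ₂ : Continuous Θ₂ := continuous_iff_continuousAt.2 fun x => (h3 x).continuousAt
  have cw := hw.cx t
  have cw₁ := hw.dx.cx t
  have cw₂ := hw.dx.dx.cx t
  have cw₃ := hw.dx.dx.dx.cx t
  have cwt := hw.dt.cx t
  have ftc := intervalIntegral.integral_eq_sub_of_hasDerivAt (a := -R) (b := R)
    (f := fun x => 4 * w t x ^ 3 * Θ t x - 2 * (w t x * dx (dx w) t x) * Θ t x
      + dx w t x ^ 2 * Θ t x + 2 * (w t x * dx w t x) * Θ₁ x - w t x ^ 2 * Θ₂ x)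
    (f' := fun x => 2 * w t x * dt w t x * Θ t x + 4 * w t x ^ 3 * Θ₁ x
      + 3 * dx w t x ^ 2 * Θ₁ x - w t x ^ 2 * Θ₃ x) (fun x _ => by
      have := (((((((d0 x).pow 3).const_mul 4).mul (h1 x)).sub
        ((((d0 x).mul (d2 x)).const_mul 2).mul (h1 x))).add (((d1 x).pow 2).mul (h1 x))).add
        ((((d0 x).mul (d1 x)).const_mul 2).mul (h2 x))).sub (((d0 x).pow 2).mul (h3 x))
      refine this.congr_deriv ?_
      rw [hk]
      simp only [Pi.pow_apply, Pi.mul_apply]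
      push_cast
      ring) (by apply Continuous.intervalIntegrable; fun_prop)
  simp only [z0.1, z0.2, z1.1, z1.2, z2.1, z2.2, mul_zero, sub_zero, add_zero] at ftc
  have j1 : IntervalIntegrable (fun x => 2 * w t x * dt w t x * Θ t x + w t x ^ 2 * Θt t x)
      volume (-R) R := by apply Continuous.intervalIntegrable; fun_prop
  have j2 : IntervalIntegrable (fun x => w t x ^ 2 * (Θt t x + Θ₃ x) - 3 * dx w t x ^ 2 * Θ₁ x
      - 4 * w t x ^ 3 * Θ₁ x) volume (-R) R := by apply Continuous.intervalIntegrable; fun_prop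
  rw [← sub_eq_zero, ← intervalIntegral.integral_sub j1 j2, ← ftc]
  congr 1; ext x
  ring

/-- The logistic step of steepness `κ`. -/
noncomputable def step (κ x : ℝ) : ℝ := (1 + exp (-(κ * x)))⁻¹

theorem step_pos (κ x : ℝ) : 0 < step κ x := inv_pos.2 (by positivity)

theorem step_lt_one (κ x : ℝ) : step κ x < 1 :=
  inv_lt_one_of_one_lt₀ (by linarith [exp_pos (-(κ * x))])

theorem hasDerivAt_step (κ x : ℝ) :
    HasDerivAt (step κ) (κ * step κ x * (1 - step κ x)) x := by
  have h1 : HasDerivAt (fun x => 1 + exp (-(κ * x))) (exp (-(κ * x)) * -(κ * 1)) x :=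
    (((hasDerivAt_id x).const_mul κ).neg.exp).const_add 1
  refine (h1.inv (by positivity)).congr_deriv ?_
  unfold step
  have : 1 + exp (-(κ * x)) ≠ 0 := by positivity
  field_simp
  ring

theorem continuous_step (κ : ℝ) : Continuous (step κ) :=
  continuous_iff_continuousAt.2 fun x => (hasDerivAt_step κ x).continuousAt

theorem abs_cutoff_le {p r : ℝ} (hp : |p| ≤ 1) (hr : 0 ≤ r) (hr1 : r ≤ 1) :
    (0 ≤ (1 - p ^ 2) ^ 3 ∧ (1 - p ^ 2) ^ 3 ≤ 1) ∧ |r * (-6 * p + 12 * p ^ 3 - 6 * p ^ 5)| ≤ 24 * r ∧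
      |r ^ 2 * (-6 + 36 * p ^ 2 - 30 * p ^ 4)| ≤ 72 * r ∧ |r ^ 3 * (72 * p - 120 * p ^ 3)| ≤ 192 * r := by
  have hk : ∀ k : ℕ, |p ^ k| ≤ 1 := fun k => by
    rw [abs_pow]; exact pow_le_one₀ (abs_nonneg _) hp
  have h1 := abs_le.1 hp
  have h2 := abs_le.1 (hk 2)
  have h3 := abs_le.1 (hk 3)
  have h4 := abs_le.1 (hk 4)
  have h5 := abs_le.1 (hk 5)
  have r2 : r ^ 2 ≤ r := by nlinarith
  have r3 : r ^ 3 ≤ r := by nlinarith [mul_nonneg hr hr]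
  refine ⟨⟨pow_nonneg (by linarith) 3, pow_le_one₀ (by linarith) (by nlinarith [sq_nonneg p])⟩,
    ?_, ?_, ?_⟩
  · rw [abs_mul, abs_of_nonneg hr, mul_comm]
    exact mul_le_mul_of_nonneg_right (abs_le.2 ⟨by linarith, by linarith⟩) hr
  · rw [abs_mul, abs_of_nonneg (by positivity), mul_comm]
    exact mul_le_mul (abs_le.2 ⟨by linarith, by linarith⟩) r2 (by positivity) (by norm_num)
  · rw [abs_mul, abs_of_nonneg (by positivity), mul_comm]
    exact mul_le_mul (abs_le.2 ⟨by linarith, by linarith⟩) r3 (by positivity) (by norm_num)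

/-- Pointwise bound for the derivative of the localized mass. -/
theorem weighted_density_le {κ a K r s χ χ₁ χ₂ χ₃ w w₁ : ℝ} (hκ : 0 < κ) (hκ1 : κ ≤ 1)
    (hr : 0 ≤ r) (hs : 0 < s) (hs1 : s < 1) (hχ : 0 ≤ χ)
    (h1 : |χ₁| ≤ 24 * r) (h2 : |χ₂| ≤ 72 * r) (h3 : |χ₃| ≤ 192 * r) (hw : |w| ≤ K) :
    w ^ 2 * (-a * (κ * s * (1 - s)) * χ + (κ ^ 3 * s * (1 - s) * (1 - 6 * s + 6 * s ^ 2) * χ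
        + 3 * (κ ^ 2 * s * (1 - s) * (1 - 2 * s)) * χ₁ + 3 * (κ * s * (1 - s)) * χ₂ + s * χ₃))
      - 3 * w₁ ^ 2 * (κ * s * (1 - s) * χ + s * χ₁) - 4 * w ^ 3 * (κ * s * (1 - s) * χ + s * χ₁)
    ≤ -(a - κ ^ 2) * (w ^ 2 * (κ * s * (1 - s) * χ)) - 3 * (w₁ ^ 2 * (κ * s * (1 - s) * χ))
      + 4 * (|w| * (w ^ 2 * (κ * s * (1 - s) * χ))) + r * (1000 + 96 * K) * (w ^ 2 + w₁ ^ 2) := by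
  have hs' : 0 < 1 - s := by linarith
  have hss : 0 < s * (1 - s) := mul_pos hs hs'
  have hss1 : s * (1 - s) ≤ 1 := by nlinarith
  have hK : 0 ≤ K := (abs_nonneg _).trans hw
  have hω : 0 ≤ κ * s * (1 - s) * χ := by positivity
  have b1 : κ ^ 3 * s * (1 - s) * (1 - 6 * s + 6 * s ^ 2) * χ ≤ κ ^ 2 * (κ * s * (1 - s) * χ) := by
    have : 1 - 6 * s + 6 * s ^ 2 ≤ 1 := by nlinarith
    have := mul_le_mul_of_nonneg_left this (show 0 ≤ κ ^ 2 * (κ * s * (1 - s) * χ) by positivity)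
    linarith
  have hκ2 : κ ^ 2 ≤ 1 := pow_le_one₀ hκ.le hκ1
  have c1 : |κ ^ 2 * s * (1 - s) * (1 - 2 * s)| ≤ 1 := by
    rw [show κ ^ 2 * s * (1 - s) * (1 - 2 * s) = κ ^ 2 * (s * (1 - s)) * (1 - 2 * s) by ring,
      abs_mul, abs_of_pos (by positivity)]
    exact mul_le_one₀ (mul_le_one₀ hκ2 hss.le hss1) (abs_nonneg _) (abs_le.2 ⟨by linarith, by linarith⟩)
  have c2 : |κ * s * (1 - s)| ≤ 1 := by
    rw [abs_of_pos (by positivity), mul_assoc]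
    exact mul_le_one₀ hκ1 hss.le hss1
  have m : ∀ {x y z : ℝ}, |x| ≤ 1 → |y| ≤ z → |x * y| ≤ z := fun {x y z} hx hy => by
    rw [abs_mul]
    exact (mul_le_of_le_one_left (abs_nonneg _) hx).trans hy
  have b2 := (abs_le.1 (m c1 h1)).2
  have b3 := (abs_le.1 (m c2 h2)).2
  have hs1' : |s| ≤ 1 := abs_le.2 ⟨by linarith, hs1.le⟩
  have b4 := (abs_le.1 (m hs1' h3)).2
  have b5 := m hs1' h1
  have d1 : κ ^ 3 * s * (1 - s) * (1 - 6 * s + 6 * s ^ 2) * χ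
        + 3 * (κ ^ 2 * s * (1 - s) * (1 - 2 * s)) * χ₁ + 3 * (κ * s * (1 - s)) * χ₂ + s * χ₃
      ≤ κ ^ 2 * (κ * s * (1 - s) * χ) + 1000 * r - 480 * r := by linarith
  have d2 := mul_le_mul_of_nonneg_left d1 (sq_nonneg w)
  have d3 := mul_le_mul_of_nonneg_left (abs_le.1 b5).1 (show 0 ≤ 3 * w₁ ^ 2 by positivity)
  have d4 : -(4 * w ^ 3 * (κ * s * (1 - s) * χ)) ≤ 4 * (|w| * (w ^ 2 * (κ * s * (1 - s) * χ))) := by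
    have := mul_le_mul_of_nonneg_right (neg_abs_le w) (mul_nonneg (sq_nonneg w) hω)
    linarith
  have d5 : -(4 * w ^ 3 * (s * χ₁)) ≤ 4 * (K * w ^ 2 * (24 * r)) := by
    have : |w * w ^ 2 * (s * χ₁)| ≤ K * w ^ 2 * (24 * r) := by
      rw [abs_mul, abs_mul, abs_of_nonneg (sq_nonneg w)]
      gcongr
    linarith [(abs_le.1 this).1]
  have e1 : 0 ≤ r * (1000 + 96 * K) * w₁ ^ 2 - 72 * r * w₁ ^ 2 := by
    have : 0 ≤ r * (928 + 96 * K) * w₁ ^ 2 := by positivity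
    linarith
  have e2 : 0 ≤ r * w ^ 2 := by positivity
  linarith

theorem cubic_weight_le {w ω S m : ℝ} (hω : 0 ≤ ω) (hm : 0 < m) (hS : w ^ 2 * ω ≤ S) :
    |w| * (w ^ 2 * ω) ≤ w ^ 2 * S / (2 * m) + m / 2 * (w ^ 2 * ω) := by
  have hS0 : 0 ≤ S := (by positivity : 0 ≤ w ^ 2 * ω).trans hS
  have h1 : |w| * ω ≤ (S / m + m * ω) / 2 := by
    refine abs_le_of_sq_le_sq' ?_ (by positivity) |>.2
    have h2 : (|w| * ω) ^ 2 ≤ S * ω := by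
      rw [mul_pow, sq_abs]; nlinarith
    have h3 : 0 ≤ (S / m - m * ω) ^ 2 := sq_nonneg _
    have h4 : S / m * (m * ω) = S * ω := by field_simp
    nlinarith
  have := mul_le_mul_of_nonneg_left h1 (sq_nonneg w)
  calc |w| * (w ^ 2 * ω) = w ^ 2 * (|w| * ω) := by ring
    _ ≤ _ := this
    _ = _ := by field_simp

set_option maxHeartbeats 1000000 in
theorem weighted_integral_le {κ a K r R y m H : ℝ} {w w₁ : ℝ → ℝ} (hκ : 0 < κ) (hκ1 : κ ≤ 1)
    (hm : 0 < m) (ha : κ ^ 2 + 2 * m * (2 + κ) ≤ a) (hm1 : m ≤ 1) (hR : 1 ≤ R) (hr : r = 1 / R)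
    (hw : SqI w) (hw₁ : SqI w₁) (hd : ∀ x, HasDerivAt w (w₁ x) x) (hK : ∀ x, |w x| ≤ K)
    (hM : ∫ x, w x ^ 2 ≤ m ^ 2) (hH : (∫ x, w x ^ 2) + ∫ x, w₁ x ^ 2 ≤ H) :
    ∫ x in (-R)..R, (w x ^ 2 * (-a * (κ * step κ (x - y) * (1 - step κ (x - y)))
        * (1 - (r * x) ^ 2) ^ 3 + (κ ^ 3 * step κ (x - y) * (1 - step κ (x - y))
          * (1 - 6 * step κ (x - y) + 6 * step κ (x - y) ^ 2) * (1 - (r * x) ^ 2) ^ 3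
        + 3 * (κ ^ 2 * step κ (x - y) * (1 - step κ (x - y)) * (1 - 2 * step κ (x - y)))
          * (r * (-6 * (r * x) + 12 * (r * x) ^ 3 - 6 * (r * x) ^ 5))
        + 3 * (κ * step κ (x - y) * (1 - step κ (x - y)))
          * (r ^ 2 * (-6 + 36 * (r * x) ^ 2 - 30 * (r * x) ^ 4))
        + step κ (x - y) * (r ^ 3 * (72 * (r * x) - 120 * (r * x) ^ 3))))
      - 3 * w₁ x ^ 2 * (κ * step κ (x - y) * (1 - step κ (x - y)) * (1 - (r * x) ^ 2) ^ 3
        + step κ (x - y) * (r * (-6 * (r * x) + 12 * (r * x) ^ 3 - 6 * (r * x) ^ 5)))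
      - 4 * w x ^ 3 * (κ * step κ (x - y) * (1 - step κ (x - y)) * (1 - (r * x) ^ 2) ^ 3
        + step κ (x - y) * (r * (-6 * (r * x) + 12 * (r * x) ^ 3 - 6 * (r * x) ^ 5))))
      ≤ (1048 + 96 * K) * H * r := by
  have hR0 : 0 < R := by linarith
  have hr0 : 0 < r := by rw [hr]; positivity
  have hr1 : r ≤ 1 := by rw [hr, div_le_one hR0]; exact hR
  have hrR : r * R = 1 := by rw [hr]; field_simp
  have hK0 : 0 ≤ K := (abs_nonneg _).trans (hK 0)
  have hp : ∀ x ∈ Set.Icc (-R) R, |r * x| ≤ 1 := fun x hx => by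
    rw [abs_mul, abs_of_pos hr0, ← hrR]
    exact mul_le_mul_of_nonneg_left (abs_le.2 hx) hr0.le
  have cw := hw.1
  have cw₁ := hw₁.1
  have cs : Continuous fun x => step κ (x - y) := (continuous_step κ).comp (by fun_prop)
  set s : ℝ → ℝ := fun x => step κ (x - y) with hs
  have s0 : ∀ x, 0 < s x := fun x => step_pos _ _
  have s1 : ∀ x, s x < 1 := fun x => step_lt_one _ _
  have ds : ∀ x, HasDerivAt s (κ * s x * (1 - s x)) x := fun x => by
    refine ((hasDerivAt_step κ (x - y)).comp x ((hasDerivAt_id x).sub_const y)).congr_deriv ?_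
    rw [mul_one]
  set ω : ℝ → ℝ := fun x => κ * s x * (1 - s x) * (1 - (r * x) ^ 2) ^ 3 with hω
  have cω : Continuous ω := by fun_prop
  have ω0 : ∀ x ∈ Set.Icc (-R) R, 0 ≤ ω x := fun x hx =>
    mul_nonneg (mul_nonneg (mul_pos hκ (s0 x)).le (by linarith [s1 x]))
      (abs_cutoff_le (hp x hx) hr0.le hr1).1.1
  have dω : ∀ x, HasDerivAt ω (κ ^ 2 * s x * (1 - s x) * (1 - 2 * s x) * (1 - (r * x) ^ 2) ^ 3
      + κ * s x * (1 - s x) * (r * (-6 * (r * x) + 12 * (r * x) ^ 3 - 6 * (r * x) ^ 5))) x := fun x => by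
    have := ((((ds x).const_mul κ).mul ((ds x).const_sub 1)).mul
      ((((((hasDerivAt_id x).const_mul r).pow 2).const_sub 1)).pow 3))
    refine this.congr_deriv ?_
    simp only [Pi.mul_apply, Pi.pow_apply, id]
    push_cast
    ring
  have hRR : -R ≤ R := by linarith
  have mono : ∀ {f g : ℝ → ℝ}, Continuous f → Continuous g → (∀ x ∈ Set.Icc (-R) R, f x ≤ g x) →
      ∫ x in (-R)..R, f x ≤ ∫ x in (-R)..R, g x := fun hf hg h =>
    intervalIntegral.integral_mono_on hRR (hf.intervalIntegrable _ _) (hg.intervalIntegrable _ _) h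
  set P := ∫ x in (-R)..R, w x ^ 2 * ω x with hP
  set D := ∫ x in (-R)..R, w₁ x ^ 2 * ω x with hD
  set N := ∫ x in (-R)..R, (w x ^ 2 + w₁ x ^ 2) with hN
  have P0 : 0 ≤ P := intervalIntegral.integral_nonneg hRR fun x hx =>
    mul_nonneg (sq_nonneg _) (ω0 x hx)
  have D0 : 0 ≤ D := intervalIntegral.integral_nonneg hRR fun x hx =>
    mul_nonneg (sq_nonneg _) (ω0 x hx)
  have N0 : 0 ≤ N := intervalIntegral.integral_nonneg hRR fun x hx => by positivity
  have NH : N ≤ H := by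
    refine le_trans ?_ hH
    rw [hN, intervalIntegral.integral_of_le hRR, ← integral_add hw.2 hw₁.2]
    exact setIntegral_le_integral (hw.2.add hw₁.2) (Eventually.of_forall fun x => by
      simp only [Pi.zero_apply]; positivity)
  have Mm : ∫ x in (-R)..R, w x ^ 2 ≤ m ^ 2 := by
    refine le_trans ?_ hM
    rw [intervalIntegral.integral_of_le hRR]
    exact hw.setIntegral_le _
  obtain ⟨S, hS⟩ : ∃ S, S = (1 + κ) * P + D + 24 * r * N := ⟨_, rfl⟩
  have S0 : 0 ≤ S := by rw [hS]; positivity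
  have hsup : ∀ x ∈ Set.Icc (-R) R, w x ^ 2 * ω x ≤ S := fun x hx => by
    have ftc := intervalIntegral.integral_eq_sub_of_hasDerivAt (a := -R) (b := x)
      (f := fun x => w x ^ 2 * ω x) (fun z _ => ((hd z).pow 2).mul (dω z))
      (by apply Continuous.intervalIntegrable; simp only [Pi.pow_apply]; fun_prop)
    have z : ω (-R) = 0 := by
      simp only [hω]; rw [mul_neg, hrR]; norm_num
    rw [z, mul_zero, sub_zero] at ftc
    rw [← ftc]
    set G : ℝ → ℝ := fun x => (1 + κ) * (w x ^ 2 * ω x) + w₁ x ^ 2 * ω x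
        + 24 * r * (w x ^ 2 + w₁ x ^ 2) with hG
    have cG : Continuous G := by fun_prop
    have i1 : ∫ z in (-R)..x, G z ≤ ∫ z in (-R)..R, G z := by
      refine intervalIntegral.integral_mono_interval le_rfl hx.1 hx.2 ?_
        (cG.intervalIntegrable _ _)
      refine (ae_restrict_mem measurableSet_Ioc).mono fun z hz => ?_
      have := ω0 z ⟨hz.1.le, hz.2⟩
      simp only [hG, Pi.zero_apply]
      positivity
    have i2 : ∫ z in (-R)..R, G z = S := by
      have k1 : IntervalIntegrable (fun x => (1 + κ) * (w x ^ 2 * ω x)) volume (-R) R := by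
        apply Continuous.intervalIntegrable; fun_prop
      have k2 : IntervalIntegrable (fun x => w₁ x ^ 2 * ω x) volume (-R) R := by
        apply Continuous.intervalIntegrable; fun_prop
      have k3 : IntervalIntegrable (fun x => 24 * r * (w x ^ 2 + w₁ x ^ 2)) volume (-R) R := by
        apply Continuous.intervalIntegrable; fun_prop
      rw [hG, intervalIntegral.integral_add (k1.add k2) k3, intervalIntegral.integral_add k1 k2,
        intervalIntegral.integral_const_mul, intervalIntegral.integral_const_mul, hS]
    rw [← i2]
    refine le_trans ?_ i1
    refine intervalIntegral.integral_mono_on hx.1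
      (by apply Continuous.intervalIntegrable; simp only [Pi.pow_apply]; fun_prop)
      (cG.intervalIntegrable _ _) fun z hz => ?_
    have hz' : z ∈ Set.Icc (-R) R := ⟨hz.1, hz.2.trans hx.2⟩
    obtain ⟨-, hc1, -, -⟩ := abs_cutoff_le (hp z hz') hr0.le hr1
    have w0 := ω0 z hz'
    have ss : 0 < s z * (1 - s z) := mul_pos (s0 z) (by linarith [s1 z])
    have ss1 : s z * (1 - s z) ≤ 1 := by nlinarith [sq_nonneg (s z), s0 z, s1 z]
    have a1 : κ ^ 2 * s z * (1 - s z) * (1 - 2 * s z) * (1 - (r * z) ^ 2) ^ 3 ≤ κ * ω z := by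
      have := mul_le_mul_of_nonneg_left (show 1 - 2 * s z ≤ 1 by linarith [s0 z])
        (mul_nonneg hκ.le w0)
      simp only [hω] at this ⊢
      linarith
    have a2 : κ * s z * (1 - s z) * (r * (-6 * (r * z) + 12 * (r * z) ^ 3 - 6 * (r * z) ^ 5))
        ≤ 24 * r := by
      refine (le_abs_self _).trans ?_
      rw [abs_mul, mul_assoc κ, abs_of_pos (mul_pos hκ ss)]
      exact (mul_le_of_le_one_left (abs_nonneg _) (mul_le_one₀ hκ1 ss.le ss1)).trans hc1
    have a3 := mul_le_mul_of_nonneg_left (add_le_add a1 a2) (sq_nonneg (w z))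
    have a4 := mul_nonneg (sq_nonneg (w z - w₁ z)) w0
    have a5 : 0 ≤ r * w₁ z ^ 2 := by positivity
    simp only [hG, Pi.pow_apply]
    push_cast
    nlinarith
  have hpt : ∀ x ∈ Set.Icc (-R) R, _ ≤ _ := fun x hx =>
    (weighted_density_le (κ := κ) (a := a) (K := K) (r := r) (s := s x) (w := w x) (w₁ := w₁ x)
      hκ hκ1 hr0.le (s0 x) (s1 x) (abs_cutoff_le (hp x hx) hr0.le hr1).1.1
      (abs_cutoff_le (hp x hx) hr0.le hr1).2.1 (abs_cutoff_le (hp x hx) hr0.le hr1).2.2.1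
      (abs_cutoff_le (hp x hx) hr0.le hr1).2.2.2 (hK x)).trans
    (add_le_add (add_le_add le_rfl (mul_le_mul_of_nonneg_left
      (cubic_weight_le (ω0 x hx) hm (hsup x hx)) (by norm_num : (0:ℝ) ≤ 4))) le_rfl)
  refine (mono (by fun_prop) (by fun_prop) hpt).trans ?_
  have e : ∀ x, -(a - κ ^ 2) * (w x ^ 2 * (κ * s x * (1 - s x) * (1 - (r * x) ^ 2) ^ 3))
      - 3 * (w₁ x ^ 2 * (κ * s x * (1 - s x) * (1 - (r * x) ^ 2) ^ 3))
      + 4 * (w x ^ 2 * S / (2 * m) + m / 2 * (w x ^ 2 * (κ * s x * (1 - s x) * (1 - (r * x) ^ 2) ^ 3)))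
      + r * (1000 + 96 * K) * (w x ^ 2 + w₁ x ^ 2) =
      ((-(a - κ ^ 2) + 2 * m) * (w x ^ 2 * ω x) + (-3) * (w₁ x ^ 2 * ω x))
        + ((2 * S / m) * w x ^ 2 + r * (1000 + 96 * K) * (w x ^ 2 + w₁ x ^ 2)) := fun x => by
    simp only [hω]; field_simp; ring
  have k1 : IntervalIntegrable (fun x => (-(a - κ ^ 2) + 2 * m) * (w x ^ 2 * ω x)) volume (-R) R := by
    apply Continuous.intervalIntegrable; fun_prop
  have k2 : IntervalIntegrable (fun x => (-3) * (w₁ x ^ 2 * ω x)) volume (-R) R := by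
    apply Continuous.intervalIntegrable; fun_prop
  have k3 : IntervalIntegrable (fun x => (2 * S / m) * w x ^ 2) volume (-R) R := by
    apply Continuous.intervalIntegrable; fun_prop
  have k4 : IntervalIntegrable (fun x => r * (1000 + 96 * K) * (w x ^ 2 + w₁ x ^ 2)) volume (-R) R := by
    apply Continuous.intervalIntegrable; fun_prop
  simp only [e]
  rw [intervalIntegral.integral_add (k1.add k2) (k3.add k4), intervalIntegral.integral_add k1 k2,
    intervalIntegral.integral_add k3 k4, intervalIntegral.integral_const_mul,
    intervalIntegral.integral_const_mul, intervalIntegral.integral_const_mul,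
    intervalIntegral.integral_const_mul]
  have f1 : 2 * S / m * ∫ x in (-R)..R, w x ^ 2 ≤ 2 * S * m := by
    have := mul_le_mul_of_nonneg_left Mm (show 0 ≤ 2 * S / m by positivity)
    rwa [show 2 * S / m * m ^ 2 = 2 * S * m by field_simp] at this
  have f2 : 2 * S * m = 2 * m * (1 + κ) * P + 2 * m * D + 48 * (m * (r * N)) := by rw [hS]; ring
  have f3 := mul_nonneg (sub_nonneg.2 ha) P0
  have f4 : 2 * m * D ≤ 2 * D := by nlinarith
  have f5 : m * (r * N) ≤ r * N := mul_le_of_le_one_left (by positivity) hm1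
  have f6 := mul_le_mul_of_nonneg_left NH (show 0 ≤ (1048 + 96 * K) * r by positivity)
  linarith

theorem abs_step_le (κ x : ℝ) : |step κ x| ≤ 1 :=
  abs_le.2 ⟨by linarith [step_pos κ x], (step_lt_one κ x).le⟩

/-- A truncated integral with cubic cutoff is squeezed by the full integral. -/
theorem integral_le_of_cutoff {F G : ℝ → ℝ} (hF : Integrable F) (hG : Integrable G)
    (hFc : Continuous F) (hGc : Continuous G)
    (hF0 : ∀ x, 0 ≤ F x) (hG0 : ∀ x, 0 ≤ G x) {C : ℝ}
    (h : ∀ R, 1 ≤ R → ∫ x in (-R)..R, F x * (1 - (1 / R * x) ^ 2) ^ 3 ≤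
      (∫ x in (-R)..R, G x * (1 - (1 / R * x) ^ 2) ^ 3) + C * (1 / R)) :
    ∫ x, F x ≤ ∫ x, G x := by
  have t1 := (((tendsto_integral_cutoff hF).const_mul 3).sub_const (2 * ∫ x, F x))
  have t2 : Tendsto (fun R : ℝ => (∫ x, G x) + C * (1 / R)) atTop (nhds (∫ x, G x)) := by
    have := (tendsto_inv_atTop_zero.const_mul C).const_add (∫ x, G x)
    simpa using this
  rw [show 3 * (∫ x, F x) - 2 * ∫ x, F x = ∫ x, F x by ring] at t1
  refine le_of_tendsto_of_tendsto t1 t2 ((eventually_ge_atTop 1).mono fun R hR => ?_)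
  have hRR : -R ≤ R := by linarith
  have hp : ∀ x ∈ Set.Icc (-R) R, (1 / R * x) ^ 2 ≤ 1 := fun x hx => by
    rw [sq_le_one_iff_abs_le_one, abs_mul, abs_of_pos (by positivity), one_div, inv_mul_le_iff₀ (by linarith),
      mul_one]
    exact abs_le.2 hx
  have a1 : ∫ x in (-R)..R, F x ≤ ∫ x, F x := by
    rw [intervalIntegral.integral_of_le hRR]
    exact setIntegral_le_integral hF (Eventually.of_forall hF0)
  have a2 : ∫ x in (-R)..R, G x ≤ ∫ x, G x := by
    rw [intervalIntegral.integral_of_le hRR]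
    exact setIntegral_le_integral hG (Eventually.of_forall hG0)
  have k1 : IntervalIntegrable (fun x => 3 * (F x * (1 - (x / R) ^ 2))) volume (-R) R := by
    apply Continuous.intervalIntegrable; fun_prop
  have k2 : IntervalIntegrable (fun x => 2 * F x) volume (-R) R := by
    apply Continuous.intervalIntegrable; fun_prop
  have k3 : IntervalIntegrable (fun x => F x * (1 - (1 / R * x) ^ 2) ^ 3) volume (-R) R := by
    apply Continuous.intervalIntegrable; fun_prop
  have k4 : IntervalIntegrable (fun x => G x * (1 - (1 / R * x) ^ 2) ^ 3) volume (-R) R := by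
    apply Continuous.intervalIntegrable; fun_prop
  have a3 : 3 * (∫ x in (-R)..R, F x * (1 - (x / R) ^ 2)) - 2 * (∫ x in (-R)..R, F x) ≤
      ∫ x in (-R)..R, F x * (1 - (1 / R * x) ^ 2) ^ 3 := by
    rw [← intervalIntegral.integral_const_mul, ← intervalIntegral.integral_const_mul,
      ← intervalIntegral.integral_sub k1 k2]
    refine intervalIntegral.integral_mono_on hRR (k1.sub k2) k3 fun x hx => ?_
    have h1 := hp x hx
    have h2 : 0 ≤ (1 - (1 / R * x) ^ 2) := by linarith
    have h3 : 3 * (1 - (1 / R * x) ^ 2) - 2 ≤ (1 - (1 / R * x) ^ 2) ^ 3 := by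
      nlinarith [mul_nonneg (sq_nonneg ((1 - (1 / R * x) ^ 2) - 1)) (by linarith : 0 ≤ (1 - (1 / R * x) ^ 2) + 2)]
    have h4 := mul_le_mul_of_nonneg_left h3 (hF0 x)
    rw [show x / R = 1 / R * x by ring]
    linarith
  have a4 : ∫ x in (-R)..R, G x * (1 - (1 / R * x) ^ 2) ^ 3 ≤ ∫ x in (-R)..R, G x := by
    refine intervalIntegral.integral_mono_on hRR k4 (hGc.intervalIntegrable _ _) fun x hx => ?_
    have h1 := hp x hx
    exact mul_le_of_le_one_right (hG0 x) (pow_le_one₀ (by linarith) (by linarith [sq_nonneg (1 / R * x)]))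
  have := h R hR
  linarith

/-- Almost monotonicity: mass to the right of a moving front does not increase. -/
theorem SolOn.weighted_mass_le {w : ℝ → ℝ → ℝ} (hw : SolOn Set.univ w) {κ a m y T : ℝ}
    (hκ : 0 < κ) (hκ1 : κ ≤ 1) (hm : 0 < m) (ha : κ ^ 2 + 2 * m * (2 + κ) ≤ a) (hm1 : m ≤ 1)
    (hM : ∀ t, ∫ x, w t x ^ 2 ≤ m ^ 2) (hT : 0 ≤ T) :
    ∫ x, w T x ^ 2 * step κ (x - (y + a * T)) ≤ ∫ x, w 0 x ^ 2 * step κ (x - y) := by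
  obtain ⟨K, hK0, hK⟩ := hw.exists_bound
  obtain ⟨H, hH⟩ := hw.bdd
  have hi : ∀ t z, Integrable fun x => w t x ^ 2 * step κ (x - z) := fun t z => by
    have cs : Continuous fun x => step κ (x - z) := (continuous_step κ).comp (by fun_prop)
    refine ((hw.sqI t (Set.mem_univ _)).int_bdd_mul (hw.sqI t (Set.mem_univ _)) cs
      fun x => abs_step_le _ _).congr (Eventually.of_forall fun x => ?_)
    simp only; ring
  have hcont : ∀ t z, Continuous fun x => w t x ^ 2 * step κ (x - z) := fun t z =>
    ((hw.sm.cx t).pow 2).mul ((continuous_step κ).comp (by fun_prop))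
  refine integral_le_of_cutoff (hi _ _) (hi _ _) (hcont _ _) (hcont _ _)
    (fun x => mul_nonneg (sq_nonneg _) (step_pos _ _).le)
    (fun x => mul_nonneg (sq_nonneg _) (step_pos _ _).le) (C := (1048 + 96 * K) * H * T)
    fun R hR => ?_
  obtain ⟨r, hr⟩ : ∃ r, r = 1 / R := ⟨_, rfl⟩
  have hrR : r * R = 1 := by rw [hr]; field_simp
  rw [← hr]
  have ds : ∀ t x, HasDerivAt (fun x => step κ (x - (y + a * t)))
      (κ * step κ (x - (y + a * t)) * (1 - step κ (x - (y + a * t)))) x := fun t x => by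
    refine ((hasDerivAt_step κ _).comp x ((hasDerivAt_id x).sub_const (y + a * t))).congr_deriv ?_
    rw [mul_one]; rfl
  have dst : ∀ t x, HasDerivAt (fun t => step κ (x - (y + a * t)))
      (-a * (κ * step κ (x - (y + a * t)) * (1 - step κ (x - (y + a * t))))) t := fun t x => by
    refine ((hasDerivAt_step κ _).comp t ((((hasDerivAt_id t).const_mul a).const_add y).const_sub
      x)).congr_deriv ?_
    rw [mul_one, mul_comm]; rfl
  have cs : Continuous fun p : ℝ × ℝ => step κ (p.2 - (y + a * p.1)) :=
    (continuous_step κ).comp (by fun_prop)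
  have csx : ∀ t, Continuous fun x : ℝ => step κ (x - (y + a * t)) := fun t =>
    (continuous_step κ).comp (by fun_prop)
  set χ : ℝ → ℝ := fun x => (1 - (r * x) ^ 2) ^ 3 with hχ
  set χ₁ : ℝ → ℝ := fun x => r * (-6 * (r * x) + 12 * (r * x) ^ 3 - 6 * (r * x) ^ 5) with hχ₁
  set χ₂ : ℝ → ℝ := fun x => r ^ 2 * (-6 + 36 * (r * x) ^ 2 - 30 * (r * x) ^ 4) with hχ₂
  set χ₃ : ℝ → ℝ := fun x => r ^ 3 * (72 * (r * x) - 120 * (r * x) ^ 3) with hχ₃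
  have dl : ∀ x : ℝ, HasDerivAt (fun x => r * x) (r * 1) x := fun x => (hasDerivAt_id x).const_mul r
  have dχ : ∀ x, HasDerivAt χ (χ₁ x) x := fun x => by
    refine ((((dl x).pow 2).const_sub 1).pow 3).congr_deriv ?_
    simp only [hχ₁, Pi.pow_apply]; push_cast; ring
  have dχ₁ : ∀ x, HasDerivAt χ₁ (χ₂ x) x := fun x => by
    refine ((((dl x).const_mul (-6)).add (((dl x).pow 3).const_mul 12)).sub
      (((dl x).pow 5).const_mul 6) |>.const_mul r).congr_deriv ?_
    simp only [hχ₂]; push_cast; ring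
  have dχ₂ : ∀ x, HasDerivAt χ₂ (χ₃ x) x := fun x => by
    refine (((((dl x).pow 2).const_mul 36).const_add (-6)).sub
      (((dl x).pow 4).const_mul 30) |>.const_mul (r ^ 2)).congr_deriv ?_
    simp only [hχ₃]; push_cast; ring
  have z0 : χ R = 0 ∧ χ (-R) = 0 := by simp only [hχ]; rw [mul_neg, hrR]; norm_num
  have z1 : χ₁ R = 0 ∧ χ₁ (-R) = 0 := by simp only [hχ₁]; rw [mul_neg, hrR]; norm_num
  have z2 : χ₂ R = 0 ∧ χ₂ (-R) = 0 := by simp only [hχ₂]; rw [mul_neg, hrR]; norm_num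
  have d0 := fun t => hasDerivAt_weighted_mass (R := R) (t := t) hw.sm hw.kdv
    (Θ := fun t x => step κ (x - (y + a * t)) * χ x)
    (Θt := fun t x => -a * (κ * step κ (x - (y + a * t)) * (1 - step κ (x - (y + a * t)))) * χ x)
    (Θ₁ := fun x => κ * step κ (x - (y + a * t)) * (1 - step κ (x - (y + a * t))) * χ x
      + step κ (x - (y + a * t)) * χ₁ x)
    (Θ₂ := fun x => κ ^ 2 * step κ (x - (y + a * t)) * (1 - step κ (x - (y + a * t)))
        * (1 - 2 * step κ (x - (y + a * t))) * χ x
      + 2 * (κ * step κ (x - (y + a * t)) * (1 - step κ (x - (y + a * t)))) * χ₁ x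
      + step κ (x - (y + a * t)) * χ₂ x)
    (Θ₃ := fun x => κ ^ 3 * step κ (x - (y + a * t)) * (1 - step κ (x - (y + a * t)))
        * (1 - 6 * step κ (x - (y + a * t)) + 6 * step κ (x - (y + a * t)) ^ 2) * χ x
      + 3 * (κ ^ 2 * step κ (x - (y + a * t)) * (1 - step κ (x - (y + a * t)))
        * (1 - 2 * step κ (x - (y + a * t)))) * χ₁ x
      + 3 * (κ * step κ (x - (y + a * t)) * (1 - step κ (x - (y + a * t)))) * χ₂ x
      + step κ (x - (y + a * t)) * χ₃ x)
    (by simp only [Function.uncurry_def]; fun_prop) (by simp only [Function.uncurry_def]; fun_prop)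
    (fun t x => (dst t x).mul_const _)
    (fun x => (ds t x).mul (dχ x))
    (fun x => by
      refine (((((ds t x).const_mul κ).mul ((ds t x).const_sub 1)).mul (dχ x)).add
        ((ds t x).mul (dχ₁ x))).congr_deriv ?_
      simp only [Pi.mul_apply]; ring)
    (fun x => by
      refine ((((((ds t x).const_mul (κ ^ 2)).mul ((ds t x).const_sub 1)).mul
        (((ds t x).const_mul 2).const_sub 1)).mul (dχ x)).add
        (((((ds t x).const_mul κ).mul ((ds t x).const_sub 1)).const_mul 2).mul (dχ₁ x)) |>.add
        ((ds t x).mul (dχ₂ x))).congr_deriv ?_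
      simp only [Pi.mul_apply]; ring)
    (by have := csx t; fun_prop)
    (by simp [z0]) (by simp [z0, z1]) (by simp [z0, z1, z2])
  set I : ℝ → ℝ := fun t => ∫ x in (-R)..R, w t x ^ 2 * (step κ (x - (y + a * t)) * χ x) with hI
  have anti : Antitone fun t => I t - (1048 + 96 * K) * H * r * t := by
    refine antitone_of_hasDerivAt_nonpos (fun t => (d0 t).sub ((hasDerivAt_id t).const_mul _))
      fun t => ?_
    have := weighted_integral_le (κ := κ) (a := a) (K := K) (r := r) (R := R) (y := y + a * t)
      (m := m) (H := H) hκ hκ1 hm ha hm1 hR hr (hw.sqI t (Set.mem_univ _))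
      (hw.sqI' t (Set.mem_univ _)) (hw.sm.hasDerivAt_x t) (hK t (Set.mem_univ _)) (hM t)
      (hH t (Set.mem_univ _))
    simp only [Pi.zero_apply, mul_one]
    simp only [hχ, hχ₁, hχ₂, hχ₃]
    linarith
  have := anti hT
  simp only [mul_zero, sub_zero, hI, add_zero] at this
  have e : ∀ t z x, w t x ^ 2 * step κ (x - z) * χ x = w t x ^ 2 * (step κ (x - z) * χ x) :=
    fun t z x => mul_assoc _ _ _
  simp only [hχ] at e this
  simp only [e]
  linarith

theorem tendsto_integral_mul_step {F : ℝ → ℝ} (hF : Integrable F) {κ : ℝ} (hκ : 0 < κ) :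
    Tendsto (fun y => ∫ x, F x * step κ (x - y)) atTop (nhds 0) := by
  have h := tendsto_integral_filter_of_dominated_convergence (μ := volume) (l := (atTop : Filter ℝ))
    (F := fun y x => F x * step κ (x - y)) (f := fun _ => 0) (fun x => |F x|)
    (Eventually.of_forall fun y => hF.aestronglyMeasurable.mul
      ((continuous_step κ).comp (by fun_prop : Continuous fun x => x - y)).aestronglyMeasurable)
    (Eventually.of_forall fun y => Eventually.of_forall fun x => by
      rw [Real.norm_eq_abs, abs_mul]
      exact mul_le_of_le_one_right (abs_nonneg _) (abs_step_le _ _)) hF.abs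
    (Eventually.of_forall fun x => by
      have t1 : Tendsto (fun y : ℝ => 1 + exp (-(κ * (x - y)))) atTop atTop := by
        refine tendsto_atTop_add_const_left _ _ (tendsto_exp_atTop.comp ?_)
        have : Tendsto (fun y => κ * y - κ * x) atTop atTop :=
          tendsto_atTop_add_const_right _ _ (tendsto_id.const_mul_atTop hκ)
        exact this.congr fun y => by ring
      simpa [step] using (tendsto_inv_atTop_zero.comp t1).const_mul (F x))
  simpa using h

theorem SolOn.tendsto_right_mass {w : ℝ → ℝ → ℝ} (hw : SolOn Set.univ w) {a₀ : ℝ} (ha₀ : 0 < a₀)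
    (hM : ∀ t, ∫ x, w t x ^ 2 ≤ (min 1 (a₀ / 12)) ^ 2) {a : ℝ} (ha : a₀ < a) :
    Tendsto (fun t => ∫ x in Set.Ioi (a * t), w t x ^ 2) atTop (nhds 0) := by
  obtain ⟨m, hm⟩ : ∃ m, m = min 1 (a₀ / 12) := ⟨_, rfl⟩
  have hm0 : 0 < m := by rw [hm]; exact lt_min one_pos (by linarith)
  have hm1 : m ≤ 1 := hm ▸ min_le_left _ _
  have hm2 : m ≤ a₀ / 12 := hm ▸ min_le_right _ _
  obtain ⟨κ, hκ⟩ : ∃ κ, κ = min 1 (a₀ / 2) := ⟨_, rfl⟩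
  have hκ0 : 0 < κ := by rw [hκ]; exact lt_min one_pos (by linarith)
  have hκ1 : κ ≤ 1 := hκ ▸ min_le_left _ _
  have hκ2 : κ ≤ a₀ / 2 := hκ ▸ min_le_right _ _
  have hκa : κ ^ 2 + 2 * m * (2 + κ) ≤ a₀ := by
    have h1 : κ ^ 2 ≤ κ := by nlinarith
    have h2 : m * κ ≤ m := mul_le_of_le_one_right hm0.le hκ1
    linarith
  rw [← hm] at hM
  have t1 := (tendsto_integral_mul_step (hw.sqI 0 (Set.mem_univ _)).2 hκ0).comp
    (tendsto_id.const_mul_atTop (sub_pos.2 ha))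
  have t2 := t1.const_mul 2
  rw [mul_zero] at t2
  refine squeeze_zero' (Eventually.of_forall fun t => setIntegral_nonneg measurableSet_Ioi
    fun x _ => sq_nonneg _) ((eventually_ge_atTop 0).mono fun t ht => ?_) t2
  have h1 := hw.weighted_mass_le (y := (a - a₀) * t) hκ0 hκ1 hm0 hκa hm1 hM ht
  rw [show (a - a₀) * t + a₀ * t = a * t by ring] at h1
  refine le_trans ?_ (mul_le_mul_of_nonneg_left h1 zero_le_two)
  have hs := hw.sqI t (Set.mem_univ t)
  have hi : Integrable fun x => 2 * (w t x ^ 2 * step κ (x - a * t)) := by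
    have cs : Continuous fun x => step κ (x - a * t) := (continuous_step κ).comp (by fun_prop)
    refine ((hs.int_bdd_mul hs cs fun x => abs_step_le _ _).const_mul 2).congr
      (Eventually.of_forall fun x => ?_)
    simp only; ring
  rw [← integral_const_mul]
  refine le_trans (setIntegral_mono_on hs.2.integrableOn hi.integrableOn measurableSet_Ioi
    fun x hx => ?_) (setIntegral_le_integral hi (Eventually.of_forall fun x => ?_))
  · have : 1 / 2 ≤ step κ (x - a * t) := by
      unfold step
      rw [one_div]
      refine inv_anti₀ (by positivity) ?_
      have : exp (-(κ * (x - a * t))) ≤ 1 := exp_le_one_iff.2 (by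
        have := mul_nonneg hκ0.le (sub_nonneg.2 (le_of_lt hx)); linarith)
      linarith
    nlinarith [mul_le_mul_of_nonneg_left this (sq_nonneg (w t x))]
  · have := step_pos κ (x - a * t)
    simp only [Pi.zero_apply]; positivity

theorem le_mul_exp_of_logDeriv_le {g v : ℝ → ℝ} (hg : ∀ x, HasDerivAt g (v x * g x) x)
    (h0 : ∀ x, 0 < g x) {k x₀ x₁ : ℝ} (hx : x₀ ≤ x₁) (hv : ∀ x ∈ Set.Icc x₀ x₁, v x ≤ k) :
    g x₁ ≤ g x₀ * exp (k * (x₁ - x₀)) := by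
  have hd : ∀ x, HasDerivAt (fun x => g x * exp (-(k * x))) ((v x - k) * (g x * exp (-(k * x)))) x :=
    fun x => by
      refine ((hg x).mul (((hasDerivAt_id x).const_mul k).neg.exp)).congr_deriv ?_
      simp only [id_eq, Pi.neg_apply]; ring
  have anti : AntitoneOn (fun x => g x * exp (-(k * x))) (Set.Icc x₀ x₁) :=
    antitoneOn_of_hasDerivWithinAt_nonpos (convex_Icc _ _)
      (fun x _ => (hd x).continuousAt.continuousWithinAt) (fun x _ => (hd x).hasDerivWithinAt)
      fun x hx => mul_nonpos_of_nonpos_of_nonneg (by linarith [hv x (interior_subset hx)])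
        (mul_pos (h0 x) (exp_pos _)).le
  have h := anti (Set.left_mem_Icc.2 hx) (Set.right_mem_Icc.2 hx) hx
  have := mul_le_mul_of_nonneg_right h (exp_pos (k * x₁)).le
  simp only [mul_assoc, ← Real.exp_add] at this
  rw [show -(k * x₁) + k * x₁ = 0 by ring, Real.exp_zero, mul_one] at this
  rwa [show k * (x₁ - x₀) = -(k * x₀) + k * x₁ by ring]

theorem mul_exp_le_of_le_logDeriv {g v : ℝ → ℝ} (hg : ∀ x, HasDerivAt g (v x * g x) x)
    (h0 : ∀ x, 0 < g x) {k x₀ x₁ : ℝ} (hx : x₀ ≤ x₁) (hv : ∀ x ∈ Set.Icc x₀ x₁, k ≤ v x) :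
    g x₀ * exp (k * (x₁ - x₀)) ≤ g x₁ := by
  have h := le_mul_exp_of_logDeriv_le (g := fun x => g (-x)) (v := fun x => -v (-x)) (k := -k)
    (x₀ := -x₁) (x₁ := -x₀) (fun x => (hasDerivAt_neg_arg (hg (-x))).congr_deriv (by ring))
    (fun x => h0 _) (by linarith) fun x hx => by
      linarith [hv (-x) ⟨by linarith [hx.2], by linarith [hx.1]⟩]
  simp only [neg_neg] at h
  have := mul_le_mul_of_nonneg_right h (exp_pos (k * (x₁ - x₀))).le
  simp only [mul_assoc, ← Real.exp_add] at this
  rwa [show -k * (-x₀ - -x₁) + k * (x₁ - x₀) = 0 by ring, Real.exp_zero, mul_one] at this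

namespace Dar
variable {q f : ℝ → ℝ → ℝ} {b : ℝ}

theorem hasDerivAt_f (h : Dar q b f) (t x : ℝ) : HasDerivAt (f t) (v f t x * f t x) x :=
  (h.lax.sm.hasDerivAt_x t x).congr_deriv (div_mul_cancel₀ _ (h.pos t x).ne').symm

theorem dx_f (h : Dar q b f) (t x : ℝ) : dx f t x = v f t x * f t x :=
  (div_mul_cancel₀ _ (h.pos t x).ne').symm

theorem hasDerivAt_flux (h : Dar q b f) (t x : ℝ) :
    HasDerivAt (fun x => (2 * w q b f t x - 4 * b ^ 2) * f t x ^ 2)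
      (2 * f t x * dt f t x) x := by
  have h1 := (((h.sm_w.hasDerivAt_x t x).const_mul 2).sub_const (4 * b ^ 2)).mul
    ((h.hasDerivAt_f t x).pow 2)
  refine h1.congr_deriv ?_
  rw [h.lax.t, h.dx_f, h.dx_w]
  simp only [w, Pi.pow_apply]
  push_cast
  ring

theorem tendsto_f (h : Dar q b f) (t : ℝ) :
    Tendsto (f t) atTop (nhds 0) ∧ Tendsto (f t) atBot (nhds 0) := by
  have hb := h.hb
  constructor
  · obtain ⟨X, hX⟩ := eventually_atTop.1 ((h.top t).eventually (eventually_le_nhds (b := -b / 2)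
      (by linarith)))
    have t1 : Tendsto (fun x => f t X * exp (-b / 2 * (x - X))) atTop (nhds 0) := by
      have := (tendsto_exp_atBot.comp ((tendsto_atTop_add_const_right atTop (-X)
        tendsto_id).const_mul_atTop_of_neg (by linarith : -b / 2 < 0))).const_mul (f t X)
      simpa [Function.comp_def, sub_eq_add_neg] using this
    exact squeeze_zero' (Eventually.of_forall fun x => (h.pos t x).le)
      ((eventually_ge_atTop X).mono fun x hx => le_mul_exp_of_logDeriv_le (h.hasDerivAt_f t)
        (h.pos t) hx fun y hy => hX y hy.1) t1
  · obtain ⟨X, hX⟩ := eventually_atBot.1 ((h.bot t).eventually (eventually_ge_nhds (by linarith : b / 2 < b)))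
    have t1 : Tendsto (fun x => f t X * exp (-(b / 2 * (X - x)))) atBot (nhds 0) := by
      have : Tendsto (fun x => -(b / 2 * (X - x))) atBot atBot :=
        ((tendsto_atBot_add_const_right atBot (-X) tendsto_id).const_mul_atBot
          (by linarith : 0 < b / 2)).congr fun x => by simp only [id_eq]; ring
      simpa using (tendsto_exp_atBot.comp this).const_mul (f t X)
    refine squeeze_zero' (Eventually.of_forall fun x => (h.pos t x).le)
      ((eventually_le_atBot X).mono fun x hx => ?_) t1
    have h1 := mul_exp_le_of_le_logDeriv (h.hasDerivAt_f t) (h.pos t) hx fun y hy => hX y hy.2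
    rw [Real.exp_neg, ← div_eq_mul_inv, le_div_iff₀ (exp_pos _)]
    exact h1

theorem exists_mass (h : Dar q b f) : ∃ G : ℝ → ℝ → ℝ, Sm G ∧
    (∀ t x, HasDerivAt (G t) (f t x ^ 2) x) ∧
    (∀ t x, HasDerivAt (fun t => G t x) ((2 * w q b f t x - 4 * b ^ 2) * f t x ^ 2) t) ∧
    ∃ g₀ g₁ : ℝ, (∀ t x, g₀ < G t x ∧ G t x < g₁) ∧ (∀ t, Tendsto (G t) atBot (nhds g₀)) ∧
      ∀ t, Tendsto (G t) atTop (nhds g₁) := by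
  have hb := h.hb
  have sJ : Sm fun t x => (2 * w q b f t x - 4 * b ^ 2) * f t x ^ 2 :=
    (((Sm.const 2).mul h.sm_w).sub (Sm.const _)).mul (h.lax.sm.pow 2)
  set J : ℝ → ℝ → ℝ := fun t x => (2 * w q b f t x - 4 * b ^ 2) * f t x ^ 2 with hJ
  set G : ℝ → ℝ → ℝ := fun t x => (∫ s in (0 : ℝ)..x, f t s ^ 2) + ∫ τ in (0 : ℝ)..t, J τ 0 with hG
  have c2 : ∀ t, Continuous fun s => f t s ^ 2 := fun t => (h.lax.sm.cx t).pow 2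
  have hGx : ∀ t x, HasDerivAt (G t) (f t x ^ 2) x := fun t x =>
    (((c2 t).integral_hasStrictDerivAt 0 x).hasDerivAt).add_const _
  have hGt : ∀ t x, HasDerivAt (fun t => G t x) (J t x) t := fun t x => by
    have h1 := hasDerivAt_intervalIntegral_param (F := fun s t => f t s ^ 2)
      (F' := fun s t => 2 * f t s * dt f t s)
      (by
        have c1 := h.lax.sm.continuous
        have c2 := h.lax.sm.dt.continuous
        exact (((continuous_const.mul c1).mul c2).comp continuous_swap))
      (fun s t => ((h.lax.sm.hasDerivAt_t t s).pow 2).congr_deriv (by push_cast; ring))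
      c2 0 x t
    have h2 := ((sJ.ct 0).integral_hasStrictDerivAt 0 t).hasDerivAt
    refine (h1.add h2).congr_deriv ?_
    rw [intervalIntegral.integral_eq_sub_of_hasDerivAt (fun s _ => h.hasDerivAt_flux t s)]
    · simp only [hJ]; ring
    · exact ((continuous_const.mul (h.lax.sm.cx t)).mul (h.lax.sm.dt.cx t)).intervalIntegrable _ _
  have sG : Sm G := Sm.of_partial hGt hGx sJ (h.lax.sm.pow 2)
  have mono : ∀ t, StrictMono (G t) := fun t =>
    strictMono_of_hasDerivAt_pos (hGx t) fun x => pow_pos (h.pos t x) 2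
  have hup : ∃ g₁, Tendsto (G 0) atTop (nhds g₁) := by
    obtain ⟨X, hX⟩ := eventually_atTop.1 ((h.top 0).eventually (eventually_le_nhds (b := -b / 2)
      (by linarith)))
    have anti : AntitoneOn (fun x => G 0 x + f 0 x ^ 2 / b) (Set.Ici X) := by
      have hd := fun x => (hGx 0 x).add (((h.hasDerivAt_f 0 x).pow 2).div_const b)
      refine antitoneOn_of_hasDerivWithinAt_nonpos (convex_Ici _)
        (fun x _ => (hd x).continuousAt.continuousWithinAt) (fun x _ => (hd x).hasDerivWithinAt)
        fun x hx => ?_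
      have h1 : v f 0 x ≤ -b / 2 := hX x (interior_subset hx)
      have h2 : f 0 x ^ 2 + (2 : ℕ) * f 0 x ^ (2 - 1) * (v f 0 x * f 0 x) / b =
        f 0 x ^ 2 * (2 / b * (v f 0 x + b / 2)) := by push_cast; field_simp; ring
      rw [h2]
      exact mul_nonpos_of_nonneg_of_nonpos (sq_nonneg _)
        (mul_nonpos_of_nonneg_of_nonpos (by positivity) (by linarith))
    refine ⟨_, tendsto_atTop_ciSup (mono 0).monotone ⟨G 0 X + f 0 X ^ 2 / b, ?_⟩⟩
    rintro _ ⟨x, rfl⟩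
    have h3 := anti Set.self_mem_Ici (le_max_left X x : X ≤ max X x) (le_max_left _ _)
    have h4 := (mono 0).monotone (le_max_right X x)
    have h5 : 0 ≤ f 0 (max X x) ^ 2 / b := by positivity
    simp only at h3
    linarith
  have hdn : ∃ g₀, Tendsto (G 0) atBot (nhds g₀) := by
    obtain ⟨X, hX⟩ := eventually_atBot.1 ((h.bot 0).eventually (eventually_ge_nhds (by linarith : b / 2 < b)))
    have anti : AntitoneOn (fun x => G 0 x - f 0 x ^ 2 / b) (Set.Iic X) := by
      have hd := fun x => (hGx 0 x).sub (((h.hasDerivAt_f 0 x).pow 2).div_const b)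
      refine antitoneOn_of_hasDerivWithinAt_nonpos (convex_Iic _)
        (fun x _ => (hd x).continuousAt.continuousWithinAt) (fun x _ => (hd x).hasDerivWithinAt)
        fun x hx => ?_
      have h1 : b / 2 ≤ v f 0 x := hX x (interior_subset hx : x ∈ Set.Iic X)
      have h2 : f 0 x ^ 2 - (2 : ℕ) * f 0 x ^ (2 - 1) * (v f 0 x * f 0 x) / b =
        f 0 x ^ 2 * (2 / b * (b / 2 - v f 0 x)) := by push_cast; field_simp
      rw [h2]
      exact mul_nonpos_of_nonneg_of_nonpos (sq_nonneg _)
        (mul_nonpos_of_nonneg_of_nonpos (by positivity) (by linarith))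
    refine ⟨_, tendsto_atBot_ciInf (mono 0).monotone ⟨G 0 X - f 0 X ^ 2 / b, ?_⟩⟩
    rintro _ ⟨x, rfl⟩
    have h3 := anti (min_le_left X x : min X x ≤ X) Set.self_mem_Iic (min_le_left _ _)
    have h4 := (mono 0).monotone (min_le_right X x)
    have h5 : 0 ≤ f 0 (min X x) ^ 2 / b := by positivity
    simp only at h3
    linarith
  obtain ⟨K, hK0, hK⟩ := h.sol.exists_bound
  obtain ⟨W, hW0, hW⟩ := h.sol_w.exists_bound
  have trans : ∀ (l : Filter ℝ) (g : ℝ), Tendsto (f 0) l (nhds 0) → Tendsto (G 0) l (nhds g) →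
      ∀ t, Tendsto (G t) l (nhds g) := by
    intro l g hf0 hg t
    set A := 2 * √(K + b ^ 2) + (2 * K + (2 * K + 4 * b ^ 2) * √(K + b ^ 2)) * |t| with hA
    have hfA : ∀ τ ∈ Set.uIcc 0 t, ∀ x, f τ x ≤ f 0 x * exp A := fun τ hτ x => by
      have h1 := h.lax.abs_log_sub_le h.sol.sm (by simp) Set.ordConnected_univ hK (fun t _ => h.pos t)
        (Set.mem_univ τ) (Set.mem_univ 0) x
      have h2 : |τ - 0| ≤ |t| := by
        have := Set.abs_sub_left_of_mem_uIcc hτ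
        simpa using this
      have h3 := mul_le_mul_of_nonneg_left h2
        (by positivity : 0 ≤ 2 * K + (2 * K + 4 * b ^ 2) * √(K + b ^ 2))
      have h4 := (abs_le.1 h1).2
      rw [← Real.exp_log (h.pos τ x), ← Real.exp_log (h.pos 0 x), ← Real.exp_add, Real.exp_le_exp]
      linarith
    have hb1 : ∀ x, |G t x - G 0 x| ≤ (2 * W + 4 * b ^ 2) * (f 0 x * exp A) ^ 2 * |t| := fun x => by
      have := (convex_uIcc 0 t).norm_image_sub_le_of_norm_hasDerivWithin_le
        (f := fun t => G t x) (f' := fun t => J t x)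
        (C := (2 * W + 4 * b ^ 2) * (f 0 x * exp A) ^ 2)
        (fun τ _ => (hGt τ x).hasDerivWithinAt) (fun τ hτ => ?_) Set.left_mem_uIcc
        Set.right_mem_uIcc
      · simpa using this
      · rw [Real.norm_eq_abs, hJ, abs_mul, abs_of_nonneg (sq_nonneg (f τ x))]
        refine mul_le_mul ?_ (pow_le_pow_left₀ (h.pos τ x).le (hfA τ hτ x) 2) (sq_nonneg _) (by positivity)
        have := abs_le.1 (hW τ (Set.mem_univ _) x)
        exact abs_le.2 ⟨by linarith, by linarith [sq_nonneg b]⟩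
    have t1 : Tendsto (fun x => (2 * W + 4 * b ^ 2) * (f 0 x * exp A) ^ 2 * |t|) l (nhds 0) := by
      simpa using (((hf0.mul_const (exp A)).pow 2).const_mul (2 * W + 4 * b ^ 2)).mul_const |t|
    have t2 : Tendsto (fun x => G t x - G 0 x) l (nhds 0) :=
      squeeze_zero_norm hb1 t1
    simpa using t2.add hg
  obtain ⟨g₁, hg₁⟩ := hup
  obtain ⟨g₀, hg₀⟩ := hdn
  have T1 := trans _ _ (h.tendsto_f 0).1 hg₁
  have T0 := trans _ _ (h.tendsto_f 0).2 hg₀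
  refine ⟨G, sG, hGx, hGt, g₀, g₁, fun t x => ⟨?_, ?_⟩, T0, T1⟩
  · exact (((mono t).monotone.le_of_tendsto (T0 t) (x - 1))).trans_lt (mono t (by linarith))
  · exact (mono t (by linarith : x < x + 1)).trans_le ((mono t).monotone.ge_of_tendsto (T1 t) (x + 1))

end Dar

theorem integral_abs_le_of_sq {e : ℝ → ℝ} (he : Continuous e) {x₀ x₁ η : ℝ} (hx : x₀ ≤ x₁)
    (hη : 0 < η) (h : ∫ x in x₀..x₁, e x ^ 2 ≤ η ^ 2) :
    ∫ x in x₀..x₁, |e x| ≤ η * (1 + (x₁ - x₀)) := by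
  have h1 : ∫ x in x₀..x₁, 2 * η * |e x| ≤ ∫ x in x₀..x₁, (e x ^ 2 + η ^ 2) := by
    refine intervalIntegral.integral_mono_on hx (Continuous.intervalIntegrable (by fun_prop) _ _)
      (Continuous.intervalIntegrable (by fun_prop) _ _) fun x _ => ?_
    nlinarith [sq_nonneg (|e x| - η), sq_abs (e x)]
  rw [intervalIntegral.integral_const_mul, intervalIntegral.integral_add
    (Continuous.intervalIntegrable (by fun_prop) _ _) intervalIntegrable_const,
    intervalIntegral.integral_const, smul_eq_mul] at h1
  have h2 : 0 ≤ ∫ x in x₀..x₁, |e x| := intervalIntegral.integral_nonneg hx fun x _ => abs_nonneg _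
  have h3 : 2 * η * ∫ x in x₀..x₁, |e x| ≤ η * (η * (1 + (x₁ - x₀))) := by linarith
  have h4 : 2 * (∫ x in x₀..x₁, |e x|) ≤ η * (1 + (x₁ - x₀)) := by
    refine le_of_mul_le_mul_left ?_ hη
    linarith
  linarith

/-- Gronwall's inequality for a scalar linear equation with square integrable forcing. -/
theorem abs_le_of_linear_ode {d a e : ℝ → ℝ} (hd : ∀ x, HasDerivAt d (a x * d x + e x) x)
    (ha : Continuous a) (he : Continuous e) {x₀ x₁ α C η : ℝ} (hx : x₀ ≤ x₁)
    (hα : ∀ x ∈ Set.Icc x₀ x₁, a x ≤ α) (hC : ∀ s ∈ Set.Icc x₀ x₁, exp (α * (x₁ - s)) ≤ C)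
    (hη : 0 < η) (h : ∫ x in x₀..x₁, e x ^ 2 ≤ η ^ 2) :
    |d x₁| ≤ exp (α * (x₁ - x₀)) * |d x₀| + C * (η * (1 + (x₁ - x₀))) := by
  set A : ℝ → ℝ := fun x => ∫ s in x..x₁, a s with hA
  have dA : ∀ x, HasDerivAt A (-a x) x := fun x =>
    intervalIntegral.integral_hasDerivAt_left (ha.intervalIntegrable _ _)
      (ha.stronglyMeasurableAtFilter _ _) ha.continuousAt
  have cA : Continuous A := continuous_iff_continuousAt.2 fun x => (dA x).continuousAt
  have dd : ∀ x, HasDerivAt (fun x => exp (A x) * d x) (exp (A x) * e x) x := fun x => by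
    refine (((dA x).exp).mul (hd x)).congr_deriv ?_
    ring
  have hAle : ∀ s ∈ Set.Icc x₀ x₁, A s ≤ α * (x₁ - s) := fun s hs => by
    have := intervalIntegral.integral_mono_on (μ := volume) (g := fun _ => α) hs.2 (ha.intervalIntegrable s x₁)
      intervalIntegrable_const fun x hx => hα x ⟨hs.1.trans hx.1, hx.2⟩
    rw [intervalIntegral.integral_const, smul_eq_mul] at this
    linarith
  have ec : Continuous fun x => exp (A x) * e x := (Real.continuous_exp.comp cA).mul he
  have key := intervalIntegral.integral_eq_sub_of_hasDerivAt (fun x _ => dd x)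
    (ec.intervalIntegrable x₀ x₁)
  have hA1 : A x₁ = 0 := intervalIntegral.integral_same
  rw [hA1, Real.exp_zero, one_mul] at key
  have hb : |∫ x in x₀..x₁, exp (A x) * e x| ≤ C * ∫ x in x₀..x₁, |e x| := by
    refine (intervalIntegral.abs_integral_le_integral_abs hx).trans ?_
    rw [← intervalIntegral.integral_const_mul]
    refine intervalIntegral.integral_mono_on hx (ec.abs.intervalIntegrable _ _)
      ((he.abs.const_mul C).intervalIntegrable _ _) fun x hx => ?_
    rw [abs_mul, abs_of_pos (exp_pos _)]
    exact mul_le_mul_of_nonneg_right ((exp_le_exp.2 (hAle x hx)).trans (hC x hx)) (abs_nonneg _)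
  have hC0 : 0 ≤ C := (exp_pos _).le.trans (hC x₁ (Set.right_mem_Icc.2 hx))
  have h2 := mul_le_mul_of_nonneg_left (integral_abs_le_of_sq he hx hη h) hC0
  have h3 : |exp (A x₀) * d x₀| ≤ exp (α * (x₁ - x₀)) * |d x₀| := by
    rw [abs_mul, abs_of_pos (exp_pos _)]
    exact mul_le_mul_of_nonneg_right (exp_le_exp.2 (hAle x₀ (Set.left_mem_Icc.2 hx))) (abs_nonneg _)
  have h4 : d x₁ = (∫ x in x₀..x₁, exp (A x) * e x) + exp (A x₀) * d x₀ := by linarith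
  rw [h4]
  refine (abs_add_le _ _).trans ?_
  linarith

theorem le_of_darboux_ode {v w : ℝ → ℝ} {b η x₀ x₁ : ℝ}
    (hv : ∀ x, HasDerivAt v (v x ^ 2 - b ^ 2 - w x) x) (hw : Continuous w) (hη : 0 < η)
    (hη1 : η ≤ b / 2) (hη2 : η < 7 / 8 * b ^ 2) (h : ∫ x in x₀..x₁, w x ^ 2 ≤ η ^ 2)
    (h0 : v x₀ ≤ b / 2) : ∀ x ∈ Set.Icc x₀ x₁, v x ≤ 3 / 4 * b := by
  have cw : Continuous fun s => w s ^ 2 := hw.pow 2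
  have dB : ∀ x, HasDerivAt (fun x => b / 2 + (∫ s in x₀..x, w s ^ 2) / (2 * η))
      (w x ^ 2 / (2 * η)) x := fun x =>
    (((cw.integral_hasStrictDerivAt x₀ x).hasDerivAt).div_const _).const_add _
  have hB : ∀ x ∈ Set.Icc x₀ x₁, b / 2 ≤ b / 2 + (∫ s in x₀..x, w s ^ 2) / (2 * η) ∧
      b / 2 + (∫ s in x₀..x, w s ^ 2) / (2 * η) ≤ 3 / 4 * b := fun x hx => by
    have h1 : 0 ≤ ∫ s in x₀..x, w s ^ 2 := intervalIntegral.integral_nonneg hx.1 fun _ _ => sq_nonneg _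
    have h2 : ∫ s in x₀..x, w s ^ 2 ≤ ∫ s in x₀..x₁, w s ^ 2 :=
      intervalIntegral.integral_mono_interval le_rfl hx.1 hx.2
        (Eventually.of_forall fun _ => sq_nonneg _) (cw.intervalIntegrable _ _)
    have h3 : (∫ s in x₀..x, w s ^ 2) / (2 * η) ≤ η / 2 := by
      rw [div_le_iff₀ (by positivity)]; nlinarith
    have h4 : 0 ≤ (∫ s in x₀..x, w s ^ 2) / (2 * η) := by positivity
    constructor <;> linarith
  intro x hx
  refine (image_le_of_deriv_right_lt_deriv_boundary' (f := v)
    (fun x _ => (hv x).continuousAt.continuousWithinAt)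
    (fun x _ => (hv x).hasDerivWithinAt) (by simpa using h0)
    (fun x _ => (dB x).continuousAt.continuousWithinAt)
    (fun x _ => (dB x).hasDerivWithinAt) (fun x hx heq => ?_) hx).trans (hB x hx).2
  obtain ⟨h1, h2⟩ := hB x ⟨hx.1, hx.2.le⟩
  rw [← heq] at h1 h2
  rw [lt_div_iff₀ (by positivity)]
  have h3 : v x ^ 2 ≤ (3 / 4 * b) ^ 2 := pow_le_pow_left₀ (by linarith) h2 2
  nlinarith [sq_nonneg (w x + η)]

/-- If the potential is small, the logarithmic derivative relaxes to `-b`, moving right. -/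
theorem exists_forward_relaxation {b K : ℝ} (hb : 0 < b) {ε : ℝ} (hε : 0 < ε) :
    ∃ l > 0, ∃ η > 0, ∀ v w : ℝ → ℝ, Continuous w →
      (∀ x, HasDerivAt v (v x ^ 2 - b ^ 2 - w x) x) → (∀ x, |v x| ≤ K) → ∀ x₀ x₁,
      ∫ x in x₀..x₁, w x ^ 2 ≤ η → v x₀ ≤ b / 2 → ∀ x ∈ Set.Icc (x₀ + l) x₁, |v x + b| ≤ ε := by
  have t1 : Tendsto (fun l : ℝ => exp (-(b / 4) * l) * (K + b)) atTop (nhds 0) := by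
    simpa using ((tendsto_exp_atBot.comp
      (tendsto_id.const_mul_atTop_of_neg (by linarith : -(b / 4) < 0))).mul_const (K + b))
  obtain ⟨l, hl, hl0⟩ := ((t1.eventually (eventually_le_nhds (half_pos hε))).and
    (eventually_gt_atTop 0)).exists
  obtain ⟨η, hη0, hη⟩ : ∃ η > 0, η ≤ b / 2 ∧ η < 7 / 8 * b ^ 2 ∧ η * (1 + l) ≤ ε / 2 := by
    refine ⟨min (b / 2) (min (b ^ 2 / 2) (ε / (2 * (1 + l)))), by positivity, min_le_left _ _, ?_, ?_⟩
    · have : min (b / 2) (min (b ^ 2 / 2) (ε / (2 * (1 + l)))) ≤ b ^ 2 / 2 :=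
        (min_le_right _ _).trans (min_le_left _ _)
      nlinarith [pow_pos hb 2]
    · have : min (b / 2) (min (b ^ 2 / 2) (ε / (2 * (1 + l)))) ≤ ε / (2 * (1 + l)) :=
        (min_le_right _ _).trans (min_le_right _ _)
      refine (mul_le_mul_of_nonneg_right this (by linarith)).trans (le_of_eq ?_)
      field_simp
  refine ⟨l, hl0, η ^ 2, by positivity, fun v w hw hv hvK x₀ x₁ h h0 x hx => ?_⟩
  have cv : Continuous v := continuous_iff_continuousAt.2 fun x => (hv x).continuousAt
  have bar := le_of_darboux_ode hv hw hη0 hη.1 hη.2.1 h h0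
  have cw : Continuous fun s => w s ^ 2 := hw.pow 2
  have h1 : ∫ s in (x - l)..x, (-w s) ^ 2 ≤ η ^ 2 := by
    simp only [neg_sq]
    exact (intervalIntegral.integral_mono_interval (by linarith [hx.1]) (by linarith) hx.2
      (Eventually.of_forall fun _ => sq_nonneg _) (cw.intervalIntegrable _ _)).trans h
  have := abs_le_of_linear_ode (d := fun x => v x + b) (a := fun x => v x - b) (e := fun x => -w x)
    (α := -(b / 4)) (C := 1) (x₀ := x - l) (x₁ := x)
    (fun x => ((hv x).add_const b).congr_deriv (by ring)) (by fun_prop) (by fun_prop)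
    (by linarith)
    (fun y hy => by linarith [bar y ⟨by linarith [hx.1, hy.1], hy.2.trans hx.2⟩])
    (fun s hs => exp_le_one_iff.2 (by nlinarith [hs.2])) hη0 h1
  rw [show x - (x - l) = l by ring] at this
  have h2 : |v (x - l) + b| ≤ K + b := (abs_add_le _ _).trans (by
    rw [abs_of_pos hb]; linarith [hvK (x - l)])
  have h3 := mul_le_mul_of_nonneg_left h2 (exp_pos (-(b / 4) * l)).le
  linarith [hη.2.2]

theorem exists_backward_relaxation {b K : ℝ} (hb : 0 < b) {ε : ℝ} (hε : 0 < ε) :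
    ∃ l > 0, ∃ η > 0, ∀ v w : ℝ → ℝ, Continuous w →
      (∀ x, HasDerivAt v (v x ^ 2 - b ^ 2 - w x) x) → (∀ x, |v x| ≤ K) → ∀ x₀ x₁,
      ∫ x in x₀..x₁, w x ^ 2 ≤ η → -(b / 2) ≤ v x₁ → ∀ x ∈ Set.Icc x₀ (x₁ - l), |v x - b| ≤ ε := by
  obtain ⟨l, hl, η, hη, H⟩ := exists_forward_relaxation (K := K) hb hε
  refine ⟨l, hl, η, hη, fun v w hw hv hvK x₀ x₁ h h0 x hx => ?_⟩
  have := H (fun x => -v (-x)) (fun x => w (-x)) (by fun_prop)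
    (fun x => (hasDerivAt_neg_arg (hv (-x))).neg.congr_deriv (by ring))
    (fun x => by rw [abs_neg]; exact hvK _) (-x₁) (-x₀)
    (by rw [intervalIntegral.integral_comp_neg fun x => w x ^ 2]; simpa using h)
    (by rw [neg_neg]; linarith) (-x) ⟨by linarith [hx.2], by linarith [hx.1]⟩
  rw [neg_neg] at this
  rw [← abs_neg]
  convert this using 2
  ring

/-- The mass of `q` to the right of any front faster than `a₀` vanishes as `t → ∞`. -/
def RightVanishing (q : ℝ → ℝ → ℝ) (a₀ : ℝ) : Prop :=
  ∀ a, a₀ < a → Tendsto (fun t => ∫ x in Set.Ioi (a * t), q t x ^ 2) atTop (nhds 0)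

theorem RightVanishing.eventually_le {q : ℝ → ℝ → ℝ} {a₀ a η : ℝ} (h : RightVanishing q a₀)
    (hq : ∀ t, SqI (q t)) (ha : a₀ < a) (hη : 0 < η) :
    ∀ᶠ t in atTop, ∀ x₀ x₁, a * t ≤ x₀ → ∫ x in x₀..x₁, q t x ^ 2 ≤ η := by
  filter_upwards [(h a ha).eventually (eventually_le_nhds hη)] with t ht x₀ x₁ hx
  rcases le_total x₀ x₁ with h' | h'
  · rw [intervalIntegral.integral_of_le h']
    refine (setIntegral_mono_set (hq t).2.integrableOn (Eventually.of_forall fun x => sq_nonneg _)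
      (Set.Ioc_subset_Ioi_self.trans (Set.Ioi_subset_Ioi hx)).eventuallyLE).trans ht
  · rw [intervalIntegral.integral_symm]
    have := intervalIntegral.integral_nonneg (f := fun x => q t x ^ 2) (μ := volume) h'
      fun _ _ => sq_nonneg _
    linarith

namespace Dar
variable {q f : ℝ → ℝ → ℝ} {b : ℝ}

theorem hasDerivAt_v (h : Dar q b f) (t x : ℝ) :
    HasDerivAt (v f t) (v f t x ^ 2 - b ^ 2 - w q b f t x) x :=
  (h.ric t x).congr_deriv (by simp only [w]; ring)

theorem sq_le_integral (h : Dar q b f) {K : ℝ} (hK : ∀ t x, |v f t x| ≤ K) {t x y : ℝ}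
    (hy : y ∈ Set.Icc x (x + 1)) : f t y ^ 2 ≤ exp (2 * K) * ∫ s in x..(x + 1), f t s ^ 2 := by
  have hK0 : 0 ≤ K := (abs_nonneg _).trans (hK 0 0)
  have key : ∀ s ∈ Set.Icc x (x + 1), f t y ≤ exp K * f t s := fun s hs => by
    rcases le_total s y with hsy | hsy
    · refine (le_mul_exp_of_logDeriv_le (h.hasDerivAt_f t) (h.pos t) hsy
        fun z _ => (abs_le.1 (hK t z)).2).trans ?_
      rw [mul_comm]
      exact mul_le_mul_of_nonneg_right (exp_le_exp.2 (mul_le_of_le_one_right hK0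
        (by linarith [hs.1, hy.2]))) (h.pos t s).le
    · have h1 := mul_exp_le_of_le_logDeriv (h.hasDerivAt_f t) (h.pos t) hsy
        fun z _ => (abs_le.1 (hK t z)).1
      have h2 := mul_le_mul_of_nonneg_left h1 (exp_pos K).le
      refine le_trans ?_ h2
      rw [mul_left_comm, ← Real.exp_add]
      refine le_mul_of_one_le_right (h.pos t y).le (one_le_exp ?_)
      nlinarith [hs.2, hy.1]
  have h1 := intervalIntegral.integral_mono_on (μ := volume) (f := fun _ => f t y ^ 2)
    (g := fun s => exp (2 * K) * f t s ^ 2) (by linarith : x ≤ x + 1) intervalIntegrable_const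
    ((((h.lax.sm.cx t).pow 2).const_mul _).intervalIntegrable _ _) fun s hs => by
      have := pow_le_pow_left₀ (h.pos t y).le (key s hs) 2
      rwa [mul_pow, ← Real.exp_nat_mul] at this
  rwa [intervalIntegral.integral_const, intervalIntegral.integral_const_mul, smul_eq_mul,
    show x + 1 - x = 1 by ring, one_mul] at h1

theorem abs_integral_w_mul_le (h : Dar q b f) {K : ℝ} (hK : ∀ t x, |v f t x| ≤ K) {t x η : ℝ}
    (hη : 0 < η) (hw : ∫ s in x..(x + 1), w q b f t s ^ 2 ≤ η ^ 2) :
    |∫ s in x..(x + 1), 2 * w q b f t s * f t s ^ 2| ≤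
      4 * exp (2 * K) * η * ∫ s in x..(x + 1), f t s ^ 2 := by
  have hx : x ≤ x + 1 := by linarith
  have cw := h.sm_w.cx t
  have cf := h.lax.sm.cx t
  refine (intervalIntegral.abs_integral_le_integral_abs hx).trans ?_
  have h1 := intervalIntegral.integral_mono_on (μ := volume)
    (f := fun s => |2 * w q b f t s * f t s ^ 2|)
    (g := fun s => 2 * (exp (2 * K) * ∫ s in x..(x + 1), f t s ^ 2) * |w q b f t s|) hx
    (Continuous.intervalIntegrable (by fun_prop) _ _)
    (Continuous.intervalIntegrable (by fun_prop) _ _) fun s hs => by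
      have := mul_le_mul_of_nonneg_left (h.sq_le_integral hK (t := t) hs) (abs_nonneg (w q b f t s))
      rw [abs_mul, abs_mul, abs_two, abs_of_nonneg (sq_nonneg (f t s))]
      linarith
  rw [intervalIntegral.integral_const_mul] at h1
  have h2 := integral_abs_le_of_sq cw hx hη hw
  have h3 : 0 ≤ exp (2 * K) * ∫ s in x..(x + 1), f t s ^ 2 :=
    (sq_nonneg _).trans (h.sq_le_integral hK (Set.left_mem_Icc.2 hx) (t := t))
  have h4 := mul_le_mul_of_nonneg_left h2 h3
  rw [show x + 1 - x = 1 by ring] at h4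
  linarith

section Mass
variable {G : ℝ → ℝ → ℝ} {a₀ a K : ℝ}

theorem hasDerivAt_window_mass (h : Dar q b f) (sG : Sm G)
    (hGx : ∀ t x, HasDerivAt (G t) (f t x ^ 2) x)
    (hGt : ∀ t x, HasDerivAt (fun t => G t x) ((2 * w q b f t x - 4 * b ^ 2) * f t x ^ 2) t)
    (X a t : ℝ) : HasDerivAt (fun t => ∫ s in (0 : ℝ)..1, G t (X + a * t + s))
      ((a - 4 * b ^ 2) * (∫ s in (X + a * t)..(X + a * t + 1), f t s ^ 2) +
        ∫ s in (X + a * t)..(X + a * t + 1), 2 * w q b f t s * f t s ^ 2) t := by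
  have cp : Continuous fun p : ℝ × ℝ => (p.2, X + a * p.2 + p.1) := by fun_prop
  have c1 := h.lax.sm.continuous.comp cp
  have c2 := h.sm_w.continuous.comp cp
  have hc : Continuous (Function.uncurry fun s t => (a - 4 * b ^ 2) * f t (X + a * t + s) ^ 2
      + 2 * w q b f t (X + a * t + s) * f t (X + a * t + s) ^ 2) :=
    ((c1.pow 2).const_mul (a - 4 * b ^ 2)).add ((c2.const_mul 2).mul (c1.pow 2))
  have hd : ∀ s t, HasDerivAt (fun t => G t (X + a * t + s))
      ((a - 4 * b ^ 2) * f t (X + a * t + s) ^ 2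
      + 2 * w q b f t (X + a * t + s) * f t (X + a * t + s) ^ 2) t := fun s t => by
    have hX : HasDerivAt (fun t => X + a * t + s) a t := by
      simpa using (((hasDerivAt_id t).const_mul a).const_add X).add_const s
    have h3 : _root_.dt G t (X + a * t + s) = _ := (hGt t _).deriv
    have h4 : _root_.dx G t (X + a * t + s) = _ := (hGx t _).deriv
    refine ((sG.hasDerivWithinAt_along hX.hasDerivWithinAt).hasDerivAt univ_mem).congr_deriv ?_
    rw [h3, h4]
    ring
  have h1 := hasDerivAt_intervalIntegral_param hc hd
    (fun t => (sG.cx t).comp (by fun_prop : Continuous fun s => X + a * t + s)) 0 1 t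
  refine h1.congr_deriv ?_
  rw [intervalIntegral.integral_comp_add_left (fun x => (a - 4 * b ^ 2) * f t x ^ 2
      + 2 * w q b f t x * f t x ^ 2), add_zero, intervalIntegral.integral_add,
      intervalIntegral.integral_const_mul]
  · exact (((h.lax.sm.cx t).pow 2).const_mul _).intervalIntegrable _ _
  · exact (((h.sm_w.cx t).const_mul 2).mul ((h.lax.sm.cx t).pow 2)).intervalIntegrable _ _

theorem exists_window_mass_monotone (h : Dar q b f) (hK : ∀ t x, |v f t x| ≤ K) (sG : Sm G)
    (hGx : ∀ t x, HasDerivAt (G t) (f t x ^ 2) x)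
    (hGt : ∀ t x, HasDerivAt (fun t => G t x) ((2 * w q b f t x - 4 * b ^ 2) * f t x ^ 2) t)
    (hr : RightVanishing (w q b f) a₀) (ha : a₀ < a) (hac : a ≠ 4 * b ^ 2) :
    ∃ T : ℝ, 0 ≤ T ∧ ∀ X, 0 ≤ X → ∀ t, T ≤ t →
      0 ≤ (a - 4 * b ^ 2) * ((∫ s in (0 : ℝ)..1, G t (X + a * t + s)) -
        ∫ s in (0 : ℝ)..1, G T (X + a * T + s)) := by
  have hd : 0 < |a - 4 * b ^ 2| := abs_pos.2 (sub_ne_zero.2 hac)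
  obtain ⟨η, hη⟩ : ∃ η, η = |a - 4 * b ^ 2| / (4 * exp (2 * K)) := ⟨_, rfl⟩
  have hη0 : 0 < η := by rw [hη]; positivity
  have hη1 : 4 * exp (2 * K) * η = |a - 4 * b ^ 2| := by rw [hη]; field_simp
  obtain ⟨T, hT⟩ := eventually_atTop.1 ((hr.eventually_le (fun t => h.sol_w.sqI t (Set.mem_univ _)) ha
    (pow_pos hη0 2)).and (eventually_ge_atTop 0))
  refine ⟨T, (hT T le_rfl).2, fun X hX t ht => ?_⟩
  have hd := fun t => ((h.hasDerivAt_window_mass sG hGx hGt X a t).const_mul (a - 4 * b ^ 2))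
  have mono : MonotoneOn (fun t => (a - 4 * b ^ 2) * ∫ s in (0 : ℝ)..1, G t (X + a * t + s))
      (Set.Ici T) := by
    refine monotoneOn_of_hasDerivWithinAt_nonneg (convex_Ici _)
      (fun t _ => (hd t).continuousAt.continuousWithinAt) (fun t _ => (hd t).hasDerivWithinAt)
      fun t ht => ?_
    have h1 := h.abs_integral_w_mul_le hK hη0 ((hT t (interior_subset ht : t ∈ Set.Ici T)).1
      (X + a * t) (X + a * t + 1) (by linarith))
    rw [hη1] at h1
    have h2 := mul_le_mul_of_nonneg_left h1 (abs_nonneg (a - 4 * b ^ 2))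
    rw [← abs_mul, ← mul_assoc, ← abs_mul, abs_mul_self] at h2
    have := (abs_le.1 h2).1
    linarith
  have := mono Set.self_mem_Ici ht ht
  simp only at this
  linarith

theorem window_mass_bounds (sG : Sm G) (mono : ∀ t, Monotone (G t)) (t y : ℝ) :
    G t y ≤ (∫ s in (0 : ℝ)..1, G t (y + s)) ∧ (∫ s in (0 : ℝ)..1, G t (y + s)) ≤ G t (y + 1) := by
  have c : Continuous fun s => G t (y + s) := (sG.cx t).comp (by fun_prop)
  constructor
  · have := intervalIntegral.integral_mono_on (μ := volume) (f := fun _ => G t y) zero_le_one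
      intervalIntegrable_const (c.intervalIntegrable 0 1) fun s hs => mono t (by linarith [hs.1])
    simpa using this
  · have := intervalIntegral.integral_mono_on (μ := volume) (g := fun _ => G t (y + 1)) zero_le_one
      (c.intervalIntegrable 0 1) intervalIntegrable_const fun s hs => mono t (by linarith [hs.2])
    simpa using this

theorem sub_le_of_le_logDeriv (h : Dar q b f) (hGx : ∀ t x, HasDerivAt (G t) (f t x ^ 2) x)
    {t x₁ x₂ k : ℝ} (hk : 0 < k) (hx : x₁ ≤ x₂) (hv : ∀ x ∈ Set.Icc x₁ x₂, k ≤ v f t x) :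
    G t x₂ - G t x₁ ≤ f t x₂ ^ 2 / (2 * k) := by
  have hd := fun x => (hGx t x).sub (((h.hasDerivAt_f t x).pow 2).div_const (2 * k))
  have anti : AntitoneOn (fun x => G t x - f t x ^ 2 / (2 * k)) (Set.Icc x₁ x₂) := by
    refine antitoneOn_of_hasDerivWithinAt_nonpos (convex_Icc _ _)
      (fun x _ => (hd x).continuousAt.continuousWithinAt) (fun x _ => (hd x).hasDerivWithinAt)
      fun x hx => ?_
    have h1 := hv x (interior_subset hx)
    have h2 : f t x ^ 2 - (2 : ℕ) * f t x ^ (2 - 1) * (v f t x * f t x) / (2 * k) =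
      f t x ^ 2 * (1 / k * (k - v f t x)) := by push_cast; field_simp
    rw [h2]
    exact mul_nonpos_of_nonneg_of_nonpos (sq_nonneg _)
      (mul_nonpos_of_nonneg_of_nonpos (by positivity) (by linarith))
  have h3 := anti (Set.left_mem_Icc.2 hx) (Set.right_mem_Icc.2 hx) hx
  have h4 : 0 ≤ f t x₁ ^ 2 / (2 * k) := by positivity
  simp only at h3
  linarith

theorem sub_le_of_logDeriv_le (h : Dar q b f) (hGx : ∀ t x, HasDerivAt (G t) (f t x ^ 2) x)
    {t x₁ x₂ k : ℝ} (hk : 0 < k) (hx : x₁ ≤ x₂) (hv : ∀ x ∈ Set.Icc x₁ x₂, v f t x ≤ -k) :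
    G t x₂ - G t x₁ ≤ f t x₁ ^ 2 / (2 * k) := by
  have hd := fun x => (hGx t x).add (((h.hasDerivAt_f t x).pow 2).div_const (2 * k))
  have anti : AntitoneOn (fun x => G t x + f t x ^ 2 / (2 * k)) (Set.Icc x₁ x₂) := by
    refine antitoneOn_of_hasDerivWithinAt_nonpos (convex_Icc _ _)
      (fun x _ => (hd x).continuousAt.continuousWithinAt) (fun x _ => (hd x).hasDerivWithinAt)
      fun x hx => ?_
    have h1 := hv x (interior_subset hx)
    have h2 : f t x ^ 2 + (2 : ℕ) * f t x ^ (2 - 1) * (v f t x * f t x) / (2 * k) =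
      f t x ^ 2 * (1 / k * (k + v f t x)) := by push_cast; field_simp
    rw [h2]
    exact mul_nonpos_of_nonneg_of_nonpos (sq_nonneg _)
      (mul_nonpos_of_nonneg_of_nonpos (by positivity) (by linarith))
  have h3 := anti (Set.left_mem_Icc.2 hx) (Set.right_mem_Icc.2 hx) hx
  have h4 : 0 ≤ f t x₂ ^ 2 / (2 * k) := by positivity
  simp only at h3
  linarith

end Mass
end Dar

theorem eventually_mul_exp_lt {k p : ℝ} (hk : 0 < k) (hp : 0 < p) (C l : ℝ) :
    ∀ᶠ t : ℝ in atTop, C * exp (-(k * t - l)) < p := by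
  have h1 : Tendsto (fun t : ℝ => k * t - l) atTop atTop :=
    tendsto_atTop_add_const_right _ (-l) (tendsto_id.const_mul_atTop hk)
  have h2 := (tendsto_exp_neg_atTop_nhds_zero.comp h1).const_mul C
  rw [mul_zero] at h2
  exact h2.eventually (eventually_lt_nhds hp)

theorem eventually_mul_add_le {a a' : ℝ} (h : a < a') (l : ℝ) :
    ∀ᶠ t : ℝ in atTop, a * t + l ≤ a' * t := by
  filter_upwards [(tendsto_id.const_mul_atTop (sub_pos.2 h)).eventually_ge_atTop l] with t ht
  simp only [id_eq] at ht
  linarith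

/-- A Darboux transform whose output is negligible to the right of the front of speed `a₀`,
together with a primitive `G` of the squared eigenfunction. -/
structure Front (q f : ℝ → ℝ → ℝ) (b a₀ K C : ℝ) (G : ℝ → ℝ → ℝ) (g₁ : ℝ) : Prop where
  dar : Dar q b f
  abs_v_le : ∀ t x, |Dar.v f t x| ≤ K
  rv : RightVanishing (Dar.w q b f) a₀
  lt : a₀ < 4 * b ^ 2
  sm : Sm G
  deriv_x : ∀ t x, HasDerivAt (G t) (f t x ^ 2) x
  deriv_t : ∀ t x, HasDerivAt (fun t => G t x) ((2 * Dar.w q b f t x - 4 * b ^ 2) * f t x ^ 2) t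
  lt_top : ∀ t x, G t x < g₁
  top : ∀ t, Tendsto (G t) atTop (nhds g₁)
  sq_le : ∀ t x, f t x ^ 2 ≤ C

theorem Dar.exists_front {q f : ℝ → ℝ → ℝ} {b a₀ : ℝ} (h : Dar q b f)
    (hr : RightVanishing (Dar.w q b f) a₀) (ha : a₀ < 4 * b ^ 2) :
    ∃ K C G g₁, Front q f b a₀ K C G g₁ := by
  obtain ⟨K, -, -, hK⟩ := h.exists_bound
  obtain ⟨G, sG, hx, ht, g₀, g₁, hG, -, htop⟩ := h.exists_mass
  refine ⟨K, exp (2 * K) * (g₁ - g₀), G, g₁, h, hK, hr, ha, sG, hx, ht, fun t x => (hG t x).2, htop,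
    fun t x => ?_⟩
  refine (h.sq_le_integral hK (Set.left_mem_Icc.2 (by linarith : x ≤ x + 1))).trans ?_
  rw [intervalIntegral.integral_eq_sub_of_hasDerivAt (fun y _ => hx t y)
    (((h.lax.sm.cx t).pow 2).intervalIntegrable _ _)]
  refine mul_le_mul_of_nonneg_left ?_ (exp_pos _).le
  linarith [(hG t x).1, (hG t (x + 1)).2]

namespace Front
variable {q f G : ℝ → ℝ → ℝ} {b a₀ K C g₁ a ε : ℝ}
open Dar

theorem mono (h : Front q f b a₀ K C G g₁) (t : ℝ) : Monotone (G t) :=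
  monotone_of_hasDerivAt_nonneg (h.deriv_x t) fun _ => sq_nonneg _

theorem forward (h : Front q f b a₀ K C G g₁) (ha : a₀ < a) (hε : 0 < ε) :
    ∃ l > 0, ∀ᶠ t in atTop, ∀ x₀ x, a * t ≤ x₀ → x₀ + l ≤ x → v f t x₀ ≤ b / 2 →
      |v f t x + b| ≤ ε := by
  obtain ⟨l, hl, η, hη, H⟩ := exists_forward_relaxation (K := K) h.dar.hb hε
  refine ⟨l, hl, ?_⟩
  filter_upwards [h.rv.eventually_le (fun t => h.dar.sol_w.sqI t (Set.mem_univ _)) ha hη]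
    with t ht x₀ x h0 hx hv
  exact H _ _ (h.dar.sm_w.cx t) (h.dar.hasDerivAt_v t) (h.abs_v_le t) x₀ x (ht _ _ h0) hv x
    ⟨hx, le_rfl⟩

theorem backward (h : Front q f b a₀ K C G g₁) (ha : a₀ < a) (hε : 0 < ε) :
    ∃ l > 0, ∀ᶠ t in atTop, ∀ x x₁, a * t ≤ x → x + l ≤ x₁ → -(b / 2) ≤ v f t x₁ →
      |v f t x - b| ≤ ε := by
  obtain ⟨l, hl, η, hη, H⟩ := exists_backward_relaxation (K := K) h.dar.hb hε
  refine ⟨l, hl, ?_⟩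
  filter_upwards [h.rv.eventually_le (fun t => h.dar.sol_w.sqI t (Set.mem_univ _)) ha hη]
    with t ht x x₁ h0 hx hv
  exact H _ _ (h.dar.sm_w.cx t) (h.dar.hasDerivAt_v t) (h.abs_v_le t) x x₁ (ht _ _ h0) hv x
    ⟨le_rfl, by linarith⟩

theorem mass_slow (h : Front q f b a₀ K C G g₁) (ha : a₀ < a) (hac : a < 4 * b ^ 2) :
    ∃ p > 0, ∀ᶠ t in atTop, G t (a * t) ≤ g₁ - p := by
  obtain ⟨T, -, hT⟩ := h.dar.exists_window_mass_monotone h.abs_v_le h.sm h.deriv_x h.deriv_t h.rv ha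
    hac.ne
  refine ⟨g₁ - G T (a * T + 1), sub_pos.2 (h.lt_top _ _), ?_⟩
  filter_upwards [eventually_ge_atTop T] with t ht
  have h1 := nonpos_of_mul_nonneg_right (hT 0 le_rfl t ht) (sub_neg.2 hac)
  simp only [zero_add] at h1
  linarith [(window_mass_bounds h.sm h.mono t (a * t)).1,
    (window_mass_bounds h.sm h.mono T (a * T)).2]

theorem mass_fast (h : Front q f b a₀ K C G g₁) (hac : 4 * b ^ 2 < a) (hε : 0 < ε) :
    ∀ᶠ t in atTop, g₁ - ε ≤ G t (a * t) := by
  obtain ⟨a', h1, h2⟩ := exists_between hac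
  obtain ⟨T, -, hT⟩ := h.dar.exists_window_mass_monotone h.abs_v_le h.sm h.deriv_x h.deriv_t h.rv
    (h.lt.trans h1) h1.ne'
  obtain ⟨X, hX0, hX⟩ := ((eventually_ge_atTop 0).and
    (((h.top T).comp (tendsto_atTop_add_const_right _ (a' * T) tendsto_id)).eventually
      (eventually_ge_nhds (sub_lt_self g₁ hε)))).exists
  simp only [Function.comp_apply, id_eq] at hX
  filter_upwards [eventually_ge_atTop T, eventually_mul_add_le h2 (X + 1)] with t ht ht2
  have h3 := nonneg_of_mul_nonneg_right (hT X hX0 t ht) (sub_pos.2 h1)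
  linarith [(window_mass_bounds h.sm h.mono T (X + a' * T)).1,
    (window_mass_bounds h.sm h.mono t (X + a' * t)).2,
    h.mono t (show X + a' * t + 1 ≤ a * t by linarith)]

theorem half_le_slow (h : Front q f b a₀ K C G g₁) (ha : a₀ < a) (hac : a < 4 * b ^ 2) :
    ∀ᶠ t in atTop, b / 2 ≤ v f t (a * t) := by
  have hb := h.dar.hb
  obtain ⟨a', h1, h2⟩ := exists_between hac
  obtain ⟨p, hp, hP⟩ := h.mass_slow (ha.trans h1) h2
  obtain ⟨l, hl, hL⟩ := h.forward ha (half_pos hb)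
  filter_upwards [hP, hL, eventually_mul_add_le h1 l,
    eventually_mul_exp_lt (mul_pos hb (sub_pos.2 h1)) hp (C / b) (b * l)] with t hP hL ht he
  by_contra! hv
  have key : ∀ x, a * t + l ≤ x → v f t x ≤ -(b / 2) := fun x hx => by
    linarith [(abs_le.1 (hL _ x le_rfl hx hv.le)).2]
  have h3 := le_mul_exp_of_logDeriv_le (h.dar.hasDerivAt_f t) (h.dar.pos t) ht
    fun x hx => key x hx.1
  have h4 : f t (a' * t) ^ 2 ≤ C * exp (-(b * (a' - a) * t - b * l)) := by
    refine (pow_le_pow_left₀ (h.dar.pos t _).le h3 2).trans ?_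
    rw [mul_pow, ← Real.exp_nat_mul]
    refine mul_le_mul (h.sq_le t _) (exp_le_exp.2 (le_of_eq ?_)) (exp_pos _).le
      ((sq_nonneg _).trans (h.sq_le 0 0))
    push_cast; ring
  have h5 : ∀ᶠ X in atTop, G t X ≤ G t (a' * t) + f t (a' * t) ^ 2 / b := by
    filter_upwards [eventually_ge_atTop (a' * t)] with X hX
    have := h.dar.sub_le_of_logDeriv_le h.deriv_x (half_pos hb) hX
      fun x hx => key x (ht.trans hx.1)
    rw [show 2 * (b / 2) = b by ring] at this
    linarith
  have h6 := le_of_tendsto (h.top t) h5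
  have h7 := div_le_div_of_nonneg_right h4 hb.le
  rw [mul_div_right_comm] at h7
  linarith

theorem le_neg_half_fast (h : Front q f b a₀ K C G g₁) (hac : 4 * b ^ 2 < a) :
    ∀ᶠ t in atTop, v f t (a * t) ≤ -(b / 2) := by
  have hb := h.dar.hb
  obtain ⟨a₁, h1, h1'⟩ := exists_between h.lt
  obtain ⟨a', h2, h2'⟩ := exists_between hac
  obtain ⟨p, hp, hP⟩ := h.mass_slow h1 h1'
  obtain ⟨l, hl, hL⟩ := h.backward h1 (half_pos hb)
  filter_upwards [hP, hL, eventually_mul_add_le h2' l, eventually_ge_atTop 0,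
    h.mass_fast h2 (half_pos hp),
    eventually_mul_exp_lt (mul_pos hb (sub_pos.2 h2')) (half_pos hp) (C / b) (b * l)]
    with t hP hL ht ht0 hF he
  by_contra! hv
  have ha1 : a₁ * t ≤ a' * t := mul_le_mul_of_nonneg_right (h1'.trans h2).le ht0
  have key : ∀ x, a₁ * t ≤ x → x ≤ a * t - l → b / 2 ≤ v f t x := fun x hx hx' => by
    linarith [(abs_le.1 (hL x _ hx (by linarith) hv.le)).1]
  have h3 := mul_exp_le_of_le_logDeriv (h.dar.hasDerivAt_f t) (h.dar.pos t)
    (show a' * t ≤ a * t - l by linarith) fun x hx => key x (ha1.trans hx.1) hx.2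
  have h4 : f t (a' * t) ^ 2 ≤ C * exp (-(b * (a - a') * t - b * l)) := by
    have h5 := (pow_le_pow_left₀ (mul_nonneg (h.dar.pos t _).le (exp_pos _).le) h3 2).trans
      (h.sq_le t _)
    rw [mul_pow, ← Real.exp_nat_mul] at h5
    rw [exp_neg, ← div_eq_mul_inv, le_div_iff₀ (exp_pos _)]
    refine le_trans (le_of_eq ?_) h5
    congr 2
    push_cast; ring
  have h5 := h.dar.sub_le_of_le_logDeriv h.deriv_x (half_pos hb) ha1
    fun x hx => key x hx.1 (by linarith [hx.2])
  rw [show 2 * (b / 2) = b by ring] at h5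
  have h7 := div_le_div_of_nonneg_right h4 hb.le
  rw [mul_div_right_comm] at h7
  linarith

theorem slow (h : Front q f b a₀ K C G g₁) {a₁ : ℝ} (ha : a₀ < a₁) (hac : a < 4 * b ^ 2)
    (hε : 0 < ε) : ∀ᶠ t in atTop, ∀ x, a₁ * t ≤ x → x ≤ a * t → |v f t x - b| ≤ ε := by
  obtain ⟨a', h1, h2⟩ := exists_between (max_lt hac h.lt)
  obtain ⟨l, hl, hL⟩ := h.backward ha hε
  filter_upwards [hL, eventually_mul_add_le ((le_max_left _ _).trans_lt h1) l,
    h.half_le_slow ((le_max_right _ _).trans_lt h1) h2] with t hL ht hv x hx hx'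
  exact hL x (a' * t) hx (by linarith) (by linarith [h.dar.hb])

theorem fast (h : Front q f b a₀ K C G g₁) (hac : 4 * b ^ 2 < a) (hε : 0 < ε) :
    ∀ᶠ t in atTop, ∀ x, a * t ≤ x → |v f t x + b| ≤ ε := by
  obtain ⟨a', h1, h2⟩ := exists_between hac
  obtain ⟨l, hl, hL⟩ := h.forward (h.lt.trans h1) hε
  filter_upwards [hL, eventually_mul_add_le h2 l, h.le_neg_half_fast h1] with t hL ht hv x hx
  exact hL (a' * t) x le_rfl (by linarith) (by linarith [h.dar.hb])

theorem rightVanishing (h : Front q f b a₀ K C G g₁) : RightVanishing q (4 * b ^ 2) := by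
  intro a ha
  have hcc : Continuous (Ric.cub b) := by unfold Ric.cub; fun_prop
  have h1 : Tendsto (fun t => v f t (a * t)) atTop (nhds (-b)) := by
    refine Metric.tendsto_nhds.2 fun ε hε => ?_
    filter_upwards [h.fast ha (half_pos hε)] with t ht
    rw [Real.dist_eq, sub_neg_eq_add]
    linarith [ht _ le_rfl]
  have h2 := ((hcc.tendsto (-b)).comp h1).const_sub (Ric.cub b (-b)) |>.const_mul 4
  have h3 := (h.rv a (h.lt.trans ha)).add h2
  rw [sub_self, mul_zero, add_zero] at h3
  refine h3.congr fun t => ?_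
  have hq := h.dar.sol.sqI t (Set.mem_univ t)
  have hw := h.dar.sol_w.sqI t (Set.mem_univ t)
  have h4 := integral_Ioi_of_hasDerivAt_of_tendsto' (a := a * t)
    (f := fun x => 4 * Ric.cub b (v f t x)) (f' := fun x => q t x ^ 2 - w q b f t x ^ 2)
    (fun x _ => (((h.dar.ric t).hasDerivAt_cub x).const_mul 4).congr_deriv (by
      simp only [w]; ring)) (hq.2.sub hw.2).integrableOn
    (((hcc.tendsto (-b)).comp (h.dar.top t)).const_mul 4)
  rw [integral_sub hq.2.integrableOn hw.2.integrableOn] at h4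
  simp only [Function.comp_apply]
  linarith

theorem exists_center (h : Front q f b a₀ K C G g₁) : ∃ y : ℝ → ℝ,
    Tendsto (fun t => y t / t) atTop (nhds (4 * b ^ 2)) ∧ ∀ᶠ t in atTop, v f t (y t) = 0 := by
  have hb := h.dar.hb
  obtain ⟨a₁, h1, h1'⟩ := exists_between h.lt
  have hex : ∀ t, ∃ y, (∃ y, a₁ * t ≤ y ∧ v f t y = 0) → a₁ * t ≤ y ∧ v f t y = 0 := fun t => by
    by_cases hy : ∃ y, a₁ * t ≤ y ∧ v f t y = 0
    · obtain ⟨y, hy⟩ := hy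
      exact ⟨y, fun _ => hy⟩
    · exact ⟨0, fun h => absurd h hy⟩
  choose y hy using hex
  have hev : ∀ᶠ t in atTop, a₁ * t ≤ y t ∧ v f t (y t) = 0 := by
    filter_upwards [h.slow h1 h1' (half_pos hb), h.fast (lt_add_one _) (half_pos hb),
      eventually_ge_atTop 0] with t hs hf ht
    refine hy t ?_
    have h2 : a₁ * t ≤ (4 * b ^ 2 + 1) * t := mul_le_mul_of_nonneg_right (by linarith) ht
    obtain ⟨z, hz, hz'⟩ := intermediate_value_Icc' h2 (h.dar.sm_v.cx t).continuousOn
      (show (0 : ℝ) ∈ Set.Icc (v f t ((4 * b ^ 2 + 1) * t)) (v f t (a₁ * t)) from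
        ⟨by linarith [(abs_le.1 (hf _ le_rfl)).2], by linarith [(abs_le.1 (hs _ le_rfl le_rfl)).1]⟩)
    exact ⟨z, hz.1, hz'⟩
  refine ⟨y, ?_, hev.mono fun t ht => ht.2⟩
  rw [tendsto_order]
  constructor
  · intro a ha
    filter_upwards [hev, h.slow h1 ha (half_pos hb), eventually_gt_atTop 0] with t ht hs h0
    rw [lt_div_iff₀ h0]
    by_contra! hc
    have := (abs_le.1 (hs _ ht.1 hc)).1
    rw [ht.2] at this
    linarith
  · intro a ha
    filter_upwards [hev, h.fast ha (half_pos hb), eventually_gt_atTop 0] with t ht hs h0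
    rw [div_lt_iff₀ h0]
    by_contra! hc
    have := (abs_le.1 (hs _ hc)).2
    rw [ht.2] at this
    linarith

end Front

/-- Locally uniform convergence as `t → ∞`. -/
def LocU (v : ℝ → ℝ → ℝ) (V : ℝ → ℝ) : Prop :=
  ∀ R ε, 0 < ε → ∀ᶠ t in atTop, ∀ x, |x| ≤ R → |v t x - V x| ≤ ε

/-- Convergence in `L²_loc` as `t → ∞`. -/
def LocL2 (w : ℝ → ℝ → ℝ) (S : ℝ → ℝ) : Prop :=
  ∀ R ε, 0 < ε → ∀ᶠ t in atTop, ∫ x in (-R)..R, (w t x - S x) ^ 2 ≤ ε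

theorem abs_le_of_linear_ode_backward {d a e : ℝ → ℝ}
    (hd : ∀ x, HasDerivAt d (a x * d x + e x) x)
    (ha : Continuous a) (he : Continuous e) {x₀ x₁ α C η : ℝ} (hx : x₀ ≤ x₁)
    (hα : ∀ x ∈ Set.Icc x₀ x₁, -α ≤ a x) (hC : ∀ s ∈ Set.Icc x₀ x₁, exp (α * (s - x₀)) ≤ C)
    (hη : 0 < η) (h : ∫ x in x₀..x₁, e x ^ 2 ≤ η ^ 2) :
    |d x₀| ≤ exp (α * (x₁ - x₀)) * |d x₁| + C * (η * (1 + (x₁ - x₀))) := by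
  have h1 := abs_le_of_linear_ode (d := fun x => d (-x)) (a := fun x => -a (-x))
    (e := fun x => -e (-x)) (x₀ := -x₁) (x₁ := -x₀) (α := α) (C := C) (η := η)
    (fun x => (hasDerivAt_neg_arg (hd (-x))).congr_deriv (by ring))
    (ha.comp continuous_neg).neg (he.comp continuous_neg).neg (neg_le_neg hx)
    (fun x hx => by linarith [hα (-x) ⟨by linarith [hx.2], by linarith [hx.1]⟩])
    (fun s hs => by
      have := hC (-s) ⟨by linarith [hs.2], by linarith [hs.1]⟩
      rwa [show -s - x₀ = -x₀ - s by ring] at this) hη (by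
      simp only [neg_sq]
      rwa [intervalIntegral.integral_comp_neg (fun x => e x ^ 2), neg_neg, neg_neg])
  simp only [neg_neg] at h1
  rwa [show -x₀ - -x₁ = x₁ - x₀ by ring] at h1

theorem intervalIntegral_sq_le_symm {g : ℝ → ℝ} (hg : Continuous g) {x₀ x₁ R : ℝ} (h0 : -R ≤ x₀)
    (h : x₀ ≤ x₁) (h1 : x₁ ≤ R) : ∫ x in x₀..x₁, g x ^ 2 ≤ ∫ x in (-R)..R, g x ^ 2 :=
  intervalIntegral.integral_mono_interval h0 h h1 (Eventually.of_forall fun _ => sq_nonneg _)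
    ((hg.pow 2).intervalIntegrable _ _)

section Window
variable {v w p : ℝ → ℝ → ℝ} {V S P : ℝ → ℝ} {β K ℓ : ℝ}

theorem hasDerivAt_riccati_sub {v V w S : ℝ → ℝ} {x : ℝ}
    (hv : HasDerivAt v (v x ^ 2 - β ^ 2 - w x) x) (hV : HasDerivAt V (V x ^ 2 - β ^ 2 - S x) x) :
    HasDerivAt (fun x => v x - V x) ((v x + V x) * (v x - V x) + (S x - w x)) x :=
  (hv.sub hV).congr_deriv (by ring)

theorem LocU.of_window (hv : ∀ t x, HasDerivAt (v t) (v t x ^ 2 - β ^ 2 - w t x) x)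
    (hw : ∀ t, Continuous (w t)) (hK : ∀ t x, |v t x| ≤ K)
    (hV : ∀ x, HasDerivAt V (V x ^ 2 - β ^ 2 - S x) x) (hS : Continuous S) (hVK : ∀ x, |V x| ≤ K)
    (hwS : LocL2 w S) (hp : LocU p P) (hpos : ∀ R, ∀ᶠ t in atTop, ∀ x, x ≤ R → -p t x ≤ v t x)
    (hℓ : 0 < ℓ) (hlim : ∀ᶠ x in atTop, ℓ ≤ V x - P x) : LocU v V := by
  intro R' ε hε
  obtain ⟨R, hR⟩ : ∃ R, R = max R' 0 := ⟨_, rfl⟩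
  have hR0 : 0 ≤ R := hR ▸ le_max_right _ _
  have hK0 : 0 ≤ K := (abs_nonneg _).trans (hVK 0)
  obtain ⟨X₁, hX₁⟩ := eventually_atTop.1 hlim
  obtain ⟨X₀, hX₀⟩ : ∃ X, X = max X₁ R := ⟨_, rfl⟩
  have hXR : R ≤ X₀ := hX₀ ▸ le_max_right _ _
  have hXl : ∀ x, X₀ ≤ x → ℓ ≤ V x - P x := fun x hx =>
    hX₁ x ((le_max_left _ _).trans (hX₀.symm.le.trans hx))
  obtain ⟨E, hE⟩ : ∃ E, E = exp (2 * K * (X₀ + R)) := ⟨_, rfl⟩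
  have hE0 : 0 < E := hE ▸ exp_pos _
  obtain ⟨L, hL, hL0⟩ := ((eventually_mul_exp_lt (half_pos hℓ) (by positivity : 0 < ε / 3)
    (E * (2 * K)) 0).and (eventually_ge_atTop 0)).exists
  rw [sub_zero] at hL
  obtain ⟨η, hη⟩ : ∃ η, η = ε / (3 * E * (1 + L + (X₀ + R))) := ⟨_, rfl⟩
  have hη0 : 0 < η := by rw [hη]; have : 0 ≤ X₀ := hR0.trans hXR; positivity
  have hη1 : E * (η * (1 + L + (X₀ + R))) = ε / 3 := by
    have : 0 ≤ X₀ := hR0.trans hXR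
    rw [hη]; field_simp
  filter_upwards [hwS (X₀ + L) (η ^ 2) (pow_pos hη0 2), hp (X₀ + L) (ℓ / 2) (half_pos hℓ),
    hpos (X₀ + L)] with t h1 h2 h3 x hx
  have hxR : |x| ≤ R := hx.trans (hR ▸ le_max_left _ _)
  have hcv : Continuous (v t) := continuous_iff_continuousAt.2 fun x => (hv t x).continuousAt
  have hcV : Continuous V := continuous_iff_continuousAt.2 fun x => (hV x).continuousAt
  have hd := fun x => hasDerivAt_riccati_sub (hv t x) (hV x)
  have h1' : ∫ x in (-(X₀ + L))..(X₀ + L), (S x - w t x) ^ 2 ≤ η ^ 2 := by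
    refine le_of_eq_of_le (intervalIntegral.integral_congr fun x _ => ?_) h1
    ring
  have hx0 : x ≤ X₀ := (le_abs_self x).trans (hxR.trans hXR)
  have hx1 : -R ≤ x := (abs_le.1 hxR).1
  have g1 := abs_le_of_linear_ode_backward hd (hcv.add hcV) (hS.sub (hw t))
    (x₀ := X₀) (x₁ := X₀ + L) (α := -(ℓ / 2)) (C := 1) (η := η) (by linarith)
    (fun y hy => by
      have e1 := hXl y hy.1
      have e2 := (abs_le.1 (h2 y (abs_le.2 ⟨by linarith [hy.1], hy.2⟩))).2
      have e3 := h3 y hy.2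
      linarith)
    (fun s hs => exp_le_one_iff.2
      (mul_nonpos_of_nonpos_of_nonneg (by linarith) (by linarith [hs.1]))) hη0
    ((intervalIntegral_sq_le_symm (hS.sub (hw t)) (by linarith) (by linarith) le_rfl).trans h1')
  have g2 := abs_le_of_linear_ode_backward hd (hcv.add hcV) (hS.sub (hw t))
    (x₀ := x) (x₁ := X₀) (α := 2 * K) (C := E) (η := η) hx0
    (fun y _ => by linarith [(abs_le.1 (hK t y)).1, (abs_le.1 (hVK y)).1])
    (fun s hs => hE ▸ exp_le_exp.2 (mul_le_mul_of_nonneg_left (by linarith [hs.2])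
      (by positivity))) hη0
    ((intervalIntegral_sq_le_symm (hS.sub (hw t)) (by linarith) hx0 (by linarith)).trans h1')
  have g3 : exp (2 * K * (X₀ - x)) ≤ E :=
    hE ▸ exp_le_exp.2 (mul_le_mul_of_nonneg_left (by linarith) (by positivity))
  have g4 : |v t (X₀ + L) - V (X₀ + L)| ≤ 2 * K := by
    have := abs_sub (v t (X₀ + L)) (V (X₀ + L))
    linarith [hK t (X₀ + L), hVK (X₀ + L)]
  rw [show X₀ + L - X₀ = L by ring, one_mul] at g1
  have g5 := mul_le_mul_of_nonneg_left g4 (exp_pos (-(ℓ / 2) * L)).le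
  have g6 := mul_le_mul_of_nonneg_left (g1.trans (add_le_add_left g5 _)) hE0.le
  have g7 := mul_le_mul_of_nonneg_right g3 (abs_nonneg (v t X₀ - V X₀))
  have g8 : E * (η * (1 + (X₀ - x))) ≤ E * (η * (1 + (X₀ + R))) := by gcongr; linarith
  have g9 : E * (η * (1 + L)) + E * (η * (1 + (X₀ + R))) = ε / 3 + E * η := by rw [← hη1]; ring
  have g10 : E * (η * 1) ≤ E * (η * (1 + L + (X₀ + R))) := by gcongr; linarith
  rw [show -(ℓ / 2) * L = -(ℓ / 2 * L) by ring] at g6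
  have g11 : E * (exp (-(ℓ / 2 * L)) * (2 * K) + η * (1 + L)) =
    E * (2 * K) * exp (-(ℓ / 2 * L)) + E * (η * (1 + L)) := by ring
  linarith

theorem LocU.of_zero (hv : ∀ t x, HasDerivAt (v t) (v t x ^ 2 - β ^ 2 - w t x) x)
    (hw : ∀ t, Continuous (w t)) (hK : ∀ t x, |v t x| ≤ K)
    (hV : ∀ x, HasDerivAt V (V x ^ 2 - β ^ 2 - S x) x) (hS : Continuous S) (hVK : ∀ x, |V x| ≤ K)
    (hwS : LocL2 w S) (h0 : ∀ᶠ t in atTop, v t 0 = V 0) : LocU v V := by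
  intro R' ε hε
  obtain ⟨R, hR⟩ : ∃ R, R = max R' 0 := ⟨_, rfl⟩
  have hR0 : 0 ≤ R := hR ▸ le_max_right _ _
  have hK0 : 0 ≤ K := (abs_nonneg _).trans (hVK 0)
  obtain ⟨E, hE⟩ : ∃ E, E = exp (2 * K * R) := ⟨_, rfl⟩
  have hE0 : 0 < E := hE ▸ exp_pos _
  obtain ⟨η, hη⟩ : ∃ η, η = ε / (E * (1 + R)) := ⟨_, rfl⟩
  have hη0 : 0 < η := by rw [hη]; positivity
  have hη1 : E * (η * (1 + R)) = ε := by rw [hη]; field_simp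
  filter_upwards [hwS R (η ^ 2) (pow_pos hη0 2), h0] with t h1 h2 x hx
  have hxR := abs_le.1 (hx.trans (hR ▸ le_max_left _ _ : R' ≤ R))
  have hcv : Continuous (v t) := continuous_iff_continuousAt.2 fun x => (hv t x).continuousAt
  have hcV : Continuous V := continuous_iff_continuousAt.2 fun x => (hV x).continuousAt
  have hd := fun x => hasDerivAt_riccati_sub (hv t x) (hV x)
  have h1' : ∫ x in (-R)..R, (S x - w t x) ^ 2 ≤ η ^ 2 := by
    refine le_of_eq_of_le (intervalIntegral.integral_congr fun x _ => ?_) h1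
    ring
  have hb : ∀ y, |v t y + V y| ≤ 2 * K := fun y => (abs_add_le _ _).trans (by
    linarith [hK t y, hVK y])
  have hexp : ∀ s, s ≤ R → exp (2 * K * s) ≤ E := fun s hs =>
    hE ▸ exp_le_exp.2 (mul_le_mul_of_nonneg_left hs (by positivity))
  rcases le_total x 0 with hx0 | hx0
  · have g := abs_le_of_linear_ode_backward hd (hcv.add hcV) (hS.sub (hw t)) (α := 2 * K) (C := E)
      hx0 (fun y _ => (abs_le.1 (hb y)).1) (fun s hs => hexp _ (by linarith [hs.2])) hη0
      ((intervalIntegral_sq_le_symm (hS.sub (hw t)) hxR.1 hx0 hR0).trans h1')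
    rw [h2, sub_self, abs_zero, mul_zero, zero_add] at g
    refine g.trans (hη1 ▸ ?_)
    gcongr; linarith
  · have g := abs_le_of_linear_ode hd (hcv.add hcV) (hS.sub (hw t)) (α := 2 * K) (C := E)
      hx0 (fun y _ => (abs_le.1 (hb y)).2) (fun s hs => hexp _ (by linarith [hs.1])) hη0
      ((intervalIntegral_sq_le_symm (hS.sub (hw t)) (by linarith) hx0 hxR.2).trans h1')
    rw [h2, sub_self, abs_zero, mul_zero, zero_add] at g
    refine g.trans (hη1 ▸ ?_)
    gcongr; linarith

theorem LocL2.darboux (hcv : ∀ t, Continuous (v t)) (hcV : Continuous V)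
    (hw : ∀ t, Continuous (w t)) (hS : Continuous S) (hK : ∀ t x, |v t x| ≤ K)
    (hVK : ∀ x, |V x| ≤ K) (hwS : LocL2 w S) (h : LocU v V) :
    LocL2 (fun t x => 2 * (v t x ^ 2 - β ^ 2) - w t x) (fun x => 2 * (V x ^ 2 - β ^ 2) - S x) := by
  intro R' ε hε
  obtain ⟨R, hR⟩ : ∃ R, R = max R' 0 := ⟨_, rfl⟩
  have hR0 : 0 ≤ R := hR ▸ le_max_right _ _
  have hK0 : 0 ≤ K := (abs_nonneg _).trans (hVK 0)
  obtain ⟨ρ, hρ⟩ : ∃ ρ, ρ = ε / (4 * (16 * K ^ 2 + 1) * (2 * R + 1)) := ⟨_, rfl⟩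
  have hρ0 : 0 < ρ := by rw [hρ]; positivity
  filter_upwards [h R (√ρ) (Real.sqrt_pos.2 hρ0), hwS R (ε / 4) (by positivity)] with t h1 h2
  have c1 := hcv t
  have c2 := hw t
  have key : ∫ x in (-R)..R, (2 * (v t x ^ 2 - β ^ 2) - w t x - (2 * (V x ^ 2 - β ^ 2) - S x)) ^ 2 ≤
      ε := by
    have m := intervalIntegral.integral_mono_on (μ := volume)
      (f := fun x => (2 * (v t x ^ 2 - β ^ 2) - w t x - (2 * (V x ^ 2 - β ^ 2) - S x)) ^ 2)
      (g := fun x => 32 * K ^ 2 * ρ + 2 * (w t x - S x) ^ 2) (show -R ≤ R by linarith)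
      (Continuous.intervalIntegrable (by fun_prop) _ _)
      (Continuous.intervalIntegrable (by fun_prop) _ _) fun x hx => by
        have e1 : (v t x - V x) ^ 2 ≤ ρ := by
          rw [← Real.sq_sqrt hρ0.le, ← sq_abs]
          exact pow_le_pow_left₀ (abs_nonneg _) (h1 x (abs_le.2 hx)) 2
        have e2 : (v t x + V x) ^ 2 ≤ 4 * K ^ 2 := by
          rw [← sq_abs, show 4 * K ^ 2 = (2 * K) ^ 2 by ring]
          exact pow_le_pow_left₀ (abs_nonneg _) ((abs_add_le _ _).trans (by
            linarith [hK t x, hVK x])) 2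
        have e3 := mul_le_mul e2 e1 (sq_nonneg _) (by positivity)
        rw [← mul_pow] at e3
        nlinarith [sq_nonneg (2 * ((v t x + V x) * (v t x - V x)) + (w t x - S x))]
    rw [intervalIntegral.integral_add (Continuous.intervalIntegrable (by fun_prop) _ _)
      (Continuous.intervalIntegrable (by fun_prop) _ _), intervalIntegral.integral_const,
      intervalIntegral.integral_const_mul, smul_eq_mul] at m
    have e4 : (R - -R) * (32 * K ^ 2 * ρ) ≤ ε / 2 := by
      have : ρ * (4 * (16 * K ^ 2 + 1) * (2 * R + 1)) = ε := by rw [hρ]; field_simp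
      have := mul_nonneg hρ0.le hR0
      nlinarith [mul_nonneg (mul_nonneg hρ0.le hR0) (sq_nonneg K), mul_nonneg hρ0.le (sq_nonneg K)]
    linarith
  rcases le_total 0 R' with h0 | h0
  · rwa [hR, max_eq_left h0] at key
  · rw [intervalIntegral.integral_symm]
    have := intervalIntegral.integral_nonneg (μ := volume) (f := fun x =>
      (2 * (v t x ^ 2 - β ^ 2) - w t x - (2 * (V x ^ 2 - β ^ 2) - S x)) ^ 2)
      (show R' ≤ -R' by linarith) fun _ _ => sq_nonneg _
    linarith

end Window

theorem hasDerivAt_tanh (x : ℝ) : HasDerivAt tanh (1 - tanh x ^ 2) x := by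
  have h := (hasDerivAt_sinh x).div (hasDerivAt_cosh x) (cosh_pos x).ne'
  have e : (sinh / cosh : ℝ → ℝ) = tanh := funext fun y => (tanh_eq_sinh_div_cosh y).symm
  rw [e] at h
  refine h.congr_deriv ?_
  rw [tanh_eq_sinh_div_cosh]
  have := (cosh_pos x).ne'
  field_simp

theorem continuous_tanh : Continuous tanh :=
  continuous_iff_continuousAt.2 fun x => (hasDerivAt_tanh x).continuousAt

theorem tanh_add_mul (x y : ℝ) :
    tanh (x + y) * (1 + tanh x * tanh y) = tanh x + tanh y := by
  have h1 := cosh_pos x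
  have h2 := cosh_pos y
  have h3 := cosh_pos (x + y)
  simp only [tanh_eq_sinh_div_cosh, sinh_add]
  rw [cosh_add] at *
  field_simp
  rw [mul_div_cancel_right₀]
  rw [mul_comm (cosh y)]
  exact h3.ne'

theorem one_sub_tanh_sq (x : ℝ) : 1 - tanh x ^ 2 = 1 / cosh x ^ 2 := by
  have h := cosh_sq x
  have := (cosh_pos x).ne'
  rw [tanh_eq_sinh_div_cosh, div_pow]
  field_simp
  linarith

theorem tendsto_tanh_atTop : Tendsto tanh atTop (nhds 1) := by
  have h : ∀ x : ℝ, 1 - exp (-x) ≤ tanh x := fun x => by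
    have h1 := cosh_sub_sinh x
    have h2 := cosh_pos x
    rw [tanh_eq_sinh_div_cosh, le_div_iff₀ h2]
    have := mul_le_mul_of_nonneg_left (one_le_cosh x) (exp_pos (-x)).le
    linarith
  have h2 := tendsto_exp_neg_atTop_nhds_zero.const_sub 1
  rw [sub_zero] at h2
  exact tendsto_of_tendsto_of_tendsto_of_le_of_le h2 tendsto_const_nhds h
    fun x => (tanh_lt_one x).le

/-- The soliton profile `-2β² sech²(βx)`. -/
noncomputable def Sol (β x : ℝ) : ℝ := -(2 * β ^ 2) * (1 - tanh (β * x) ^ 2)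

theorem continuous_sol (β : ℝ) : Continuous (Sol β) := by
  have := continuous_tanh.comp (continuous_const_mul β)
  unfold Sol
  fun_prop

theorem exists_window_profile {β κ : ℝ} (hκ : 0 < κ) (hβ : κ < β) (s : ℝ) : ∃ V : ℝ → ℝ, ∃ s' : ℝ,
    (∀ x, HasDerivAt V (V x ^ 2 - β ^ 2 - Sol κ (x - s)) x) ∧ (∀ x, |V x| ≤ β + 2 * κ) ∧
    Tendsto V atTop (nhds β) ∧ ∀ x, 2 * (V x ^ 2 - β ^ 2) - Sol κ (x - s) = Sol κ (x - s') := by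
  have hβ0 := hκ.trans hβ
  have hm : κ / β ∈ Set.Ioo (-1) 1 :=
    ⟨by linarith [div_pos hκ hβ0], (div_lt_one hβ0).2 hβ⟩
  obtain ⟨d, hd⟩ : ∃ d, d = artanh (κ / β) := ⟨_, rfl⟩
  have hd' : tanh d = κ / β := hd ▸ tanh_artanh hm
  have key : ∀ z, β * (tanh (z + d) - tanh z) = κ * (1 - tanh z * tanh (z + d)) := fun z => by
    have := tanh_add_mul z d
    rw [hd'] at this
    field_simp at this
    linarith
  have hT : ∀ z, |tanh z| ≤ 1 := fun z => (abs_tanh_lt_one z).le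
  have key2 : ∀ z, (β - κ * (tanh (z + d) - tanh z)) ^ 2 - β ^ 2 =
      κ ^ 2 * (tanh (z + d) ^ 2 + tanh z ^ 2 - 2) := fun z => by
    linear_combination -2 * κ * key z
  have lin : ∀ c : ℝ, Tendsto (fun x => κ * (x - s) + c) atTop atTop := fun c =>
    tendsto_atTop_add_const_right _ _ ((tendsto_atTop_add_const_right _ (-s)
      tendsto_id).const_mul_atTop hκ)
  have e : ∀ x, κ * (x - (s - d / κ)) = κ * (x - s) + d := fun x => by field_simp; ring
  refine ⟨fun x => β - κ * (tanh (κ * (x - s) + d) - tanh (κ * (x - s))), s - d / κ, fun x => ?_,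
    fun x => ?_, ?_, fun x => ?_⟩
  · have hz : HasDerivAt (fun x => κ * (x - s)) κ x := by
      simpa using ((hasDerivAt_id x).sub_const s).const_mul κ
    have h1 := (hasDerivAt_tanh (κ * (x - s) + d)).comp x (hz.add_const d)
    have h2 := (hasDerivAt_tanh (κ * (x - s))).comp x hz
    refine (((h1.sub h2).const_mul κ).const_sub β).congr_deriv ?_
    rw [key2, Sol]
    ring
  · have h1 := abs_le.1 (hT (κ * (x - s) + d))
    have h2 := abs_le.1 (hT (κ * (x - s)))
    have h3 := mul_le_mul_of_nonneg_left
      (show tanh (κ * (x - s) + d) - tanh (κ * (x - s)) ≤ 2 by linarith) hκ.le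
    have h4 := mul_le_mul_of_nonneg_left
      (show -2 ≤ tanh (κ * (x - s) + d) - tanh (κ * (x - s)) by linarith) hκ.le
    exact abs_le.2 ⟨by linarith, by linarith⟩
  · have h1 := (tendsto_tanh_atTop.comp (lin d)).sub (tendsto_tanh_atTop.comp (lin 0))
    simpa using (h1.const_mul κ).const_sub β
  · rw [key2, Sol, Sol, e]
    ring

theorem Dar.add_pos_of_pos {q f f' Q' : ℝ → ℝ → ℝ} {b b' : ℝ} (h : Dar q b f) (h' : Dar Q' b' f')
    (hw : Dar.w Q' b' f' = q) (hb : b < b') {t X x : ℝ} (hX : 0 < Dar.v f t X + Dar.v f' t X)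
    (hx : x ≤ X) : 0 < Dar.v f t x + Dar.v f' t x := by
  have cg : Continuous fun x => Dar.v f' t x - Dar.v f t x := (h'.sm_v.cx t).sub (h.sm_v.cx t)
  have hd : ∀ x, HasDerivAt (fun x => (Dar.v f t x + Dar.v f' t x) *
      exp (-∫ y in (0 : ℝ)..x, (Dar.v f' t y - Dar.v f t y)))
      (-(b' ^ 2 - b ^ 2) * exp (-∫ y in (0 : ℝ)..x, (Dar.v f' t y - Dar.v f t y))) x := fun x => by
    have h1 := (h.ric t x).add (h'.hasDerivAt_v t x)
    refine (h1.mul (cg.integral_hasStrictDerivAt 0 x).hasDerivAt.neg.exp).congr_deriv ?_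
    rw [hw]
    simp only [Pi.add_apply, Pi.neg_apply]
    ring
  have anti := antitone_of_hasDerivAt_nonpos hd fun x => by
    simp only [Pi.zero_apply]
    have : b ^ 2 < b' ^ 2 := pow_lt_pow_left₀ hb h.hb.le two_ne_zero
    exact mul_nonpos_of_nonpos_of_nonneg (by linarith) (exp_pos _).le
  have := (mul_pos hX (exp_pos (-∫ y in (0 : ℝ)..X, (Dar.v f' t y - Dar.v f t y)))).trans_le (anti hx)
  exact pos_of_mul_pos_left this (exp_pos _).le

/-- A chain of Darboux transforms with increasing eigenvalues, removing the solitons one by one. -/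
structure Chain (N : ℕ) (q f : ℕ → ℝ → ℝ → ℝ) (β : ℕ → ℝ) (a₀ : ℝ) : Prop where
  dar : ∀ j < N, Dar (q (j + 1)) (β j) (f j)
  w_eq : ∀ j < N, Dar.w (q (j + 1)) (β j) (f j) = q j
  lt : ∀ j, j + 1 < N → β j < β (j + 1)
  rv : RightVanishing (q 0) a₀
  lt_zero : a₀ < 4 * β 0 ^ 2

namespace Chain
variable {N : ℕ} {q f : ℕ → ℝ → ℝ → ℝ} {β : ℕ → ℝ} {a₀ : ℝ}

theorem exists_front (h : Chain N q f β a₀) : ∀ j < N, ∃ K C G g₁,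
    Front (q (j + 1)) (f j) (β j) (if j = 0 then a₀ else 4 * β (j - 1) ^ 2) K C G g₁ := by
  intro j
  induction j with
  | zero =>
    intro hj
    rw [if_pos rfl]
    exact (h.dar 0 hj).exists_front (by rw [h.w_eq 0 hj]; exact h.rv) h.lt_zero
  | succ j ih =>
    intro hj
    obtain ⟨K, C, G, g₁, hF⟩ := ih (by omega)
    rw [if_neg (Nat.succ_ne_zero j), Nat.add_sub_cancel]
    refine (h.dar _ hj).exists_front (by rw [h.w_eq _ hj]; exact hF.rightVanishing) ?_
    have := pow_lt_pow_left₀ (h.lt j hj) hF.dar.hb.le two_ne_zero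
    linarith

theorem strictMono (h : Chain N q f β a₀) {k m : ℕ} (hkm : k ≤ m) (hm : m < N) : β k ≤ β m := by
  induction m, hkm using Nat.le_induction with
  | base => rfl
  | succ m hkm ih => exact (ih (by omega)).trans (h.lt m hm).le

theorem eventually_neg_v_le (h : Chain N q f β a₀) {m : ℕ} (hm : m + 1 < N) {a : ℝ}
    {y : ℝ → ℝ} (hy : Tendsto (fun t => y t / t) atTop (nhds a)) (ha : a ≤ 4 * β m ^ 2) (R : ℝ) :
    ∀ᶠ t in atTop, ∀ x, x ≤ R → -Dar.v (f m) t (y t + x) ≤ Dar.v (f (m + 1)) t (y t + x) := by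
  obtain ⟨K, C, G, g₁, hF⟩ := h.exists_front m (by omega)
  obtain ⟨K', C', G', g₁', hF'⟩ := h.exists_front (m + 1) hm
  rw [if_neg (Nat.succ_ne_zero m), Nat.add_sub_cancel] at hF'
  obtain ⟨a₂, h2, h2'⟩ := exists_between hF'.lt
  obtain ⟨a₁, h1, h1'⟩ := exists_between (ha.trans_lt h2)
  have hε : 0 < (β (m + 1) - β m) / 4 := by linarith [h.lt m hm]
  filter_upwards [hF.fast h2 hε, hF'.slow h2 h2' hε, eventually_gt_atTop 0,
    eventually_mul_add_le h1' R, hy.eventually (eventually_lt_nhds h1)] with t e1 e2 ht e3 e4 x hx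
  rw [div_lt_iff₀ ht] at e4
  have h0 : a₂ * t ≤ a₂ * t := le_rfl
  have e5 := hF.dar.add_pos_of_pos hF'.dar (h.w_eq _ hm) (h.lt m hm) (t := t) (X := a₂ * t)
    (x := y t + x) (by
      linarith [(abs_le.1 (e1 _ h0)).1, (abs_le.1 (e2 _ h0 (by
        exact mul_le_mul_of_nonneg_right le_rfl ht.le))).1]) (by linarith)
  linarith

end Chain

theorem LocL2.shift {q : ℝ → ℝ → ℝ} {y : ℝ → ℝ} {S : ℝ → ℝ} {s : ℝ}
    (hq : ∀ t, Continuous (q t)) (hS : Continuous S)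
    (h : LocL2 (fun t x => q t (y t + x)) fun x => S (x - s)) :
    LocL2 (fun t x => q t (y t + s + x)) S := by
  intro R ε hε
  filter_upwards [h (|R| + |s|) ε hε] with t ht
  have hc : Continuous fun x => q t (y t + x) - S (x - s) :=
    ((hq t).comp (continuous_const.add continuous_id)).sub
      (hS.comp (continuous_id.sub continuous_const))
  have e : ∀ x, (q t (y t + s + x) - S x) ^ 2 =
      (fun x => (q t (y t + x) - S (x - s)) ^ 2) (s + x) := fun x => by
    simp only [add_sub_cancel_left, add_assoc]
  simp only [e]
  rw [intervalIntegral.integral_comp_add_left (fun x => (q t (y t + x) - S (x - s)) ^ 2)]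
  rcases le_total 0 R with h0 | h0
  · rw [abs_of_nonneg h0] at ht
    exact (intervalIntegral_sq_le_symm hc (by linarith [neg_abs_le s]) (by linarith)
      (by linarith [le_abs_self s])).trans ht
  · rw [intervalIntegral.integral_symm]
    have := intervalIntegral.integral_nonneg (μ := volume)
      (f := fun x => (q t (y t + x) - S (x - s)) ^ 2)
      (show s + R ≤ s + -R by linarith) fun _ _ => sq_nonneg _
    linarith

theorem RightVanishing.locL2 {q : ℝ → ℝ → ℝ} {a₀ a : ℝ} {y : ℝ → ℝ} (h : RightVanishing q a₀)
    (hq : ∀ t, SqI (q t)) (ha : a₀ < a) (hy : Tendsto (fun t => y t / t) atTop (nhds a)) :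
    LocL2 (fun t x => q t (y t + x)) fun _ => 0 := by
  intro R ε hε
  obtain ⟨a₂, h2, h2'⟩ := exists_between ha
  obtain ⟨a₁, h1, h1'⟩ := exists_between h2
  filter_upwards [h.eventually_le hq h1 hε, hy.eventually (eventually_gt_nhds h2'),
    eventually_mul_add_le h1' R, eventually_gt_atTop 0] with t e1 e2 e3 ht
  rw [lt_div_iff₀ ht] at e2
  simp only [sub_zero]
  rw [intervalIntegral.integral_comp_add_left (fun x => q t x ^ 2)]
  exact e1 _ _ (by linarith)

theorem hasDerivAt_translate {g : ℝ → ℝ} {g' c x : ℝ} (h : HasDerivAt g g' (c + x)) :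
    HasDerivAt (fun x => g (c + x)) g' x :=
  h.comp_const_add c x

namespace Chain
variable {N : ℕ} {q f : ℕ → ℝ → ℝ → ℝ} {β : ℕ → ℝ} {a₀ : ℝ}

theorem window_base (h : Chain N q f β a₀) {k : ℕ} (hk : k < N) : ∃ y : ℝ → ℝ,
    Tendsto (fun t => y t / t) atTop (nhds (4 * β k ^ 2)) ∧
    LocU (fun t x => Dar.v (f k) t (y t + x)) (fun x => -(β k * tanh (β k * x))) ∧
    LocL2 (fun t x => q (k + 1) t (y t + x)) (Sol (β k)) := by
  obtain ⟨K, C, G, g₁, hF⟩ := h.exists_front k hk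
  obtain ⟨y, hy, h0⟩ := hF.exists_center
  have hD := hF.dar
  have hb := hD.hb
  have hw := hF.rv.locL2 (fun t => hD.sol_w.sqI t (Set.mem_univ t)) hF.lt hy
  have cy : ∀ t, Continuous fun x : ℝ => y t + x := fun t => continuous_const.add continuous_id
  have hV : ∀ x, HasDerivAt (fun x => -(β k * tanh (β k * x)))
      ((-(β k * tanh (β k * x))) ^ 2 - β k ^ 2 - 0) x := fun x => by
    have hz : HasDerivAt (fun x => β k * x) (β k) x := by
      simpa using (hasDerivAt_id x).const_mul (β k)
    exact (((hasDerivAt_tanh _).comp x hz).const_mul (β k)).neg.congr_deriv (by ring)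
  have hcV : Continuous fun x => -(β k * tanh (β k * x)) :=
    continuous_iff_continuousAt.2 fun x => (hV x).continuousAt
  have hVK : ∀ x, |-(β k * tanh (β k * x))| ≤ β k := fun x => by
    rw [abs_neg, abs_mul, abs_of_pos hb]
    exact mul_le_of_le_one_right hb.le (abs_tanh_lt_one _).le
  have hU : LocU (fun t x => Dar.v (f k) t (y t + x)) (fun x => -(β k * tanh (β k * x))) :=
    LocU.of_zero (K := max K (β k)) (S := fun _ => 0)
      (fun t x => hasDerivAt_translate (hD.hasDerivAt_v t (y t + x)))
      (fun t => (hD.sm_w.cx t).comp (cy t)) (fun t x => (hF.abs_v_le _ _).trans (le_max_left _ _))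
      hV continuous_const (fun x => (hVK x).trans (le_max_right _ _)) hw
      (h0.mono fun t ht => by simp [ht])
  refine ⟨y, hy, hU, ?_⟩
  have := LocL2.darboux (β := β k) (K := max K (β k)) (fun t => (hD.sm_v.cx t).comp (cy t)) hcV
    (fun t => (hD.sm_w.cx t).comp (cy t)) continuous_const
    (fun t x => (hF.abs_v_le _ _).trans (le_max_left _ _))
    (fun x => (hVK x).trans (le_max_right _ _)) hw hU
  have e1 : (fun x => 2 * ((-(β k * tanh (β k * x))) ^ 2 - β k ^ 2) - 0) = Sol (β k) :=
    funext fun x => by rw [Sol]; ring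
  have e2 : (fun t x => 2 * (Dar.v (f k) t (y t + x) ^ 2 - β k ^ 2) -
      Dar.w (q (k + 1)) (β k) (f k) t (y t + x)) = fun t x => q (k + 1) t (y t + x) :=
    funext fun t => funext fun x => by rw [Dar.w]; ring
  rw [← e1, ← e2]
  exact this

theorem window_step (h : Chain N q f β a₀) {k m : ℕ} (hkm : k ≤ m) (hm : m + 1 < N) {y : ℝ → ℝ}
    (hy : Tendsto (fun t => y t / t) atTop (nhds (4 * β k ^ 2))) {P : ℝ → ℝ} {l s : ℝ}
    (hU : LocU (fun t x => Dar.v (f m) t (y t + x)) P) (hP : Tendsto P atTop (nhds l))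
    (hl : l ≤ β m) (hq : LocL2 (fun t x => q (m + 1) t (y t + x)) fun x => Sol (β k) (x - s)) :
    ∃ P' s', LocU (fun t x => Dar.v (f (m + 1)) t (y t + x)) P' ∧
      Tendsto P' atTop (nhds (β (m + 1))) ∧
      LocL2 (fun t x => q (m + 1 + 1) t (y t + x)) fun x => Sol (β k) (x - s') := by
  obtain ⟨K, C, G, g₁, hF⟩ := h.exists_front (m + 1) hm
  have hD := hF.dar
  have hk0 := (h.dar k (by omega)).hb
  have hkb := (h.strictMono hkm (by omega)).trans_lt (h.lt m hm)
  obtain ⟨V, s', hV, hVb, hVt, hVs⟩ := exists_window_profile hk0 hkb s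
  have cy : ∀ t, Continuous fun x : ℝ => y t + x := fun t => continuous_const.add continuous_id
  have cS : Continuous fun x => Sol (β k) (x - s) :=
    (continuous_sol _).comp (continuous_id.sub continuous_const)
  have hw : ∀ t, Continuous fun x => q (m + 1) t (y t + x) := fun t => by
    have := hD.sm_w.cx t
    rw [h.w_eq _ hm] at this
    exact this.comp (cy t)
  obtain ⟨M, hM⟩ : ∃ M, M = max K (β (m + 1) + 2 * β k) := ⟨_, rfl⟩
  have hVM : ∀ x, |V x| ≤ M := fun x => (hVb x).trans (hM ▸ le_max_right _ _)
  have hvM : ∀ t x, |Dar.v (f (m + 1)) t (y t + x)| ≤ M := fun t x =>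
    (hF.abs_v_le _ _).trans (hM ▸ le_max_left _ _)
  have hd : 0 < β (m + 1) - l := by linarith [h.lt m hm]
  have hU' : LocU (fun t x => Dar.v (f (m + 1)) t (y t + x)) V := by
    refine LocU.of_window (w := fun t x => q (m + 1) t (y t + x)) (β := β (m + 1)) (fun t x => ?_) hw
      hvM hV cS hVM hq hU
      (fun R => h.eventually_neg_v_le hm hy ?_ R) (half_pos hd)
      ((hVt.sub hP).eventually (eventually_ge_nhds (half_lt_self hd)))
    · have := hasDerivAt_translate (hD.hasDerivAt_v t (y t + x))
      rwa [h.w_eq _ hm] at this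
    · have := pow_le_pow_left₀ hk0.le (h.strictMono hkm (by omega)) 2
      linarith
  refine ⟨V, s', hU', hVt, ?_⟩
  have := LocL2.darboux (β := β (m + 1)) (fun t => (hD.sm_v.cx t).comp (cy t))
    (continuous_iff_continuousAt.2 fun x => (hV x).continuousAt) hw cS hvM hVM hq hU'
  simp only [hVs] at this
  have e2 : (fun t x => 2 * (Dar.v (f (m + 1)) t (y t + x) ^ 2 - β (m + 1) ^ 2) -
      q (m + 1) t (y t + x)) = fun t x => q (m + 1 + 1) t (y t + x) :=
    funext fun t => funext fun x => by rw [← h.w_eq _ hm, Dar.w]; ring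
  rwa [← e2]

theorem exists_window (h : Chain N q f β a₀) {k : ℕ} (hk : k < N) : ∃ z : ℝ → ℝ,
    Tendsto (fun t => z t / t) atTop (nhds (4 * β k ^ 2)) ∧
    LocL2 (fun t x => q N t (z t + x)) (Sol (β k)) := by
  obtain ⟨y, hy, hU, hq⟩ := h.window_base hk
  have hb := (h.dar k hk).hb
  have key : ∀ m, k ≤ m → m < N → ∃ P l s, LocU (fun t x => Dar.v (f m) t (y t + x)) P ∧
      Tendsto P atTop (nhds l) ∧ l ≤ β m ∧
      LocL2 (fun t x => q (m + 1) t (y t + x)) fun x => Sol (β k) (x - s) := by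
    intro m hkm
    induction m, hkm using Nat.le_induction with
    | base =>
      refine fun _ => ⟨_, -(β k * 1), 0, hU, ((tendsto_tanh_atTop.comp
        (tendsto_id.const_mul_atTop hb)).const_mul (β k)).neg, by linarith, ?_⟩
      simpa using hq
    | succ m hkm ih =>
      intro hm
      obtain ⟨P, l, s, h1, h2, h3, h4⟩ := ih (by omega)
      obtain ⟨P', s', h5, h6, h7⟩ := h.window_step hkm hm hy h1 h2 h3 h4
      exact ⟨P', _, s', h5, h6, le_rfl, h7⟩
  obtain ⟨n, rfl⟩ : ∃ n, N = n + 1 := ⟨N - 1, by omega⟩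
  obtain ⟨P, l, s, -, -, -, hs⟩ := key n (by omega) (by omega)
  refine ⟨fun t => y t + s, ?_, LocL2.shift (fun t => (h.dar n (by omega)).sol.sm.cx t)
    (continuous_sol _) hs⟩
  have := hy.add (tendsto_const_nhds (x := s) |>.div_atTop tendsto_id)
  rw [add_zero] at this
  exact this.congr fun t => by simp only [id_eq]; ring

end Chain

theorem Q_eq_sol {c : ℝ} (hc : 0 < c) (x : ℝ) : Q c x = -3 * Sol (√c / 2) x := by
  have h1 := one_sub_tanh_sq (√c / 2 * x)
  have h2 : cosh (√c * x) = 2 * cosh (√c / 2 * x) ^ 2 - 1 := by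
    have e : √c * x = 2 * (√c / 2 * x) := by ring
    rw [e, cosh_two_mul, cosh_sq]; ring
  have h3 : 0 < cosh (√c / 2 * x) := cosh_pos _
  have h4 : √c ^ 2 = c := sq_sqrt hc.le
  rw [Q, Sol, h1, h2, div_pow, h4]
  field_simp
  ring

theorem sol_neg (β x : ℝ) : Sol β (-x) = Sol β x := by
  rw [Sol, Sol, mul_neg, tanh_neg, neg_sq]

theorem sol_nonpos (β x : ℝ) : Sol β x ≤ 0 := by
  rw [Sol, one_sub_tanh_sq]
  have : 0 ≤ 1 / cosh (β * x) ^ 2 := by positivity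
  nlinarith [mul_nonneg (sq_nonneg β) this]

theorem abs_sol_le {κ K β : ℝ} (hκ : 0 ≤ κ) (h : κ ≤ β) (hK : β ≤ K) (x : ℝ) :
    |Sol β x| ≤ 8 * K ^ 2 * exp (-(2 * κ * |x|)) := by
  have hc : exp |β * x| ≤ 2 * cosh (β * x) := by
    rw [← cosh_abs (β * x), cosh_eq]
    have := exp_pos (-|β * x|)
    linarith
  have h0 : 0 ≤ β := hκ.trans h
  have h1 : κ * |x| ≤ |β * x| := by
    rw [abs_mul, abs_of_nonneg h0]
    exact mul_le_mul_of_nonneg_right h (abs_nonneg x)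
  have h2 : exp (κ * |x|) ≤ 2 * cosh (β * x) := (exp_le_exp.2 h1).trans hc
  have h3 : exp (κ * |x|) ^ 2 ≤ (2 * cosh (β * x)) ^ 2 :=
    pow_le_pow_left₀ (exp_pos _).le h2 2
  have h4 : exp (-(2 * κ * |x|)) = (exp (κ * |x|) ^ 2)⁻¹ := by
    rw [← exp_nat_mul, ← exp_neg]; congr 1; push_cast; ring
  rw [abs_of_nonpos (sol_nonpos _ _), Sol, one_sub_tanh_sq, h4]
  have h5 : 1 / cosh (β * x) ^ 2 = 4 * ((2 * cosh (β * x)) ^ 2)⁻¹ := by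
    have := cosh_pos (β * x)
    field_simp
    ring
  have h6 : ((2 * cosh (β * x)) ^ 2)⁻¹ ≤ (exp (κ * |x|) ^ 2)⁻¹ :=
    inv_anti₀ (by positivity) h3
  have h7 : β ^ 2 ≤ K ^ 2 := pow_le_pow_left₀ h0 hK 2
  rw [h5]
  have h8 : 0 ≤ (exp (κ * |x|) ^ 2)⁻¹ := by positivity
  have h9 := mul_le_mul h7 h6 (by positivity) (sq_nonneg K)
  linarith

theorem abs_sol_le_const {β : ℝ} (h : 0 ≤ β) (x : ℝ) : |Sol β x| ≤ 8 * β ^ 2 := by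
  simpa using abs_sol_le le_rfl h le_rfl x

theorem integrable_exp_neg_mul_abs {κ : ℝ} (hκ : 0 < κ) :
    Integrable fun x : ℝ => exp (-(κ * |x|)) := by
  rw [← integrableOn_univ, ← Set.Iic_union_Ioi (a := (0 : ℝ))]
  refine IntegrableOn.union ?_ ?_
  · refine (integrableOn_exp_mul_Iic hκ 0).congr_fun (fun x hx => ?_) measurableSet_Iic
    simp only [abs_of_nonpos (Set.mem_Iic.1 hx), mul_neg, neg_neg]
  · refine (integrableOn_exp_mul_Ioi (neg_neg_of_pos hκ) 0).congr_fun (fun x hx => ?_)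
      measurableSet_Ioi
    simp only [abs_of_pos (Set.mem_Ioi.1 hx), neg_mul]

theorem integrable_sol {β : ℝ} (hβ : 0 < β) : Integrable (Sol β) := by
  refine Integrable.mono' ((integrable_exp_neg_mul_abs (κ := 2 * β) (by positivity)).const_mul
    (8 * β ^ 2)) (continuous_sol β).aestronglyMeasurable (.of_forall fun x => ?_)
  exact abs_sol_le hβ.le le_rfl le_rfl x

theorem sqI_sol {β : ℝ} (hβ : 0 < β) : SqI (Sol β) := by
  refine SqI.of_sq_le (((integrable_sol hβ).abs).const_mul (8 * β ^ 2)) (continuous_sol β)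
    fun x => ?_
  rw [← sq_abs, sq]
  exact mul_le_mul_of_nonneg_right (abs_sol_le_const hβ.le x) (abs_nonneg _)

theorem integral_sol_sq {β : ℝ} (hβ : 0 < β) : ∫ x, Sol β x ^ 2 = 16 / 3 * β ^ 3 := by
  have hd : ∀ x, HasDerivAt (fun x => 4 * β ^ 3 * (tanh (β * x) - tanh (β * x) ^ 3 / 3))
      (Sol β x ^ 2) x := by
    intro x
    have h1 : HasDerivAt (fun x => tanh (β * x)) ((1 - tanh (β * x) ^ 2) * β) x := by
      refine ((hasDerivAt_tanh (β * x)).comp x ((hasDerivAt_id x).const_mul β)).congr_deriv ?_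
      rw [mul_one]
    refine ((h1.sub ((h1.pow 3).div_const 3)).const_mul (4 * β ^ 3)).congr_deriv ?_
    rw [Sol]
    push_cast
    ring
  have ht : Tendsto (fun x => tanh (β * x)) atTop (nhds 1) :=
    tendsto_tanh_atTop.comp (tendsto_id.const_mul_atTop hβ)
  have hb : Tendsto (fun x => tanh (β * x)) atBot (nhds (-1)) := by
    have := (ht.comp tendsto_neg_atBot_atTop).neg
    refine this.congr fun x => ?_
    simp [tanh_neg]
  have hT := (ht.sub ((ht.pow 3).div_const 3)).const_mul (4 * β ^ 3)
  have hB := (hb.sub ((hb.pow 3).div_const 3)).const_mul (4 * β ^ 3)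
  rw [integral_of_hasDerivAt_of_tendsto hd (sqI_sol hβ).2 hB hT]
  ring

theorem tendsto_integral_sol_mul_sol {β β' : ℝ} (hβ : 0 < β) (hβ' : 0 < β') :
    Tendsto (fun d => ∫ x, Sol β x * Sol β' (x + d)) (comap (fun x : ℝ => |x|) atTop)
      (nhds 0) := by
  have h0 : ∫ _ : ℝ, (0 : ℝ) = 0 := integral_zero _ _
  rw [← h0]
  refine tendsto_integral_filter_of_dominated_convergence (fun x => 8 * β' ^ 2 * |Sol β x|)
    (.of_forall fun d => ?_) (.of_forall fun d => .of_forall fun x => ?_)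
    ((integrable_sol hβ).abs.const_mul _) (.of_forall fun x => ?_)
  · exact ((continuous_sol β).mul ((continuous_sol β').comp (continuous_add_const d)))
      |>.aestronglyMeasurable
  · rw [norm_mul, mul_comm]
    exact mul_le_mul_of_nonneg_right (abs_sol_le_const hβ'.le _) (abs_nonneg _)
  · rw [← mul_zero (Sol β x)]
    refine Tendsto.const_mul _ ?_
    have hs : Tendsto (fun d : ℝ => 8 * β' ^ 2 * exp (-(2 * β' * |x + d|)))
        (comap (fun x : ℝ => |x|) atTop) (nhds 0) := by
      rw [show (0 : ℝ) = 8 * β' ^ 2 * 0 by ring]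
      refine Tendsto.const_mul _ (tendsto_exp_neg_atTop_nhds_zero.comp
        (Tendsto.const_mul_atTop (by positivity) ?_))
      refine tendsto_atTop_mono (fun d => ?_)
        (tendsto_atTop_add_const_right _ (-|x|) tendsto_comap)
      have := abs_sub_abs_le_abs_sub d (-x)
      rw [abs_neg, sub_neg_eq_add, add_comm d x] at this
      exact this
    exact squeeze_zero_norm (fun d => abs_sol_le hβ'.le le_rfl le_rfl _) hs

theorem tendsto_integral_sol_sub_sol {β : ℝ} (hβ : 0 < β) :
    Tendsto (fun b => ∫ x, (Sol b x - Sol β x) ^ 2) (nhds β) (nhds 0) := by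
  have h0 : ∫ x : ℝ, (Sol β x - Sol β x) ^ 2 = 0 := by simp
  rw [← h0]
  refine tendsto_integral_filter_of_dominated_convergence
    (fun x => (64 * β ^ 2) * (64 * β ^ 2 * exp (-(β * |x|))))
    (.of_forall fun b => ?_) ?_
    (((integrable_exp_neg_mul_abs hβ).const_mul _).const_mul _) (.of_forall fun x => ?_)
  · exact (((continuous_sol b).sub (continuous_sol β)).pow 2).aestronglyMeasurable
  · filter_upwards [eventually_ge_nhds (half_lt_self hβ),
      eventually_le_nhds (show β < 2 * β by linarith)] with b hb1 hb2
    refine .of_forall fun x => ?_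
    have h1 := abs_sol_le (by positivity) hb1 hb2 x
    have h2 := abs_sol_le (by positivity) (half_lt_self hβ).le
      (show β ≤ 2 * β by linarith) x
    have h3 : |Sol b x - Sol β x| ≤ 64 * β ^ 2 * exp (-(β * |x|)) := by
      have e : 2 * (β / 2) * |x| = β * |x| := by ring
      rw [e] at h1 h2
      refine (abs_sub _ _).trans ?_
      linarith
    have h4 : exp (-(β * |x|)) ≤ 1 := exp_le_one_iff.2 (by
      have := mul_nonneg hβ.le (abs_nonneg x); linarith)
    have h5 : |Sol b x - Sol β x| ≤ 64 * β ^ 2 :=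
      h3.trans (mul_le_of_le_one_right (by positivity) h4)
    rw [norm_pow, Real.norm_eq_abs, sq]
    exact mul_le_mul h5 h3 (abs_nonneg _) (by positivity)
  · have hc : Continuous fun b => Sol b x := by
      unfold Sol
      have := continuous_tanh
      fun_prop
    exact ((hc.tendsto β).sub_const _).pow 2

theorem IsSchwartzFn.sqI_iteratedDeriv {f : ℝ → ℝ} (h : IsSchwartzFn f) (n : ℕ)
    (hf : Continuous (iteratedDeriv n f)) : SqI (iteratedDeriv n f) := by
  obtain ⟨C, hC⟩ := h 0 n
  obtain ⟨D, hD⟩ := h 1 n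
  refine SqI.of_sq_le (integrable_inv_one_add_sq.const_mul (C ^ 2 + D ^ 2)) hf fun x => ?_
  have h1 := hC x
  have h2 := hD x
  rw [pow_zero, one_mul] at h1
  rw [pow_one] at h2
  have h3 : iteratedDeriv n f x ^ 2 ≤ C ^ 2 := by
    rw [← sq_abs]; exact pow_le_pow_left₀ (abs_nonneg _) h1 2
  have h4 : x ^ 2 * iteratedDeriv n f x ^ 2 ≤ D ^ 2 := by
    rw [← sq_abs x, ← sq_abs (iteratedDeriv n f x), ← mul_pow]
    exact pow_le_pow_left₀ (by positivity) h2 2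
  rw [← div_eq_mul_inv, le_div_iff₀ (by positivity)]
  linarith

theorem IsKdVSolution.sliceSol {u : ℝ → ℝ → ℝ} (h : IsKdVSolution u) :
    SliceSol fun t x => -u (-t) (-x) / 3 := by
  obtain ⟨hu, hS, he⟩ := h
  replace hu : Sm u := hu
  have refl : ∀ {g : ℝ → ℝ → ℝ}, Sm g → Sm fun t x => g (-t) (-x) := fun {g} hg => by
    have hr : ContDiff ℝ (⊤ : ℕ∞) fun p : ℝ × ℝ => (-p.1, -p.2) := by fun_prop
    exact ContDiff.comp (g := Function.uncurry g) hg hr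
  have dxr : ∀ {g : ℝ → ℝ → ℝ} (c : ℝ), Sm g →
      dx (fun t x => g (-t) (-x) * c) = fun t x => dx g (-t) (-x) * (-c) := by
    intro g c hg
    funext t x
    have h1 : HasDerivAt (fun y => g (-t) (-y)) (-dx g (-t) (-x)) x := by
      have := (hg.hasDerivAt_x (-t) (-x)).comp x (hasDerivAt_neg x)
      refine (this.congr_deriv ?_)
      ring
    exact (h1.mul_const c).deriv.trans (by ring)
  have dtr : ∀ {g : ℝ → ℝ → ℝ} (c : ℝ), Sm g →
      dt (fun t x => g (-t) (-x) * c) = fun t x => dt g (-t) (-x) * (-c) := by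
    intro g c hg
    funext t x
    have h1 : HasDerivAt (fun s => g (-s) (-x)) (-dt g (-t) (-x)) t := by
      have := (hg.hasDerivAt_t (-t) (-x)).comp t (hasDerivAt_neg t)
      refine (this.congr_deriv ?_)
      ring
    exact (h1.mul_const c).deriv.trans (by ring)
  have e0 : (fun t x => -u (-t) (-x) / 3) = fun t x => u (-t) (-x) * (-1 / 3) := by
    funext t x; ring
  have e1 := dxr (-1 / 3) hu
  have e2 := dxr (-(-1 / 3)) hu.dx
  have e3 := dxr (-(-(-1 / 3))) hu.dx.dx
  have et := dtr (-1 / 3) hu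
  have s0 : ∀ t, SqI (u t) := fun t => by
    have := (hS t).sqI_iteratedDeriv 0 (by rw [iteratedDeriv_zero]; exact hu.cx t)
    rwa [iteratedDeriv_zero] at this
  have s1 : ∀ t, SqI (dx u t) := fun t => by
    have e : iteratedDeriv 1 (u t) = dx u t := iteratedDeriv_one
    rw [← e]
    exact (hS t).sqI_iteratedDeriv 1 (by rw [e]; exact hu.dx.cx t)
  have s2 : ∀ t, SqI (dx (dx u) t) := fun t => by
    have e : iteratedDeriv 2 (u t) = dx (dx u) t := by
      rw [iteratedDeriv_succ, iteratedDeriv_one]; rfl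
    rw [← e]
    exact (hS t).sqI_iteratedDeriv 2 (by rw [e]; exact hu.dx.dx.cx t)
  have sc : ∀ {g : ℝ → ℝ} (c : ℝ), SqI g → SqI fun x => g (-x) * c := fun {g} c hg => by
    have := hg.comp_neg.const_mul c
    simpa only [mul_comm] using this
  rw [e0]
  refine ⟨(refl hu).mul (Sm.const _), fun t x => ?_, fun t => sc _ (s0 _), fun t => ?_,
    fun t => ?_⟩
  · rw [et, e1, e2, e3]
    have h1 := he (-t) (-x)
    have h2 : HasDerivAt (fun y => deriv (deriv (u (-t))) y + u (-t) y ^ 2)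
        (dx (dx (dx u)) (-t) (-x) + 2 * u (-t) (-x) * dx u (-t) (-x)) (-x) := by
      refine ((hu.dx.dx.hasDerivAt_x (-t) (-x)).add
        ((hu.hasDerivAt_x (-t) (-x)).pow 2)).congr_deriv ?_
      push_cast
      ring
    rw [h2.deriv] at h1
    have h3 : dt u (-t) (-x) = -(dx (dx (dx u)) (-t) (-x) + 2 * u (-t) (-x) * dx u (-t) (-x)) := by
      have : dt u (-t) (-x) = deriv (fun τ => u τ (-x)) (-t) := rfl
      linarith
    simp only [h3]
    ring
  · rw [e1]; exact sc _ (s1 _)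
  · rw [e1, e2]; exact sc _ (s2 _)

theorem SolOn.exists_darboux_chain (γ : ℕ → ℝ) : ∀ (N : ℕ) (q : ℝ → ℝ → ℝ), (∀ j < N, 0 < γ j) →
    SolOn Set.univ q → (∀ j < N, Trial (q 0) (γ j) (N - j)) →
    ∃ (p f : ℕ → ℝ → ℝ → ℝ) (β : ℕ → ℝ), p N = q ∧ (∀ j < N, γ j ≤ β j) ∧
      (∀ j < N, Dar (p (j + 1)) (β j) (f j)) ∧
      (∀ j < N, Dar.w (p (j + 1)) (β j) (f j) = p j) ∧ SolOn Set.univ (p 0) ∧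
      ∀ t, ∫ x, p 0 t x ^ 2 = (∫ x, q t x ^ 2) - ∑ j ∈ Finset.range N, 16 / 3 * β j ^ 3 := by
  intro N
  induction N with
  | zero =>
    intro q _ hq _
    exact ⟨fun _ => q, fun _ => q, fun _ => 0, rfl, by simp, by simp, by simp, hq, by simp⟩
  | succ N ih =>
    intro q hγ hq ht
    have hqc := (hq.sqI 0 (Set.mem_univ _)).1
    have ht1 : Trial (q 0) (γ N) 1 := by simpa using ht N (Nat.lt_succ_self N)
    obtain ⟨K, -, hK⟩ := hq.exists_bound
    obtain ⟨b, v, hb, hv, hl, hr⟩ := Ric.exists_ground (hq.sqI 0 (Set.mem_univ _))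
      (hK 0 (Set.mem_univ _)) (hγ N (Nat.lt_succ_self N))
      fun b v hb hv => hv.le_of_trial hqc hb ht1
    obtain ⟨g, hg, hgv⟩ := hq.exists_dar ((hγ N (Nat.lt_succ_self N)).trans_le hb) hv hl hr
    have hw : Dar.w q b g 0 = fun x => 2 * (v x ^ 2 - b ^ 2) - q 0 x := by
      funext x
      simp only [Dar.w, Dar.v, hgv]
    obtain ⟨p, f, β, hp, h1, h2, h3, h4, h5⟩ := ih (Dar.w q b g)
      (fun j hj => hγ j (hj.trans (Nat.lt_succ_self N))) hg.sol_w fun j hj => by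
        rw [hw]
        refine hv.trial_darboux hqc ?_
        have := ht j (hj.trans (Nat.lt_succ_self N))
        rwa [Nat.succ_sub hj.le] at this
    have up : ∀ {α : Type} (F : ℕ → α) (a : α) (n : ℕ) {j : ℕ}, j < n →
        Function.update F n a j = F j := fun F a n j hj => Function.update_of_ne hj.ne _ _
    refine ⟨Function.update p (N + 1) q, Function.update f N g, Function.update β N b,
      Function.update_self .., fun j hj => ?_, fun j hj => ?_, fun j hj => ?_, ?_, fun t => ?_⟩
    · rcases Nat.lt_succ_iff_lt_or_eq.1 hj with hj | rfl
      · rw [up _ _ _ hj]; exact h1 j hj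
      · rwa [Function.update_self]
    · rcases Nat.lt_succ_iff_lt_or_eq.1 hj with hj | rfl
      · rw [up _ _ _ hj, up _ _ _ hj, up _ _ _ (Nat.succ_lt_succ hj)]; exact h2 j hj
      · rwa [Function.update_self, Function.update_self, Function.update_self]
    · rcases Nat.lt_succ_iff_lt_or_eq.1 hj with hj | rfl
      · rw [up _ _ _ hj, up _ _ _ hj, up _ _ _ (Nat.succ_lt_succ hj),
          up p _ _ (hj.trans (Nat.lt_succ_self N))]
        exact h3 j hj
      · rw [Function.update_self, Function.update_self, Function.update_self,
          up p _ _ (Nat.lt_succ_self j), hp]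
    · rwa [up p _ _ (Nat.succ_pos N)]
    · rw [up p _ _ (Nat.succ_pos N), h5 t, hg.integral_w t, Finset.sum_range_succ,
        Function.update_self]
      have : ∑ j ∈ Finset.range N, 16 / 3 * Function.update β N b j ^ 3 =
          ∑ j ∈ Finset.range N, 16 / 3 * β j ^ 3 := by
        refine Finset.sum_congr rfl fun j hj => ?_
        rw [up _ _ _ (Finset.mem_range.1 hj)]
      rw [this]
      ring

theorem ric_sol (β : ℝ) : Ric (Sol β) β fun x => -(β * tanh (β * x)) := fun x => by
  have h1 : HasDerivAt (fun x => tanh (β * x)) ((1 - tanh (β * x) ^ 2) * (β * 1)) x :=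
    (hasDerivAt_tanh (β * x)).comp x ((hasDerivAt_id x).const_mul β)
  refine ((h1.const_mul β).neg).congr_deriv ?_
  rw [Sol]
  ring

theorem Cc1.of_bump (f : ContDiffBump (0 : ℝ)) {ψ : ℝ → ℝ} (hψ : ContDiff ℝ 1 ψ) {R : ℝ}
    (hR : 0 < R) : Cc1 fun x => f (R⁻¹ * x) * ψ x := by
  have hR' : R⁻¹ ≠ 0 := (inv_pos.2 hR).ne'
  have hf : ContDiff ℝ 1 fun x => f (R⁻¹ * x) :=
    (f.contDiff (n := 1)).comp (contDiff_const.mul contDiff_id)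
  refine ⟨hf.mul hψ, HasCompactSupport.mul_right ?_⟩
  exact f.hasCompactSupport.comp_homeomorph (Homeomorph.mulLeft₀ _ hR')

theorem exists_trial_sol {γ β : ℝ} (hγ : 0 < γ) (hβ : γ < β) : ∃ φ : ℝ → ℝ, ∃ R, Cc1 φ ∧ 0 < R ∧
    (∀ x, R ≤ |x| → φ x = 0 ∧ deriv φ x = 0) ∧
    (∫ x, (deriv φ x ^ 2 + Sol β x * φ x ^ 2)) + γ ^ 2 * ∫ x, φ x ^ 2 < 0 := by
  have hb : 0 < β := hγ.trans hβ
  let f : ContDiffBump (0 : ℝ) := ⟨1, 2, one_pos, one_lt_two⟩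
  obtain ⟨C, hC⟩ := f.hasCompactSupport.deriv.exists_bound_of_continuous
    ((f.contDiff (n := 1)).continuous_deriv le_rfl)
  obtain ⟨ψ, hψ⟩ : ∃ ψ : ℝ → ℝ, ψ = fun x => (cosh (β * x))⁻¹ := ⟨_, rfl⟩
  have hψ1 : ContDiff ℝ 1 ψ := by
    rw [hψ]
    exact (contDiff_cosh.comp (contDiff_const.mul contDiff_id)).inv fun x => (cosh_pos _).ne'
  have hψd : ∀ x, HasDerivAt ψ (-(β * tanh (β * x)) * ψ x) x := fun x => by
    have h1 : HasDerivAt (fun x => cosh (β * x)) (sinh (β * x) * (β * 1)) x :=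
      (hasDerivAt_cosh (β * x)).comp x ((hasDerivAt_id x).const_mul β)
    rw [hψ]
    refine (h1.inv (cosh_pos _).ne').congr_deriv ?_
    simp only [tanh_eq_sinh_div_cosh]
    have := cosh_pos (β * x)
    field_simp
  have hψp : ∀ x, 0 < ψ x := fun x => by rw [hψ]; exact inv_pos.2 (cosh_pos _)
  have hψs : ∀ x, ψ x ^ 2 = -1 / (2 * β ^ 2) * Sol β x := fun x => by
    rw [hψ, Sol, one_sub_tanh_sq]
    field_simp
  have hψq : SqI ψ := ⟨hψ1.continuous, by
    simp only [hψs]; exact (integrable_sol hb).const_mul _⟩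
  obtain ⟨m, hm⟩ : ∃ m, m = ∫ x in (-1 : ℝ)..1, ψ x ^ 2 := ⟨_, rfl⟩
  have hm0 : 0 < m := by
    rw [hm]
    exact intervalIntegral.intervalIntegral_pos_of_pos
      ((hψ1.continuous.pow 2).intervalIntegrable _ _) (fun x => pow_pos (hψp x) 2) (by norm_num)
  obtain ⟨M, hM⟩ : ∃ M, M = ∫ x, ψ x ^ 2 := ⟨_, rfl⟩
  have hlim : Tendsto (fun R : ℝ => (C * R⁻¹) ^ 2 * M) atTop (nhds 0) := by
    have := ((tendsto_inv_atTop_zero (𝕜 := ℝ)).const_mul C |>.pow 2).mul_const M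
    simpa using this
  have hgap : 0 < (β ^ 2 - γ ^ 2) * m :=
    mul_pos (sub_pos.2 (pow_lt_pow_left₀ hβ hγ.le two_ne_zero)) hm0
  obtain ⟨R, hR, hR1⟩ := ((hlim.eventually (eventually_lt_nhds hgap)).and
    (eventually_ge_atTop 1)).exists
  have hR0 : 0 < R := by linarith
  have hCc := Cc1.of_bump f hψ1 hR0
  obtain ⟨φ, hφ⟩ : ∃ φ : ℝ → ℝ, φ = fun x => f (R⁻¹ * x) * ψ x := ⟨_, rfl⟩
  rw [← hφ] at hCc
  have hz : ∀ x, 2 * R ≤ |x| → φ x = 0 := fun x hx => by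
    have : f (R⁻¹ * x) = 0 := f.zero_of_le_dist (by
      rw [dist_zero_right, Real.norm_eq_abs, abs_mul, abs_of_pos (inv_pos.2 hR0),
        inv_mul_eq_div, le_div_iff₀ hR0]
      exact hx)
    rw [hφ]
    simp only [this, zero_mul]
  have hd : ∀ x, deriv φ x - -(β * tanh (β * x)) * φ x = deriv f (R⁻¹ * x) * R⁻¹ * ψ x := by
    intro x
    have h1 : HasDerivAt (fun x => f (R⁻¹ * x)) (deriv f (R⁻¹ * x) * (R⁻¹ * 1)) x :=
      (((f.contDiff (n := 1)).differentiable one_ne_zero _).hasDerivAt).comp x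
        ((hasDerivAt_id x).const_mul R⁻¹)
    have h2 := (h1.mul (hψd x)).deriv
    have h3 : deriv φ x = deriv f (R⁻¹ * x) * (R⁻¹ * 1) * ψ x +
        f (R⁻¹ * x) * (-(β * tanh (β * x)) * ψ x) := by rw [hφ]; exact h2
    rw [h3, hφ]
    ring
  refine ⟨φ, 2 * R + 1, hCc, by linarith, fun x hx => ⟨hz x (by linarith), ?_⟩, ?_⟩
  · have : φ =ᶠ[nhds x] fun _ => 0 := by
      filter_upwards [continuous_abs.continuousAt.eventually
        (eventually_gt_nhds (show 2 * R < |x| by linarith))] with y hy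
      exact hz y hy.le
    rw [this.deriv_eq, deriv_const]
  · have hE := (ric_sol β).integral_energy (continuous_sol β) hCc
    have h1 : ∫ x, (deriv φ x - -(β * tanh (β * x)) * φ x) ^ 2 ≤ (C * R⁻¹) ^ 2 * M := by
      rw [hM, ← integral_const_mul]
      refine integral_mono_of_nonneg (.of_forall fun x => sq_nonneg _) (hψq.2.const_mul _)
        (.of_forall fun x => ?_)
      simp only [hd]
      rw [mul_pow, ← sq_abs (deriv f _ * _), abs_mul, abs_of_pos (inv_pos.2 hR0)]
      exact mul_le_mul_of_nonneg_right (pow_le_pow_left₀ (by positivity)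
        (mul_le_mul_of_nonneg_right (hC _) (inv_pos.2 hR0).le) 2) (sq_nonneg _)
    have h2 : m ≤ ∫ x, φ x ^ 2 := by
      have e : m = ∫ x in Set.Ioc (-1 : ℝ) 1, φ x ^ 2 := by
        rw [hm, intervalIntegral.integral_of_le (by norm_num)]
        refine setIntegral_congr_fun measurableSet_Ioc fun x hx => ?_
        have : f (R⁻¹ * x) = 1 := f.one_of_mem_closedBall (by
          rw [mem_closedBall_zero_iff, Real.norm_eq_abs, abs_mul, abs_of_pos (inv_pos.2 hR0),
            inv_mul_eq_div, div_le_iff₀ hR0]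
          have : |x| ≤ 1 := abs_le.2 ⟨hx.1.le, hx.2⟩
          show |x| ≤ 1 * R
          linarith)
        simp only [hφ, this, one_mul]
      rw [e]
      exact hCc.sqI.setIntegral_le _
    have h3 : (β ^ 2 - γ ^ 2) * m ≤ (β ^ 2 - γ ^ 2) * ∫ x, φ x ^ 2 :=
      mul_le_mul_of_nonneg_left h2
        (sub_nonneg.2 (pow_le_pow_left₀ hγ.le hβ.le 2))
    linarith

theorem sum_sq_of_mul_eq_zero {ι : Type*} [Fintype ι] {F : ι → ℝ}
    (h : ∀ i j, i ≠ j → F i * F j = 0) : (∑ i, F i) ^ 2 = ∑ i, F i ^ 2 := by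
  rw [sq, Finset.sum_mul_sum]
  refine Finset.sum_congr rfl fun i _ => ?_
  rw [Finset.sum_eq_single i (fun j _ hj => h i j hj.symm) (by simp), sq]

theorem Cc1.sum {ι : Type*} (s : Finset ι) {g : ι → ℝ → ℝ} (h : ∀ i ∈ s, Cc1 (g i)) :
    Cc1 fun x => ∑ i ∈ s, g i x := by
  classical
  induction s using Finset.induction_on with
  | empty =>
    simp only [Finset.sum_empty]
    exact ⟨contDiff_const, HasCompactSupport.zero⟩
  | insert i s hi ih =>
    have h1 := ih fun j hj => h j (Finset.mem_insert_of_mem hj)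
    have h2 := h i (Finset.mem_insert_self i s)
    simp only [Finset.sum_insert hi]
    exact ⟨h2.1.add h1.1, h2.2.add h1.2⟩

theorem Cc1.integrable_energy {g : ℝ → ℝ} (hg : Cc1 g) {q : ℝ → ℝ} (hq : Continuous q) :
    Integrable fun x => deriv g x ^ 2 + q x * g x ^ 2 := by
  refine hg.sqI_deriv.2.add ((hg.integrable_mul (hq.mul hg.continuous)).congr
    (.of_forall fun x => ?_))
  simp only [Pi.mul_apply]
  ring

theorem Trial.of_disjoint {q : ℝ → ℝ} (hq : Continuous q) {γ : ℝ} {d : ℕ} {g : Fin d → ℝ → ℝ}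
    (hg : ∀ i, Cc1 (g i)) (h0 : ∀ i j, i ≠ j → ∀ x, g i x * g j x = 0)
    (h1 : ∀ i j, i ≠ j → ∀ x, deriv (g i) x * deriv (g j) x = 0)
    (h : ∀ i, ∫ x, (deriv (g i) x ^ 2 + q x * g i x ^ 2) < -γ ^ 2 * ∫ x, g i x ^ 2) :
    Trial q γ d := by
  refine ⟨{ toFun := fun a x => ∑ i, a i * g i x, map_add' := ?_, map_smul' := ?_ },
    fun a => ?_⟩
  · intro a b
    funext x
    simp only [Pi.add_apply, add_mul, Finset.sum_add_distrib]
  · intro c a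
    funext x
    simp only [Pi.smul_apply, smul_eq_mul, RingHom.id_apply, Finset.mul_sum, mul_assoc]
  have hag : ∀ i, Cc1 fun x => a i * g i x := fun i =>
    ⟨contDiff_const.mul (hg i).1, (hg i).2.mul_left⟩
  refine ⟨Cc1.sum (g := fun i x => a i * g i x) Finset.univ fun i _ => hag i, fun ha => ?_⟩
  simp only [LinearMap.coe_mk, AddHom.coe_mk]
  have e0 : ∀ x, (∑ i, a i * g i x) ^ 2 = ∑ i, a i ^ 2 * g i x ^ 2 := fun x => by
    rw [sum_sq_of_mul_eq_zero]
    · simp only [mul_pow]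
    · intro i j hij
      have := h0 i j hij x
      linear_combination a i * a j * this
  have e1 : ∀ x, deriv (fun x => ∑ i, a i * g i x) x = ∑ i, a i * deriv (g i) x := fun x =>
    (HasDerivAt.fun_sum fun i _ => ((hg i).hasDerivAt x).const_mul (a i)).deriv
  have e2 : ∀ x, deriv (fun x => ∑ i, a i * g i x) x ^ 2 = ∑ i, a i ^ 2 * deriv (g i) x ^ 2 :=
    fun x => by
      rw [e1, sum_sq_of_mul_eq_zero]
      · simp only [mul_pow]
      · intro i j hij
        have := h1 i j hij x
        linear_combination a i * a j * this
  have e3 : ∀ x, deriv (fun x => ∑ i, a i * g i x) x ^ 2 + q x * (∑ i, a i * g i x) ^ 2 =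
      ∑ i, a i ^ 2 * (deriv (g i) x ^ 2 + q x * g i x ^ 2) := fun x => by
    rw [e0, e2, Finset.mul_sum, ← Finset.sum_add_distrib]
    refine Finset.sum_congr rfl fun i _ => by ring
  rw [integral_congr_ae (.of_forall e3), integral_congr_ae (.of_forall e0),
    integral_finsetSum _ fun i _ => ((hg i).integrable_energy hq).const_mul _,
    integral_finsetSum _ fun i _ => ((hg i).sqI.2).const_mul _, Finset.mul_sum]
  simp only [integral_const_mul]
  obtain ⟨k, hk⟩ := Function.ne_iff.1 ha
  refine Finset.sum_lt_sum (fun i _ => ?_) ⟨k, Finset.mem_univ k, ?_⟩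
  · have := mul_le_mul_of_nonneg_left (h i).le (sq_nonneg (a i))
    linarith
  · have := mul_lt_mul_of_pos_left (h k) (sq_pos_of_ne_zero hk)
    linarith

theorem Cc1.comp_sub {g : ℝ → ℝ} (hg : Cc1 g) (y : ℝ) : Cc1 fun x => g (x - y) :=
  ⟨hg.1.comp (contDiff_id.sub contDiff_const),
    hg.2.comp_homeomorph (Homeomorph.subRight y)⟩

theorem energy_lt_of_near {γ β y α C : ℝ} {φ q S : ℝ → ℝ} (hφ : Cc1 φ) (hq : SqI q) (hS : SqI S)
    (hle : ∀ x, S x ≤ Sol β (x - y)) (hα : ∫ x, (q x - S x) ^ 2 ≤ α)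
    (hC : C = √(∫ x, (φ x * φ x) ^ 2))
    (h : (∫ x, (deriv φ x ^ 2 + Sol β x * φ x ^ 2)) + γ ^ 2 * (∫ x, φ x ^ 2) + √α * C < 0) :
    ∫ x, (deriv (fun x => φ (x - y)) x ^ 2 + q x * φ (x - y) ^ 2) <
      -γ ^ 2 * ∫ x, φ (x - y) ^ 2 := by
  have hg := hφ.comp_sub y
  have hgg : Cc1 fun x => φ (x - y) * φ (x - y) := ⟨hg.1.mul hg.1, hg.2.mul_left⟩
  have he := hq.sub hS
  have hSol : Continuous fun x => Sol β (x - y) :=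
    (continuous_sol β).comp (continuous_id.sub continuous_const)
  have hd : ∀ x, deriv (fun x => φ (x - y)) x = deriv φ (x - y) := fun x =>
    deriv_comp_sub_const ..
  have h1 : ∫ x, (deriv (fun x => φ (x - y)) x ^ 2 + q x * φ (x - y) ^ 2) ≤
      ∫ x, ((deriv (fun x => φ (x - y)) x ^ 2 + Sol β (x - y) * φ (x - y) ^ 2) +
        (q x - S x) * (φ (x - y) * φ (x - y))) := by
    refine integral_mono (hg.integrable_energy hq.1)
      ((hg.integrable_energy hSol).add (he.mul_int hgg.sqI)) fun x => ?_
    have := mul_le_mul_of_nonneg_right (hle x) (sq_nonneg (φ (x - y)))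
    simp only
    linarith
  rw [integral_add (hg.integrable_energy hSol) (he.mul_int hgg.sqI)] at h1
  have h2 := (le_abs_self _).trans (he.abs_integral_mul_le hgg.sqI)
  have e1 : ∫ x, (φ (x - y) * φ (x - y)) ^ 2 = ∫ x, (φ x * φ x) ^ 2 :=
    integral_sub_right_eq_self (fun x => (φ x * φ x) ^ 2) y
  have e2 : ∫ x, φ (x - y) ^ 2 = ∫ x, φ x ^ 2 :=
    integral_sub_right_eq_self (fun x => φ x ^ 2) y
  have e3 : ∫ x, (deriv (fun x => φ (x - y)) x ^ 2 + Sol β (x - y) * φ (x - y) ^ 2) =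
      ∫ x, (deriv φ x ^ 2 + Sol β x * φ x ^ 2) := by
    simp only [hd]
    exact integral_sub_right_eq_self (fun x => deriv φ x ^ 2 + Sol β x * φ x ^ 2) y
  rw [e1, ← hC] at h2
  rw [e2]
  rw [e3] at h1
  have h3 := mul_le_mul_of_nonneg_right (Real.sqrt_le_sqrt hα)
    (show 0 ≤ C by rw [hC]; exact sqrt_nonneg _)
  linarith

theorem sqI_sum_sol {N : ℕ} {β : ℕ → ℝ} (hβ : ∀ j < N, 0 < β j) (y : ℕ → ℝ) :
    SqI fun x => ∑ k ∈ Finset.range N, Sol (β k) (x - y k) :=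
  SqI.sum _ fun k hk => by
    simpa only [sub_eq_add_neg] using (sqI_sol (hβ k (Finset.mem_range.1 hk))).comp_add (-y k)

theorem exists_trial_of_near {N : ℕ} {β γ : ℕ → ℝ} (hγ : ∀ j < N, 0 < γ j)
    (hβ : ∀ j < N, γ j < β j) (hm : ∀ i j, i ≤ j → j < N → γ i ≤ γ j) :
    ∃ α L, 0 < α ∧ 0 < L ∧ ∀ y : ℕ → ℝ, (∀ i < N, ∀ j < N, i ≠ j → L ≤ |y i - y j|) →
      ∀ q : ℝ → ℝ, SqI q →
        ∫ x, (q x - ∑ k ∈ Finset.range N, Sol (β k) (x - y k)) ^ 2 ≤ α →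
        ∀ j < N, Trial q (γ j) (N - j) := by
  have hex : ∀ j, ∃ (φ : ℝ → ℝ) (R : ℝ), j < N → Cc1 φ ∧ 0 < R ∧
      (∀ x, R ≤ |x| → φ x = 0 ∧ deriv φ x = 0) ∧
      (∫ x, (deriv φ x ^ 2 + Sol (β j) x * φ x ^ 2)) + γ j ^ 2 * ∫ x, φ x ^ 2 < 0 := by
    intro j
    by_cases hj : j < N
    · obtain ⟨φ, R, h⟩ := exists_trial_sol (hγ j hj) (hβ j hj)
      exact ⟨φ, R, fun _ => h⟩
    · exact ⟨0, 0, fun h => absurd h hj⟩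
  choose φ R hφ using hex
  have hα : ∀ᶠ α in nhdsWithin (0 : ℝ) (Set.Ioi 0), ∀ j ∈ Finset.range N,
      (∫ x, (deriv (φ j) x ^ 2 + Sol (β j) x * φ j x ^ 2)) + γ j ^ 2 * (∫ x, φ j x ^ 2) +
        √α * √(∫ x, (φ j x * φ j x) ^ 2) < 0 := by
    rw [Filter.eventually_all_finset]
    intro j hj
    have hlt := (hφ j (Finset.mem_range.1 hj)).2.2.2
    have hc : Tendsto (fun α : ℝ => (∫ x, (deriv (φ j) x ^ 2 + Sol (β j) x * φ j x ^ 2)) +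
        γ j ^ 2 * (∫ x, φ j x ^ 2) + √α * √(∫ x, (φ j x * φ j x) ^ 2)) (nhds 0)
        (nhds ((∫ x, (deriv (φ j) x ^ 2 + Sol (β j) x * φ j x ^ 2)) +
        γ j ^ 2 * (∫ x, φ j x ^ 2) + √0 * √(∫ x, (φ j x * φ j x) ^ 2))) :=
      Continuous.tendsto (by fun_prop) 0
    rw [Real.sqrt_zero, zero_mul, add_zero] at hc
    exact (hc.mono_left nhdsWithin_le_nhds).eventually (eventually_lt_nhds hlt)
  obtain ⟨α, hα, hα0⟩ := (hα.and self_mem_nhdsWithin).exists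
  have hRle : ∀ j ∈ Finset.range N, R j ≤ ∑ k ∈ Finset.range N, R k := fun j hj =>
    Finset.single_le_sum (f := R) (fun k hk => (hφ k (Finset.mem_range.1 hk)).2.1.le) hj
  have hR0 : 0 ≤ ∑ k ∈ Finset.range N, R k :=
    Finset.sum_nonneg fun k hk => (hφ k (Finset.mem_range.1 hk)).2.1.le
  refine ⟨α, 2 * (∑ k ∈ Finset.range N, R k) + 1, hα0, by linarith,
    fun y hy q hq hle j hj => ?_⟩
  have hlt : ∀ i : Fin (N - j), j + i < N := fun i => by have := i.2; omega
  have hsep : ∀ i k : Fin (N - j), i ≠ k → ∀ x,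
      R (j + i) ≤ |x - y (j + i)| ∨ R (j + k) ≤ |x - y (j + k)| := by
    intro i k hik x
    by_contra! hcon
    have h1 := hy (j + i) (hlt i) (j + k) (hlt k) (by
      intro h; exact hik (Fin.ext (by omega)))
    have h2 := hRle _ (Finset.mem_range.2 (hlt i))
    have h3 := hRle _ (Finset.mem_range.2 (hlt k))
    have h4 := abs_sub_le (y (j + i)) x (y (j + k))
    rw [abs_sub_comm _ x] at h4
    linarith [hcon.1, hcon.2]
  have hd : ∀ (i : ℕ) x, deriv (fun x => φ i (x - y i)) x = deriv (φ i) (x - y i) := fun i x =>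
    deriv_comp_sub_const ..
  refine Trial.of_disjoint (g := fun i x => φ (j + i) (x - y (j + i))) hq.1
    (fun i => (hφ _ (hlt i)).1.comp_sub _) (fun i k hik x => ?_) (fun i k hik x => ?_)
    fun i => ?_
  · rcases hsep i k hik x with h | h
    · simp only [((hφ _ (hlt i)).2.2.1 _ h).1, zero_mul]
    · simp only [((hφ _ (hlt k)).2.2.1 _ h).1, mul_zero]
  · rcases hsep i k hik x with h | h
    · simp only [hd, ((hφ _ (hlt i)).2.2.1 _ h).2, zero_mul]
    · simp only [hd, ((hφ _ (hlt k)).2.2.1 _ h).2, mul_zero]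
  · have hS := sqI_sum_sol (fun k hk => (hγ k hk).trans (hβ k hk)) y
    have h1 := energy_lt_of_near (γ := γ (j + i)) (β := β (j + i)) (y := y (j + i))
      (hφ _ (hlt i)).1 hq hS (fun x => ?_) hle rfl (hα _ (Finset.mem_range.2 (hlt i)))
    · refine h1.trans_le ?_
      have h2 : γ j ^ 2 ≤ γ (j + i) ^ 2 :=
        pow_le_pow_left₀ (hγ j hj).le (hm _ _ (Nat.le_add_right _ _) (hlt i)) 2
      have h3 := mul_le_mul_of_nonneg_right h2
        (SqI.integral_nonneg fun x => φ (j + i) (x - y (j + i)))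
      linarith
    · have hin := Finset.mem_range.2 (hlt i)
      rw [← Finset.add_sum_erase _ _ hin]
      have := Finset.sum_nonpos fun k (_ : k ∈ (Finset.range N).erase (j + i)) =>
        sol_nonpos (β k) (x - y k)
      linarith

theorem LocL2.tendsto_integral_mul {w : ℝ → ℝ → ℝ} {S : ℝ → ℝ} {C : ℝ} (h : LocL2 w S)
    (hw : ∀ t, SqI (w t)) (hC : ∀ t, ∫ x, w t x ^ 2 ≤ C) (hS : SqI S) :
    Tendsto (fun t => ∫ x, w t x * S x) atTop (nhds (∫ x, S x ^ 2)) := by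
  obtain ⟨D, hD⟩ : ∃ D, D = 2 * C + 3 * ∫ x, S x ^ 2 := ⟨_, rfl⟩
  have hC0 : 0 ≤ C := (SqI.integral_nonneg _).trans (hC 0)
  have hS0 := SqI.integral_nonneg S
  have hD0 : 0 ≤ D := by linarith
  rw [Metric.tendsto_nhds]
  intro ε hε
  obtain ⟨η, hη, hηD⟩ : ∃ η, 0 < η ∧ η * D < ε := by
    refine ⟨ε / (D + 1), by positivity, ?_⟩
    rw [div_mul_eq_mul_div, div_lt_iff₀ (by linarith)]
    nlinarith
  have hηε : 0 < η * ε / 2 := by positivity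
  have hR := intervalIntegral_tendsto_integral hS.2 tendsto_neg_atTop_atBot tendsto_id
  obtain ⟨R, hR, hR0⟩ := ((hR.eventually
    (eventually_gt_nhds (show (∫ x, S x ^ 2) - η * ε / 2 < ∫ x, S x ^ 2 by linarith))).and
    (eventually_ge_atTop 0)).exists
  filter_upwards [h R (η * ε / 2) hηε] with t ht
  have hf := (hw t).sub hS
  simp only [id] at hR
  rw [intervalIntegral.integral_of_le (by linarith)] at ht hR
  have hfS := hf.mul_int hS
  have e1 : (∫ x, w t x * S x) - ∫ x, S x ^ 2 = ∫ x, (w t x - S x) * S x := by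
    rw [← integral_sub ((hw t).mul_int hS) hS.2]
    refine integral_congr_ae (.of_forall fun x => ?_)
    simp only
    ring
  have am : ∀ a b s : ℝ, 0 < s → |a * b| ≤ s / 2 * a ^ 2 + 1 / (2 * s) * b ^ 2 := by
    intro a b s hs
    have h1 : 0 ≤ (s * |a| - |b|) ^ 2 / (2 * s) := by positivity
    have h2 : (s * |a| - |b|) ^ 2 / (2 * s) =
        s / 2 * a ^ 2 + 1 / (2 * s) * b ^ 2 - |a| * |b| := by
      rw [← sq_abs a, ← sq_abs b]
      field_simp
      ring
    rw [abs_mul]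
    linarith
  have i1 : ∀ s r : ℝ, Integrable fun x => s * (w t x - S x) ^ 2 + r * S x ^ 2 := fun s r =>
    (hf.2.const_mul s).add (hS.2.const_mul r)
  have e2 : ∀ (A : Set ℝ) (s r : ℝ), ∫ x in A, (s * (w t x - S x) ^ 2 + r * S x ^ 2) =
      s * (∫ x in A, (w t x - S x) ^ 2) + r * ∫ x in A, S x ^ 2 := fun A s r => by
    rw [integral_add (hf.2.const_mul s).integrableOn (hS.2.const_mul r).integrableOn,
      integral_const_mul, integral_const_mul]
  have b1 := setIntegral_mono (s := Set.Ioc (-R) R) hfS.abs.integrableOn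
    (i1 (1 / η / 2) (1 / (2 * (1 / η)))).integrableOn fun x =>
      am (w t x - S x) (S x) (1 / η) (by positivity)
  have b2 := setIntegral_mono (s := (Set.Ioc (-R) R)ᶜ) hfS.abs.integrableOn
    (i1 (η / 2) (1 / (2 * η))).integrableOn fun x => am (w t x - S x) (S x) η hη
  rw [e2] at b1 b2
  have b3 := integral_add_compl (measurableSet_Ioc (a := -R) (b := R)) hfS.abs
  have b4 := integral_add_compl (measurableSet_Ioc (a := -R) (b := R)) hS.2
  have b5 := hf.setIntegral_le (Set.Ioc (-R) R)ᶜ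
  have b6 := hS.setIntegral_le (Set.Ioc (-R) R)
  have b7 := (hw t).integral_sq_add_le hS.neg
  simp only [← sub_eq_add_neg, neg_sq] at b7
  have b8 := hC t
  have b9 : ∫ x in (Set.Ioc (-R) R)ᶜ, S x ^ 2 ≤ η * ε / 2 := by linarith
  have c1 := mul_le_mul_of_nonneg_left ht (show 0 ≤ 1 / η / 2 by positivity)
  have c2 := mul_le_mul_of_nonneg_left b9 (show 0 ≤ 1 / (2 * η) by positivity)
  have c3 := mul_le_mul_of_nonneg_left b6 (show 0 ≤ 1 / (2 * (1 / η)) by positivity)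
  have c4 := mul_le_mul_of_nonneg_left (b5.trans (b7.trans (by linarith :
    _ ≤ 2 * C + 2 * ∫ x, S x ^ 2))) (show 0 ≤ η / 2 by positivity)
  have c5 : 1 / η / 2 * (η * ε / 2) = ε / 4 := by field_simp; ring
  have c6 : 1 / (2 * η) * (η * ε / 2) = ε / 4 := by field_simp; ring
  have c7 : 1 / (2 * (1 / η)) = η / 2 := by field_simp
  have c8 : η / 2 * (2 * C + 2 * ∫ x, S x ^ 2) + η / 2 * (∫ x, S x ^ 2) = η * D / 2 := by
    rw [hD]; ring
  rw [c7] at c3 b1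
  rw [dist_eq_norm, e1]
  have c9 := norm_integral_le_integral_norm (μ := volume) fun x => (w t x - S x) * S x
  simp only [Real.norm_eq_abs] at c9 ⊢
  linarith

theorem integral_sq_sum {ι : Type*} (s : Finset ι) {F : ι → ℝ → ℝ} (h : ∀ i ∈ s, SqI (F i)) :
    ∫ x, (∑ i ∈ s, F i x) ^ 2 = ∑ i ∈ s, ∑ j ∈ s, ∫ x, F i x * F j x := by
  simp only [sq, Finset.sum_mul_sum]
  rw [integral_finsetSum _ fun i hi => integrable_finsetSum _ fun j hj =>
    (h i hi).mul_int (h j hj)]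
  refine Finset.sum_congr rfl fun i hi => ?_
  rw [integral_finsetSum _ fun j hj => (h i hi).mul_int (h j hj)]

theorem integral_sq_sum_le {ι : Type*} (s : Finset ι) {F : ι → ℝ → ℝ} (h : ∀ i ∈ s, SqI (F i)) :
    ∫ x, (∑ i ∈ s, F i x) ^ 2 ≤ s.card * ∑ i ∈ s, ∫ x, F i x ^ 2 := by
  rw [← integral_finsetSum _ fun i hi => (h i hi).2, ← integral_const_mul]
  refine integral_mono (SqI.sum s h).2 ((integrable_finsetSum _ fun i hi => (h i hi).2).const_mul _)
    fun x => ?_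
  exact sq_sum_le_card_mul_sum_sq

theorem exists_integral_sq_sum_sol {N : ℕ} {β : ℕ → ℝ} (hβ : ∀ j < N, 0 < β j) {ε : ℝ}
    (hε : 0 < ε) : ∃ L, ∀ y : ℕ → ℝ, (∀ i < N, ∀ j < N, i ≠ j → L ≤ |y i - y j|) →
      |(∫ x, (∑ k ∈ Finset.range N, Sol (β k) (x - y k)) ^ 2) -
        ∑ k ∈ Finset.range N, 16 / 3 * β k ^ 3| ≤ ε := by
  obtain ⟨τ, hτ, hτN⟩ : ∃ τ, 0 < τ ∧ N * (N * τ) ≤ ε := by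
    refine ⟨ε / (N * N + 1), by positivity, ?_⟩
    rw [← mul_assoc, mul_div_assoc', div_le_iff₀ (by positivity)]
    nlinarith
  have hL : ∀ᶠ d in comap (fun x : ℝ => |x|) atTop, ∀ i ∈ Finset.range N, ∀ j ∈ Finset.range N,
      |∫ x, Sol (β i) x * Sol (β j) (x + d)| < τ := by
    simp only [Filter.eventually_all_finset]
    intro i hi j hj
    have := (tendsto_integral_sol_mul_sol (hβ i (Finset.mem_range.1 hi))
      (hβ j (Finset.mem_range.1 hj))).abs
    rw [abs_zero] at this
    exact this.eventually (eventually_lt_nhds hτ)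
  obtain ⟨L, -, hL⟩ := (atTop_basis.comap fun x : ℝ => |x|).eventually_iff.1 hL
  refine ⟨L, fun y hy => ?_⟩
  rw [integral_sq_sum _ fun k hk => by
    simpa only [sub_eq_add_neg] using (sqI_sol (hβ k (Finset.mem_range.1 hk))).comp_add (-y k),
    ← Finset.sum_sub_distrib]
  have tr : ∀ i j, ∫ x, Sol (β i) (x - y i) * Sol (β j) (x - y j) =
      ∫ x, Sol (β i) x * Sol (β j) (x + (y i - y j)) := fun i j => by
    rw [← integral_sub_right_eq_self
      (fun x => Sol (β i) x * Sol (β j) (x + (y i - y j))) (y i)]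
    refine integral_congr_ae (.of_forall fun x => ?_)
    simp only
    congr 2
    ring
  refine (Finset.abs_sum_le_sum_abs _ _).trans ((Finset.sum_le_card_nsmul _ _ (N * τ)
    fun i hi => ?_).trans (by simpa using hτN))
  rw [← Finset.add_sum_erase _ _ hi, tr, sub_self]
  have e : ∫ x, Sol (β i) x * Sol (β i) (x + 0) = 16 / 3 * β i ^ 3 := by
    rw [← integral_sol_sq (hβ i (Finset.mem_range.1 hi))]
    simp only [add_zero, sq]
  rw [e, add_sub_cancel_left]
  refine (Finset.abs_sum_le_sum_abs _ _).trans ((Finset.sum_le_card_nsmul _ _ τ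
    fun j hj => ?_).trans ?_)
  · rw [tr]
    obtain ⟨hji, hj⟩ := Finset.mem_erase.1 hj
    exact (hL (hy i (Finset.mem_range.1 hi) j (Finset.mem_range.1 hj) hji.symm) i hi j hj).le
  · rw [Finset.card_erase_of_mem hi, Finset.card_range, nsmul_eq_mul]
    exact mul_le_mul_of_nonneg_right (by exact_mod_cast Nat.sub_le N 1) hτ.le

theorem Chain.exists_asymptotics {N : ℕ} {q f : ℕ → ℝ → ℝ → ℝ} {β : ℕ → ℝ} {a₀ E : ℝ}
    (h : Chain N q f β a₀) (hq : ∀ t, SqI (q N t))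
    (hE : ∀ t, ∫ x, q N t x ^ 2 = E + ∑ j ∈ Finset.range N, 16 / 3 * β j ^ 3) :
    ∃ z : ℕ → ℝ → ℝ, Tendsto (fun t => ∫ x,
      (q N t x - ∑ k ∈ Finset.range N, Sol (β k) (x - z k t)) ^ 2) atTop (nhds E) := by
  have hβ : ∀ j < N, 0 < β j := fun j hj => (h.dar j hj).hb
  have hex : ∀ k, ∃ z : ℝ → ℝ, k < N → Tendsto (fun t => z t / t) atTop (nhds (4 * β k ^ 2)) ∧
      LocL2 (fun t x => q N t (z t + x)) (Sol (β k)) := fun k => by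
    by_cases hk : k < N
    · obtain ⟨z, hz⟩ := h.exists_window hk
      exact ⟨z, fun _ => hz⟩
    · exact ⟨0, fun h => absurd h hk⟩
  choose z hz using hex
  have hlt : ∀ i j, i < j → j < N → β i < β j := fun i j hij hj =>
    (h.lt i (by omega)).trans_le (h.strictMono hij hj)
  have hsep : ∀ L : ℝ, ∀ᶠ t in atTop, ∀ i < N, ∀ j < N, i ≠ j → L ≤ |z i t - z j t| := by
    intro L
    have key : ∀ i < N, ∀ j < N, i ≠ j → Tendsto (fun t => |z i t - z j t|) atTop atTop := by
      intro i hi j hj hij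
      have h1 := ((hz i hi).1.sub (hz j hj).1).abs
      have h2 : 0 < |4 * β i ^ 2 - 4 * β j ^ 2| := by
        rw [abs_pos, sub_ne_zero]
        intro he
        have h3 : β i = β j := (pow_left_inj₀ (hβ i hi).le (hβ j hj).le two_ne_zero).1 (by
          linarith)
        rcases lt_or_gt_of_ne hij with h | h
        · exact (hlt i j h hj).ne h3
        · exact (hlt j i h hi).ne' h3
      refine (h1.pos_mul_atTop h2 tendsto_id).congr' ?_
      filter_upwards [eventually_gt_atTop 0] with t ht
      rw [← sub_div, abs_div, abs_of_pos ht]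
      exact div_mul_cancel₀ _ ht.ne'
    have : ∀ᶠ t in atTop, ∀ i ∈ Finset.range N, ∀ j ∈ Finset.range N, i ≠ j →
        L ≤ |z i t - z j t| := by
      simp only [Filter.eventually_all_finset]
      intro i hi j hj
      by_cases hij : i = j
      · exact .of_forall fun t h => absurd hij h
      · filter_upwards [(key i (Finset.mem_range.1 hi) j (Finset.mem_range.1 hj)
          hij).eventually_ge_atTop L] with t ht _
        exact ht
    filter_upwards [this] with t ht i hi j hj
    exact ht i (Finset.mem_range.2 hi) j (Finset.mem_range.2 hj)
  have hS2 : Tendsto (fun t => ∫ x, (∑ k ∈ Finset.range N, Sol (β k) (x - z k t)) ^ 2) atTop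
      (nhds (∑ j ∈ Finset.range N, 16 / 3 * β j ^ 3)) := by
    rw [Metric.tendsto_nhds]
    intro ε hε
    obtain ⟨L, hL⟩ := exists_integral_sq_sum_sol hβ (half_pos hε)
    filter_upwards [hsep L] with t ht
    exact (hL (fun k => z k t) ht).trans_lt (half_lt_self hε)
  have hqS : ∀ k ∈ Finset.range N, Tendsto (fun t => ∫ x, q N t x * Sol (β k) (x - z k t)) atTop
      (nhds (16 / 3 * β k ^ 3)) := by
    intro k hk
    have hk' := Finset.mem_range.1 hk
    rw [← integral_sol_sq (hβ k hk')]
    have e : ∀ t, ∫ x, q N t (z k t + x) ^ 2 = ∫ x, q N t x ^ 2 := fun t =>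
      integral_add_left_eq_self (fun x => q N t x ^ 2) (z k t)
    refine ((hz k hk').2.tendsto_integral_mul (fun t => ?_) (fun t => ((e t).trans (hE t)).le)
      (sqI_sol (hβ k hk'))).congr fun t => ?_
    · simpa only [add_comm] using (hq t).comp_add (z k t)
    · rw [← integral_add_left_eq_self (fun x => q N t x * Sol (β k) (x - z k t)) (z k t)]
      simp only [add_sub_cancel_left]
  have hlim := ((tendsto_const_nhds (x := E + ∑ j ∈ Finset.range N, 16 / 3 * β j ^ 3)
    (f := atTop)).sub ((tendsto_finsetSum _ hqS).const_mul 2)).add hS2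
  refine ⟨z, ?_⟩
  have e : E + ∑ j ∈ Finset.range N, 16 / 3 * β j ^ 3 -
      2 * ∑ j ∈ Finset.range N, 16 / 3 * β j ^ 3 + ∑ j ∈ Finset.range N, 16 / 3 * β j ^ 3 = E := by
    ring
  rw [e] at hlim
  refine hlim.congr fun t => ?_
  have hSk : ∀ k ∈ Finset.range N, SqI fun x => Sol (β k) (x - z k t) := fun k hk => by
    simpa only [sub_eq_add_neg] using (sqI_sol (hβ k (Finset.mem_range.1 hk))).comp_add (-z k t)
  have hS := SqI.sum _ hSk
  rw [← hE t, ← integral_finsetSum _ fun k hk => (hq t).mul_int (hSk k hk), ← integral_const_mul]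
  have hm : Integrable fun x => 2 * ∑ k ∈ Finset.range N, q N t x * Sol (β k) (x - z k t) :=
    (integrable_finsetSum _ fun k hk => (hq t).mul_int (hSk k hk)).const_mul 2
  have hi : Integrable fun x => q N t x ^ 2 -
      2 * ∑ k ∈ Finset.range N, q N t x * Sol (β k) (x - z k t) := (hq t).2.sub hm
  have hS2 : Integrable fun x => (∑ k ∈ Finset.range N, Sol (β k) (x - z k t)) ^ 2 := hS.2
  rw [← integral_sub (hq t).2 hm, ← integral_add hi hS2]
  refine integral_congr_ae (.of_forall fun x => ?_)
  simp only [← Finset.mul_sum]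
  ring

theorem exists_integral_sq_le_of_near {N : ℕ} {β : ℕ → ℝ} (hβ : ∀ j < N, 0 < β j) {ε : ℝ}
    (hε : 0 < ε) : ∃ α L, 0 < α ∧ 0 < L ∧ ∀ y : ℕ → ℝ,
      (∀ i < N, ∀ j < N, i ≠ j → L ≤ |y i - y j|) → ∀ q : ℝ → ℝ, SqI q →
        ∫ x, (q x - ∑ k ∈ Finset.range N, Sol (β k) (x - y k)) ^ 2 ≤ α →
        ∫ x, q x ^ 2 ≤ (∑ k ∈ Finset.range N, 16 / 3 * β k ^ 3) + ε := by
  obtain ⟨L, hL⟩ := exists_integral_sq_sum_sol hβ (half_pos hε)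
  obtain ⟨M, hM⟩ : ∃ M, M = (∑ k ∈ Finset.range N, 16 / 3 * β k ^ 3) + ε / 2 := ⟨_, rfl⟩
  have hc : Tendsto (fun α : ℝ => M + 2 * (√α * √M) + α) (nhds 0)
      (nhds (M + 2 * (√0 * √M) + 0)) := Continuous.tendsto (by fun_prop) 0
  rw [Real.sqrt_zero, zero_mul, mul_zero, add_zero, add_zero] at hc
  obtain ⟨α, hα, hα0⟩ := (((hc.mono_left nhdsWithin_le_nhds).eventually
    (eventually_lt_nhds (show M < M + ε / 2 by linarith))).and
    (self_mem_nhdsWithin (s := Set.Ioi (0 : ℝ)))).exists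
  refine ⟨α, max L 1, hα0, lt_max_of_lt_right one_pos, fun y hy q hq hle => ?_⟩
  have h1 := (abs_le.1 (hL y fun i hi j hj hij => (le_max_left _ _).trans (hy i hi j hj hij))).2
  have hS := sqI_sum_sol hβ y
  have he := hq.sub hS
  have h2 := (le_abs_self _).trans (he.abs_integral_mul_le hS)
  have h3 : √(∫ x, (q x - ∑ k ∈ Finset.range N, Sol (β k) (x - y k)) ^ 2) *
      √(∫ x, (∑ k ∈ Finset.range N, Sol (β k) (x - y k)) ^ 2) ≤ √α * √M :=
    mul_le_mul (Real.sqrt_le_sqrt hle) (Real.sqrt_le_sqrt (by linarith)) (sqrt_nonneg _)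
      (sqrt_nonneg _)
  obtain ⟨S, hSd⟩ : ∃ S, S = fun x => ∑ k ∈ Finset.range N, Sol (β k) (x - y k) := ⟨_, rfl⟩
  have h4 : ∫ x, q x ^ 2 = (∫ x, (q x - S x) ^ 2) + ∫ x, (2 * ((q x - S x) * S x) + S x ^ 2) := by
    rw [← hSd] at hS
    have he := hq.sub hS
    have hi : Integrable fun x => 2 * ((q x - S x) * S x) + S x ^ 2 :=
      ((he.mul_int hS).const_mul 2).add hS.2
    rw [← integral_add he.2 hi]
    refine integral_congr_ae (.of_forall fun x => ?_)
    simp only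
    ring
  have h5 : ∫ x, (2 * ((q x - S x) * S x) + S x ^ 2) =
      2 * (∫ x, (q x - S x) * S x) + ∫ x, S x ^ 2 := by
    rw [← hSd] at hS
    rw [integral_add (((hq.sub hS).mul_int hS).const_mul 2) hS.2, integral_const_mul]
  simp only [hSd] at h4 h5
  linarith

theorem exists_asymptotics_of_near {N : ℕ} {β : ℕ → ℝ} (hN : 0 < N) (hβ : ∀ j < N, 0 < β j)
    (hlt : ∀ j, j + 1 < N → β j < β (j + 1)) {ε : ℝ} (hε : 0 < ε) :
    ∃ α L, 0 < α ∧ 0 < L ∧ ∀ y : ℕ → ℝ, (∀ i < N, ∀ j < N, i ≠ j → L ≤ |y i - y j|) →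
      ∀ q : ℝ → ℝ → ℝ, SliceSol q →
        ∫ x, (q 0 x - ∑ k ∈ Finset.range N, Sol (β k) (x - y k)) ^ 2 ≤ α →
        ∃ (b : ℕ → ℝ) (z : ℕ → ℝ → ℝ) (E : ℝ), (∀ j < N, 0 < b j ∧ |b j - β j| < ε) ∧ E < ε ∧
          Tendsto (fun t => ∫ x,
            (q t x - ∑ k ∈ Finset.range N, Sol (b k) (x - z k t)) ^ 2) atTop (nhds E) := by
  have hmono : ∀ i j, i ≤ j → j < N → β i ≤ β j := fun i j hij => by
    induction j, hij using Nat.le_induction with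
    | base => exact fun _ => le_rfl
    | succ j _ ih => exact fun hj => (ih (by omega)).trans (hlt j hj).le
  have hm0 : 0 < (min 1 (β 0 ^ 2 / 12)) ^ 2 := by
    have := hβ 0 hN
    positivity
  have hev : ∀ᶠ η in nhdsWithin (0 : ℝ) (Set.Ioi 0), 0 < η ∧ η < ε ∧ η ^ 3 < ε ∧
      η ^ 3 < (min 1 (β 0 ^ 2 / 12)) ^ 2 ∧ ∀ j ∈ Finset.range N, 2 * η < β j ∧
        (j + 1 < N → 2 * η < β (j + 1) - β j) := by
    have t1 : Tendsto (fun η : ℝ => η) (nhdsWithin 0 (Set.Ioi 0)) (nhds 0) := nhdsWithin_le_nhds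
    have t2 : Tendsto (fun η : ℝ => 2 * η) (nhdsWithin 0 (Set.Ioi 0)) (nhds 0) := by
      simpa using t1.const_mul 2
    have t3 : Tendsto (fun η : ℝ => η ^ 3) (nhdsWithin 0 (Set.Ioi 0)) (nhds 0) := by
      simpa using t1.pow 3
    refine (eventually_mem_nhdsWithin (s := Set.Ioi (0 : ℝ))).and <|
      (t1.eventually (eventually_lt_nhds hε)).and <|
      (t3.eventually (eventually_lt_nhds hε)).and <|
      (t3.eventually (eventually_lt_nhds hm0)).and ?_
    rw [Filter.eventually_all_finset]
    intro j hj
    refine (t2.eventually (eventually_lt_nhds (hβ j (Finset.mem_range.1 hj)))).and ?_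
    by_cases hj1 : j + 1 < N
    · filter_upwards [t2.eventually (eventually_lt_nhds (sub_pos.2 (hlt j hj1)))] with η h _
      exact h
    · exact .of_forall fun η h => absurd h hj1
  obtain ⟨η, hη0, hηε, hη3, hηm, hηβ⟩ := hev.exists
  have hη30 : 0 < η ^ 3 := pow_pos hη0 3
  obtain ⟨s, hs, hsη, hs0⟩ : ∃ s, (∑ j ∈ Finset.range N, 16 / 3 * (β j ^ 3 - (β j - s) ^ 3) <
      η ^ 3 / 2) ∧ s < η ∧ 0 < s := by
    have hc : Tendsto (fun s : ℝ => ∑ j ∈ Finset.range N, 16 / 3 * (β j ^ 3 - (β j - s) ^ 3))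
        (nhdsWithin 0 (Set.Ioi 0))
        (nhds (∑ j ∈ Finset.range N, 16 / 3 * (β j ^ 3 - (β j - 0) ^ 3))) :=
      (Continuous.tendsto (by fun_prop) 0).mono_left nhdsWithin_le_nhds
    simp only [sub_zero, sub_self, mul_zero, Finset.sum_const_zero] at hc
    have t1 : Tendsto (fun η : ℝ => η) (nhdsWithin 0 (Set.Ioi 0)) (nhds 0) := nhdsWithin_le_nhds
    exact ((hc.eventually (eventually_lt_nhds (half_pos hη30))).and
      ((t1.eventually (eventually_lt_nhds hη0)).and
      (eventually_mem_nhdsWithin (s := Set.Ioi (0 : ℝ))))).exists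
  have hγ : ∀ j < N, 0 < β j - s := fun j hj => by
    have := (hηβ j (Finset.mem_range.2 hj)).1
    linarith
  obtain ⟨α₁, L₁, hα₁, hL₁, H₁⟩ := exists_trial_of_near (γ := fun j => β j - s) hγ
    (fun j _ => sub_lt_self _ hs0) fun i j hij hj => sub_le_sub_right (hmono i j hij hj) s
  obtain ⟨α₂, L₂, hα₂, hL₂, H₂⟩ := exists_integral_sq_le_of_near hβ (half_pos hη30)
  refine ⟨min α₁ α₂, max L₁ L₂, lt_min hα₁ hα₂, lt_max_of_lt_left hL₁, fun y hy q hq hle => ?_⟩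
  have hT := H₁ y (fun i hi j hj hij => (le_max_left _ _).trans (hy i hi j hj hij)) (q 0)
    (hq.sqI 0) (hle.trans (min_le_left _ _))
  have hM := H₂ y (fun i hi j hj hij => (le_max_right _ _).trans (hy i hi j hj hij)) (q 0)
    (hq.sqI 0) (hle.trans (min_le_right _ _))
  obtain ⟨p, f, b, hp, hb, hdar, hw, hp0, hmass⟩ :=
    hq.solOn_univ.exists_darboux_chain _ N q hγ hT
  simp only [hq.integral_sq_eq _ 0] at hmass
  have hcube : ∀ j ∈ Finset.range N, (β j - s) ^ 3 ≤ b j ^ 3 := fun j hj =>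
    pow_le_pow_left₀ (hγ j (Finset.mem_range.1 hj)).le (hb j (Finset.mem_range.1 hj)) 3
  have hsum : ∑ j ∈ Finset.range N, 16 / 3 * (β j ^ 3 - (β j - s) ^ 3) =
      (∑ j ∈ Finset.range N, 16 / 3 * β j ^ 3) -
        ∑ j ∈ Finset.range N, 16 / 3 * (β j - s) ^ 3 := by
    rw [← Finset.sum_sub_distrib]
    exact Finset.sum_congr rfl fun j _ => by ring
  have hsum' : ∑ j ∈ Finset.range N, 16 / 3 * (b j ^ 3 - (β j - s) ^ 3) =
      (∑ j ∈ Finset.range N, 16 / 3 * b j ^ 3) -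
        ∑ j ∈ Finset.range N, 16 / 3 * (β j - s) ^ 3 := by
    rw [← Finset.sum_sub_distrib]
    exact Finset.sum_congr rfl fun j _ => by ring
  have hnn : ∀ j ∈ Finset.range N, 0 ≤ 16 / 3 * (b j ^ 3 - (β j - s) ^ 3) := fun j hj => by
    have := hcube j hj
    linarith
  have hE : ∀ t, ∫ x, p 0 t x ^ 2 < η ^ 3 := fun t => by
    rw [hmass]
    have := Finset.sum_nonneg hnn
    linarith
  have hclose : ∀ j < N, β j - η < b j ∧ b j < β j + η := by
    intro j hj
    have hj' := Finset.mem_range.2 hj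
    refine ⟨by have := hb j hj; linarith, ?_⟩
    have h1 := Finset.single_le_sum hnn hj'
    have h2 : (0 : ℝ) ≤ ∫ x, p 0 0 x ^ 2 := SqI.integral_nonneg _
    rw [hmass] at h2
    have hβj := hβ j hj
    refine lt_of_pow_lt_pow_left₀ 3 (by linarith) ?_
    have h3 : β j ^ 3 + η ^ 3 ≤ (β j + η) ^ 3 := by
      have : 0 ≤ 3 * β j * η * (β j + η) := by positivity
      linarith [show (β j + η) ^ 3 = β j ^ 3 + η ^ 3 + 3 * β j * η * (β j + η) by ring]
    have h4 : (β j - s) ^ 3 ≤ β j ^ 3 := pow_le_pow_left₀ (hγ j hj).le (by linarith) 3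
    linarith
  have hβ0 := hβ 0 hN
  have hb0 : β 0 < 2 * b 0 := by
    have := (hηβ 0 (Finset.mem_range.2 hN)).1
    have := (hclose 0 hN).1
    linarith
  have ha : β 0 ^ 2 < 4 * b 0 ^ 2 := by
    have := pow_lt_pow_left₀ hb0 hβ0.le two_ne_zero
    linarith [show (2 * b 0) ^ 2 = 4 * b 0 ^ 2 by ring]
  have hchain : Chain N p f b (β 0 ^ 2) :=
    { dar := hdar
      w_eq := hw
      lt := fun j hj => by
        have h1 := (hclose j (by omega)).2
        have h2 := (hclose (j + 1) hj).1
        have h3 := (hηβ j (Finset.mem_range.2 (by omega))).2 hj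
        linarith
      rv := fun a ha' => hp0.tendsto_right_mass (by positivity)
        (fun t => (hE t).le.trans hηm.le) ha'
      lt_zero := ha }
  subst hp
  obtain ⟨z, hz⟩ := hchain.exists_asymptotics (E := ∫ x, p 0 0 x ^ 2) hq.sqI fun t => by
    rw [hmass, hq.integral_sq_eq t 0]
    ring
  refine ⟨b, z, _, fun j hj => ⟨(hdar j hj).hb, ?_⟩, (hE 0).trans hη3, hz⟩
  have := hclose j hj
  exact abs_lt.2 ⟨by linarith, by linarith⟩

theorem integral_sq_reflect {N : ℕ} {c : Fin N → ℝ} (hc : ∀ j, 0 < c j) {β : ℕ → ℝ}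
    (hβ : ∀ j : Fin N, β j = √(c j) / 2) (u : ℝ → ℝ) (y : ℕ → ℝ) :
    ∫ x, (-u (-x) / 3 - ∑ k ∈ Finset.range N, Sol (β k) (x - y k)) ^ 2 =
      1 / 9 * L2sq fun x => u x - ∑ j : Fin N, Q (c j) (x - -y j) := by
  rw [← integral_neg_eq_self, L2sq, ← integral_const_mul]
  refine integral_congr_ae (.of_forall fun x => ?_)
  have h : ∑ j : Fin N, Q (c j) (x - -y j) =
      -3 * ∑ k ∈ Finset.range N, Sol (β k) (-x - y k) := by
    rw [Finset.sum_range, Finset.mul_sum]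
    refine Finset.sum_congr rfl fun j _ => ?_
    rw [Q_eq_sol (hc j), hβ, ← sol_neg]
    congr 2
    ring
  simp only [h, neg_neg]
  ring

theorem integral_sq_sub_sum_sol_le {N : ℕ} {b β : ℕ → ℝ} (hb : ∀ j < N, 0 < b j)
    (hβ : ∀ j < N, 0 < β j) {q : ℝ → ℝ} (hq : SqI q) (y : ℕ → ℝ) {τ : ℝ}
    (hτ : ∀ j < N, ∫ x, (Sol (b j) x - Sol (β j) x) ^ 2 ≤ τ)
    (h : ∫ x, (q x - ∑ k ∈ Finset.range N, Sol (b k) (x - y k)) ^ 2 ≤ τ) :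
    ∫ x, (q x - ∑ k ∈ Finset.range N, Sol (β k) (x - y k)) ^ 2 ≤ 2 * τ * (1 + N * N) := by
  have hd : ∀ k ∈ Finset.range N, SqI fun x => Sol (b k) (x - y k) - Sol (β k) (x - y k) :=
    fun k hk => by
      have hk := Finset.mem_range.1 hk
      simpa only [sub_eq_add_neg] using ((sqI_sol (hb k hk)).sub (sqI_sol (hβ k hk))).comp_add (-y k)
  have h1 := (hq.sub (sqI_sum_sol hb y)).integral_sq_add_le (SqI.sum _ hd)
  have h2 := integral_sq_sum_le _ hd
  have h3 : ∑ k ∈ Finset.range N, ∫ x, (Sol (b k) (x - y k) - Sol (β k) (x - y k)) ^ 2 ≤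
      N * τ := by
    refine (Finset.sum_le_card_nsmul _ _ τ fun k hk => ?_).trans (by simp)
    rw [integral_sub_right_eq_self (fun x => (Sol (b k) x - Sol (β k) x) ^ 2) (y k)]
    exact hτ k (Finset.mem_range.1 hk)
  rw [Finset.card_range] at h2
  have h4 := h2.trans (mul_le_mul_of_nonneg_left h3 (Nat.cast_nonneg N))
  have e : ∀ x, q x - ∑ k ∈ Finset.range N, Sol (b k) (x - y k) +
      ∑ k ∈ Finset.range N, (Sol (b k) (x - y k) - Sol (β k) (x - y k)) =
      q x - ∑ k ∈ Finset.range N, Sol (β k) (x - y k) := fun x => by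
    rw [Finset.sum_sub_distrib]
    ring
  simp only [e] at h1
  linarith

/-- `L²`-stability for negative times. -/
theorem kdv_sum_of_solitons_L2_stability_negative_times
    (N : ℕ) (hN : 2 ≤ N) (c : Fin N → ℝ) (hcpos : ∀ j, 0 < c j) (hc : StrictMono c)
    (δ : ℝ) (hδ : 0 < δ) :
    ∃ α₀ L₀ : ℝ, 0 < α₀ ∧ 0 < L₀ ∧
      ∀ L α : ℝ, L₀ < L → 0 < α → α < α₀ →
      ∀ x₀ : Fin N → ℝ, StrictMono x₀ →
        (∀ i j : Fin N, (i : ℕ) + 1 = (j : ℕ) → x₀ i + L < x₀ j) →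
      ∀ u : ℝ → ℝ → ℝ, IsKdVSolution u →
        L2sq (fun x => u 0 x - ∑ j, Q (c j) (x - x₀ j)) ≤ α ^ 2 →
        ∃ T : ℝ, 0 ≤ T ∧ ∃ X : Fin N → ℝ → ℝ, ∀ t : ℝ, t ≤ -T →
          L2sq (fun x => u t x - ∑ j, Q (c j) (x - X j t)) ≤ δ ^ 2 := by
  obtain ⟨β, hβc⟩ : ∃ β : ℕ → ℝ, ∀ j : Fin N, β j = √(c j) / 2 :=
    ⟨fun k => if h : k < N then √(c ⟨k, h⟩) / 2 else 0, fun j => by simp⟩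
  have hβ : ∀ j < N, 0 < β j := fun j hj => by
    rw [hβc ⟨j, hj⟩]
    exact half_pos (sqrt_pos.2 (hcpos _))
  have hlt : ∀ j, j + 1 < N → β j < β (j + 1) := fun j hj => by
    rw [hβc ⟨j, by omega⟩, hβc ⟨j + 1, hj⟩]
    exact div_lt_div_of_pos_right (sqrt_lt_sqrt (hcpos _).le (hc (Fin.mk_lt_mk.2
      (Nat.lt_succ_self j)))) two_pos
  obtain ⟨τ, hτ, hτδ⟩ : ∃ τ, 0 < τ ∧ 9 * (2 * τ * (1 + N * N)) ≤ δ ^ 2 := by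
    refine ⟨δ ^ 2 / (18 * (1 + N * N)), by positivity, le_of_eq ?_⟩
    field_simp
    norm_num
  have hclose : ∀ᶠ ε in nhdsWithin (0 : ℝ) (Set.Ioi 0), ∀ j ∈ Finset.range N, ∀ b,
      |b - β j| < ε → ∫ x, (Sol b x - Sol (β j) x) ^ 2 ≤ τ := by
    rw [Filter.eventually_all_finset]
    intro j hj
    obtain ⟨r, hr, h⟩ := Metric.eventually_nhds_iff.1 ((tendsto_integral_sol_sub_sol
      (hβ j (Finset.mem_range.1 hj))).eventually (eventually_le_nhds hτ))
    filter_upwards [nhdsWithin_le_nhds (eventually_le_nhds hr)] with ε hε b hb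
    exact h (hb.trans_le hε)
  have hle : ∀ᶠ ε in nhdsWithin (0 : ℝ) (Set.Ioi 0), ε ≤ τ :=
    nhdsWithin_le_nhds (eventually_le_nhds hτ)
  obtain ⟨ε, hε, hετ, hε0⟩ := (hclose.and (hle.and
    (eventually_mem_nhdsWithin (s := Set.Ioi (0 : ℝ))))).exists
  obtain ⟨α₁, L₁, hα₁, hL₁, H⟩ := exists_asymptotics_of_near (by omega) hβ hlt hε0
  refine ⟨√α₁, L₁, sqrt_pos.2 hα₁, hL₁, fun L α hL hα hαα x₀ hx₀ hsep u hu h0 => ?_⟩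
  obtain ⟨y, hy⟩ : ∃ y : ℕ → ℝ, ∀ j : Fin N, -y j = x₀ j :=
    ⟨fun k => if h : k < N then -x₀ ⟨k, h⟩ else 0, fun j => by simp⟩
  have hlt' : ∀ i j, i < j → j < N → L₁ ≤ |y i - y j| := fun i j hij hj => by
    have h1 := hsep ⟨i, by omega⟩ ⟨i + 1, by omega⟩ rfl
    have h2 : x₀ ⟨i + 1, by omega⟩ ≤ x₀ ⟨j, hj⟩ := hx₀.monotone (Fin.mk_le_mk.2 hij)
    rw [← hy] at h1
    rw [← hy ⟨j, hj⟩] at h2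
    refine le_trans ?_ (le_abs_self _)
    simp only at h1 h2
    linarith
  have hysep : ∀ i < N, ∀ j < N, i ≠ j → L₁ ≤ |y i - y j| := fun i hi j hj hij => by
    rcases lt_or_gt_of_ne hij with h | h
    · exact hlt' i j h hj
    · rw [abs_sub_comm]
      exact hlt' j i h hi
  have h_start : ∫ x, (-u (-0) (-x) / 3 - ∑ k ∈ Finset.range N, Sol (β k) (x - y k)) ^ 2 ≤ α₁ := by
    rw [integral_sq_reflect hcpos hβc, neg_zero]
    simp only [hy]
    have h1 := (pow_le_pow_left₀ hα.le hαα.le 2).trans_eq (sq_sqrt hα₁.le)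
    linarith [sq_nonneg α]
  obtain ⟨b, z, E, hb, hE, hlim⟩ := H y hysep _ hu.sliceSol h_start
  obtain ⟨T, hT⟩ := eventually_atTop.1 (hlim.eventually (eventually_le_nhds (hE.trans_le hετ)))
  refine ⟨max T 0, le_max_right _ _, fun j t => -z j (-t), fun t ht => ?_⟩
  have h1 := integral_sq_sub_sum_sol_le (fun j hj => (hb j hj).1) hβ (hu.sliceSol.sqI (-t))
    (fun k => z k (-t)) (fun j hj => hε j (Finset.mem_range.2 hj) _ (hb j hj).2)
    (hT (-t) (by linarith [le_max_left T 0]))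
  rw [neg_neg, integral_sq_reflect hcpos hβc] at h1
  linarith
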